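/- Let K be a number field whose ring of integers 𝓞_K is a Euclidean domain, let r₁ be the number of real places of K and r₂ the number of complex places of K. Then for every n ≥ 1, the rational group cohomology H^d(Sp_{2n}(𝓞_K); ℚ) vanishes in the degree d = r₁·n(n+1) + r₂·n(2n+1) − n (the virtual cohomological dimension of Sp_{2n}(𝓞_K)). (Brück–Santos Rego–Sroka, after Gunnells) -/

import Mathlib

open NumberField NumberField.InfinitePlace

/-- A commutative ring *is a Euclidean domain* if it admits a Euclidean domain structure
compatible with its given ring structure. -/
def IsEuclideanDomain (R : Type*) [commR : CommRing R] : Prop :=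
  ∃ e : EuclideanDomain R, e.toCommRing = commR

set_option linter.unusedSectionVars false

section ListCochains

variable {S A : Type*} [AddCommGroup A]

/-- The simplicial coboundary on cochains given by functions on lists. -/
def cob : (List S → A) → List S → A
  | _, [] => 0
  | c, s :: l => c l - cob (fun t => c (s :: t)) l

@[simp] theorem cob_nil (c : List S → A) : cob c [] = 0 := rfl

theorem cob_cons (c : List S → A) (s : S) (l : List S) :
    cob c (s :: l) = c l - cob (fun t => c (s :: t)) l := rfl

/-- If the values on all faces of `l` lie in a subgroup, so does the coboundary. -/
theorem cob_mem {N : AddSubgroup A} : ∀ {c : List S → A} {l : List S},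
    (∀ t, t.Sublist l → t.length + 1 = l.length → c t ∈ N) → cob c l ∈ N
  | _, [], _ => N.zero_mem
  | c, s :: l, h => by
    rw [cob_cons]
    refine N.sub_mem (h l (List.sublist_cons_self s l) rfl) (cob_mem fun t ht hl => ?_)
    exact h _ (ht.cons_cons s) (by simp [hl])

theorem map_cob {B : Type*} [AddCommGroup B] (f : A →+ B) : ∀ (c : List S → A) (l : List S),
    f (cob c l) = cob (fun t => f (c t)) l
  | _, [] => by simp
  | c, s :: l => by rw [cob_cons, cob_cons, map_sub, map_cob f]

theorem cob_sub (c c' : List S → A) (l : List S) :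
    cob (fun t => c t - c' t) l = cob c l - cob c' l := by
  induction l generalizing c c' with
  | nil => simp
  | cons s l ih => rw [cob_cons, cob_cons, cob_cons, ih]; abel

theorem cob_add (c c' : List S → A) (l : List S) :
    cob (fun t => c t + c' t) l = cob c l + cob c' l := by
  induction l generalizing c c' with
  | nil => simp
  | cons s l ih => rw [cob_cons, cob_cons, cob_cons, ih]; abel

theorem cob_zero (l : List S) : cob (fun _ => (0 : A)) l = 0 := by
  induction l with
  | nil => simp
  | cons s l ih => rw [cob_cons, ih]; simp

theorem cob_sub_mem {N : AddSubgroup A} {c c' : List S → A} {l : List S}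
    (h : ∀ t, t.Sublist l → t.length + 1 = l.length → c t - c' t ∈ N) :
    cob c l - cob c' l ∈ N := by
  rw [← cob_sub]; exact cob_mem h

theorem cob_congr {c c' : List S → A} {l : List S}
    (h : ∀ t, t.Sublist l → t.length + 1 = l.length → c t = c' t) : cob c l = cob c' l := by
  have := cob_sub_mem (N := ⊥) (c := c) (c' := c') (l := l)
    fun t ht hl => by simp [h t ht hl]
  simpa [sub_eq_zero] using this

theorem cob_cob (c : List S → A) (l : List S) : cob (cob c) l = 0 := by
  induction l generalizing c with
  | nil => rfl
  | cons s l ih =>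
    rw [cob_cons]
    have : (fun t => cob c (s :: t)) = fun t => c t - cob (fun u => c (s :: u)) t := rfl
    rw [this, cob_sub]
    have := ih (fun u => c (s :: u))
    simp only [this]; abel

theorem cob_map {T : Type*} (f : S → T) : ∀ (c : List T → A) (l : List S),
    cob c (l.map f) = cob (fun t => c (t.map f)) l
  | _, [] => rfl
  | c, s :: l => by
    rw [List.map_cons, cob_cons, cob_cons, cob_map f]; rfl

/-- Evaluation of a cochain on the cross-polytope with opposite vertices the given pairs. -/
def apt : List (S × S) → (List S → A) → A
  | [], c => c []
  | p :: ps, c => apt ps (fun l => c (p.1 :: l)) - apt ps (fun l => c (p.2 :: l))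

/-- The vertices of a facet of the cross-polytope with the given pairs. -/
inductive Transversal : List (S × S) → List S → Prop
  | nil : Transversal [] []
  | fst (p : S × S) {ps : List (S × S)} {l : List S} (h : Transversal ps l) :
      Transversal (p :: ps) (p.1 :: l)
  | snd (p : S × S) {ps : List (S × S)} {l : List S} (h : Transversal ps l) :
      Transversal (p :: ps) (p.2 :: l)

theorem Transversal.length {ps : List (S × S)} {l : List S} (h : Transversal ps l) :
    l.length = ps.length := by
  induction h <;> simp_all

theorem Transversal.mem {ps : List (S × S)} {l : List S} (h : Transversal ps l) {s : S}
    (hs : s ∈ l) : ∃ p ∈ ps, s = p.1 ∨ s = p.2 := by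
  induction h with
  | nil => simp at hs
  | fst p h ih =>
    rcases List.mem_cons.1 hs with rfl | hs
    · exact ⟨p, by simp, Or.inl rfl⟩
    · obtain ⟨q, hq, h⟩ := ih hs; exact ⟨q, by simp [hq], h⟩
  | snd p h ih =>
    rcases List.mem_cons.1 hs with rfl | hs
    · exact ⟨p, by simp, Or.inr rfl⟩
    · obtain ⟨q, hq, h⟩ := ih hs; exact ⟨q, by simp [hq], h⟩

theorem apt_sub (ps : List (S × S)) (c c' : List S → A) :
    apt ps (fun l => c l - c' l) = apt ps c - apt ps c' := by
  induction ps generalizing c c' with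
  | nil => rfl
  | cons p ps ih => rw [apt, apt, apt, ih, ih]; abel

theorem apt_congr {ps : List (S × S)} {c c' : List S → A}
    (h : ∀ l, Transversal ps l → c l = c' l) : apt ps c = apt ps c' := by
  induction ps generalizing c c' with
  | nil => exact h _ .nil
  | cons p ps ih =>
    rw [apt, apt, ih fun l hl => h _ (.fst p hl), ih fun l hl => h _ (.snd p hl)]

theorem apt_cob (ps : List (S × S)) (b : List S → A) : apt ps (cob b) = 0 := by
  induction ps generalizing b with
  | nil => rfl
  | cons p ps ih =>
    rw [apt]
    have h : ∀ s : S, apt ps (fun l => cob b (s :: l)) = apt ps b := fun s => by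
      have : (fun l => cob b (s :: l)) = fun l => b l - cob (fun t => b (s :: t)) l := rfl
      rw [this, apt_sub, ih, sub_zero]
    rw [h, h, sub_self]

/-- A cocycle on lists compatible with a cone point is a coboundary there. -/
theorem cob_cone {c : List S → A} {s : S} {l : List S} (h : cob c (s :: l) = 0) :
    cob (fun t => c (s :: t)) l = c l := by
  rw [cob_cons, sub_eq_zero] at h; exact h.symm

/-- Transfinite extension of a solution of `cob b = c`, one vertex at a time. -/
theorem cob_extend [LinearOrder S] [WellFoundedLT S] (ok : List S → Prop)
    (P₀ : S → Prop) (hP₀ : ∀ s t, t ≤ s → P₀ s → P₀ t) (j : ℕ) (c b₀ : List S → A)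
    (h₀ : ∀ l, ok l → l.length = j → (∀ s ∈ l, P₀ s) → cob b₀ l = c l)
    (hstep : ∀ s, ¬ P₀ s → ∀ b : List S → A,
      (∀ l, (∀ t ∈ l, P₀ t) → b l = b₀ l) →
      (∀ l, ok l → l.length = j → (∀ t ∈ l, t < s) → cob b l = c l) →
      ∃ b' : List S → A, (∀ l, (∀ t ∈ l, t < s) → b' l = b l) ∧
        ∀ l, ok l → l.length = j → (∀ t ∈ l, t ≤ s) → cob b' l = c l) :
    ∃ b : List S → A, ∀ l, ok l → l.length = j → cob b l = c l := by
  classical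
  let ext : S → (List S → A) → (List S → A) := fun s b =>
    if h : ∃ b' : List S → A, (∀ l, (∀ t ∈ l, t < s) → b' l = b l) ∧
        ∀ l, ok l → l.length = j → (∀ t ∈ l, t ≤ s) → cob b' l = c l then h.choose else b
  let glue : (s : S) → ((t : S) → t < s → List S → A) → List S → A := fun s G l =>
    if ∀ t ∈ l, P₀ t then b₀ l else
      if h : ∃ m ∈ l, (∀ t ∈ l, t ≤ m) ∧ m < s then G h.choose h.choose_spec.2.2 l else 0
  let G : S → List S → A := wellFounded_lt.fix fun s G => ext s (glue s G)
  have hG : ∀ s, G s = ext s (glue s fun t _ => G t) := fun s => wellFounded_lt.fix_eq _ s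
  let b : List S → A := fun l =>
    if ∀ t ∈ l, P₀ t then b₀ l else
      if h : ∃ m ∈ l, ∀ t ∈ l, t ≤ m then G h.choose l else 0
  have hmax : ∀ l : List S, (∀ t ∈ l, P₀ t) ∨ ∃ m ∈ l, ∀ t ∈ l, t ≤ m := by
    intro l
    rcases eq_or_ne l [] with rfl | hl
    · left; simp
    · right
      obtain ⟨m, hm⟩ := WithBot.ne_bot_iff_exists.1 (mt List.maximum_eq_bot.1 hl)
      replace hm := hm.symm
      exact ⟨m, List.maximum_mem hm, fun t ht => List.le_maximum_of_mem ht hm⟩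
  have hb : ∀ l m, m ∈ l → (∀ t ∈ l, t ≤ m) → (¬ P₀ m) → b l = G m l := by
    intro l m hm hle hP
    have h : ∃ m ∈ l, ∀ t ∈ l, t ≤ m := ⟨m, hm, hle⟩
    have : h.choose = m := le_antisymm (hle _ h.choose_spec.1) (h.choose_spec.2 _ hm)
    simp only [b]
    rw [if_neg fun h' => hP (h' m hm), dif_pos h, this]
  have hglue : ∀ s l, (∀ t ∈ l, t < s) → glue s (fun t _ => G t) l = b l := by
    intro s l hl
    by_cases h0 : ∀ t ∈ l, P₀ t
    · simp only [glue, b]; rw [if_pos h0, if_pos h0]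
    · obtain ⟨m, hm, hle⟩ := (hmax l).resolve_left h0
      have h : ∃ m ∈ l, (∀ t ∈ l, t ≤ m) ∧ m < s := ⟨m, hm, hle, hl m hm⟩
      have : h.choose = m := le_antisymm (hle _ h.choose_spec.1) (h.choose_spec.2.1 _ hm)
      simp only [glue]
      rw [if_neg h0, dif_pos h, this, hb l m hm hle]
      intro hP; exact h0 fun t ht => hP₀ m t (hle t ht) hP
  have key : ∀ s, ∀ l, ok l → l.length = j → (∀ t ∈ l, t ≤ s) → cob b l = c l := by
    intro s
    induction s using WellFoundedLT.induction with
    | _ s ih =>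
    intro l hok hlen hle
    by_cases hs : P₀ s
    · have hl0 : ∀ t ∈ l, P₀ t := fun t ht => hP₀ s t (hle t ht) hs
      rw [← h₀ l hok hlen hl0]
      refine cob_congr fun t ht _ => ?_
      simp only [b]; rw [if_pos fun u hu => hl0 u (ht.subset hu)]
    have hlt : ∀ l, ok l → l.length = j → (∀ t ∈ l, t < s) → cob b l = c l := by
      intro l hok hlen hlt
      rcases hmax l with h0 | ⟨m, hm, hle⟩
      · rw [← h₀ l hok hlen h0]
        refine cob_congr fun t ht _ => ?_
        simp only [b]; rw [if_pos fun u hu => h0 u (ht.subset hu)]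
      · exact ih m (hlt m hm) l hok hlen hle
    have hex : ∃ b' : List S → A, (∀ l, (∀ t ∈ l, t < s) →
        b' l = (glue s fun t _ => G t) l) ∧
        ∀ l, ok l → l.length = j → (∀ t ∈ l, t ≤ s) → cob b' l = c l := by
      obtain ⟨b', h1, h2⟩ := hstep s hs b (fun l hl => by simp only [b]; rw [if_pos hl]) hlt
      exact ⟨b', fun l hl => (h1 l hl).trans (hglue s l hl).symm, h2⟩
    have hGs : G s = hex.choose := by rw [hG s]; exact dif_pos hex
    rw [← hex.choose_spec.2 l hok hlen hle, ← hGs]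
    refine cob_congr fun t ht _ => ?_
    have htle : ∀ u ∈ t, u ≤ s := fun u hu => hle u (ht.subset hu)
    by_cases hst : s ∈ t
    · exact hb t s hst htle hs
    · have h' : ∀ u ∈ t, u < s := fun u hu => lt_of_le_of_ne (htle u hu) fun h => hst (h ▸ hu)
      rw [hGs, hex.choose_spec.1 t h', hglue s t h']
  refine ⟨b, fun l hok hlen => ?_⟩
  rcases hmax l with h0 | ⟨m, hm, hle⟩
  · rw [← h₀ l hok hlen h0]
    refine cob_congr fun t ht _ => ?_
    simp only [b]; rw [if_pos fun u hu => h0 u (ht.subset hu)]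
  · exact key m l hok hlen hle

end ListCochains

section SymplecticEuclid

universe u
variable {R L : Type*} [CommRing R] [IsDomain R] [AddCommGroup L] [Module R L]

/-- `w` is primitive in the submodule `M`, as witnessed by the form `ω`. -/
def PrimIn (ω : LinearMap.BilinForm R L) (M : Submodule R L) (w : L) : Prop :=
  w ∈ M ∧ ∃ z ∈ M, ω w z = 1

/-- The orthogonal complement inside `M` of two vectors. -/
def perp (ω : LinearMap.BilinForm R L) (M : Submodule R L) (z v : L) : Submodule R L :=
  M ⊓ LinearMap.ker (ω z) ⊓ LinearMap.ker (ω v)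

theorem mem_perp {ω : LinearMap.BilinForm R L} {M : Submodule R L} {z v x : L} :
    x ∈ perp ω M z v ↔ (x ∈ M ∧ ω z x = 0) ∧ ω v x = 0 := by
  simp [perp]

/-- Hyperbolic planes can be split off `M` at least `k` times. -/
def Splits (ω : LinearMap.BilinForm R L) : ℕ → Submodule R L → Prop
  | 0, _ => True
  | k + 1, M => (∃ e, PrimIn ω M e) ∧
      ∀ z ∈ M, ∀ v ∈ M, ω z v = 1 → Splits ω k (perp ω M z v)

/-- Every nonzero vector of `M` is a multiple of a primitive one. -/
def HasPrim (ω : LinearMap.BilinForm R L) (M : Submodule R L) : Prop :=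
  ∀ v ∈ M, v ≠ 0 → ∃ (m : R) (v₀ : L), v = m • v₀ ∧ PrimIn ω M v₀

/-- Lists of hyperbolic pairs that are mutually orthogonal. -/
def IsFrame (ω : LinearMap.BilinForm R L) (ps : List (L × L)) : Prop :=
  (∀ p ∈ ps, ω p.1 p.2 = 1) ∧
    ps.Pairwise fun p q => ω p.1 q.1 = 0 ∧ ω p.1 q.2 = 0 ∧ ω p.2 q.1 = 0 ∧ ω p.2 q.2 = 0

theorem Transversal.pairwise {S : Type*} {ps : List (S × S)} {l : List S}
    (h : Transversal ps l) (r : S → S → Prop)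
    (hr : ps.Pairwise fun p q => r p.1 q.1 ∧ r p.1 q.2 ∧ r p.2 q.1 ∧ r p.2 q.2) :
    l.Pairwise r := by
  induction h with
  | nil => simp
  | fst p h ih =>
    rw [List.pairwise_cons] at hr ⊢
    refine ⟨fun a ha => ?_, ih hr.2⟩
    obtain ⟨q, hq, rfl | rfl⟩ := h.mem ha
    exacts [(hr.1 q hq).1, (hr.1 q hq).2.1]
  | snd p h ih =>
    rw [List.pairwise_cons] at hr ⊢
    refine ⟨fun a ha => ?_, ih hr.2⟩
    obtain ⟨q, hq, rfl | rfl⟩ := h.mem ha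
    exacts [(hr.1 q hq).2.2.1, (hr.1 q hq).2.2.2]

theorem exists_order {S : Type*} (f : S → Ordinal.{u}) (g : S → Prop) :
    ∃ _ : LinearOrder S, WellFoundedLT S ∧ (∀ s t, f t < f s → t < s) ∧
      ∀ s t, f t = f s → g t → ¬ g s → t < s := by
  classical
  obtain ⟨lo, wf⟩ := exists_wellFoundedLT S
  let κ : S → Ordinal.{u} ×ₗ (ℕ ×ₗ S) := fun s => toLex (f s, toLex (if g s then 0 else 1, s))
  have hκ : Function.Injective κ := by
    intro s t h
    have := congrArg (fun x => (ofLex (ofLex x).2).2) h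
    simpa [κ] using this
  refine ⟨LinearOrder.lift' κ hκ, ⟨InvImage.wf κ wellFounded_lt⟩, fun s t h => ?_,
    fun s t h ht hs => ?_⟩
  · change κ t < κ s
    exact Prod.Lex.toLex_lt_toLex.2 (Or.inl h)
  · change κ t < κ s
    refine Prod.Lex.toLex_lt_toLex.2 (Or.inr ⟨h, Prod.Lex.toLex_lt_toLex.2 (Or.inl ?_)⟩)
    simp [ht, hs]

theorem IsFrame.exists_dual {ω : LinearMap.BilinForm R L} (hω : ω.IsAlt) {M : Submodule R L}
    (c : L → R) : ∀ {ps : List (L × L)}, IsFrame ω ps → (∀ p ∈ ps, p.1 ∈ M ∧ p.2 ∈ M) →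
    ∃ y ∈ M, (∀ x, (∀ p ∈ ps, ω p.1 x = 0 ∧ ω p.2 x = 0) → ω y x = 0) ∧
      ∀ p ∈ ps, ω y p.1 = - c p.1 ∧ ω y p.2 = - c p.2
  | [], _, _ => ⟨0, M.zero_mem, by simp, by simp⟩
  | p :: ps, hf, hM => by
    obtain ⟨h1, h2⟩ := hf
    rw [List.pairwise_cons] at h2
    have symm0 : ∀ x y, ω x y = 0 → ω y x = 0 := fun x y h => by rw [← hω.neg_eq, h, neg_zero]
    obtain ⟨y, hy, hy1, hy2⟩ := IsFrame.exists_dual hω (M := M) c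
      (ps := ps) ⟨fun q hq => h1 q (by simp [hq]), h2.2⟩ fun q hq => hM q (by simp [hq])
    have hp := hM p (by simp)
    have h12 := h1 p (by simp)
    have h21 : ω p.2 p.1 = -1 := by rw [← hω.neg_eq, h12]
    have e1 : ω y p.1 = 0 := hy1 _ fun q hq =>
      ⟨symm0 _ _ (h2.1 q hq).1, symm0 _ _ (h2.1 q hq).2.1⟩
    have e2 : ω y p.2 = 0 := hy1 _ fun q hq =>
      ⟨symm0 _ _ (h2.1 q hq).2.2.1, symm0 _ _ (h2.1 q hq).2.2.2⟩
    refine ⟨y - c p.2 • p.1 + c p.1 • p.2,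
      M.add_mem (M.sub_mem hy (M.smul_mem _ hp.1)) (M.smul_mem _ hp.2), fun x hx => ?_, ?_⟩
    · have hpx := hx p (by simp)
      simp [hy1 x fun q hq => hx q (by simp [hq]), hpx.1, hpx.2]
    · intro q hq
      rcases List.mem_cons.1 hq with rfl | hq
      · simp [e1, e2, h12, h21, hω.self_eq_zero]
      · have := h2.1 q hq
        simp [hy2 q hq, this]

theorem hasPrim_perp {ω : LinearMap.BilinForm R L} (hω : ω.IsAlt) {M : Submodule R L}
    [Module.IsTorsionFree R L] (hM : HasPrim ω M) {z v : L} (hz : z ∈ M) (hv : v ∈ M)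
    (hzv : ω z v = 1) : HasPrim ω (perp ω M z v) := by
  intro x hx hx0
  obtain ⟨⟨hxM, hzx⟩, hvx⟩ := mem_perp.1 hx
  obtain ⟨m, x₀, rfl, hx₀, y, hy, hxy⟩ := hM x hxM hx0
  have hm : m ≠ 0 := by rintro rfl; simp at hx0
  have h1 : ω z x₀ = 0 := by simpa [hm] using hzx
  have h2 : ω v x₀ = 0 := by simpa [hm] using hvx
  have hvz : ω v z = -1 := by rw [← hω.neg_eq, hzv]
  have h1' : ω x₀ z = 0 := by rw [← hω.neg_eq, h1, neg_zero]
  have h2' : ω x₀ v = 0 := by rw [← hω.neg_eq, h2, neg_zero]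
  refine ⟨m, x₀, rfl, mem_perp.2 ⟨⟨hx₀, h1⟩, h2⟩, y + ω v y • z - ω z y • v,
    mem_perp.2 ⟨⟨M.sub_mem (M.add_mem hy (M.smul_mem _ hz)) (M.smul_mem _ hv), ?_⟩, ?_⟩, ?_⟩
  · simp [hzv, hω.self_eq_zero]
  · simp [hvz, hω.self_eq_zero]
  · simp [hxy, h1', h2']

end SymplecticEuclid

section SymplecticEuclidMain

universe u
variable {R L : Type*} [CommRing R] [IsDomain R] [AddCommGroup L] [Module R L]

theorem exists_primGen (ω : LinearMap.BilinForm R L) {M : Submodule R L} (hM : HasPrim ω M) :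
    ∃ pg : L → L, (∀ w, PrimIn ω M w → pg w = w) ∧
      ∀ x ∈ M, x ≠ 0 → PrimIn ω M (pg x) ∧ ∃ m : R, x = m • pg x := by
  classical
  choose! m v₀ h using hM
  refine ⟨fun x => if PrimIn ω M x then x else v₀ x, fun w hw => if_pos hw, fun x hx hx0 => ?_⟩
  dsimp only
  split_ifs with h'
  · exact ⟨h', 1, (one_smul _ _).symm⟩
  · exact ⟨(h x hx hx0).2, m x, (h x hx hx0).1⟩

/-- High connectivity of the complex of isotropic lists over a Euclidean ring, together with the
fact that its top cohomology is detected by the standard cross-polytopes. -/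
theorem isotropic_acyclic {S A : Type*} [AddCommGroup A] [Module.IsTorsionFree R L]
    {ω : LinearMap.BilinForm R L} (hω : ω.IsAlt)
    (ρ : R → Ordinal.{u}) (hρ0 : ∀ a, ρ a = 0 ↔ a = 0)
    (hρ : ∀ a b, b ≠ 0 → ∃ q, ρ (a + q * b) < ρ b) (k : ℕ) :
    ∀ (M : Submodule R L), Splits ω k M → HasPrim ω M →
    ∀ (T : S → Prop) (π : S → L) (σ : L → S) (_ : ∀ s, T s → PrimIn ω M (π s))
    (_ : ∀ w, PrimIn ω M w → T (σ w) ∧ π (σ w) = w) (j : ℕ) (_ : j ≤ k) (c : List S → A)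
    (_ : ∀ l : List S, (∀ s ∈ l, T s) → (l.Pairwise fun s t => ω (π s) (π t) = 0) →
      l.length = j + 1 → cob c l = 0)
    (_ : j = k → ∀ ps, IsFrame ω ps → (∀ p ∈ ps, p.1 ∈ M ∧ p.2 ∈ M) → ps.length = k →
      apt (ps.map (Prod.map σ σ)) c = 0),
    ∃ b : List S → A, ∀ l : List S, (∀ s ∈ l, T s) →
      (l.Pairwise fun s t => ω (π s) (π t) = 0) → l.length = j → cob b l = c l := by
  have symm0 : ∀ x y, ω x y = 0 → ω y x = 0 := fun x y h => by
    rw [← hω.neg_eq, h, neg_zero]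
  induction k with
  | zero =>
    intro M _ _ T π σ _ _ j hj c _ hfr
    obtain rfl : j = 0 := by omega
    refine ⟨0, fun l _ _ hl => ?_⟩
    obtain rfl := List.length_eq_zero_iff.1 hl
    exact (hfr rfl [] ⟨by simp, by simp⟩ (by simp) rfl).symm
  | succ k ih =>
    intro M hS hM T π σ hT hσ j hj c hc hfr
    obtain ⟨⟨e, he⟩, hS'⟩ := hS
    cases j with
    | zero =>
      refine ⟨0, fun l _ _ hl => ?_⟩
      obtain rfl := List.length_eq_zero_iff.1 hl
      have := hc [σ e] (by simpa using (hσ e he).1) (by simp) rfl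
      rw [cob_cons, cob_nil, sub_zero] at this
      exact this.symm
    | succ i =>
      obtain ⟨lo, wf, ho1, ho2⟩ :=
        exists_order (fun s => ρ (ω e (π s))) (fun s => s = σ (π s))
      have hP : ∀ l : List S, (l.Pairwise fun s t => ω (π s) (π t) = 0) →
          ∀ s ∈ l, ∀ t ∈ l, ω (π s) (π t) = 0 := fun l hl s hs t ht =>
        hl.forall_of_forall_of_flip (fun x _ => hω.self_eq_zero _)
          (hl.imp fun h => symm0 _ _ h) hs ht
      have main := cob_extend (S := S)
        (fun l => (∀ s ∈ l, T s) ∧ l.Pairwise fun s t => ω (π s) (π t) = 0)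
        (fun s => ω e (π s) = 0) ?_ (i + 1) c (fun l => c (σ e :: l)) ?_ ?_
      · obtain ⟨b, hb⟩ := main
        exact ⟨b, fun l h1 h2 h3 => hb l ⟨h1, h2⟩ h3⟩
      · intro s t hts hs
        by_contra ht
        refine absurd (ho1 t s ?_) (not_lt.2 hts)
        rw [(hρ0 _).2 hs]
        exact pos_iff_ne_zero.2 (mt (hρ0 _).1 ht)
      · intro l hl hlen hl0
        refine cob_cone (hc _ ?_ ?_ (by simp [hlen]))
        · simpa using ⟨(hσ e he).1, hl.1⟩
        · exact List.pairwise_cons.2 ⟨fun t ht => by rw [(hσ e he).2]; exact hl0 t ht, hl.2⟩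
      · intro s hs b _ hb
        by_cases hTs : T s
        swap
        · refine ⟨b, fun _ _ => rfl, fun l hl hlen hle => hb l hl hlen fun t ht =>
            lt_of_le_of_ne (hle t ht) ?_⟩
          rintro rfl; exact hTs (hl.1 _ ht)
        obtain ⟨hv, z₁, hz₁, hvz₁⟩ := hT s hTs
        set v := π s with hvdef
        set z₀ := -z₁ with hz₀def
        have hz₀ : z₀ ∈ M := M.neg_mem hz₁
        have hzv : ω z₀ v = 1 := by rw [← hω.neg_eq]; simp [z₀, hvz₁]
        have hvz : ω v z₀ = -1 := by simp [z₀, hvz₁]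
        -- it suffices to kill the difference of the two solutions on the link
        suffices hlink : ∃ a : List S → A, ∀ l : List S,
            (∀ t ∈ l, T t ∧ t < s ∧ ω v (π t) = 0) →
            (l.Pairwise fun s t => ω (π s) (π t) = 0) → l.length = i →
            cob a l = b l - c (s :: l) by
          classical
          obtain ⟨a, ha⟩ := hlink
          refine ⟨fun l => if ∀ t ∈ l, t < s then b l else c (s :: l) + cob a l,
            fun l hl => if_pos hl, fun l hl hlen hle => ?_⟩
          by_cases hsl : s ∈ l
          swap
          · have hlt : ∀ t ∈ l, t < s := fun t ht =>
              lt_of_le_of_ne (hle t ht) fun h => hsl (h ▸ ht)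
            rw [← hb l hl hlen hlt]
            exact cob_congr fun t ht _ => if_pos fun u hu => hlt u (ht.subset hu)
          · have h1 : cob (fun t => c (s :: t) + cob a t) l = c l := by
              have : cob (fun t => cob a t) l = 0 := cob_cob a l
              rw [cob_add, this, add_zero]
              refine cob_cone (hc _ ?_ ?_ (by simp [hlen]))
              · simpa using ⟨hTs, hl.1⟩
              · exact List.pairwise_cons.2 ⟨fun t ht => hP l hl.2 s hsl t ht, hl.2⟩
            rw [← h1]
            refine cob_congr fun t ht htl => ?_
            split_ifs with hlt
            · rw [ha t (fun u hu => ⟨hl.1 u (ht.subset hu), hlt u hu,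
                hP l hl.2 s hsl u (ht.subset hu)⟩) (hl.2.sublist ht) (by omega)]
              abel
            · rfl
        have hcoc : ∀ l : List S, (∀ t ∈ l, T t ∧ t < s ∧ ω v (π t) = 0) →
            (l.Pairwise fun s t => ω (π s) (π t) = 0) → l.length = i + 1 →
            cob (fun l => b l - c (s :: l)) l = 0 := by
          intro l hl hp hlen
          rw [cob_sub, hb l ⟨fun t ht => (hl t ht).1, hp⟩ hlen fun t ht => (hl t ht).2.1,
            cob_cone (hc _ ?_ ?_ (by simp [hlen])), sub_self]
          · simpa using ⟨hTs, fun t ht => (hl t ht).1⟩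
          · exact List.pairwise_cons.2 ⟨fun t ht => (hl t ht).2.2, hp⟩
        by_cases hcone : ∃ t₀, T t₀ ∧ t₀ < s ∧ ω v (π t₀) = 0 ∧
            ∀ t, T t → t < s → ω v (π t) = 0 → ω (π t₀) (π t) = 0
        · obtain ⟨t₀, h1, h2, h3, h4⟩ := hcone
          refine ⟨fun l => b (t₀ :: l) - c (s :: t₀ :: l), fun l hl hp hlen =>
            cob_cone (c := fun l => b l - c (s :: l)) (hcoc _ ?_ ?_ (by simp [hlen]))⟩
          · simpa using ⟨⟨h1, h2, h3⟩, hl⟩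
          · exact List.pairwise_cons.2
              ⟨fun t ht => h4 t (hl t ht).1 (hl t ht).2.1 (hl t ht).2.2, hp⟩
        have hnm : ∀ t, T t → t < s → ω v (π t) = 0 → ∀ a : R, π t ≠ a • v := by
          intro t ht hts htv a hta
          refine hcone ⟨t, ht, hts, htv, fun t' _ _ h' => ?_⟩
          simp [hta, h']
        have hsσ : s = σ v := by
          by_contra hne
          have hpv : PrimIn ω M v := hT s hTs
          have h2 := hσ v hpv
          refine hnm (σ v) h2.1 (ho2 _ _ ?_ ?_ hne) ?_ 1 ?_
          · rw [h2.2]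
          · rw [h2.2]
          · rw [h2.2]; exact hω.self_eq_zero _
          · rw [h2.2, one_smul]
        -- the reduced problem in the orthogonal complement of a hyperbolic plane
        have hM' : HasPrim ω (perp ω M z₀ v) := hasPrim_perp hω hM hz₀ hv hzv
        obtain ⟨pg, hpg1, hpg2⟩ := exists_primGen ω hM'
        choose cw hcw using fun w => hρ (ω e w) (ω e v) hs
        let lift : L → L := fun w => w + cw w • v
        have hlift : ∀ w, PrimIn ω (perp ω M z₀ v) w → PrimIn ω M (lift w) := by
          rintro w ⟨hw, y, hy, hwy⟩
          have hw' := mem_perp.1 hw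
          have hy' := mem_perp.1 hy
          exact ⟨M.add_mem hw'.1.1 (M.smul_mem _ hv), y, hy'.1.1, by simp [lift, hwy, hy'.2]⟩
        have hσ'T : ∀ w, PrimIn ω (perp ω M z₀ v) w →
            T (σ (lift w)) ∧ σ (lift w) < s ∧ ω v (π (σ (lift w))) = 0 := by
          intro w hw
          have h := hσ _ (hlift w hw)
          refine ⟨h.1, ho1 _ _ ?_, ?_⟩
          · rw [h.2]; simpa [lift] using hcw w
          · rw [h.2]; simp [lift, (mem_perp.1 hw.1).2, hω.self_eq_zero]
        let p : L → L := fun x => x - ω z₀ x • v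
        have hpM : ∀ t, T t → ω v (π t) = 0 → p (π t) ∈ perp ω M z₀ v := by
          intro t ht htv
          refine mem_perp.2 ⟨⟨M.sub_mem (hT t ht).1 (M.smul_mem _ hv), ?_⟩, ?_⟩
          · simp [p, hzv]
          · simp [p, htv, hω.self_eq_zero]
        have hp0 : ∀ t, T t → t < s → ω v (π t) = 0 → p (π t) ≠ 0 := by
          intro t ht hts htv h
          exact hnm t ht hts htv _ (sub_eq_zero.1 h)
        have horth : ∀ t u, (T t ∧ t < s ∧ ω v (π t) = 0) → (T u ∧ u < s ∧ ω v (π u) = 0) →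
            (ω (pg (p (π t))) (pg (p (π u))) = 0 ↔ ω (π t) (π u) = 0) := by
          rintro t u ⟨ht, hts, htv⟩ ⟨hu, hus, huv⟩
          obtain ⟨-, m, hm⟩ := hpg2 _ (hpM t ht htv) (hp0 t ht hts htv)
          obtain ⟨-, m', hm'⟩ := hpg2 _ (hpM u hu huv) (hp0 u hu hus huv)
          have h1 : ω (p (π t)) (p (π u)) = ω (π t) (π u) := by
            simp [p, huv, symm0 _ _ htv, hω.self_eq_zero]
          have hm0 : m ≠ 0 := by
            rintro rfl; exact hp0 t ht hts htv (by rw [hm, zero_smul])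
          have hm0' : m' ≠ 0 := by
            rintro rfl; exact hp0 u hu hus huv (by rw [hm', zero_smul])
          rw [← h1]
          conv_rhs => rw [hm, hm']
          simp [hm0, hm0']
        have hih := ih (perp ω M z₀ v) (hS' _ hz₀ _ hv hzv) hM'
          (fun t => T t ∧ t < s ∧ ω v (π t) = 0) (fun t => pg (p (π t)))
          (fun w => σ (lift w)) (fun t ht => (hpg2 _ (hpM t ht.1 ht.2.2)
            (hp0 t ht.1 ht.2.1 ht.2.2)).1) ?_ i (by omega)
          (fun l => b l - c (s :: l)) ?_ ?_
        · obtain ⟨a, ha⟩ := hih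
          refine ⟨a, fun l hl hp hlen => ha l hl ?_ hlen⟩
          exact hp.imp_of_mem fun {t u} ht hu h => (horth t u (hl t ht) (hl u hu)).2 h
        · intro w hw
          refine ⟨hσ'T w hw, ?_⟩
          have hw' := mem_perp.1 hw.1
          have : p (π (σ (lift w))) = w := by
            rw [(hσ _ (hlift w hw)).2]; simp [p, lift, hw'.1.2, hzv]
          rw [this]; exact hpg1 w hw
        · intro l hl hp hlen
          refine hcoc l hl ?_ hlen
          exact hp.imp_of_mem fun {t u} ht hu h => (horth t u (hl t ht) (hl u hu)).1 h
        · intro hik ps hfps hpsM hlen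
          subst hik
          obtain ⟨y, hyM, hy1, hy2⟩ := hfps.exists_dual hω cw hpsM
          have hy' := mem_perp.1 hyM
          obtain ⟨q, hq⟩ := hρ (ω e (z₀ + y)) (ω e v) hs
          set z := z₀ + y + q • v with hz
          have hzM : z ∈ M := M.add_mem (M.add_mem hz₀ hy'.1.1) (M.smul_mem _ hv)
          have hzv' : ω z v = 1 := by
            simp [hz, hzv, symm0 _ _ hy'.2, hω.self_eq_zero]
          have hzprim : PrimIn ω M z := ⟨hzM, v, hv, hzv'⟩
          have hzlt : σ z < s := ho1 _ _ (by
            rw [(hσ z hzprim).2, hz]; simpa using hq)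
          have hzp : ∀ p ∈ ps, ω z (lift p.1) = 0 ∧ ω z (lift p.2) = 0 := by
            intro p hp
            have h1 := (mem_perp.1 (hpsM p hp).1)
            have h2 := (mem_perp.1 (hpsM p hp).2)
            simp [hz, lift, hzv, h1.1.2, h1.2, h2.1.2, h2.2, hy2 p hp, symm0 _ _ hy'.2,
              hω.self_eq_zero]
          have hvp : ∀ p ∈ ps, ω v (lift p.1) = 0 ∧ ω v (lift p.2) = 0 := by
            intro p hp
            simp [lift, (mem_perp.1 (hpsM p hp).1).2, (mem_perp.1 (hpsM p hp).2).2,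
              hω.self_eq_zero]
          have hlωl : ∀ w w', ω v w = 0 → ω v w' = 0 → ω (lift w) (lift w') = ω w w' := by
            intro w w' h h'; simp [lift, h', symm0 _ _ h, hω.self_eq_zero]
          have hvps : ∀ p ∈ ps, ω v p.1 = 0 ∧ ω v p.2 = 0 := fun p hp =>
            ⟨(mem_perp.1 (hpsM p hp).1).2, (mem_perp.1 (hpsM p hp).2).2⟩
          have hpprim : ∀ p ∈ ps, PrimIn ω (perp ω M z₀ v) p.1 ∧
              PrimIn ω (perp ω M z₀ v) p.2 := fun p hp =>
            ⟨⟨(hpsM p hp).1, p.2, (hpsM p hp).2, hfps.1 p hp⟩, (hpsM p hp).2, - p.1,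
              Submodule.neg_mem _ (hpsM p hp).1, by
                rw [map_neg, hω.neg_eq]; exact hfps.1 p hp⟩
          have hF : IsFrame ω ((z, v) :: ps.map (Prod.map lift lift)) := by
            refine ⟨?_, List.pairwise_cons.2 ⟨?_, ?_⟩⟩
            · intro p hp
              rcases List.mem_cons.1 hp with rfl | hp
              · exact hzv'
              · obtain ⟨p, hp', rfl⟩ := List.mem_map.1 hp
                replace hp := hp'
                simp only [Prod.map_fst, Prod.map_snd]
                rw [hlωl _ _ (hvps p hp).1 (hvps p hp).2]; exact hfps.1 p hp
            · intro p hp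
              obtain ⟨p, hp', rfl⟩ := List.mem_map.1 hp
              replace hp := hp'
              exact ⟨(hzp p hp).1, (hzp p hp).2, (hvp p hp).1, (hvp p hp).2⟩
            · rw [List.pairwise_map]
              refine hfps.2.imp_of_mem fun {p q} hp hq h => ?_
              have hp := hvps p hp
              have hq := hvps q hq
              simp only [Prod.map_fst, Prod.map_snd]
              rw [hlωl _ _ hp.1 hq.1, hlωl _ _ hp.1 hq.2, hlωl _ _ hp.2 hq.1, hlωl _ _ hp.2 hq.2]
              exact h
          have h0 := hfr rfl _ hF (by
            intro p hp
            rcases List.mem_cons.1 hp with rfl | hp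
            · exact ⟨hzM, hv⟩
            · obtain ⟨p, hp', rfl⟩ := List.mem_map.1 hp
              replace hp := hp'
              exact ⟨(hlift _ (hpprim p hp).1).1, (hlift _ (hpprim p hp).2).1⟩)
            (by simp [hlen])
          rw [List.map_cons, apt, List.map_map, Prod.map_comp_map] at h0
          simp only [Prod.map_fst, Prod.map_snd] at h0
          rw [← hsσ] at h0
          have h1 : apt (ps.map (Prod.map (σ ∘ lift) (σ ∘ lift))) (fun l => c (σ z :: l)) =
              apt (ps.map (Prod.map (σ ∘ lift) (σ ∘ lift))) b := by
            have : apt (ps.map (Prod.map (σ ∘ lift) (σ ∘ lift))) (fun l => c (σ z :: l)) =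
              apt (ps.map (Prod.map (σ ∘ lift) (σ ∘ lift)))
                (fun l => b l - cob (fun t => b (σ z :: t)) l) := by
              refine apt_congr fun l hl => ?_
              have hlT : ∀ t ∈ l, (T t ∧ t < s ∧ ω v (π t) = 0) ∧ ω z (π t) = 0 := by
                intro t ht
                obtain ⟨p, hp, h⟩ := hl.mem ht
                obtain ⟨p, hp', rfl⟩ := List.mem_map.1 hp
                replace hp := hp'
                rcases h with rfl | rfl
                · refine ⟨hσ'T _ (hpprim p hp).1, ?_⟩
                  simp only [Prod.map_fst, Function.comp]
                  rw [(hσ _ (hlift _ (hpprim p hp).1)).2]; exact (hzp p hp).1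
                · refine ⟨hσ'T _ (hpprim p hp).2, ?_⟩
                  simp only [Prod.map_snd, Function.comp]
                  rw [(hσ _ (hlift _ (hpprim p hp).2)).2]; exact (hzp p hp).2
              rw [← hb (σ z :: l) ⟨?_, ?_⟩ ?_ ?_, cob_cons]
              · simpa using ⟨(hσ z hzprim).1, fun t ht => (hlT t ht).1.1⟩
              · refine List.pairwise_cons.2 ⟨fun t ht => ?_, hl.pairwise _ ?_⟩
                · rw [(hσ z hzprim).2]; exact (hlT t ht).2
                · rw [List.pairwise_map]
                  refine hfps.2.imp_of_mem fun {p q} hp hq h => ?_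
                  simp only [Prod.map_fst, Prod.map_snd, Function.comp]
                  rw [(hσ _ (hlift _ (hpprim p hp).1)).2, (hσ _ (hlift _ (hpprim p hp).2)).2,
                    (hσ _ (hlift _ (hpprim q hq).1)).2, (hσ _ (hlift _ (hpprim q hq).2)).2]
                  have hp := hvps p hp
                  have hq := hvps q hq
                  rw [hlωl _ _ hp.1 hq.1, hlωl _ _ hp.1 hq.2, hlωl _ _ hp.2 hq.1,
                    hlωl _ _ hp.2 hq.2]
                  exact h
              · simp [hl.length, hlen]
              · simpa using ⟨hzlt, fun t ht => (hlT t ht).1.2.1⟩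
            rw [this, apt_sub, apt_cob, sub_zero]
          rw [h1] at h0
          exact (apt_sub _ _ _).trans h0

end SymplecticEuclidMain

section

open Set Filter Topology MeasureTheory
open scoped ContDiff

section ParametricIntegral

variable {E F : Type} [NormedAddCommGroup E] [NormedSpace ℝ E]
  [NormedAddCommGroup F] [NormedSpace ℝ F]

theorem hasFDerivAt_integral_param {W : Set (E × ℝ)} (hW : IsOpen W) {f : E × ℝ → F}
    (hf : ContDiffOn ℝ 1 f W) {x₀ : E} (hx : ∀ t ∈ Icc (0 : ℝ) 1, (x₀, t) ∈ W) :
    HasFDerivAt (fun x => ∫ t in (0 : ℝ)..1, f (x, t))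
      (∫ t in (0 : ℝ)..1, (fderiv ℝ f (x₀, t)).comp (ContinuousLinearMap.inl ℝ E ℝ)) x₀ := by
  set G : E × ℝ → E →L[ℝ] F := fun p => (fderiv ℝ f p).comp (ContinuousLinearMap.inl ℝ E ℝ)
  have hG : ContinuousOn G W :=
    (hf.continuousOn_fderiv_of_isOpen hW le_rfl).clm_comp continuousOn_const
  have hKc : IsCompact ((fun t : ℝ => (x₀, t)) '' Icc 0 1) :=
    isCompact_Icc.image (by fun_prop)
  have hKW : (fun t : ℝ => (x₀, t)) '' Icc 0 1 ⊆ W := by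
    rintro _ ⟨t, ht, rfl⟩; exact hx t ht
  obtain ⟨C, hC⟩ := (hKc.image_of_continuousOn (hG.mono hKW).norm).bddAbove
  have hVo : IsOpen (W ∩ (fun p => ‖G p‖) ⁻¹' Iio (C + 1)) :=
    hG.norm.isOpen_inter_preimage hW isOpen_Iio
  have hsub : ({x₀} : Set E) ×ˢ Icc (0 : ℝ) 1 ⊆ W ∩ (fun p => ‖G p‖) ⁻¹' Iio (C + 1) := by
    rintro ⟨x, t⟩ ⟨h1, ht⟩
    obtain rfl : x = x₀ := h1
    refine ⟨hx t ht, ?_⟩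
    have : ‖G (x, t)‖ ≤ C := hC ⟨_, ⟨t, ht, rfl⟩, rfl⟩
    exact lt_of_le_of_lt this (by simp)
  obtain ⟨u, v, hu, -, hxu, hIv, huv⟩ :=
    generalized_tube_lemma isCompact_singleton isCompact_Icc hVo hsub
  have hun : u ∈ 𝓝 x₀ := hu.mem_nhds (hxu rfl)
  have hcont : ∀ x ∈ u, ∀ {F' : Type} [TopologicalSpace F'] (g : E × ℝ → F'), ContinuousOn g W →
      ContinuousOn (fun t => g (x, t)) (Icc 0 1) := by
    intro x hx F' _ g hg
    refine hg.comp (by fun_prop) fun t ht => (huv ⟨hx, hIv ht⟩).1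
  have hI : uIoc (0 : ℝ) 1 ⊆ Icc 0 1 := by
    rw [uIoc_of_le zero_le_one]; exact Ioc_subset_Icc_self
  have h_int : ∀ x ∈ u, ∀ {F' : Type} [NormedAddCommGroup F'] [NormedSpace ℝ F']
      (g : E × ℝ → F'), ContinuousOn g W →
      IntervalIntegrable (fun t => g (x, t)) volume 0 1 := by
    intro x hx F' _ _ g hg
    refine ContinuousOn.intervalIntegrable ?_
    rw [uIcc_of_le zero_le_one]
    exact hcont x hx g hg
  refine intervalIntegral.hasFDerivAt_integral_of_dominated_of_fderiv_le
    (F := fun x t => f (x, t)) (F' := fun x t => G (x, t)) (bound := fun _ => C + 1) hun ?_ ?_ ?_ ?_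
    (by simp) ?_
  · filter_upwards [hun] with x hx
    have := (h_int x hx f hf.continuousOn).1.aestronglyMeasurable; rwa [uIoc_of_le zero_le_one]
  · exact h_int x₀ (hxu rfl) f hf.continuousOn
  · have := (h_int x₀ (hxu rfl) G hG).1.aestronglyMeasurable; rwa [uIoc_of_le zero_le_one]
  · refine ae_of_all _ fun t ht x hx => ?_
    exact le_of_lt (huv ⟨hx, hIv (hI ht)⟩).2
  · refine ae_of_all _ fun t ht x hx => ?_
    have hxt := (huv (show (x, t) ∈ u ×ˢ v from ⟨hx, hIv (hI ht)⟩)).1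
    have h1 : HasFDerivAt f (fderiv ℝ f (x, t)) (x, t) :=
      ((hf.contDiffAt (hW.mem_nhds hxt)).differentiableAt one_ne_zero).hasFDerivAt
    exact h1.comp x (hasFDerivAt_prodMk_left x t)

variable [CompleteSpace F]

theorem contDiffOn_integral_param {W : Set (E × ℝ)} (hW : IsOpen W) {f : E × ℝ → F}
    (hf : ContDiffOn ℝ ∞ f W) {U : Set E} (hU : IsOpen U)
    (hx : ∀ x ∈ U, ∀ t ∈ Icc (0 : ℝ) 1, (x, t) ∈ W) :
    ContDiffOn ℝ ∞ (fun x => ∫ t in (0 : ℝ)..1, f (x, t)) U := by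
  rw [contDiffOn_infty]
  intro n
  induction n generalizing F with
  | zero =>
    rw [Nat.cast_zero, contDiffOn_zero]
    intro x hxU
    exact (hasFDerivAt_integral_param hW (hf.of_le (by simp))
      (hx x hxU)).continuousAt.continuousWithinAt
  | succ n ih =>
    have hd := fun x hxU => hasFDerivAt_integral_param hW (hf.of_le (by simp)) (hx x hxU)
    push_cast
    rw [contDiffOn_succ_iff_fderiv_of_isOpen hU]
    refine ⟨fun x hxU => (hd x hxU).differentiableAt.differentiableWithinAt, by simp, ?_⟩
    have h2 : ContDiffOn ℝ ∞ (fun p => (fderiv ℝ f p).comp (ContinuousLinearMap.inl ℝ E ℝ)) W :=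
      (hf.fderiv_of_isOpen hW (by simp)).clm_comp contDiffOn_const
    exact (ih h2).congr fun x hxU => (hd x hxU).fderiv

theorem clm_fderiv_integral_param {G : Type} [NormedAddCommGroup G] [NormedSpace ℝ G]
    [CompleteSpace G] {W : Set (E × ℝ)} (hW : IsOpen W) {f : E × ℝ → F}
    (hf : ContDiffOn ℝ 1 f W) {x₀ : E} (hx : ∀ t ∈ Icc (0 : ℝ) 1, (x₀, t) ∈ W)
    (L : (E →L[ℝ] F) →L[ℝ] G) :
    L (fderiv ℝ (fun x => ∫ t in (0 : ℝ)..1, f (x, t)) x₀) =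
      ∫ t in (0 : ℝ)..1, L ((fderiv ℝ f (x₀, t)).comp (ContinuousLinearMap.inl ℝ E ℝ)) := by
  rw [(hasFDerivAt_integral_param hW hf hx).fderiv]
  refine (L.intervalIntegral_comp_comm (ContinuousOn.intervalIntegrable ?_)).symm
  rw [uIcc_of_le zero_le_one]
  exact ((hf.continuousOn_fderiv_of_isOpen hW le_rfl).clm_comp continuousOn_const).comp
    (by fun_prop) hx

end ParametricIntegral

end

section

open Set Filter Topology MeasureTheory
open scoped ContDiff

section Poincare

variable {E : Type} [NormedAddCommGroup E] [NormedSpace ℝ E]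

open ContinuousAlternatingMap in
theorem curryLeft_alternatize {q : ℕ} (f : E →L[ℝ] E [⋀^Fin (q + 1)]→L[ℝ] ℝ) (y : E) :
    (alternatizeUncurryFin f).curryLeft y =
      f y - alternatizeUncurryFin
        ((((curryLeftLI (𝕜 := ℝ) (E := E) (F := ℝ) (n := q)).toContinuousLinearMap).comp f).flip y) := by
  ext v
  rw [curryLeft_apply_apply, alternatizeUncurryFin_apply, Fin.sum_univ_succ,
    ContinuousAlternatingMap.sub_apply, alternatizeUncurryFin_apply, sub_eq_add_neg,
    ← Finset.sum_neg_distrib]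
  congr 1
  · simp
  · refine Finset.sum_congr rfl fun i _ => ?_
    have h : (i.succ).removeNth (Matrix.vecCons y v) = Matrix.vecCons y (i.removeNth v) := by
      ext j; refine Fin.cases ?_ (fun j => ?_) j <;> simp [Fin.removeNth, Matrix.vecCons]
    simp only [h, Fin.val_succ, pow_succ, Matrix.cons_val_succ, ContinuousLinearMap.flip_apply,
      ContinuousLinearMap.comp_apply]
    simp [curryLeftLI]


theorem homotopy_primitive {V₀ V₁ : Type} [NormedAddCommGroup V₀] [NormedSpace ℝ V₀]
    [CompleteSpace V₀] [NormedAddCommGroup V₁] [NormedSpace ℝ V₁] [CompleteSpace V₁]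
    (c : V₁ →L[ℝ] E →L[ℝ] V₀) (A : (E →L[ℝ] V₀) →L[ℝ] V₁) (q : ℕ)
    (hA : ∀ v, A (c v) = (q + 1) • v) {U : Set E} (hU : IsOpen U) (hc : Convex ℝ U)
    (w : E → V₁) (hw : ContDiffOn ℝ ∞ w U)
    (hd : ∀ x ∈ U, ∀ y, A ((c.comp (fderiv ℝ w x)).flip y) = fderiv ℝ w x y) {p : E} (hp : p ∈ U) :
    ∃ η : E → V₀, ContDiffOn ℝ ∞ η U ∧ ∀ x ∈ U, A (fderiv ℝ η x) = w x := by
  let γ : E × ℝ → E := fun y => p + y.2 • (y.1 - p)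
  have hγ : ContDiff ℝ ∞ γ := by fun_prop
  let W : Set (E × ℝ) := γ ⁻¹' U
  have hW : IsOpen W := hU.preimage hγ.continuous
  have hUW : ∀ x ∈ U, ∀ t ∈ Icc (0 : ℝ) 1, (x, t) ∈ W := fun x hx t ht =>
    hc.add_smul_sub_mem hp hx ht
  let f : E × ℝ → V₀ := fun y => y.2 ^ q • c (w (γ y)) (y.1 - p)
  have hwγ : ContDiffOn ℝ ∞ (fun y => w (γ y)) W := hw.comp hγ.contDiffOn fun y hy => hy
  have hf : ContDiffOn ℝ ∞ f W := by
    have h1 : ContDiffOn ℝ ∞ (fun y : E × ℝ => y.2 ^ q) W := by fun_prop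
    have h2 : ContDiffOn ℝ ∞ (fun y : E × ℝ => y.1 - p) W := by fun_prop
    have h3 : ContDiffOn ℝ ∞ (fun y => c (w (γ y))) W := c.contDiff.comp_contDiffOn hwγ
    exact h1.smul (h3.clm_apply h2)
  refine ⟨_, contDiffOn_integral_param hW hf hU hUW, fun x hx => ?_⟩
  have hG : ContinuousOn
      (fun y => A ((fderiv ℝ f y).comp (ContinuousLinearMap.inl ℝ E ℝ))) W :=
    A.continuous.comp_continuousOn
      ((hf.continuousOn_fderiv_of_isOpen hW (by simp)).clm_comp continuousOn_const)
  have key : ∀ t ∈ Icc (0 : ℝ) 1,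
      HasDerivAt (fun t => t ^ (q + 1) • w (γ (x, t)))
        (A ((fderiv ℝ f (x, t)).comp (ContinuousLinearMap.inl ℝ E ℝ))) t := by
    intro t ht
    have hxt := hUW x hx t ht
    have hDw : HasFDerivAt w (fderiv ℝ w (γ (x, t))) (γ (x, t)) :=
      ((hw.contDiffAt (hU.mem_nhds hxt)).differentiableAt (by simp)).hasFDerivAt
    have hfd : HasFDerivAt f (fderiv ℝ f (x, t)) (x, t) :=
      ((hf.contDiffAt (hW.mem_nhds hxt)).differentiableAt (by simp)).hasFDerivAt
    have e1 : HasFDerivAt (fun z => f (z, t))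
        ((fderiv ℝ f (x, t)).comp (ContinuousLinearMap.inl ℝ E ℝ)) x :=
      hfd.comp (f := fun z => (z, t)) x (hasFDerivAt_prodMk_left x t)
    have g1 : HasFDerivAt (fun z => γ (z, t)) (t • ContinuousLinearMap.id ℝ E) x :=
      (((hasFDerivAt_id x).sub_const p).const_smul t).const_add p
    have g2 : HasFDerivAt (fun z => c (w (γ (z, t))))
        (c.comp ((fderiv ℝ w (γ (x, t))).comp (t • ContinuousLinearMap.id ℝ E))) x :=
      c.hasFDerivAt.comp (f := fun z => w (γ (z, t))) x (hDw.comp (f := fun z => γ (z, t)) x g1)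
    have e2 := (g2.clm_apply ((hasFDerivAt_id x).sub_const p)).const_smul (t ^ q)
    rw [e1.unique e2]
    have hcl := hd _ hxt (x - p)
    have hA2 := hA (w (γ (x, t)))
    have g3 : HasDerivAt (fun t => γ (x, t)) (x - p) t := by
      simpa [γ] using ((hasDerivAt_id t).smul_const (x - p)).const_add p
    have g4 := (hasDerivAt_pow (q + 1) t).smul (hDw.comp_hasDerivAt (f := fun t => γ (x, t)) t g3)
    refine HasDerivAt.congr_deriv g4 ?_
    have : (c (w (γ (x, t)))).comp (ContinuousLinearMap.id ℝ E) +
        (c.comp ((fderiv ℝ w (γ (x, t))).comp (t • ContinuousLinearMap.id ℝ E))).flip (id x - p)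
        = c (w (γ (x, t))) + t • (c.comp (fderiv ℝ w (γ (x, t)))).flip (x - p) := by
      ext z
      simp
    rw [this, map_smul, map_add, map_smul, hA2]
    simp only [Nat.add_sub_cancel, pow_succ, Function.comp_apply, id_eq] at *
    rw [hcl]; push_cast; module
  have hcont : ∀ t ∈ Icc (0:ℝ) 1, (x, t) ∈ W := hUW x hx
  have h_int : IntervalIntegrable
      (fun t => A ((fderiv ℝ f (x, t)).comp (ContinuousLinearMap.inl ℝ E ℝ))) volume 0 1 := by
    refine ContinuousOn.intervalIntegrable ?_
    rw [uIcc_of_le zero_le_one]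
    exact hG.comp (by fun_prop) hcont
  have h2 := intervalIntegral.integral_eq_sub_of_hasDerivAt
    (f := fun t => t ^ (q + 1) • w (γ (x, t))) (a := 0) (b := 1)
    (f' := fun t => A ((fderiv ℝ f (x, t)).comp (ContinuousLinearMap.inl ℝ E ℝ)))
    (by rw [uIcc_of_le zero_le_one]; exact key) h_int
  rw [clm_fderiv_integral_param hW (hf.of_le (by simp)) (hUW x hx) A, h2]
  simp [γ]

variable {q : ℕ}

theorem exists_primitive_of_convex {U : Set E} (hU : IsOpen U) (hc : Convex ℝ U)
    (w : E → E [⋀^Fin (q + 1)]→L[ℝ] ℝ) (hw : ContDiffOn ℝ ∞ w U)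
    (hd : ∀ x ∈ U, extDeriv w x = 0) :
    ∃ η : E → E [⋀^Fin q]→L[ℝ] ℝ, ContDiffOn ℝ ∞ η U ∧ ∀ x ∈ U, extDeriv η x = w x := by
  rcases U.eq_empty_or_nonempty with rfl | ⟨p, hp⟩
  · exact ⟨0, contDiffOn_empty, by simp⟩
  refine homotopy_primitive (ContinuousAlternatingMap.curryLeftLI (𝕜 := ℝ) (E := E) (F := ℝ)
    (n := q)).toContinuousLinearMap (ContinuousAlternatingMap.alternatizeUncurryFinCLM ℝ E ℝ) q
    (fun v => ContinuousAlternatingMap.alternatizeUncurryFin_curryLeft v) hU hc w hw ?_ hp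
  intro x hx y
  have := curryLeft_alternatize (fderiv ℝ w x) y
  have h0 : ContinuousAlternatingMap.alternatizeUncurryFin (fderiv ℝ w x) = 0 := hd _ hx
  rw [h0] at this
  have h00 : (0 : E [⋀^Fin (q + 2)]→L[ℝ] ℝ).curryLeft y = 0 := by ext; simp
  rw [h00] at this
  exact (sub_eq_zero.1 this.symm).symm

end Poincare

end

section

open Set Filter Topology
open scoped ContDiff

section ExtDerivTools

variable {E : Type} [NormedAddCommGroup E] [NormedSpace ℝ E] {q : ℕ}

theorem contDiffOn_extDeriv {U : Set E} (hU : IsOpen U) {w : E → E [⋀^Fin q]→L[ℝ] ℝ}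
    (hw : ContDiffOn ℝ ∞ w U) : ContDiffOn ℝ ∞ (extDeriv w) U :=
  (ContinuousAlternatingMap.alternatizeUncurryFinCLM ℝ E ℝ).contDiff.comp_contDiffOn
    (hw.fderiv_of_isOpen hU (by simp))

theorem extDeriv_congr_on {U : Set E} (hU : IsOpen U) {v w : E → E [⋀^Fin q]→L[ℝ] ℝ}
    (h : ∀ x ∈ U, v x = w x) {x : E} (hx : x ∈ U) : extDeriv v x = extDeriv w x :=
  Filter.EventuallyEq.extDeriv_eq (Filter.eventuallyEq_of_mem (hU.mem_nhds hx) h)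

theorem extDeriv_extDeriv_on {U : Set E} (hU : IsOpen U) {w : E → E [⋀^Fin q]→L[ℝ] ℝ}
    (hw : ContDiffOn ℝ ∞ w U) {x : E} (hx : x ∈ U) : extDeriv (extDeriv w) x = 0 :=
  extDeriv_extDeriv_apply (hw.contDiffAt (hU.mem_nhds hx)) (by
    rw [minSmoothness_of_isRCLikeNormedField]; exact WithTop.coe_le_coe.2 le_top)

theorem diffAt_of_contDiffOn {U : Set E} (hU : IsOpen U) {w : E → E [⋀^Fin q]→L[ℝ] ℝ}
    (hw : ContDiffOn ℝ ∞ w U) {x : E} (hx : x ∈ U) : DifferentiableAt ℝ w x :=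
  (hw.contDiffAt (hU.mem_nhds hx)).differentiableAt (by simp)

@[simp] theorem extDeriv_zero_form (x : E) :
    extDeriv (fun _ => (0 : E [⋀^Fin q]→L[ℝ] ℝ)) x = 0 := by
  have := extDeriv_fun_smul (𝕜 := ℝ) (0 : ℝ) (fun _ : E => (0 : E [⋀^Fin q]→L[ℝ] ℝ)) (x := x)
  simp only [zero_smul] at this; exact this

theorem extDeriv_fun_neg' (w : E → E [⋀^Fin q]→L[ℝ] ℝ) (x : E) :
    extDeriv (fun y => - w y) x = - extDeriv w x := by
  have := extDeriv_fun_smul (𝕜 := ℝ) (-1 : ℝ) w (x := x)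
  simp only [neg_smul, one_smul] at this; exact this

theorem extDeriv_const_smul' (a : ℝ) (w : E → E [⋀^Fin q]→L[ℝ] ℝ) (x : E) :
    extDeriv (fun y => a • w y) x = a • extDeriv w x :=
  extDeriv_smul a w

theorem extDeriv_fun_sub' {v w : E → E [⋀^Fin q]→L[ℝ] ℝ} {x : E} (hv : DifferentiableAt ℝ v x)
    (hw : DifferentiableAt ℝ w x) :
    extDeriv (fun y => v y - w y) x = extDeriv v x - extDeriv w x := by
  simp only [sub_eq_add_neg]
  rw [extDeriv_fun_add hv hw.fun_neg, extDeriv_fun_neg']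

theorem fderiv_eq_zero_of_extDeriv_zero {w : E → E [⋀^Fin 0]→L[ℝ] ℝ} {x : E}
    (h : extDeriv w x = 0) : fderiv ℝ w x = 0 := by
  ext y v
  have := congrArg (fun f => f (fun _ => y)) h
  simp only [extDeriv, ContinuousAlternatingMap.alternatizeUncurryFin_apply] at this
  simp at this
  rw [Subsingleton.elim v (Fin.tail fun _ => y), this]
  simp

theorem const_of_extDeriv_zero {U : Set E} (hU : IsOpen U) (hc : Convex ℝ U)
    {w : E → E [⋀^Fin 0]→L[ℝ] ℝ} (hw : ContDiffOn ℝ ∞ w U)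
    (hd : ∀ x ∈ U, extDeriv w x = 0) {x y : E} (hx : x ∈ U) (hy : y ∈ U) : w x = w y := by
  refine hU.is_const_of_fderiv_eq_zero hc.isPreconnected (𝕜 := ℝ)
    (fun z hz => (diffAt_of_contDiffOn hU hw hz).differentiableWithinAt)
    (fun z hz => fderiv_eq_zero_of_extDeriv_zero (hd z hz)) hx hy

theorem contDiffOn_union_zero {F : Type} [NormedAddCommGroup F] [NormedSpace ℝ F]
    {U A B : Set E} {f : E → F} (hA : IsOpen A) (hB : IsOpen B) (h : U ⊆ A ∪ B)
    (hf : ContDiffOn ℝ ∞ f A) (h0 : ∀ x ∈ B, f x = 0) : ContDiffOn ℝ ∞ f U := by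
  intro x hx
  rcases h hx with hx | hx
  · exact (hf.contDiffAt (hA.mem_nhds hx)).contDiffWithinAt
  · refine ContDiffAt.contDiffWithinAt ?_
    exact (contDiffAt_const (c := (0 : F))).congr_of_eventuallyEq
      (Filter.eventuallyEq_of_mem (hB.mem_nhds hx) h0)

end ExtDerivTools

end

section

open Set Filter Topology
open scoped ContDiff

section CylinderSupports

variable {E : Type} [NormedAddCommGroup E] [NormedSpace ℝ E]

/-- Supports bounded in the first `j` coordinates. -/
def FSupp (ℓ : ℕ → E →L[ℝ] ℝ) (j : ℕ) (U : Set E) {q : ℕ} (w : E → E [⋀^Fin q]→L[ℝ] ℝ) : Prop :=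
  ∃ R : ℝ, ∀ x ∈ U, ∀ i < j, R < |ℓ i x| → w x = 0

/-- Exactness with supports bounded in the first `j` coordinates. -/
def FExact (ℓ : ℕ → E →L[ℝ] ℝ) (j : ℕ) (U : Set E) : ∀ {q : ℕ}, (E → E [⋀^Fin q]→L[ℝ] ℝ) → Prop
  | 0, w => ∀ x ∈ U, w x = 0
  | _ + 1, w => ∃ η, ContDiffOn ℝ ∞ η U ∧ FSupp ℓ j U η ∧ ∀ x ∈ U, extDeriv η x = w x

structure IsCyl (e : ℕ → E) (j : ℕ) (U : Set E) : Prop where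
  isOpen : IsOpen U
  convex : Convex ℝ U
  nonempty : U.Nonempty
  shift : ∀ x ∈ U, ∀ i < j, ∀ t : ℝ, x + t • e i ∈ U

/-- Generator of the top cohomology with supports bounded in the first `j` coordinates. -/
noncomputable def theta (ℓ : ℕ → E →L[ℝ] ℝ) : ∀ j : ℕ, E → E [⋀^Fin j]→L[ℝ] ℝ
  | 0 => fun _ => ContinuousAlternatingMap.constOfIsEmpty ℝ E (Fin 0) 1
  | j + 1 => extDeriv (fun x => Real.smoothTransition (ℓ j x) • theta ℓ j x)

variable {ℓ : ℕ → E →L[ℝ] ℝ} {e : ℕ → E} {q j : ℕ} {U : Set E}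

theorem FSupp.mono {V : Set E} {w : E → E [⋀^Fin q]→L[ℝ] ℝ} (h : FSupp ℓ j U w) (hV : V ⊆ U) :
    FSupp ℓ j V w := by
  obtain ⟨R, hR⟩ := h
  exact ⟨R, fun x hx => hR x (hV hx)⟩

theorem FSupp.sub {v w : E → E [⋀^Fin q]→L[ℝ] ℝ} (hv : FSupp ℓ j U v) (hw : FSupp ℓ j U w) :
    FSupp ℓ j U (fun x => v x - w x) := by
  obtain ⟨R, hR⟩ := hv
  obtain ⟨R', hR'⟩ := hw
  refine ⟨max R R', fun x hx i hi h => ?_⟩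
  simp only [hR x hx i hi ((le_max_left _ _).trans_lt h),
    hR' x hx i hi ((le_max_right _ _).trans_lt h), sub_zero]

theorem FSupp.smul {w : E → E [⋀^Fin q]→L[ℝ] ℝ} (hw : FSupp ℓ j U w) (f : E → ℝ) :
    FSupp ℓ j U (fun x => f x • w x) := by
  obtain ⟨R, hR⟩ := hw
  exact ⟨R, fun x hx i hi h => by simp only [hR x hx i hi h, smul_zero]⟩

theorem FSupp.congr {v w : E → E [⋀^Fin q]→L[ℝ] ℝ} (hv : FSupp ℓ j U v)
    (h : ∀ x ∈ U, v x = w x) : FSupp ℓ j U w := by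
  obtain ⟨R, hR⟩ := hv
  exact ⟨R, fun x hx i hi hh => by rw [← h x hx]; exact hR x hx i hi hh⟩

theorem FSupp.le {i : ℕ} {w : E → E [⋀^Fin q]→L[ℝ] ℝ} (hw : FSupp ℓ j U w) (h : i ≤ j) :
    FSupp ℓ i U w := by
  obtain ⟨R, hR⟩ := hw
  exact ⟨R, fun x hx k hk hh => hR x hx k (hk.trans_le h) hh⟩

theorem FExact.mono {V : Set E} {w : E → E [⋀^Fin q]→L[ℝ] ℝ} (h : FExact ℓ j U w) (hV : V ⊆ U) :
    FExact ℓ j V w := by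
  cases q with
  | zero => exact fun x hx => h x (hV hx)
  | succ q =>
    obtain ⟨η, h1, h2, h3⟩ := h
    exact ⟨η, h1.mono hV, h2.mono hV, fun x hx => h3 x (hV hx)⟩

theorem FExact.congr {v w : E → E [⋀^Fin q]→L[ℝ] ℝ} (hv : FExact ℓ j U v)
    (h : ∀ x ∈ U, v x = w x) : FExact ℓ j U w := by
  cases q with
  | zero => exact fun x hx => by rw [← h x hx]; exact hv x hx
  | succ q =>
    obtain ⟨η, h1, h2, h3⟩ := hv
    exact ⟨η, h1, h2, fun x hx => by rw [← h x hx]; exact h3 x hx⟩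

theorem FExact.sub (hU : IsOpen U) {v w : E → E [⋀^Fin q]→L[ℝ] ℝ} (hv : FExact ℓ j U v)
    (hw : FExact ℓ j U w) : FExact ℓ j U (fun x => v x - w x) := by
  cases q with
  | zero => exact fun x hx => by simp only [hv x hx, hw x hx, sub_zero]
  | succ q =>
    obtain ⟨η, h1, h2, h3⟩ := hv
    obtain ⟨ξ, h1', h2', h3'⟩ := hw
    refine ⟨_, h1.sub h1', h2.sub h2', fun x hx => ?_⟩
    have := extDeriv_fun_sub' (diffAt_of_contDiffOn hU h1 hx) (diffAt_of_contDiffOn hU h1' hx)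
    rw [h3 x hx, h3' x hx] at this
    exact this

theorem FExact.smul {w : E → E [⋀^Fin q]→L[ℝ] ℝ} (hw : FExact ℓ j U w) (a : ℝ) :
    FExact ℓ j U (fun x => a • w x) := by
  cases q with
  | zero => exact fun x hx => by simp only [hw x hx, smul_zero]
  | succ q =>
    obtain ⟨η, h1, h2, h3⟩ := hw
    exact ⟨fun x => a • η x, h1.const_smul a, h2.smul _,
      fun x hx => by rw [extDeriv_const_smul', h3 x hx]⟩

theorem FExact.zero : FExact ℓ j U (fun _ => (0 : E [⋀^Fin q]→L[ℝ] ℝ)) := by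
  cases q with
  | zero => exact fun x hx => rfl
  | succ q =>
    exact ⟨fun _ => 0, contDiffOn_const, ⟨0, fun _ _ _ _ _ => rfl⟩, fun x _ => extDeriv_zero_form x⟩

theorem contDiff_theta (j : ℕ) : ContDiff ℝ ∞ (theta ℓ j) := by
  induction j with
  | zero => exact contDiff_const
  | succ j ih =>
    rw [← contDiffOn_univ]
    refine contDiffOn_extDeriv isOpen_univ (contDiffOn_univ.2 ?_)
    exact (Real.smoothTransition.contDiff.comp (ℓ j).contDiff).smul ih

theorem extDeriv_theta (j : ℕ) (x : E) : extDeriv (theta ℓ j) x = 0 := by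
  cases j with
  | zero =>
    rw [show theta ℓ 0 = fun _ : E => ContinuousAlternatingMap.constOfIsEmpty ℝ E (Fin 0) (1 : ℝ)
      from rfl]
    have := extDeriv_constOfIsEmpty (𝕜 := ℝ) (fun _ : E => (1 : ℝ)) x
    rw [this]; ext; simp
  | succ j =>
    refine extDeriv_extDeriv_on isOpen_univ (contDiffOn_univ.2 ?_) (mem_univ x)
    exact (Real.smoothTransition.contDiff.comp (ℓ j).contDiff).smul (contDiff_theta j)

theorem theta_eq_zero (j : ℕ) : ∀ x : E, ∀ i < j, 1 < |ℓ i x| → theta ℓ j x = 0 := by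
  induction j with
  | zero => intro x i hi; omega
  | succ j ih =>
    intro x i hi h
    have hev : ∀ᶠ y in 𝓝 x, 1 < |ℓ i y| :=
      (isOpen_lt continuous_const (ℓ i).continuous.abs).mem_nhds h
    rcases Nat.lt_succ_iff_lt_or_eq.1 hi with hi | rfl
    · have : (fun y => Real.smoothTransition (ℓ j y) • theta ℓ j y) =ᶠ[𝓝 x] fun _ => 0 := by
        filter_upwards [hev] with y hy
        rw [ih y i hi hy, smul_zero]
      exact this.extDeriv_eq.trans (extDeriv_zero_form x)
    · rcases lt_abs.1 h with h | h
      · have : (fun y => Real.smoothTransition (ℓ i y) • theta ℓ i y) =ᶠ[𝓝 x] theta ℓ i := by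
          filter_upwards [(isOpen_lt continuous_const (ℓ i).continuous).mem_nhds h] with y hy
          rw [Real.smoothTransition.one_of_one_le (le_of_lt hy), one_smul]
        exact this.extDeriv_eq.trans (extDeriv_theta i x)
      · have : (fun y => Real.smoothTransition (ℓ i y) • theta ℓ i y) =ᶠ[𝓝 x] fun _ => 0 := by
          filter_upwards [(isOpen_lt continuous_const (ℓ i).continuous.neg).mem_nhds h] with y hy
          rw [Real.smoothTransition.zero_of_nonpos (by simp at hy; linarith), zero_smul]
        exact this.extDeriv_eq.trans (extDeriv_zero_form x)

theorem FSupp.theta : FSupp ℓ j U (theta ℓ j) := ⟨1, fun x _ => theta_eq_zero j x⟩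

/-- Multiplying a form on a half space by a cutoff. -/
theorem cutoff_primitive (hU : IsOpen U) (m : E →L[ℝ] ℝ) (R : ℝ)
    {ξ : E → E [⋀^Fin q]→L[ℝ] ℝ} (hξ : ContDiffOn ℝ ∞ ξ {x | x ∈ U ∧ R < m x})
    (hs : FSupp ℓ j {x | x ∈ U ∧ R < m x} ξ) :
    ∃ ζ : E → E [⋀^Fin q]→L[ℝ] ℝ, ContDiffOn ℝ ∞ ζ U ∧ FSupp ℓ j U ζ ∧
      (∀ x ∈ U, R + 2 < m x → extDeriv ζ x = extDeriv ξ x) ∧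
      (∀ x, m x ≤ R + 1 → ζ x = 0) := by
  have hopen : IsOpen {x | x ∈ U ∧ R < m x} :=
    hU.inter (isOpen_lt continuous_const m.continuous)
  have hz : ∀ x, m x ≤ R + 1 → Real.smoothTransition (m x - (R + 1)) • ξ x = 0 := fun x hx => by
    rw [Real.smoothTransition.zero_of_nonpos (by linarith), zero_smul]
  refine ⟨fun x => Real.smoothTransition (m x - (R + 1)) • ξ x, ?_, ?_, ?_, hz⟩
  · refine contDiffOn_union_zero hopen (isOpen_lt m.continuous (continuous_const (y := R + 1)))
      ?_ ?_ ?_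
    · intro x hx
      rcases lt_or_ge R (m x) with h | h
      · exact Or.inl ⟨hx, h⟩
      · exact Or.inr (by simp only [mem_ofPred_eq]; linarith)
    · have h1 : ContDiff ℝ ∞ (fun x => Real.smoothTransition (m x - (R + 1))) :=
        Real.smoothTransition.contDiff.comp (m.contDiff.sub contDiff_const)
      exact h1.contDiffOn.smul hξ
    · exact fun x hx => hz x (le_of_lt hx)
  · obtain ⟨R', hR'⟩ := hs
    refine ⟨R', fun x hx i hi h => ?_⟩
    rcases lt_or_ge R (m x) with h' | h'
    · simp only [hR' x ⟨hx, h'⟩ i hi h, smul_zero]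
    · exact hz x (by linarith)
  · intro x hx h
    refine Filter.EventuallyEq.extDeriv_eq ?_
    filter_upwards [(isOpen_lt continuous_const m.continuous).mem_nhds h] with y hy
    rw [Real.smoothTransition.one_of_one_le (by linarith [show R + 2 < m y from hy]), one_smul]

theorem exists_bounded_correction (hU : IsOpen U) (R : ℝ)
    {η : E → E [⋀^Fin q]→L[ℝ] ℝ} (hη : ContDiffOn ℝ ∞ η U) (hs : FSupp ℓ j U η)
    (hp : FExact ℓ j {x | x ∈ U ∧ R < ℓ j x} η) (hm : FExact ℓ j {x | x ∈ U ∧ R < (-ℓ j) x} η) :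
    ∃ η' : E → E [⋀^Fin q]→L[ℝ] ℝ, ContDiffOn ℝ ∞ η' U ∧ FSupp ℓ (j + 1) U η' ∧
      ∀ x ∈ U, extDeriv η' x = extDeriv η x := by
  cases q with
  | zero =>
    refine ⟨η, hη, ?_, fun _ _ => rfl⟩
    obtain ⟨R', hR'⟩ := hs
    refine ⟨max R R', fun x hx i hi h => ?_⟩
    rcases Nat.lt_succ_iff_lt_or_eq.1 hi with hi | rfl
    · exact hR' x hx i hi ((le_max_right _ _).trans_lt h)
    · rcases lt_abs.1 ((le_max_left _ _).trans_lt h) with h | h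
      · exact hp x ⟨hx, h⟩
      · exact hm x ⟨hx, h⟩
  | succ q =>
    obtain ⟨ξ, a1, a2, a3⟩ := hp
    obtain ⟨ξ', b1, b2, b3⟩ := hm
    obtain ⟨ζ, c1, c2, c3, c4⟩ := cutoff_primitive hU _ R a1 a2
    obtain ⟨ζ', d1, d2, d3, d4⟩ := cutoff_primitive hU _ R b1 b2
    have e1 := contDiffOn_extDeriv hU c1
    have f1 := contDiffOn_extDeriv hU d1
    have hfar : ∀ (m : E →L[ℝ] ℝ) (x : E) (ζ : E → E [⋀^Fin q]→L[ℝ] ℝ),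
        (∀ x, m x ≤ R + 1 → ζ x = 0) → m x < R + 1 → extDeriv ζ x = 0 := by
      intro m x ζ h hx
      have : ζ =ᶠ[𝓝 x] fun _ => 0 := by
        filter_upwards [(isOpen_lt m.continuous continuous_const).mem_nhds hx] with y hy
        exact h y (le_of_lt hy)
      exact this.extDeriv_eq.trans (extDeriv_zero_form x)
    have hsd : ∀ ζ : E → E [⋀^Fin q]→L[ℝ] ℝ, FSupp ℓ j U ζ → FSupp ℓ j U (extDeriv ζ) := by
      rintro ζ ⟨R', hR'⟩
      refine ⟨R', fun x hx i hi h => ?_⟩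
      have : ζ =ᶠ[𝓝 x] fun _ => 0 := by
        filter_upwards [(isOpen_lt continuous_const (ℓ i).continuous.abs).mem_nhds h,
          hU.mem_nhds hx] with y hy hyU
        exact hR' y hyU i hi hy
      exact this.extDeriv_eq.trans (extDeriv_zero_form x)
    refine ⟨fun x => η x - extDeriv ζ x - extDeriv ζ' x, (hη.sub e1).sub f1, ?_, fun x hx => ?_⟩
    · obtain ⟨R', hR'⟩ := (hs.sub (hsd ζ c2)).sub (hsd ζ' d2)
      refine ⟨max (max (R + 2) (-(R + 1))) R', fun x hx i hi h => ?_⟩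
      rcases Nat.lt_succ_iff_lt_or_eq.1 hi with hi | rfl
      · exact hR' x hx i hi ((le_max_right _ _).trans_lt h)
      · replace h := (le_max_left _ _).trans_lt h
        have h2 := (le_max_left _ _).trans_lt h
        have h3 := (le_max_right _ _).trans_lt h
        rcases le_total 0 (ℓ i x) with h0 | h0
        · rw [abs_of_nonneg h0] at h2 h3
          have g1 : extDeriv ζ x = η x := by rw [c3 x hx h2, a3 x ⟨hx, by linarith⟩]
          have g2 : extDeriv ζ' x = 0 := hfar _ x ζ' d4 (by
            simp only [_root_.neg_apply]; linarith)
          simp only [g1, g2, sub_self]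
        · rw [abs_of_nonpos h0] at h2 h3
          have g1 : extDeriv ζ' x = η x := by
            rw [d3 x hx h2, b3 x ⟨hx, by simp only [_root_.neg_apply]; linarith⟩]
          have g2 : extDeriv ζ x = 0 := hfar _ x ζ c4 (by linarith)
          simp only [g1, g2, sub_zero, sub_self]
    · rw [extDeriv_fun_sub' (diffAt_of_contDiffOn hU (hη.sub e1) hx)
        (diffAt_of_contDiffOn hU f1 hx),
        extDeriv_fun_sub' (diffAt_of_contDiffOn hU hη hx) (diffAt_of_contDiffOn hU e1 hx),
        extDeriv_extDeriv_on hU c1 hx, extDeriv_extDeriv_on hU d1 hx, sub_zero, sub_zero]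

theorem IsCyl.half (h : IsCyl e (j + 1) U) (m : E →L[ℝ] ℝ) (hm : ∀ i < j, m (e i) = 0)
    {s : ℝ} (hs : m (e j) = s) (hs0 : s ≠ 0) (R : ℝ) : IsCyl e j {x | x ∈ U ∧ R < m x} := by
  refine ⟨h.isOpen.inter (isOpen_lt continuous_const m.continuous),
    h.convex.inter (convex_halfSpace_gt m.isLinear R), ?_, ?_⟩
  · obtain ⟨x, hx⟩ := h.nonempty
    refine ⟨x + ((R + 1 - m x) / s) • e j, h.shift x hx j (by omega) _, ?_⟩
    rw [map_add, map_smul, hs, smul_eq_mul, div_mul_cancel₀ _ hs0]; linarith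
  · rintro x ⟨hx, hx'⟩ i hi t
    refine ⟨h.shift x hx i (by omega) t, ?_⟩
    rw [map_add, map_smul, hm i hi, smul_zero, add_zero]; exact hx'

theorem IsCyl.pred (h : IsCyl e (j + 1) U) : IsCyl e j U :=
  ⟨h.isOpen, h.convex, h.nonempty, fun x hx i hi => h.shift x hx i (by omega)⟩

end CylinderSupports

end

section

open Set Filter Topology
open scoped ContDiff

section CylinderCohomology

variable {E : Type} [NormedAddCommGroup E] [NormedSpace ℝ E]

structure CylCoh (ℓ : ℕ → E →L[ℝ] ℝ) (e : ℕ → E) (j : ℕ) : Prop where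
  exact : ∀ U, IsCyl e j U → ∀ q, q ≠ j → ∀ w : E → E [⋀^Fin q]→L[ℝ] ℝ, ContDiffOn ℝ ∞ w U →
    FSupp ℓ j U w → (∀ x ∈ U, extDeriv w x = 0) → FExact ℓ j U w
  top : ∀ U, IsCyl e j U → ∀ w : E → E [⋀^Fin j]→L[ℝ] ℝ, ContDiffOn ℝ ∞ w U →
    FSupp ℓ j U w → (∀ x ∈ U, extDeriv w x = 0) →
    ∃ a : ℝ, FExact ℓ j U (fun x => w x - a • theta ℓ j x)
  nontrivial : ∀ U, IsCyl e j U → ¬ FExact ℓ j U (theta ℓ j)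

variable {ℓ : ℕ → E →L[ℝ] ℝ} {e : ℕ → E}

theorem CylCoh.coeff_zero {j : ℕ} (h : CylCoh ℓ e j) {U : Set E} (hU : IsCyl e j U) {a : ℝ}
    (ha : FExact ℓ j U (fun x => a • theta ℓ j x)) : a = 0 := by
  by_contra hne
  refine h.nontrivial U hU ((ha.smul a⁻¹).congr fun x _ => ?_)
  simp only [smul_smul, inv_mul_cancel₀ hne, one_smul]

theorem cylCoh_zero : CylCoh ℓ e 0 := by
  have hs : ∀ U q (w : E → E [⋀^Fin q]→L[ℝ] ℝ), FSupp ℓ 0 U w := fun U q w =>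
    ⟨0, fun x _ i hi => by omega⟩
  refine ⟨fun U hU q hq w hw _ hd => ?_, fun U hU w hw _ hd => ?_, fun U hU h => ?_⟩
  · obtain ⟨q, rfl⟩ := Nat.exists_eq_succ_of_ne_zero hq
    obtain ⟨η, h1, h2⟩ := exists_primitive_of_convex hU.isOpen hU.convex w hw hd
    exact ⟨η, h1, hs _ _ _, h2⟩
  · obtain ⟨p, hp⟩ := hU.nonempty
    refine ⟨w p 0, fun x hx => ?_⟩
    show w x - w p 0 • theta ℓ 0 x = 0
    rw [sub_eq_zero, const_of_extDeriv_zero hU.isOpen hU.convex hw hd hx hp]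
    ext v
    simp [theta, Subsingleton.elim v 0]
  · obtain ⟨p, hp⟩ := hU.nonempty
    have := congrArg (fun f => f 0) (h p hp)
    simp [theta] at this

theorem cylCoh_succ {j : ℕ} (h : CylCoh ℓ e j) (hl : ∀ i < j, ℓ j (e i) = 0)
    (hl1 : ℓ j (e j) = 1) : CylCoh ℓ e (j + 1) := by
  have hp : ∀ U, IsCyl e (j + 1) U → ∀ R, IsCyl e j {x | x ∈ U ∧ R < ℓ j x} :=
    fun U hU R => hU.half _ hl hl1 one_ne_zero R
  have hm : ∀ U, IsCyl e (j + 1) U → ∀ R, IsCyl e j {x | x ∈ U ∧ R < (-ℓ j) x} :=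
    fun U hU R => hU.half (-ℓ j) (fun i hi => by simp [hl i hi]) (s := -1) (by simp [hl1])
      (by simp) R
  have hχ : ContDiff ℝ ∞ (fun x => Real.smoothTransition (ℓ j x)) :=
    Real.smoothTransition.contDiff.comp (ℓ j).contDiff
  have hθ := contDiff_theta (ℓ := ℓ) j
  have hχθ : ContDiff ℝ ∞ (fun x => Real.smoothTransition (ℓ j x) • theta ℓ j x) := hχ.smul hθ
  have hs : ∀ (U : Set E) (P : E → Prop), {x | x ∈ U ∧ P x} ⊆ U := fun U P x hx => hx.1
  -- the vanishing region of a form with support bounded in one more coordinate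
  have hvan : ∀ U q (w : E → E [⋀^Fin q]→L[ℝ] ℝ), FSupp ℓ (j + 1) U w → ∃ R : ℝ, 1 ≤ R ∧
      ∀ x ∈ U, R < |ℓ j x| → w x = 0 := by
    rintro U q w ⟨R, hR⟩
    exact ⟨max 1 R, le_max_left _ _, fun x hx hx' =>
      hR x hx j (Nat.lt_succ_self j) ((le_max_right _ _).trans_lt hx')⟩
  have habs : ∀ {R : ℝ} {x : E}, R < ℓ j x → R < |ℓ j x| := fun h => lt_abs.2 (Or.inl h)
  have habs' : ∀ {R : ℝ} {x : E}, R < (-ℓ j) x → R < |ℓ j x| := fun h => lt_abs.2 (Or.inr h)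
  have hχ1 : ∀ {R : ℝ} {x : E}, 1 ≤ R → R < ℓ j x → Real.smoothTransition (ℓ j x) = 1 :=
    fun hR h => Real.smoothTransition.one_of_one_le (by linarith)
  have hχ0 : ∀ {R : ℝ} {x : E}, 1 ≤ R → R < (-ℓ j) x → Real.smoothTransition (ℓ j x) = 0 :=
    fun hR h => Real.smoothTransition.zero_of_nonpos (by simp at h; linarith)
  refine ⟨fun U hU q hq w hw hsw hd => ?_, fun U hU w hw hsw hd => ?_, fun U hU hex => ?_⟩
  · obtain ⟨R, hR1, hR⟩ := hvan U q w hsw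
    cases q with
    | zero =>
      obtain ⟨y, hy⟩ := (hp U hU R).nonempty
      intro x hx
      rw [const_of_extDeriv_zero hU.isOpen hU.convex hw hd hx hy.1]
      exact hR y hy.1 (habs hy.2)
    | succ q =>
      have hexact : FExact ℓ j U w := by
        by_cases hqj : q + 1 = j
        · subst hqj
          obtain ⟨a, ha⟩ := h.top U hU.pred w hw (hsw.le (by omega)) hd
          have h1 : FExact ℓ (q + 1) {x | x ∈ U ∧ R < ℓ (q + 1) x}
              (fun x => (-a) • theta ℓ (q + 1) x) :=
            (ha.mono (hs U _)).congr fun x hx => by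
              rw [hR x hx.1 (habs hx.2), zero_sub]; exact (neg_smul _ _).symm
          have h2 := h.coeff_zero (hp U hU R) h1
          rw [neg_eq_zero] at h2
          exact ha.congr fun x _ => by rw [h2, zero_smul, sub_zero]
        · exact h.exact U hU.pred _ hqj w hw (hsw.le (by omega)) hd
      obtain ⟨η, h1, h2, h3⟩ := hexact
      have hqj : q ≠ j := by omega
      obtain ⟨η', g1, g2, g3⟩ := exists_bounded_correction hU.isOpen R h1 h2
        (h.exact _ (hp U hU R) q hqj η (h1.mono (hs U _)) (h2.mono (hs U _)) fun x hx => by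
          rw [h3 x hx.1, hR x hx.1 (habs hx.2)])
        (h.exact _ (hm U hU R) q hqj η (h1.mono (hs U _)) (h2.mono (hs U _)) fun x hx => by
          rw [h3 x hx.1, hR x hx.1 (habs' hx.2)])
      exact ⟨η', g1, g2, fun x hx => by rw [g3 x hx, h3 x hx]⟩
  · obtain ⟨R, hR1, hR⟩ := hvan U _ w hsw
    obtain ⟨η, h1, h2, h3⟩ := h.exact U hU.pred (j + 1) (by omega) w hw (hsw.le (by omega)) hd
    obtain ⟨a, ha⟩ := h.top _ (hp U hU R) η (h1.mono (hs U _)) (h2.mono (hs U _)) fun x hx => by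
      rw [h3 x hx.1, hR x hx.1 (habs hx.2)]
    obtain ⟨b, hb⟩ := h.top _ (hm U hU R) η (h1.mono (hs U _)) (h2.mono (hs U _)) fun x hx => by
      rw [h3 x hx.1, hR x hx.1 (habs' hx.2)]
    have k1 : ContDiffOn ℝ ∞ (fun x => η x - b • theta ℓ j x) U :=
      h1.sub (hθ.contDiffOn.const_smul b)
    have k2 : ContDiffOn ℝ ∞
        (fun x => (a - b) • Real.smoothTransition (ℓ j x) • theta ℓ j x) U :=
      hχθ.contDiffOn.const_smul (a - b)
    obtain ⟨η', g1, g2, g3⟩ := exists_bounded_correction (ℓ := ℓ) (j := j) hU.isOpen R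
      (k1.sub k2) ((h2.sub (FSupp.theta.smul _)).sub ((FSupp.theta.smul _).smul _))
      (ha.congr fun x hx => by
        simp only [hχ1 hR1 hx.2]; module)
      (hb.congr fun x hx => by
        simp only [hχ0 hR1 hx.2]; module)
    refine ⟨a - b, η', g1, g2, fun x hx => ?_⟩
    rw [g3 x hx]
    refine (extDeriv_fun_sub' (diffAt_of_contDiffOn hU.isOpen k1 hx)
      (diffAt_of_contDiffOn hU.isOpen k2 hx)).trans ?_
    rw [extDeriv_fun_sub' (diffAt_of_contDiffOn hU.isOpen h1 hx)
      ((hθ.const_smul b).differentiable (by simp) x), h3 x hx, extDeriv_const_smul',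
      extDeriv_const_smul', extDeriv_theta, smul_zero, sub_zero]
    rfl
  · obtain ⟨η, h1, h2, h3⟩ := hex
    obtain ⟨R, hR1, hR⟩ := hvan U _ η h2
    obtain ⟨a, ha⟩ := h.top U hU.pred (fun x => Real.smoothTransition (ℓ j x) • theta ℓ j x - η x)
      (hχθ.contDiffOn.sub h1) ((FSupp.theta.smul _).sub (h2.le (by omega))) fun x hx => by
        rw [extDeriv_fun_sub' (hχθ.differentiable (by simp) x)
          (diffAt_of_contDiffOn hU.isOpen h1 hx), h3 x hx]
        exact sub_self _
    have ha1 : (1 : ℝ) - a = 0 := h.coeff_zero (hp U hU R) ((ha.mono (hs U _)).congr fun x hx => by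
      simp only [hχ1 hR1 hx.2, hR x hx.1 (habs hx.2)]; module)
    have ha0 : -a = 0 := h.coeff_zero (hm U hU R) ((ha.mono (hs U _)).congr fun x hx => by
      simp only [hχ0 hR1 hx.2, hR x hx.1 (habs' hx.2)]; module)
    linarith

theorem cylCoh (D : ℕ) (hl : ∀ j < D, ∀ i < j, ℓ j (e i) = 0) (hl1 : ∀ j < D, ℓ j (e j) = 1) :
    ∀ j ≤ D, CylCoh ℓ e j := by
  intro j
  induction j with
  | zero => exact fun _ => cylCoh_zero
  | succ j ih => exact fun hj => cylCoh_succ (ih (by omega)) (hl j hj) (hl1 j hj)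

end CylinderCohomology

end

section

open Set Filter Topology
open scoped ContDiff

section Pullback

variable {E F : Type} [NormedAddCommGroup E] [NormedSpace ℝ E] [NormedAddCommGroup F]
  [NormedSpace ℝ F] {q : ℕ}

theorem norm_alternatization_le (f : ContinuousMultilinearMap ℝ (fun _ : Fin q => F) ℝ) :
    ‖f.alternatization‖ ≤ q.factorial * ‖f‖ := by
  refine ContinuousAlternatingMap.opNorm_le_bound _ (by positivity) fun v => ?_
  rw [ContinuousMultilinearMap.alternatization_apply_apply]
  refine (norm_sum_le _ _).trans ?_
  have : ∀ σ ∈ (Finset.univ : Finset (Equiv.Perm (Fin q))),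
      ‖Equiv.Perm.sign σ • f (v ∘ σ)‖ ≤ ‖f‖ * ∏ i, ‖v i‖ := fun σ _ => by
    have h1 : ‖Equiv.Perm.sign σ • f (v ∘ σ)‖ = ‖f (v ∘ σ)‖ := by
      rcases Int.units_eq_one_or (Equiv.Perm.sign σ) with h | h <;> simp [h]
    rw [h1]
    refine (f.le_opNorm _).trans (le_of_eq ?_)
    congr 1
    exact Equiv.prod_comp σ fun i => ‖v i‖
  refine (Finset.sum_le_card_nsmul _ _ _ this).trans (le_of_eq ?_)
  rw [Finset.card_univ, Fintype.card_perm, Fintype.card_fin, nsmul_eq_mul, mul_assoc]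

theorem contDiffOn_of_toContinuousMultilinearMap {U : Set E} {w : E → F [⋀^Fin q]→L[ℝ] ℝ}
    (h : ContDiffOn ℝ ∞ (fun x => (w x).toContinuousMultilinearMap) U) : ContDiffOn ℝ ∞ w U := by
  let A : ContinuousMultilinearMap ℝ (fun _ : Fin q => F) ℝ →ₗ[ℝ] F [⋀^Fin q]→L[ℝ] ℝ :=
    { toFun := fun f => f.alternatization
      map_add' := fun f g => map_add _ f g
      map_smul' := fun c f => by
        ext v
        simp only [ContinuousMultilinearMap.alternatization_apply_apply,
          _root_.smul_apply, ContinuousAlternatingMap.smul_apply,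
          RingHom.id_apply, Finset.smul_sum]
        exact Finset.sum_congr rfl fun σ _ => smul_comm _ _ _ }
  have hA := ((A.mkContinuous _ norm_alternatization_le).contDiff (n := ∞)).comp_contDiffOn h
  refine ((hA.const_smul ((q.factorial : ℝ)⁻¹))).congr fun x _ => ?_
  ext v
  have : ∀ σ : Equiv.Perm (Fin q), Equiv.Perm.sign σ • w x (v ∘ σ) = w x v := fun σ => by
    have := (w x).toAlternatingMap.map_perm v σ
    simp only [ContinuousAlternatingMap.coe_toAlternatingMap] at this
    rw [this, smul_smul, ← sq, Int.units_sq, one_smul]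
  have h2 : ((w x).toContinuousMultilinearMap).alternatization v = q.factorial * w x v := by
    rw [ContinuousMultilinearMap.alternatization_apply_apply]
    refine (Finset.sum_congr rfl fun σ _ => this σ).trans ?_
    rw [Finset.sum_const, Finset.card_univ, Fintype.card_perm, Fintype.card_fin, nsmul_eq_mul]
  have h3 : w x v = (q.factorial : ℝ)⁻¹ * ((w x).toContinuousMultilinearMap).alternatization v := by
    rw [h2, ← mul_assoc, inv_mul_cancel₀ (by positivity), one_mul]
  exact h3

theorem contDiffOn_comp_aux {V W : Type} [NormedAddCommGroup V] [NormedSpace ℝ V]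
    [NormedAddCommGroup W] [NormedSpace ℝ W] (M : ContinuousMultilinearMap ℝ
      (fun _ : Fin q => E →L[ℝ] F) (V →L[ℝ] W)) {U : Set E} {L : E → E →L[ℝ] F} {w : E → V}
    (hw : ContDiffOn ℝ ∞ w U) (hL : ContDiffOn ℝ ∞ L U) :
    ContDiffOn ℝ ∞ (fun x => M (fun _ => L x) (w x)) U :=
  (M.contDiff.comp_contDiffOn (contDiffOn_pi.2 fun _ : Fin q => hL)).clm_apply hw

theorem ContDiffOn.compContinuousLinearMap {U : Set E} {w : E → F [⋀^Fin q]→L[ℝ] ℝ}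
    {L : E → E →L[ℝ] F} (hw : ContDiffOn ℝ ∞ w U) (hL : ContDiffOn ℝ ∞ L U) :
    ContDiffOn ℝ ∞ (fun x => (w x).compContinuousLinearMap (L x)) U := by
  apply contDiffOn_of_toContinuousMultilinearMap
  have h2 : ContDiffOn ℝ ∞ (fun x => (w x).toContinuousMultilinearMap) U :=
    ((ContinuousAlternatingMap.toContinuousMultilinearMapCLM ℝ :
      (F [⋀^Fin q]→L[ℝ] ℝ) →L[ℝ] _).contDiff (n := ∞)).comp_contDiffOn hw
  exact contDiffOn_comp_aux (ContinuousMultilinearMap.compContinuousLinearMapContinuousMultilinear ℝ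
      (fun _ : Fin q => E) (fun _ : Fin q => F) ℝ) h2 hL

open Classical in
/-- Pullback of forms along a map defined on `X`, extended by zero. -/
noncomputable def pull (X : Set E) (f : E → F) (w : F → F [⋀^Fin q]→L[ℝ] ℝ) :
    E → E [⋀^Fin q]→L[ℝ] ℝ := fun x =>
  if x ∈ X then (w (f x)).compContinuousLinearMap (fderiv ℝ f x) else 0

variable {X : Set E} {f : E → F} {w : F → F [⋀^Fin q]→L[ℝ] ℝ} {x : E}

theorem pull_apply (hx : x ∈ X) :
    pull X f w x = (w (f x)).compContinuousLinearMap (fderiv ℝ f x) := if_pos hx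

theorem pull_apply_notMem (hx : x ∉ X) : pull X f w x = 0 := if_neg hx

theorem pull_eq_zero (h : w (f x) = 0) : pull X f w x = 0 := by
  by_cases hx : x ∈ X
  · rw [pull_apply hx, h]; ext; simp
  · exact pull_apply_notMem hx

theorem contDiffOn_pull (hX : IsOpen X) (hf : ContDiffOn ℝ ∞ f X) {U : Set E} (hU : U ⊆ X)
    {V : Set F} (hUV : MapsTo f U V) (hw : ContDiffOn ℝ ∞ w V) :
    ContDiffOn ℝ ∞ (pull X f w) U := by
  refine ((hw.comp (hf.mono hU) hUV).compContinuousLinearMap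
    ((hf.fderiv_of_isOpen hX (by simp)).mono hU)).congr fun x hx => pull_apply (hU hx)

theorem extDeriv_pull (hX : IsOpen X) (hf : ContDiffOn ℝ ∞ f X) (hx : x ∈ X)
    (hw : DifferentiableAt ℝ w (f x)) :
    extDeriv (pull X f w) x = pull X f (extDeriv w) x := by
  rw [extDeriv_congr_on hX (fun y hy => pull_apply hy) hx, pull_apply hx]
  exact extDeriv_pullback hw (hf.contDiffAt (hX.mem_nhds hx)) (by
    rw [minSmoothness_of_isRCLikeNormedField]; exact WithTop.coe_le_coe.2 le_top)

theorem pull_pull {G : Type} [NormedAddCommGroup G] [NormedSpace ℝ G] (hX : IsOpen X)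
    {Y : Set F} (hY : IsOpen Y) {f : E → F} {g : F → G} (hf : ContDiffOn ℝ ∞ f X)
    (hg : ContDiffOn ℝ ∞ g Y) (hfX : MapsTo f X Y) {h : E → G} (hh : ∀ x ∈ X, h x = g (f x))
    (w : G → G [⋀^Fin q]→L[ℝ] ℝ) : pull X f (pull Y g w) = pull X h w := by
  ext1 x
  by_cases hx : x ∈ X
  · have hd : fderiv ℝ h x = (fderiv ℝ g (f x)).comp (fderiv ℝ f x) := by
      rw [← fderiv_comp x ((hg.contDiffAt (hY.mem_nhds (hfX hx))).differentiableAt (by simp))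
        ((hf.contDiffAt (hX.mem_nhds hx)).differentiableAt (by simp))]
      exact Filter.EventuallyEq.fderiv_eq (Filter.eventuallyEq_of_mem (hX.mem_nhds hx) hh)
    rw [pull_apply hx, pull_apply hx, pull_apply (hfX hx), hh x hx, hd]
    ext v; rfl
  · rw [pull_apply_notMem hx, pull_apply_notMem hx]

theorem pull_id {X : Set E} (hX : IsOpen X) {f : E → E} (hf : ∀ x ∈ X, f x = x)
    {w : E → E [⋀^Fin q]→L[ℝ] ℝ} (hw : ∀ x ∉ X, w x = 0) : pull X f w = w := by
  ext1 x
  by_cases hx : x ∈ X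
  · have hd : fderiv ℝ f x = ContinuousLinearMap.id ℝ E := by
      have h : f =ᶠ[𝓝 x] id := Filter.eventuallyEq_of_mem (hX.mem_nhds hx) hf
      rw [h.fderiv_eq, fderiv_id]
    rw [pull_apply hx, hf x hx, hd]
    ext v; rfl
  · rw [pull_apply_notMem hx, hw x hx]

theorem pull_add (v w : F → F [⋀^Fin q]→L[ℝ] ℝ) : pull X f (v + w) = pull X f v + pull X f w := by
  ext1 x
  by_cases hx : x ∈ X
  · simp only [Pi.add_apply, pull_apply hx]; ext; simp
  · simp only [Pi.add_apply, pull_apply_notMem hx, add_zero]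

theorem pull_smul (a : ℝ) (w : F → F [⋀^Fin q]→L[ℝ] ℝ) : pull X f (a • w) = a • pull X f w := by
  ext1 x
  by_cases hx : x ∈ X
  · simp only [Pi.smul_apply, pull_apply hx]; ext; simp
  · simp only [Pi.smul_apply, pull_apply_notMem hx, smul_zero]

end Pullback

end

section

open Set Filter Topology
open scoped ContDiff

section CompactSupports

variable {E : Type} [NormedAddCommGroup E] [NormedSpace ℝ E] {q : ℕ}

/-- Smooth `q`-forms with compact support in `X`. -/
def Omc (X : Set E) (q : ℕ) : Submodule ℝ (E → E [⋀^Fin q]→L[ℝ] ℝ) where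
  carrier := {w | ContDiff ℝ ∞ w ∧ ∃ K, IsCompact K ∧ K ⊆ X ∧ ∀ x ∉ K, w x = 0}
  add_mem' := by
    rintro v w ⟨hv, K, hK, hKX, hK0⟩ ⟨hw, L, hL, hLX, hL0⟩
    refine ⟨hv.add hw, K ∪ L, hK.union hL, union_subset hKX hLX, fun x hx => ?_⟩
    rw [mem_union, not_or] at hx
    rw [Pi.add_apply, hK0 x hx.1, hL0 x hx.2, add_zero]
  zero_mem' := ⟨contDiff_const, ∅, isCompact_empty, empty_subset _, fun _ _ => rfl⟩
  smul_mem' := by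
    rintro a v ⟨hv, K, hK, hKX, hK0⟩
    exact ⟨hv.const_smul a, K, hK, hKX, fun x hx => by rw [Pi.smul_apply, hK0 x hx, smul_zero]⟩

/-- Exactness with compact supports. -/
def CExact (X : Set E) : ∀ {q : ℕ}, (E → E [⋀^Fin q]→L[ℝ] ℝ) → Prop
  | 0, w => ∀ x, w x = 0
  | q + 1, w => ∃ η ∈ Omc X q, ∀ x, extDeriv η x = w x

theorem Omc.contDiff {X : Set E} {w : E → E [⋀^Fin q]→L[ℝ] ℝ} (hw : w ∈ Omc X q) :
    ContDiff ℝ ∞ w := hw.1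

theorem Omc.differentiableAt {X : Set E} {w : E → E [⋀^Fin q]→L[ℝ] ℝ} (hw : w ∈ Omc X q) (x : E) :
    DifferentiableAt ℝ w x := hw.1.differentiable (by simp) x

theorem Omc.eq_zero {X : Set E} {w : E → E [⋀^Fin q]→L[ℝ] ℝ} (hw : w ∈ Omc X q) {x : E}
    (hx : x ∉ X) : w x = 0 := by
  obtain ⟨K, -, hKX, hK⟩ := hw.2
  exact hK x fun h => hx (hKX h)

theorem extDeriv_mem_omc {X : Set E} {w : E → E [⋀^Fin q]→L[ℝ] ℝ} (hw : w ∈ Omc X q) :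
    extDeriv w ∈ Omc X (q + 1) := by
  obtain ⟨K, hK, hKX, hK0⟩ := hw.2
  refine ⟨contDiffOn_univ.1 (contDiffOn_extDeriv isOpen_univ (contDiffOn_univ.2 hw.1)),
    K, hK, hKX, fun x hx => ?_⟩
  rw [extDeriv_congr_on hK.isClosed.isOpen_compl (w := fun _ => 0) (fun y hy => hK0 y hy) hx]
  exact extDeriv_zero_form x

/-- The exterior derivative on compactly supported forms. -/
noncomputable def omcD (X : Set E) (q : ℕ) : Omc X q →ₗ[ℝ] Omc X (q + 1) where
  toFun w := ⟨extDeriv w.1, extDeriv_mem_omc w.2⟩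
  map_add' v w := by
    ext1; funext x
    exact extDeriv_fun_add (Omc.differentiableAt v.2 x) (Omc.differentiableAt w.2 x)
  map_smul' a w := by
    ext1; funext x
    exact extDeriv_const_smul' a w.1 x

theorem omcD_omcD (X : Set E) (q : ℕ) (w : Omc X q) : omcD X (q + 1) (omcD X q w) = 0 := by
  ext1; funext x
  exact extDeriv_extDeriv_on isOpen_univ (contDiffOn_univ.2 w.2.1) (mem_univ x)

theorem contDiff_of_compact {F : Type} [NormedAddCommGroup F] [NormedSpace ℝ F] {X K : Set E}
    (hX : IsOpen X) (hK : IsCompact K) (hKX : K ⊆ X) {w : E → F} (hw : ContDiffOn ℝ ∞ w X)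
    (h0 : ∀ x ∉ K, w x = 0) : ContDiff ℝ ∞ w := by
  rw [← contDiffOn_univ]
  refine contDiffOn_union_zero hX hK.isClosed.isOpen_compl (fun x _ => ?_) hw h0
  by_cases hx : x ∈ K
  · exact Or.inl (hKX hx)
  · exact Or.inr hx

section Diffeo

variable {F : Type} [NormedAddCommGroup F] [NormedSpace ℝ F]

/-- Mutually inverse smooth maps between two open sets. -/
structure IsDiffeo (X : Set E) (Y : Set F) (f : E → F) (g : F → E) : Prop where
  openX : IsOpen X
  openY : IsOpen Y
  smooth : ContDiffOn ℝ ∞ f X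
  smooth_inv : ContDiffOn ℝ ∞ g Y
  maps : MapsTo f X Y
  maps_inv : MapsTo g Y X
  left : ∀ x ∈ X, g (f x) = x
  right : ∀ y ∈ Y, f (g y) = y

variable {X : Set E} {Y : Set F} {f : E → F} {g : F → E}

theorem IsDiffeo.symm (h : IsDiffeo X Y f g) : IsDiffeo Y X g f :=
  ⟨h.openY, h.openX, h.smooth_inv, h.smooth, h.maps_inv, h.maps, h.right, h.left⟩

theorem IsDiffeo.pull_mem (h : IsDiffeo X Y f g) {w : F → F [⋀^Fin q]→L[ℝ] ℝ}
    (hw : w ∈ Omc Y q) : pull X f w ∈ Omc X q := by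
  obtain ⟨K, hK, hKY, hK0⟩ := hw.2
  have hc : IsCompact (g '' K) := hK.image_of_continuousOn (h.smooth_inv.continuousOn.mono hKY)
  have hs : g '' K ⊆ X := by
    rintro _ ⟨y, hy, rfl⟩
    exact h.maps_inv (hKY hy)
  have h0 : ∀ x ∉ g '' K, pull X f w x = 0 := by
    intro x hx
    by_cases hxX : x ∈ X
    · refine pull_eq_zero (hK0 _ fun hfx => hx ⟨f x, hfx, h.left x hxX⟩)
    · exact pull_apply_notMem hxX
  exact ⟨contDiff_of_compact h.openX hc hs (contDiffOn_pull h.openX h.smooth Subset.rfl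
    h.maps (Omc.contDiff hw).contDiffOn) h0, _, hc, hs, h0⟩

theorem IsDiffeo.pull_pull (h : IsDiffeo X Y f g) {w : E → E [⋀^Fin q]→L[ℝ] ℝ}
    (hw : w ∈ Omc X q) : pull X f (pull Y g w) = w := by
  rw [_root_.pull_pull h.openX h.openY h.smooth h.smooth_inv h.maps (h := id)
    (fun x hx => (h.left x hx).symm)]
  exact pull_id h.openX (fun _ _ => rfl) fun x hx => Omc.eq_zero hw hx

/-- Pullback of compactly supported forms along a diffeomorphism. -/
noncomputable def IsDiffeo.omcPull (h : IsDiffeo X Y f g) (q : ℕ) : Omc Y q →ₗ[ℝ] Omc X q where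
  toFun w := ⟨pull X f w.1, h.pull_mem w.2⟩
  map_add' v w := by ext1; exact pull_add _ _
  map_smul' a w := by ext1; exact pull_smul _ _

theorem IsDiffeo.extDeriv_pull (h : IsDiffeo X Y f g) {w : F → F [⋀^Fin q]→L[ℝ] ℝ}
    (hw : w ∈ Omc Y q) (x : E) : extDeriv (pull X f w) x = pull X f (extDeriv w) x := by
  by_cases hx : x ∈ X
  · exact _root_.extDeriv_pull h.openX h.smooth hx (Omc.differentiableAt hw _)
  · rw [pull_apply_notMem hx, Omc.eq_zero (extDeriv_mem_omc (h.pull_mem hw)) hx]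

theorem IsDiffeo.cExact_pull (h : IsDiffeo X Y f g) {w : F → F [⋀^Fin q]→L[ℝ] ℝ}
    (hw : CExact Y w) : CExact X (pull X f w) := by
  cases q with
  | zero => exact fun x => pull_eq_zero (hw _)
  | succ q =>
    obtain ⟨η, h1, h2⟩ := hw
    refine ⟨_, h.pull_mem h1, fun x => ?_⟩
    rw [h.extDeriv_pull h1]
    congr 1
    exact funext h2

end Diffeo

theorem CExact.congr {X : Set E} {v w : E → E [⋀^Fin q]→L[ℝ] ℝ} (h : CExact X v)
    (hvw : ∀ x, v x = w x) : CExact X w := by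
  obtain rfl : v = w := funext hvw
  exact h

theorem CExact.sub {X : Set E} {v w : E → E [⋀^Fin q]→L[ℝ] ℝ} (hv : CExact X v)
    (hw : CExact X w) : CExact X (v - w) := by
  cases q with
  | zero => exact fun x => by rw [Pi.sub_apply, hv x, hw x, sub_zero]
  | succ q =>
    obtain ⟨η, h1, h2⟩ := hv
    obtain ⟨ξ, h1', h2'⟩ := hw
    refine ⟨_, Submodule.sub_mem _ h1 h1', fun x => ?_⟩
    rw [Pi.sub_apply, ← h2, ← h2']
    exact extDeriv_fun_sub' (Omc.differentiableAt h1 x) (Omc.differentiableAt h1' x)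

theorem CExact.smul {X : Set E} {w : E → E [⋀^Fin q]→L[ℝ] ℝ} (hw : CExact X w) (a : ℝ) :
    CExact X (a • w) := by
  cases q with
  | zero => exact fun x => by rw [Pi.smul_apply, hw x, smul_zero]
  | succ q =>
    obtain ⟨η, h1, h2⟩ := hw
    refine ⟨_, Submodule.smul_mem _ a h1, fun x => ?_⟩
    rw [Pi.smul_apply, ← h2]
    exact extDeriv_const_smul' a η x

/-- Cohomology with compact supports of an open subset diffeomorphic to a vector space. -/
structure CompactCohomology (X : Set E) (D : ℕ) : Prop where
  exact : ∀ q < D, ∀ w ∈ Omc X q, (∀ x, extDeriv w x = 0) → CExact X w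
  top : ∃ w₀ ∈ Omc X D, ¬ CExact X w₀ ∧ ∀ w ∈ Omc X D, ∃ a : ℝ, CExact X (w - a • w₀)

theorem CompactCohomology.of_diffeo {X Y : Set E} {f g : E → E} {D : ℕ}
    (h : CompactCohomology Y D) (hf : IsDiffeo X Y f g) : CompactCohomology X D := by
  refine ⟨fun q hq w hw hd => ?_, ?_⟩
  · have := hf.cExact_pull (h.exact q hq _ (hf.symm.pull_mem hw) fun x => by
      rw [hf.symm.extDeriv_pull hw, pull_eq_zero (hd _)])
    rwa [hf.pull_pull hw] at this
  · obtain ⟨w₀, h0, h1, h2⟩ := h.top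
    refine ⟨_, hf.pull_mem h0, fun hex => h1 ?_, fun w hw => ?_⟩
    · have := hf.symm.cExact_pull hex
      rwa [hf.symm.pull_pull h0] at this
    · obtain ⟨a, ha⟩ := h2 _ (hf.symm.pull_mem hw)
      have := hf.cExact_pull ha
      refine ⟨a, this.congr fun x => ?_⟩
      have e1 : pull Y g w - a • w₀ = pull Y g w + (-a) • w₀ := by
        ext y v; simp [sub_eq_add_neg]
      rw [e1, pull_add, pull_smul, hf.pull_pull hw]
      ext v; simp [sub_eq_add_neg]

theorem compactCohomology_univ [FiniteDimensional ℝ E] :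
    CompactCohomology (univ : Set E) (Module.finrank ℝ E) := by
  set D := Module.finrank ℝ E
  let b := Module.finBasis ℝ E
  let ℓ : ℕ → E →L[ℝ] ℝ := fun i =>
    if h : i < D then LinearMap.toContinuousLinearMap (b.coord ⟨i, h⟩) else 0
  let e : ℕ → E := fun i => if h : i < D then b ⟨i, h⟩ else 0
  have hle : ∀ i (hi : i < D), ∀ j (hj : j < D), ℓ j (e i) = if i = j then 1 else 0 := by
    intro i hi j hj
    simp only [ℓ, e, dif_pos hi, dif_pos hj, LinearMap.coe_toContinuousLinearMap',
      Module.Basis.coord_apply, Module.Basis.repr_self]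
    rw [Finsupp.single_apply]
    simp only [Fin.mk.injEq]
  have H := cylCoh (ℓ := ℓ) (e := e) D
    (fun j hj i hi => by rw [hle i (hi.trans hj) j hj, if_neg hi.ne])
    (fun j hj => by rw [hle j hj j hj, if_pos rfl]) D le_rfl
  have hU : IsCyl e D univ := ⟨isOpen_univ, convex_univ, univ_nonempty, fun _ _ _ _ _ => mem_univ _⟩
  have hF : ∀ {q} {w : E → E [⋀^Fin q]→L[ℝ] ℝ}, w ∈ Omc univ q → FSupp ℓ D univ w := by
    rintro q w ⟨-, K, hK, -, hK0⟩
    have : ∀ i, ∃ R, ∀ x ∈ K, |ℓ i x| ≤ R := fun i => by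
      obtain ⟨R, hR⟩ := hK.exists_bound_of_continuousOn (ℓ i).continuous.continuousOn
      exact ⟨R, hR⟩
    choose R hR using this
    refine ⟨∑ i ∈ Finset.range D, |R i|, fun x _ i hi hx => hK0 x fun hxK => ?_⟩
    have h1 := hR i x hxK
    have h2 : |R i| ≤ ∑ i ∈ Finset.range D, |R i| :=
      Finset.single_le_sum (f := fun i => |R i|) (fun _ _ => abs_nonneg _) (Finset.mem_range.2 hi)
    linarith [le_abs_self (R i)]
  have hO : ∀ {q} {w : E → E [⋀^Fin q]→L[ℝ] ℝ}, ContDiffOn ℝ ∞ w univ → FSupp ℓ D univ w →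
      w ∈ Omc univ q := by
    rintro q w hw ⟨R, hR⟩
    refine ⟨contDiffOn_univ.1 hw, {x | ∀ i, b.equivFun x i ∈ Icc (-R) R}, ?_, subset_univ _,
      fun x hx => ?_⟩
    · have hc : IsCompact (Set.pi univ fun _ : Fin D => Icc (-R) R) :=
        isCompact_univ_pi fun _ => isCompact_Icc
      have := hc.image (b.equivFun.symm.toLinearMap.continuous_of_finiteDimensional)
      refine this.of_isClosed_subset ?_ fun x hx => ⟨b.equivFun x, fun i _ => hx i, by simp⟩
      have hcont : Continuous b.equivFun := b.equivFun.toLinearMap.continuous_of_finiteDimensional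
      simp only [ofPred_forall]
      exact isClosed_iInter fun i => isClosed_Icc.preimage ((continuous_apply i).comp hcont)
    · simp only [mem_ofPred_eq, not_forall] at hx
      obtain ⟨i, hi⟩ := hx
      refine hR x (mem_univ _) i i.2 ?_
      have hℓ : ℓ i x = b.equivFun x i := by
        have hiD : (i : ℕ) < D := i.2
        simp [ℓ, hiD]
      rw [hℓ]
      by_contra hcon
      exact hi (abs_le.1 (not_lt.1 hcon))
  have hE1 : ∀ {q} {w : E → E [⋀^Fin q]→L[ℝ] ℝ}, FExact ℓ D univ w → CExact univ w := by
    intro q w h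
    cases q with
    | zero => exact fun x => h x (mem_univ x)
    | succ q =>
      obtain ⟨η, h1, h2, h3⟩ := h
      exact ⟨η, hO h1 h2, fun x => h3 x (mem_univ x)⟩
  have hE2 : ∀ {q} {w : E → E [⋀^Fin q]→L[ℝ] ℝ}, CExact univ w → FExact ℓ D univ w := by
    intro q w h
    cases q with
    | zero => exact fun x _ => h x
    | succ q =>
      obtain ⟨η, h1, h3⟩ := h
      exact ⟨η, h1.1.contDiffOn, hF h1, fun x _ => h3 x⟩
  refine ⟨fun q hq w hw hd => hE1 (H.exact univ hU q hq.ne w hw.1.contDiffOn (hF hw)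
    fun x _ => hd x), theta ℓ D, hO (contDiff_theta D).contDiffOn ?_,
    fun h => H.nontrivial univ hU (hE2 h), fun w hw => ?_⟩
  · exact FSupp.theta
  · obtain ⟨a, ha⟩ := H.top univ hU w hw.1.contDiffOn (hF hw) fun x _ => by
      have h0 : ∀ v : Fin (D + 1) → E, extDeriv w x v = 0 := fun v => by
        have hdep : ¬ LinearIndependent ℝ v := fun hli => by
          have := hli.fintype_card_le_finrank
          simp at this
          omega
        exact (extDeriv w x).toAlternatingMap.map_linearDependent v hdep
      ext v; exact h0 v
    exact ⟨a, hE1 ha⟩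

end CompactSupports

end

section Duality

variable {Γ : Type*} [Group Γ] {C : ℕ → Type*} [∀ r, AddCommGroup (C r)] [∀ r, Module ℝ (C r)]

/-- A complex of real vector spaces with a group action and equivariant finite partitions of
the identity. -/
structure GammaComplex (Γ : Type*) [Group Γ] (C : ℕ → Type*) [∀ r, AddCommGroup (C r)]
    [∀ r, Module ℝ (C r)] where
  d : ∀ r, C r →ₗ[ℝ] C (r + 1)
  d_d : ∀ r w, d (r + 1) (d r w) = 0
  act : ∀ r, Γ → C r →ₗ[ℝ] C r
  act_one : ∀ r w, act r 1 w = w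
  act_mul : ∀ r g h w, act r (g * h) w = act r g (act r h w)
  act_d : ∀ r g w, act (r + 1) g (d r w) = d r (act r g w)
  part : ∀ r, Γ → C r →ₗ[ℝ] C r
  part_finite : ∀ r w, {g | part r g w ≠ 0}.Finite
  part_sum : ∀ r w, ∑ᶠ g, part r g w = w
  act_part : ∀ r g h w, act r g (part r h w) = part r (g * h) (act r g w)

namespace GammaComplex

variable (G : GammaComplex Γ C)

/-- Equivariance of a cochain on lists of length `p` with values in functionals. -/
def Eqv {r : ℕ} (p : ℕ) (x : List Γ → C r →ₗ[ℝ] ℝ) : Prop :=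
  ∀ g l w, l.length = p → x (l.map (g * ·)) (G.act r g w) = x l w

/-- The contracting homotopy in the direction of lists. -/
noncomputable def avg (r : ℕ) (y : Γ → C r →ₗ[ℝ] ℝ) : C r →ₗ[ℝ] ℝ where
  toFun w := ∑ᶠ g, y g (G.part r g w)
  map_add' v w := by
    rw [← finsum_add_distrib]
    · exact finsum_congr fun g => by rw [map_add, map_add]
    · exact (G.part_finite r v).subset fun g hg h => hg (by simp only [h, map_zero])
    · exact (G.part_finite r w).subset fun g hg h => hg (by simp only [h, map_zero])
  map_smul' a w := by
    rw [RingHom.id_apply, smul_finsum]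
    exact finsum_congr fun g => by rw [map_smul, map_smul]

theorem avg_apply (r : ℕ) (y : Γ → C r →ₗ[ℝ] ℝ) (w : C r) :
    G.avg r y w = ∑ᶠ g, y g (G.part r g w) := rfl

theorem avg_support (r : ℕ) (y : Γ → C r →ₗ[ℝ] ℝ) (w : C r) :
    (Function.support fun g => y g (G.part r g w)).Finite :=
  (G.part_finite r w).subset fun g hg h => hg (by simp only [h, map_zero])

theorem avg_const (r : ℕ) (y : C r →ₗ[ℝ] ℝ) : G.avg r (fun _ => y) = y := by
  ext w
  have := y.toAddMonoidHom.map_finsum (G.part_finite r w)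
  rw [G.part_sum] at this
  exact this.symm

/-- `avg` as an additive map. -/
noncomputable def avgHom (r : ℕ) : (Γ → C r →ₗ[ℝ] ℝ) →+ (C r →ₗ[ℝ] ℝ) where
  toFun := G.avg r
  map_zero' := by ext w; simp [avg_apply]
  map_add' x y := by
    ext w
    rw [LinearMap.add_apply, avg_apply, avg_apply, avg_apply,
      ← finsum_add_distrib (G.avg_support r x w) (G.avg_support r y w)]
    rfl

theorem cob_pi {S A ι : Type*} [AddCommGroup A] (x : List S → ι → A) (l : List S) (i : ι) :
    cob x l i = cob (fun t => x t i) l :=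
  map_cob (Pi.evalAddMonoidHom (fun _ : ι => A) i) x l

theorem row_exact {r p : ℕ} {x : List Γ → C r →ₗ[ℝ] ℝ} (hx : G.Eqv (p + 1) x)
    (h : ∀ l, l.length = p + 2 → cob x l = 0) :
    ∃ y : List Γ → C r →ₗ[ℝ] ℝ, G.Eqv p y ∧ ∀ l, l.length = p + 1 → cob y l = x l := by
  refine ⟨fun l => G.avgHom r fun g => x (g :: l), fun g l w hl => ?_, fun l hl => ?_⟩
  · change ∑ᶠ k, x (k :: l.map (g * ·)) (G.part r k (G.act r g w)) =
      ∑ᶠ k, x (k :: l) (G.part r k w)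
    rw [← finsum_comp_equiv (Equiv.mulLeft g)]
    refine finsum_congr fun k => ?_
    rw [Equiv.coe_mulLeft, ← G.act_part]
    exact hx g (k :: l) (G.part r k w) (by simp [hl])
  · rw [← map_cob (G.avgHom r) (fun l g => x (g :: l)) l]
    have : cob (fun l g => x (g :: l)) l = fun _ => x l := by
      funext g
      rw [cob_pi]
      exact cob_cone (h _ (by simp [hl]))
    rw [this]
    exact G.avg_const r (x l)

theorem exists_functional {r : ℕ} {y : C r →ₗ[ℝ] ℝ} (h : ∀ w, G.d r w = 0 → y w = 0) :
    ∃ z : C (r + 1) →ₗ[ℝ] ℝ, ∀ w, z (G.d r w) = y w := by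
  obtain ⟨f, hf⟩ := LinearMap.exists_leftInverse_of_injective
    ((LinearMap.ker (G.d r)).liftQ (G.d r) le_rfl) (Submodule.ker_liftQ_eq_bot' _ _ rfl)
  have hle : LinearMap.ker (G.d r) ≤ LinearMap.ker y := fun w hw =>
    LinearMap.mem_ker.2 (h w (LinearMap.mem_ker.1 hw))
  refine ⟨((LinearMap.ker (G.d r)).liftQ y hle).comp f, fun w => ?_⟩
  have := LinearMap.congr_fun hf ((LinearMap.ker (G.d r)).mkQ w)
  simp only [LinearMap.comp_apply, Submodule.mkQ_apply, Submodule.liftQ_apply,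
    LinearMap.id_apply] at this
  rw [LinearMap.comp_apply, this, Submodule.liftQ_apply]

theorem col_exact {r p : ℕ} {x : List Γ → C r →ₗ[ℝ] ℝ} (hx : G.Eqv (p + 1) x)
    (h : ∀ l, l.length = p + 1 → ∀ w, G.d r w = 0 → x l w = 0) :
    ∃ y : List Γ → C (r + 1) →ₗ[ℝ] ℝ, G.Eqv (p + 1) y ∧
      ∀ l, l.length = p + 1 → ∀ w, y l (G.d r w) = x l w := by
  classical
  have : ∀ l, ∃ z : C (r + 1) →ₗ[ℝ] ℝ, l.length = p + 1 → ∀ w, z (G.d r w) = x l w := fun l => by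
    by_cases hl : l.length = p + 1
    · obtain ⟨z, hz⟩ := G.exists_functional (h l hl)
      exact ⟨z, fun _ => hz⟩
    · exact ⟨0, fun h => absurd h hl⟩
  choose z hz using this
  let hd : List Γ → Γ := fun l => l.headD 1
  refine ⟨fun l => (z (l.map ((hd l)⁻¹ * ·))).comp (G.act (r + 1) (hd l)⁻¹), fun g l w hl => ?_,
    fun l hl w => ?_⟩
  · cases l with
    | nil => simp at hl
    | cons k l =>
      have h1 : hd ((k :: l).map (g * ·)) = g * k := rfl
      have h2 : hd (k :: l) = k := rfl
      simp only [LinearMap.comp_apply, h1, h2]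
      rw [← G.act_mul, List.map_map]
      congr 2
      · refine congrArg (fun f => List.map f (k :: l)) ?_
        funext a
        simp [mul_assoc]
      · simp
  · simp only [LinearMap.comp_apply, G.act_d]
    rw [hz _ (by simpa using hl), hx _ _ _ hl]

variable {n D' : ℕ}

/-- Functionals at list length `p` linked through the double complex to the constant cochain
`c` with values in multiples of `τ`. -/
inductive Reach (τ : C (n + D') →ₗ[ℝ] ℝ) (c : List Γ → ℝ) :
    ∀ p, (List Γ → C (n + p) →ₗ[ℝ] ℝ) → Prop
  | top (y : List Γ → C (n + D') →ₗ[ℝ] ℝ) (h : G.Eqv D' y)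
      (hy : ∀ l, l.length = D' + 1 → cob y l = c l • τ) : Reach τ c D' y
  | step (p : ℕ) (y : List Γ → C (n + p) →ₗ[ℝ] ℝ) (y' : List Γ → C (n + (p + 1)) →ₗ[ℝ] ℝ)
      (h' : Reach τ c (p + 1) y') (h : G.Eqv p y)
      (hy : ∀ l, l.length = p + 1 → ∀ w, y' l (G.d (n + p) w) = cob y l w) : Reach τ c p y

variable {G} {τ : C (n + D') →ₗ[ℝ] ℝ} {c : List Γ → ℝ}

theorem Reach.le {p : ℕ} {y : List Γ → C (n + p) →ₗ[ℝ] ℝ} (h : G.Reach τ c p y) : p ≤ D' := by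
  induction h with
  | top => exact le_rfl
  | step p y y' h' h hy ih => omega

theorem Reach.eqv {p : ℕ} {y : List Γ → C (n + p) →ₗ[ℝ] ℝ} (h : G.Reach τ c p y) :
    G.Eqv p y := by
  cases h with
  | top _ h _ => exact h
  | step p y y' h' h hy => exact h

theorem cob_comp {r s : ℕ} (f : C s →ₗ[ℝ] C r) (x : List Γ → C r →ₗ[ℝ] ℝ) (l : List Γ) :
    cob (fun t => (x t).comp f) l = (cob x l).comp f :=
  (map_cob (LinearMap.lcomp ℝ ℝ f).toAddMonoidHom x l).symm

theorem Reach.exists (hτd : ∀ r (h : r + 1 = n + D') w, τ (h ▸ G.d r w) = 0)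
    (hτ : ∀ g w, τ (G.act _ g w) = τ w)
    (hc : ∀ l, l.length = D' + 2 → cob c l = 0)
    (hinv : ∀ g l, l.length = D' + 1 → c (l.map (g * ·)) = c l) :
    ∀ k p, p + k = D' → ∃ y : List Γ → C (n + p) →ₗ[ℝ] ℝ, G.Reach τ c p y := by
  intro k
  induction k with
  | zero =>
    intro p hp
    obtain rfl : p = D' := by omega
    have h1 : ∀ l, cob (fun t => c t • τ) l = cob c l • τ := fun l =>
      (map_cob (LinearMap.toSpanSingleton ℝ (C (n + p) →ₗ[ℝ] ℝ) τ).toAddMonoidHom c l).symm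
    have hx : G.Eqv (p + 1) (fun l => c l • τ) := fun g l w hl => by
      simp only [LinearMap.smul_apply, hinv g l hl, hτ]
    obtain ⟨y, hy1, hy2⟩ := G.row_exact hx fun l hl => by rw [h1, hc l hl, zero_smul]
    exact ⟨y, .top y hy1 hy2⟩
  | succ k ih =>
    intro p hp
    obtain ⟨y', hy'⟩ := ih (p + 1) (by omega)
    have hx : G.Eqv (p + 1) (fun l => (y' l).comp (G.d (n + p))) := fun g l w hl => by
      simp only [LinearMap.comp_apply, ← G.act_d]
      exact hy'.eqv g l _ hl
    obtain ⟨y, hy1, hy2⟩ := G.row_exact hx fun l hl => by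
      rw [cob_comp]
      ext w
      rw [LinearMap.comp_apply, LinearMap.zero_apply]
      cases hy' with
      | top _ _ hy => rw [hy l hl, LinearMap.smul_apply, hτd (n + p) rfl w, smul_zero]
      | step _ _ y'' _ _ hy =>
        exact (hy l hl _).symm.trans
          ((congrArg (y'' l) (G.d_d (n + p) w)).trans (map_zero _))
    exact ⟨y, .step p y y' hy' hy1 fun l hl w => by rw [hy2 l hl]; rfl⟩

theorem Reach.split (hτ : ∀ g w, τ (G.act _ g w) = τ w) (w₀ : C (n + D')) (hw₀ : τ w₀ = 1)
    (hker : ∀ r (h : r + 1 = n + D') w, τ w = 0 → ∃ v, h ▸ G.d r v = w)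
    (hex : ∀ r, r + 1 < n + D' → ∀ w, G.d (r + 1) w = 0 → ∃ v, G.d r v = w)
    {p : ℕ} {y : List Γ → C (n + p) →ₗ[ℝ] ℝ} (h : G.Reach τ c p y) :
    ∀ k (hk : p = k + 1) (b : List Γ → C (n + p) →ₗ[ℝ] ℝ), G.Eqv k b →
    (∀ l, l.length = p → ∀ v : C (n + k), y l (hk ▸ G.d (n + k) v) = cob b l (hk ▸ G.d (n + k) v)) →
    ∃ b' : List Γ → ℝ, (∀ g l, l.length = D' → b' (l.map (g * ·)) = b' l) ∧
      ∀ l, l.length = D' + 1 → cob b' l = c l := by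
  have hcobE : ∀ {r k : ℕ} {b : List Γ → C r →ₗ[ℝ] ℝ}, G.Eqv k b → G.Eqv (k + 1) (cob b) := by
    intro r k b hb g l w hl
    rw [cob_map]
    have h1 := cob_comp (G.act r g) (fun t => b (t.map (g * ·))) l
    rw [← LinearMap.comp_apply, ← h1]
    congr 1
    refine cob_congr fun t _ ht => ?_
    ext v
    exact hb g t v (by omega)
  induction h with
  | top y hE hy =>
    intro k hk b hb hyb
    subst hk
    have h1 : ∀ l, l.length = k + 1 → ∀ w, (y l - cob b l) w = (y l - cob b l) w₀ * τ w := by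
      intro l hl w
      obtain ⟨v, hv⟩ := hker (n + k) rfl (w - τ w • w₀) (by simp [hw₀])
      have h2 := hyb l hl v
      dsimp only at hv h2
      rw [hv] at h2
      rw [map_sub, map_smul, map_sub, map_smul] at h2
      simp only [LinearMap.sub_apply, smul_eq_mul] at h2 ⊢
      linarith
    refine ⟨fun l => (y l - cob b l) w₀, fun g l hl => ?_, fun l hl => ?_⟩
    · have h3 := h1 (l.map (g * ·)) (by simpa using hl) (G.act _ g w₀)
      rw [hτ, hw₀, mul_one] at h3
      change (y (l.map (g * ·)) - cob b (l.map (g * ·))) w₀ = (y l - cob b l) w₀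
      rw [← h3, LinearMap.sub_apply, LinearMap.sub_apply, hE g l w₀ hl, hcobE hb g l w₀ hl]
    · have h4 : cob (fun l => (y l - cob b l) w₀) l = (cob (fun l => y l - cob b l) l) w₀ :=
        (map_cob (LinearMap.applyₗ (R := ℝ) (M₂ := ℝ) w₀).toAddMonoidHom
          (fun l => y l - cob b l) l).symm
      rw [h4, cob_sub, hy l hl, cob_cob]
      simp [hw₀]
  | step p y y' h' hE hy ih =>
    intro k hk b hb hyb
    subst hk
    have hlt := h'.le
    have hE' : G.Eqv (k + 1) (fun l => y l - cob b l) := fun g l w hl => by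
      rw [LinearMap.sub_apply, LinearMap.sub_apply, hE g l w hl, hcobE hb g l w hl]
    obtain ⟨S, hS1, hS2⟩ := G.col_exact hE' fun l hl w hw => by
      obtain ⟨v, hv⟩ := hex (n + k) (by omega) w hw
      have h2 := hyb l hl v
      dsimp only at h2
      rw [← hv, LinearMap.sub_apply, h2, sub_self]
    refine ih (k + 1) rfl S hS1 fun l hl v => ?_
    dsimp only
    rw [hy l hl]
    have h5 : cob (fun t => (S t).comp (G.d (n + (k + 1)))) l = cob (fun l => y l - cob b l) l :=
      cob_congr fun t _ ht => LinearMap.ext fun w => hS2 t (by omega) w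
    rw [cob_comp, cob_sub, cob_cob, sub_zero] at h5
    exact (LinearMap.congr_fun h5 v).symm

/-- Duality: a homogeneous cocycle is a coboundary once every invariant functional
annihilating exact forms extends over the differential. -/
theorem exists_cob_of_functionals {m : ℕ} {τ : C (n + (m + 1)) →ₗ[ℝ] ℝ}
    (hτ : ∀ g w, τ (G.act _ g w) = τ w)
    (w₀ : C (n + (m + 1))) (hw₀ : τ w₀ = 1)
    (hker : ∀ w, τ w = 0 ↔ ∃ v, G.d (n + m) v = w)
    (hex : ∀ r, r < n + m → ∀ w, G.d (r + 1) w = 0 → ∃ v, G.d r v = w)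
    (hT : ∀ T : C n →ₗ[ℝ] ℝ, (∀ g w, T (G.act n g w) = T w) →
      (∀ w, (∃ r, ∃ h : r + 1 = n, ∃ v, h ▸ G.d r v = w) → T w = 0) →
      ∃ S : C (n + 1) →ₗ[ℝ] ℝ, (∀ g w, S (G.act _ g w) = S w) ∧ ∀ w, S (G.d n w) = T w)
    (hc : ∀ l, l.length = m + 1 + 2 → cob c l = 0)
    (hinv : ∀ g l, l.length = m + 1 + 1 → c (l.map (g * ·)) = c l) :
    ∃ b' : List Γ → ℝ, (∀ g l, l.length = m + 1 → b' (l.map (g * ·)) = b' l) ∧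
      ∀ l, l.length = m + 1 + 1 → cob b' l = c l := by
  have hτd : ∀ r (h : r + 1 = n + (m + 1)) w, τ (h ▸ G.d r w) = 0 := by
    intro r h w
    obtain rfl : r = n + m := by omega
    exact (hker _).2 ⟨w, rfl⟩
  obtain ⟨y, hy⟩ := Reach.exists hτd hτ hc hinv (m + 1) 0 (by omega)
  have hy0 := hy
  cases hy with
  | step _ _ y' h' hE hy' =>
    obtain ⟨S, hS1, hS2⟩ := hT (y []) (fun g w => hE g [] w rfl) fun w ⟨r, h, v, hv⟩ => by
      subst h
      subst hv
      have h2 := hy' [1] rfl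
      have h3 := h2 (G.d r v)
      erw [G.d_d] at h3
      rw [map_zero, cob_cons] at h3
      simpa using h3.symm
    refine h'.split hτ w₀ hw₀ (fun r h w hw => ?_) (fun r hr => hex r (by omega)) 0 rfl
      (fun _ => S) (fun g l w hl => hS1 g w) fun l hl v => ?_
    · obtain rfl : r = n + m := by omega
      exact (hker w).1 hw
    · obtain ⟨g, rfl⟩ := List.length_eq_one_iff.1 hl
      dsimp only
      have h2 := hy' [g] rfl v
      rw [cob_cons, cob_nil, sub_zero] at h2
      rw [h2, cob_cons, cob_nil, sub_zero]
      exact (hS2 v).symm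

end GammaComplex

end Duality

section

open Set Filter Topology
open scoped ContDiff

section Zigzag

set_option linter.unusedVariables false

variable {S : Type*} {E : Type} [NormedAddCommGroup E] [NormedSpace ℝ E] {q : ℕ}

theorem cob_apply' {A ι : Type*} [AddCommGroup A] (x : List S → ι → A) (l : List S) (i : ι) :
    cob x l i = cob (fun t => x t i) l :=
  map_cob (Pi.evalAddMonoidHom (fun _ : ι => A) i) x l

theorem differentiableAt_cob {x : List S → E → E [⋀^Fin q]→L[ℝ] ℝ} {l : List S} {e : E}
    (h : ∀ t, t.Sublist l → t.length + 1 = l.length → DifferentiableAt ℝ (x t) e) :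
    DifferentiableAt ℝ (cob x l) e := by
  let N : AddSubgroup (E → E [⋀^Fin q]→L[ℝ] ℝ) :=
    { carrier := {f | DifferentiableAt ℝ f e}
      add_mem' := fun ha hb => DifferentiableAt.add ha hb
      zero_mem' := differentiableAt_const 0
      neg_mem' := fun ha => DifferentiableAt.neg ha }
  exact cob_mem (N := N) h

theorem contDiffOn_cob {x : List S → E → E [⋀^Fin q]→L[ℝ] ℝ} {l : List S} {U : Set E}
    (h : ∀ t, t.Sublist l → t.length + 1 = l.length → ContDiffOn ℝ ∞ (x t) U) :
    ContDiffOn ℝ ∞ (cob x l) U := by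
  let N : AddSubgroup (E → E [⋀^Fin q]→L[ℝ] ℝ) :=
    { carrier := {f | ContDiffOn ℝ ∞ f U}
      add_mem' := fun ha hb => ContDiffOn.add ha hb
      zero_mem' := contDiffOn_const
      neg_mem' := fun ha => ContDiffOn.neg ha }
  exact cob_mem (N := N) h

theorem extDeriv_cob {x : List S → E → E [⋀^Fin q]→L[ℝ] ℝ} {l : List S} {e : E}
    (h : ∀ t, t.Sublist l → t.length + 1 = l.length → DifferentiableAt ℝ (x t) e) :
    extDeriv (cob x l) e = cob (fun t => extDeriv (x t)) l e := by
  induction l generalizing x with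
  | nil => exact extDeriv_zero_form e
  | cons s l ih =>
    have h1 : ∀ t, t.Sublist l → t.length + 1 = l.length → DifferentiableAt ℝ (x (s :: t)) e :=
      fun t ht hl => h _ (ht.cons_cons s) (by simp [hl])
    have h2 := extDeriv_fun_sub' (h l (List.sublist_cons_self s l) rfl) (differentiableAt_cob h1)
    rw [ih h1] at h2
    exact h2

variable (W : List S → Set E) (P P' : ∀ p q : ℕ, (List S → E → E [⋀^Fin q]→L[ℝ] ℝ) → Prop)

/-- Equality of cochains of list length `p` on the sets `W l`. -/
def EqOnW {A : Type*} (p : ℕ) (x y : List S → E → A) : Prop :=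
  ∀ l : List S, l.length = p → ∀ e ∈ W l, x l e = y l e

/-- Fibrewise exterior derivative. -/
noncomputable def dF (x : List S → E → E [⋀^Fin q]→L[ℝ] ℝ) :
    List S → E → E [⋀^Fin (q + 1)]→L[ℝ] ℝ := fun l => extDeriv (x l)

/-- Admissible cochains for the descent in a Cech-de Rham double complex. -/
structure Descent : Prop where
  isOpen : ∀ l, IsOpen (W l)
  anti : ∀ {t l : List S}, t.Sublist l → W l ⊆ W t
  smooth : ∀ {p q x}, P p q x → ∀ l : List S, l.length = p → ContDiffOn ℝ ∞ (x l) (W l)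
  cob : ∀ {p q x}, P p q x → P (p + 1) q (cob x)
  sub : ∀ {p q x y}, P p q x → P p q y → P p q (fun l e => x l e - y l e)
  zero : ∀ {p q}, P p q 0
  col : ∀ {p q x}, P (p + 1) (q + 1) x → EqOnW W (p + 1) (dF x) 0 →
    ∃ y, P (p + 1) q y ∧ EqOnW W (p + 1) (dF y) x

/-- Admissible cochains for the ascent in a Cech-de Rham double complex. -/
structure Ascent : Prop where
  smooth : ∀ {p q x}, P' p q x → ∀ l : List S, l.length = p → ContDiffOn ℝ ∞ (x l) (W l)
  d : ∀ {p q x}, P' p q x → P' p (q + 1) (dF x)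
  sub : ∀ {p q x y}, P' p q x → P' p q y → P' p q (fun l e => x l e - y l e)
  row : ∀ {p q x}, P' (p + 1) q x → EqOnW W (p + 2) (cob x) 0 →
    ∃ y, P' p q y ∧ EqOnW W (p + 1) (cob y) x
  cover : ∀ e ∈ W [], ∃ s, e ∈ W [s]

/-- Chains of local primitives starting from `a`. -/
inductive Linked {m : ℕ} (a : List S → E → E [⋀^Fin (m + 1)]→L[ℝ] ℝ) :
    ∀ p q : ℕ, (List S → E → E [⋀^Fin (q + 1)]→L[ℝ] ℝ) → Prop
  | base : Linked a 0 m a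
  | step (p q : ℕ) (x : List S → E → E [⋀^Fin (q + 1 + 1)]→L[ℝ] ℝ)
      (y : List S → E → E [⋀^Fin (q + 1)]→L[ℝ] ℝ) (hx : Linked a p (q + 1) x)
      (hy : P (p + 1) (q + 1) y) (h : EqOnW W (p + 1) (dF y) (cob x)) : Linked a (p + 1) q y

variable {W P P'}

theorem EqOnW.cob {A : Type*} [AddCommGroup A] (anti : ∀ {t l : List S}, t.Sublist l → W l ⊆ W t)
    {p : ℕ} {x y : List S → E → A} (h : EqOnW W p x y) : EqOnW W (p + 1) (cob x) (cob y) := by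
  intro l hl e he
  rw [cob_apply', cob_apply']
  exact cob_congr fun t ht htl => h t (by omega) e (anti ht he)

theorem EqOnW.symm {A : Type*} {p : ℕ} {x y : List S → E → A} (h : EqOnW W p x y) :
    EqOnW W p y x := fun l hl e he => (h l hl e he).symm

theorem EqOnW.trans {A : Type*} {p : ℕ} {x y z : List S → E → A} (h : EqOnW W p x y)
    (h' : EqOnW W p y z) : EqOnW W p x z := fun l hl e he => (h l hl e he).trans (h' l hl e he)

theorem EqOnW.sub_eq_zero {A : Type*} [AddCommGroup A] {p : ℕ} {x y : List S → E → A}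
    (h : EqOnW W p x y) : EqOnW W p (fun l e => x l e - y l e) 0 := fun l hl e he => by
  simp [h l hl e he]

theorem cob_cob_eq {A : Type*} [AddCommGroup A] {x : List S → E → A} (p : ℕ) :
    EqOnW W p (_root_.cob (_root_.cob x)) 0 := fun l hl e he => by rw [cob_cob]; rfl

theorem cob_sub_fun {A : Type*} [AddCommGroup A] {x y : List S → E → A} :
    _root_.cob (fun l e => x l e - y l e) =
      fun l e => _root_.cob x l e - _root_.cob y l e := by
  funext l e
  simp only [cob_apply', cob_sub]

theorem EqOnW.dF (isOpen : ∀ l, IsOpen (W l)) {p : ℕ} {x y : List S → E → E [⋀^Fin q]→L[ℝ] ℝ}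
    (h : EqOnW W p x y) : EqOnW W p (dF x) (dF y) := fun l hl _ he =>
  extDeriv_congr_on (isOpen l) (h l hl) he

theorem dF_zero (p : ℕ) : EqOnW W p (dF (0 : List S → E → E [⋀^Fin q]→L[ℝ] ℝ)) 0 :=
  fun _ _ e _ => extDeriv_zero_form e

theorem dF_dF (isOpen : ∀ l, IsOpen (W l)) {p : ℕ} {x : List S → E → E [⋀^Fin q]→L[ℝ] ℝ}
    (hx : ∀ l : List S, l.length = p → ContDiffOn ℝ ∞ (x l) (W l)) :
    EqOnW W p (dF (dF x)) 0 := fun l hl _ he =>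
  extDeriv_extDeriv_on (isOpen l) (hx l hl) he

theorem dF_sub (isOpen : ∀ l, IsOpen (W l)) {p : ℕ} {x y : List S → E → E [⋀^Fin q]→L[ℝ] ℝ}
    (hx : ∀ l : List S, l.length = p → ContDiffOn ℝ ∞ (x l) (W l))
    (hy : ∀ l : List S, l.length = p → ContDiffOn ℝ ∞ (y l) (W l)) :
    EqOnW W p (dF fun l e => x l e - y l e) (fun l e => dF x l e - dF y l e) :=
  fun l hl _ he => extDeriv_fun_sub' (diffAt_of_contDiffOn (isOpen l) (hx l hl) he)
    (diffAt_of_contDiffOn (isOpen l) (hy l hl) he)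

theorem dF_cob (isOpen : ∀ l, IsOpen (W l))
    (anti : ∀ {t l : List S}, t.Sublist l → W l ⊆ W t) {p : ℕ}
    {x : List S → E → E [⋀^Fin q]→L[ℝ] ℝ}
    (hx : ∀ l : List S, l.length = p → ContDiffOn ℝ ∞ (x l) (W l)) :
    EqOnW W (p + 1) (dF (cob x)) (cob (dF x)) := fun l hl _ he =>
  extDeriv_cob fun t ht htl =>
    diffAt_of_contDiffOn (isOpen t) (hx t (by omega)) (anti ht he)

variable {m : ℕ} {a : List S → E → E [⋀^Fin (m + 1)]→L[ℝ] ℝ}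

theorem Linked.mem (ha : P 0 (m + 1) a) {p : ℕ} {x : List S → E → E [⋀^Fin (q + 1)]→L[ℝ] ℝ}
    (h : Linked W P a p q x) : P p (q + 1) x := by
  cases h with
  | base => exact ha
  | step _ _ _ _ _ hy _ => exact hy

theorem Linked.closed (hP : Descent W P) (ha : P 0 (m + 1) a) (had : EqOnW W 0 (dF a) 0) {p : ℕ}
    {x : List S → E → E [⋀^Fin (q + 1)]→L[ℝ] ℝ} (h : Linked W P a p q x) :
    EqOnW W (p + 1) (dF (cob x)) 0 := by
  refine (dF_cob hP.isOpen hP.anti (hP.smooth (h.mem ha))).trans ?_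
  cases h with
  | base =>
    refine (had.cob hP.anti).trans fun l _ e _ => ?_
    rw [cob_apply']
    exact cob_zero l
  | step _ _ _ _ _ _ h => exact (h.cob hP.anti).trans (cob_cob_eq _)

theorem Linked.exists (hP : Descent W P) (ha : P 0 (m + 1) a) (had : EqOnW W 0 (dF a) 0) (p : ℕ) :
    ∀ q, p + q = m → ∃ x, Linked W P a p q x := by
  induction p with
  | zero =>
    intro q hq
    obtain rfl : q = m := by omega
    exact ⟨a, .base⟩
  | succ p ih =>
    intro q hq
    obtain ⟨x, hx⟩ := ih (q + 1) (by omega)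
    obtain ⟨y, hy, hyx⟩ := hP.col (hP.cob (hx.mem ha)) (hx.closed hP ha had)
    exact ⟨y, .step p q x y hx hy hyx⟩

/-- The bottom of a chain of local primitives: a cochain of functions. -/
def LinkedBot (W : List S → Set E)
    (P : ∀ p q : ℕ, (List S → E → E [⋀^Fin q]→L[ℝ] ℝ) → Prop)
    (a : List S → E → E [⋀^Fin (m + 1)]→L[ℝ] ℝ) (y : List S → E → E [⋀^Fin 0]→L[ℝ] ℝ) : Prop :=
  P (m + 1) 0 y ∧ ∃ x, Linked W P a m 0 x ∧ EqOnW W (m + 1) (dF y) (cob x)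

theorem LinkedBot.exists (hP : Descent W P) (ha : P 0 (m + 1) a) (had : EqOnW W 0 (dF a) 0) :
    ∃ y, LinkedBot W P a y := by
  obtain ⟨x, hx⟩ := Linked.exists hP ha had m 0 rfl
  obtain ⟨y, hy, hyx⟩ := hP.col (hP.cob (hx.mem ha)) (hx.closed hP ha had)
  exact ⟨y, hy, x, hx, hyx⟩

theorem LinkedBot.closed (hP : Descent W P) {y : List S → E → E [⋀^Fin 0]→L[ℝ] ℝ}
    (h : LinkedBot W P a y) : EqOnW W (m + 2) (dF (cob y)) 0 := by
  obtain ⟨hy, x, hx, hyx⟩ := h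
  exact (dF_cob hP.isOpen hP.anti (hP.smooth hy)).trans
    ((hyx.cob hP.anti).trans (cob_cob_eq _))

theorem Linked.ascend (hP : Descent W P) (hP' : Ascent W P')
    (hPP : ∀ {p q x}, P p q x → P' p q x) {p : ℕ}
    {x : List S → E → E [⋀^Fin (q + 1)]→L[ℝ] ℝ} (h : Linked W P a p q x) :
    ∀ z, P' p q z → EqOnW W (p + 1) (cob x) (cob (dF z)) →
      ∃ η, P' 0 m η ∧ EqOnW W 0 (dF η) a := by
  induction h with
  | base =>
    intro z hz h
    refine ⟨z, hz, fun l hl e he => ?_⟩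
    obtain rfl := List.length_eq_zero_iff.1 hl
    obtain ⟨s, hs⟩ := hP'.cover e he
    have := h [s] rfl e hs
    rw [cob_apply', cob_apply', cob_cons, cob_cons] at this
    simpa using this.symm
  | step p q x y hx hy hyx ih =>
    intro z hz h
    obtain ⟨z', hz', h'⟩ := hP'.row (hP'.sub (hPP hy) (hP'.d hz)) (by
      rw [cob_sub_fun]; exact h.sub_eq_zero)
    refine ih z' hz' (EqOnW.trans ?_ ((dF_cob hP.isOpen hP.anti (hP'.smooth hz'))))
    refine EqOnW.trans ?_ (h'.symm.dF hP.isOpen)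
    refine EqOnW.trans ?_
      (dF_sub hP.isOpen (hP.smooth hy) (hP'.smooth (hP'.d hz))).symm
    intro l hl e he
    dsimp only
    rw [← hyx l hl e he, dF_dF hP.isOpen (hP'.smooth hz) l hl e he]
    simp

/-- If the bottom cochain agrees up to constants with an admissible coboundary, the form at the
top has an admissible primitive. -/
theorem LinkedBot.ascend (hP : Descent W P) (hP' : Ascent W P')
    (hPP : ∀ {p q x}, P p q x → P' p q x) {y : List S → E → E [⋀^Fin 0]→L[ℝ] ℝ}
    (h : LinkedBot W P a y) {b : List S → E → E [⋀^Fin 0]→L[ℝ] ℝ} (hb : P' (m + 1) 0 b)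
    (hbd : EqOnW W (m + 1) (dF b) 0) (hby : EqOnW W (m + 2) (cob b) (cob y)) :
    ∃ η, P' 0 m η ∧ EqOnW W 0 (dF η) a := by
  obtain ⟨hy, x, hx, hyx⟩ := h
  obtain ⟨z', hz', h'⟩ := hP'.row (hP'.sub (hPP hy) hb) (by
    rw [cob_sub_fun]; exact hby.symm.sub_eq_zero)
  refine hx.ascend hP hP' hPP z' hz' ?_
  refine EqOnW.trans ?_ ((dF_cob hP.isOpen hP.anti (hP'.smooth hz')))
  refine EqOnW.trans ?_ (h'.symm.dF hP.isOpen)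
  refine EqOnW.trans ?_ (dF_sub hP.isOpen (hP.smooth hy) (hP'.smooth hb)).symm
  intro l hl e he
  dsimp only
  rw [← hyx l hl e he, hbd l hl e he]
  simp

theorem Linked.sub (hP : Descent W P)
    {a' : List S → E → E [⋀^Fin (m + 1)]→L[ℝ] ℝ} {p : ℕ}
    {x : List S → E → E [⋀^Fin (q + 1)]→L[ℝ] ℝ} (h : Linked W P a p q x) :
    ∀ x', Linked W P a' p q x' →
      Linked W P (fun l e => a l e - a' l e) p q (fun l e => x l e - x' l e) := by
  induction h with
  | base => intro x' h'; cases h'; exact .base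
  | step p q x y hx hy hyx ih =>
    intro y' h'
    cases h' with
    | step _ _ x' _ hx' hy' hyx' =>
      refine .step p q _ _ (ih x' hx') (hP.sub hy hy') ?_
      refine (dF_sub hP.isOpen (hP.smooth hy) (hP.smooth hy')).trans ?_
      rw [cob_sub_fun]
      intro l hl e he
      dsimp only
      rw [hyx l hl e he, hyx' l hl e he]

theorem LinkedBot.sub (hP : Descent W P)
    {a' : List S → E → E [⋀^Fin (m + 1)]→L[ℝ] ℝ}
    {y y' : List S → E → E [⋀^Fin 0]→L[ℝ] ℝ} (h : LinkedBot W P a y) (h' : LinkedBot W P a' y') :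
    LinkedBot W P (fun l e => a l e - a' l e) (fun l e => y l e - y' l e) := by
  obtain ⟨hy, x, hx, hyx⟩ := h
  obtain ⟨hy', x', hx', hyx'⟩ := h'
  refine ⟨hP.sub hy hy', _, hx.sub hP x' hx', ?_⟩
  refine (dF_sub hP.isOpen (hP.smooth hy) (hP.smooth hy')).trans ?_
  rw [cob_sub_fun]
  intro l hl e he
  dsimp only
  rw [hyx l hl e he, hyx' l hl e he]

theorem Linked.descend (hP : Descent W P) (ha : EqOnW W 0 a 0) {p : ℕ}
    {x : List S → E → E [⋀^Fin (q + 1)]→L[ℝ] ℝ} (h : Linked W P a p q x) :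
    ∃ u, P p q u ∧ EqOnW W (p + 1) (cob x) (dF (cob u)) := by
  induction h with
  | base =>
    refine ⟨0, hP.zero, (ha.cob hP.anti).trans fun l hl e he => ?_⟩
    have h1 : cob (0 : List S → E → E [⋀^Fin m]→L[ℝ] ℝ) l = 0 := cob_zero l
    have h2 : cob (0 : List S → E → E [⋀^Fin (m + 1)]→L[ℝ] ℝ) l = 0 := cob_zero l
    rw [h2, dF, h1]
    exact (extDeriv_zero_form e).symm
  | step p q x y hx hy hyx ih =>
    obtain ⟨u, hu, hux⟩ := ih
    obtain ⟨v, hv, hvx⟩ := hP.col (hP.sub hy (hP.cob hu))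
      ((dF_sub hP.isOpen (hP.smooth hy) (hP.smooth (hP.cob hu))).trans
        (hyx.trans hux).sub_eq_zero)
    refine ⟨v, hv, EqOnW.symm ?_⟩
    refine (dF_cob hP.isOpen hP.anti (hP.smooth hv)).trans ?_
    refine (hvx.cob hP.anti).trans ?_
    rw [cob_sub_fun]
    intro l hl e he
    dsimp only
    rw [cob_cob]
    simp

/-- The bottom of a chain over the zero form is a coboundary up to an admissible closed cochain. -/
theorem LinkedBot.descend (hP : Descent W P) (ha : EqOnW W 0 a 0)
    {y : List S → E → E [⋀^Fin 0]→L[ℝ] ℝ} (h : LinkedBot W P a y) :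
    ∃ b, P (m + 1) 0 b ∧ EqOnW W (m + 1) (dF b) 0 ∧ EqOnW W (m + 2) (cob b) (cob y) := by
  obtain ⟨hy, x, hx, hyx⟩ := h
  obtain ⟨u, hu, hux⟩ := hx.descend hP ha
  refine ⟨_, hP.sub hy (hP.cob hu),
    (dF_sub hP.isOpen (hP.smooth hy) (hP.smooth (hP.cob hu))).trans
      (hyx.trans hux).sub_eq_zero, ?_⟩
  rw [cob_sub_fun]
  intro l hl e he
  dsimp only
  rw [cob_cob]
  simp

end Zigzag

end

section

open Set Filter Topology
open scoped ContDiff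

section LocallyFiniteSums


variable {S : Type*} {E : Type} [NormedAddCommGroup E] [NormedSpace ℝ E] {q : ℕ}
  {F : Type} [NormedAddCommGroup F] [NormedSpace ℝ F]

/-- A family of functions on `X` such that near each point of `X` all but finitely many
members vanish. -/
def LocFin (X : Set E) (f : S → E → F) : Prop :=
  ∀ x ∈ X, ∃ t : Finset S, ∀ᶠ y in 𝓝 x, ∀ s ∉ t, f s y = 0

theorem LocFin.finite {X : Set E} {f : S → E → F} (h : LocFin X f) {x : E} (hx : x ∈ X) :
    {s | f s x ≠ 0}.Finite := by
  obtain ⟨t, ht⟩ := h x hx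
  exact t.finite_toSet.subset fun s hs => by
    by_contra hst
    exact hs (ht.self_of_nhds s hst)

theorem LocFin.finite_compact {X K : Set E} {f : S → E → F} (h : LocFin X f) (hK : IsCompact K)
    (hKX : K ⊆ X) : {s | ∃ x ∈ K, f s x ≠ 0}.Finite := by
  refine hK.induction_on (p := fun K => {s | ∃ x ∈ K, f s x ≠ 0}.Finite) (by simp)
    (fun A B hAB hB => hB.subset fun s ⟨x, hx, h⟩ => ⟨x, hAB hx, h⟩)
    (fun A B hA hB => (hA.union hB).subset ?_) fun x hx => ?_
  · rintro s ⟨x, hx | hx, h⟩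
    · exact Or.inl ⟨x, hx, h⟩
    · exact Or.inr ⟨x, hx, h⟩
  · obtain ⟨t, ht⟩ := h x (hKX hx)
    refine ⟨_, mem_nhdsWithin_of_mem_nhds ht, t.finite_toSet.subset ?_⟩
    rintro s ⟨y, hy, h⟩
    by_contra hst
    exact h (hy s hst)

theorem LocFin.eventually_sum {X : Set E} {f : S → E → F} (h : LocFin X f) {x : E} (hx : x ∈ X) :
    ∃ t : Finset S, ∀ᶠ y in 𝓝 x, ∑ᶠ s, f s y = ∑ s ∈ t, f s y := by
  obtain ⟨t, ht⟩ := h x hx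
  refine ⟨t, ht.mono fun y hy => finsum_eq_sum_of_support_subset _ fun s hs => ?_⟩
  by_contra hst
  exact hs (hy s hst)

theorem LocFin.contDiffOn {X U : Set E} {f : S → E → F} (h : LocFin X f) (hU : IsOpen U)
    (hUX : U ⊆ X) (hf : ∀ s, ContDiffOn ℝ ∞ (f s) U) :
    ContDiffOn ℝ ∞ (fun x => ∑ᶠ s, f s x) U := by
  intro x hx
  obtain ⟨t, ht⟩ := h.eventually_sum (hUX hx)
  have h1 : ContDiffAt ℝ ∞ (fun y => ∑ s ∈ t, f s y) x :=
    ContDiffAt.sum fun s _ => (hf s).contDiffAt (hU.mem_nhds hx)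
  exact (h1.congr_of_eventuallyEq ht).contDiffWithinAt

/-- A smooth partition of unity on `X` subordinate to `V`. -/
structure SmoothPart (X : Set E) (V : S → Set E) (ψ : S → E → ℝ) : Prop where
  smooth : ∀ s, ContDiffOn ℝ ∞ (ψ s) X
  locFin : LocFin X ψ
  sum : ∀ x ∈ X, ∑ᶠ s, ψ s x = 1
  supp : ∀ s, ∀ x ∈ X, x ∉ V s → ∀ᶠ y in 𝓝 x, ψ s y = 0

/-- The part of `X` lying in all members of the list. -/
def inter (X : Set E) (V : S → Set E) (l : List S) : Set E := {x ∈ X | ∀ s ∈ l, x ∈ V s}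

theorem inter_anti (X : Set E) (V : S → Set E) {t l : List S} (h : t.Sublist l) :
    inter X V l ⊆ inter X V t := fun _ hx => ⟨hx.1, fun s hs => hx.2 s (h.subset hs)⟩

theorem inter_nil (X : Set E) (V : S → Set E) : inter X V [] = X := by
  ext; simp [inter]

theorem inter_subset (X : Set E) (V : S → Set E) (l : List S) : inter X V l ⊆ X := fun _ h => h.1

theorem inter_cons (X : Set E) (V : S → Set E) (s : S) (l : List S) :
    inter X V (s :: l) = inter X V l ∩ V s := by
  ext; simp only [inter, List.mem_cons, mem_inter_iff]
  constructor
  · rintro ⟨h1, h2⟩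
    exact ⟨⟨h1, fun t ht => h2 t (Or.inr ht)⟩, h2 s (Or.inl rfl)⟩
  · rintro ⟨⟨h1, h2⟩, h3⟩
    refine ⟨h1, ?_⟩
    rintro t (rfl | ht)
    · exact h3
    · exact h2 t ht

theorem isOpen_inter' {X : Set E} {V : S → Set E} (hX : IsOpen X) (hV : ∀ s, IsOpen (X ∩ V s))
    (l : List S) : IsOpen (inter X V l) := by
  induction l with
  | nil => rwa [inter_nil]
  | cons s l ih =>
    have : inter X V (s :: l) = inter X V l ∩ (X ∩ V s) := by
      rw [inter_cons, ← inter_assoc, inter_eq_left.2 (inter_subset X V l)]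
    rw [this]
    exact ih.inter (hV s)

/-- The contraction of the Cech complex given by a partition of unity. -/
noncomputable def rowAvg (ψ : S → E → ℝ) (x : List S → E → E [⋀^Fin q]→L[ℝ] ℝ) :
    List S → E → E [⋀^Fin q]→L[ℝ] ℝ := fun t e => ∑ᶠ s, ψ s e • x (s :: t) e

namespace SmoothPart

variable {X : Set E} {V : S → Set E} {ψ : S → E → ℝ}

theorem rowAvg_smooth (hψ : SmoothPart X V ψ) (hX : IsOpen X) (hV : ∀ s, IsOpen (X ∩ V s))
    {x : List S → E → E [⋀^Fin q]→L[ℝ] ℝ} {p : ℕ}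
    (hx : ∀ l : List S, l.length = p + 1 → ContDiffOn ℝ ∞ (x l) (inter X V l)) (l : List S)
    (hl : l.length = p) : ContDiffOn ℝ ∞ (rowAvg ψ x l) (inter X V l) := by
  have hlf : LocFin X fun s e => ψ s e • x (s :: l) e := fun e he => by
    obtain ⟨t, ht⟩ := hψ.locFin e he
    exact ⟨t, ht.mono fun y hy s hs => by
      dsimp only
      rw [hy s hs, zero_smul]⟩
  refine hlf.contDiffOn (isOpen_inter' hX hV l) (inter_subset X V l) fun s => ?_
  refine contDiffOn_union_zero (A := inter X V (s :: l)) (B := interior {y | ψ s y = 0})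
    (isOpen_inter' hX hV _) isOpen_interior (fun e he => ?_) ?_ fun e he => ?_
  · by_cases hs : e ∈ V s
    · exact Or.inl (by rw [inter_cons]; exact ⟨he, hs⟩)
    · exact Or.inr (mem_interior_iff_mem_nhds.2 (hψ.supp s e (inter_subset X V l he) hs))
  · have h1 := (hψ.smooth s).mono (inter_subset X V (s :: l))
    have h2 := hx (s :: l) (by simp [hl])
    exact ContDiffOn.smul h1 h2
  · have h3 : e ∈ {y | ψ s y = 0} := interior_subset he
    change ψ s e • x (s :: l) e = 0
    rw [show ψ s e = 0 from h3, zero_smul]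

theorem rowAvg_cob (hψ : SmoothPart X V ψ) {x : List S → E → E [⋀^Fin q]→L[ℝ] ℝ} {p : ℕ}
    (hx : EqOnW (inter X V) (p + 2) (cob x) 0) :
    EqOnW (inter X V) (p + 1) (cob (rowAvg ψ x)) x := by
  intro l hl e he
  have heX := inter_subset X V l he
  have hfin := hψ.locFin.finite heX
  let f : (S → E [⋀^Fin q]→L[ℝ] ℝ) →+ E [⋀^Fin q]→L[ℝ] ℝ :=
    { toFun := fun z => ∑ᶠ s, ψ s e • z s
      map_zero' := by simp
      map_add' := fun y z => by
        rw [← finsum_add_distrib]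
        · exact finsum_congr fun s => smul_add _ _ _
        · exact hfin.subset fun s hs h => hs (by simp only [h, zero_smul])
        · exact hfin.subset fun s hs h => hs (by simp only [h, zero_smul]) }
  rw [cob_apply']
  have h1 := map_cob f (fun t s => x (s :: t) e) l
  refine Eq.trans h1.symm ?_
  have h2 : ∀ s, ψ s e • cob (fun t s => x (s :: t) e) l s = ψ s e • x l e := fun s => by
    by_cases hs : e ∈ V s
    · rw [cob_apply']
      have h3 := hx (s :: l) (by simp [hl]) e (by rw [inter_cons]; exact ⟨he, hs⟩)
      rw [cob_apply', cob_cons] at h3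
      rw [← sub_eq_zero.1 h3]
    · rw [(hψ.supp s e heX hs).self_of_nhds, zero_smul, zero_smul]
  have h4 := (LinearMap.toSpanSingleton ℝ (E [⋀^Fin q]→L[ℝ] ℝ) (x l e)).toAddMonoidHom.map_finsum
    hfin
  calc f (cob (fun t s => x (s :: t) e) l) = ∑ᶠ s, ψ s e • x l e := finsum_congr h2
    _ = (∑ᶠ s, ψ s e) • x l e := h4.symm
    _ = x l e := by rw [hψ.sum e heX, one_smul]

end SmoothPart

end LocallyFiniteSums

end

section

open Set Filter Topology
open scoped ContDiff

/-- A proper action on an open convex set together with a family of functions whose sublevel sets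
are the horoballs of reduction theory. -/
structure ReductionData (Γ L E : Type) [Group Γ] [AddCommGroup L] [DistribMulAction Γ L]
    [NormedAddCommGroup E] [NormedSpace ℝ E] where
  X : Set E
  isOpen : IsOpen X
  convex : Convex ℝ X
  nonempty : X.Nonempty
  act : Γ → E → E
  act_smooth : ∀ g, ContDiffOn ℝ ∞ (act g) X
  act_mem : ∀ g, MapsTo (act g) X X
  act_one : ∀ x ∈ X, act 1 x = x
  act_mul : ∀ g h, ∀ x ∈ X, act (g * h) x = act g (act h x)
  q : L → E → ℝ
  q_smooth : ∀ v, ContDiffOn ℝ ∞ (q v) X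
  q_nsmul : ∀ (k : ℕ) v, ∀ x ∈ X, q (k • v) x = k ^ 2 * q v x
  q_convex : ∀ v c, Convex ℝ {x ∈ X | q v x < c}
  q_act : ∀ g v, ∀ x ∈ X, q (g • v) (act g x) = q v x
  orth : L → L → Prop
  orth_of_short : ∀ v w, v ≠ 0 → w ≠ 0 → ∀ x ∈ X, q v x < 1 → q w x < 1 → orth v w
  exists_short : ∀ l : List L, (∀ v ∈ l, v ≠ 0) → l.Pairwise orth → ∀ ε > 0,
    ∃ x ∈ X, ∀ v ∈ l, q v x < ε
  finite_short : ∀ K, IsCompact K → K ⊆ X → ∀ c, {v | ∃ x ∈ K, q v x ≤ c}.Finite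
  proper : ∀ K, IsCompact K → K ⊆ X → {g | ∃ x ∈ K, act g x ∈ K}.Finite
  mahler : ∀ ε > 0, ∃ K, IsCompact K ∧ K ⊆ X ∧ ∀ x ∈ X, (∀ v, v ≠ 0 → ε ≤ q v x) →
    ∃ g, act g x ∈ K

namespace ReductionData

variable {Γ L E : Type} [Group Γ] [AddCommGroup L] [DistribMulAction Γ L]
  [NormedAddCommGroup E] [NormedSpace ℝ E] (G : ReductionData Γ L E)

theorem q_zero {x : E} (hx : x ∈ G.X) : G.q 0 x = 0 := by
  simpa using G.q_nsmul 0 0 x hx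

theorem act_inv_act {g : Γ} {x : E} (hx : x ∈ G.X) : G.act g⁻¹ (G.act g x) = x := by
  rw [← G.act_mul _ _ _ hx, inv_mul_cancel, G.act_one _ hx]

theorem act_act_inv {g : Γ} {x : E} (hx : x ∈ G.X) : G.act g (G.act g⁻¹ x) = x := by
  rw [← G.act_mul _ _ _ hx, mul_inv_cancel, G.act_one _ hx]

/-- Sublevel sets. -/
def V (ε : ℝ) (v : L) : Set E := {x | G.q v x < ε}

theorem isOpen_V (ε : ℝ) (v : L) : IsOpen (G.X ∩ G.V ε v) :=
  (G.q_smooth v).continuousOn.isOpen_inter_preimage G.isOpen isOpen_Iio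

theorem convex_inter (ε : ℝ) (l : List L) : Convex ℝ (inter G.X (G.V ε) l) := by
  induction l with
  | nil => rw [inter_nil]; exact G.convex
  | cons s l ih =>
    have : inter G.X (G.V ε) (s :: l) = inter G.X (G.V ε) l ∩ {x ∈ G.X | G.q s x < ε} := by
      rw [inter_cons]
      ext x
      exact ⟨fun h => ⟨h.1, inter_subset _ _ _ h.1, h.2⟩, fun h => ⟨h.1, h.2.2⟩⟩
    rw [this]
    exact ih.inter (G.q_convex s ε)

/-- The cut-off function used for the height. -/
noncomputable def cut (ε t : ℝ) : ℝ := Real.smoothTransition (2 - 4 * t / ε)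

theorem cut_smooth (ε : ℝ) : ContDiff ℝ ∞ (cut ε) :=
  Real.smoothTransition.contDiff.comp
    (contDiff_const.sub ((contDiff_const.mul contDiff_id).div_const _))

theorem cut_eq_one {ε t : ℝ} (hε : 0 < ε) (h : t ≤ ε / 4) : cut ε t = 1 := by
  refine Real.smoothTransition.one_of_one_le ?_
  rw [le_sub_comm, div_le_iff₀ hε]
  linarith

theorem cut_eq_zero {ε t : ℝ} (hε : 0 < ε) (h : ε / 2 ≤ t) : cut ε t = 0 := by
  refine Real.smoothTransition.zero_of_nonpos ?_
  rw [sub_nonpos, le_div_iff₀ hε]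
  linarith

theorem cut_nonneg (ε t : ℝ) : 0 ≤ cut ε t := Real.smoothTransition.nonneg _

open Classical in
/-- The contribution of a vector to the height. -/
noncomputable def bump (ε : ℝ) (v : L) (x : E) : ℝ := if v = 0 then 0 else cut ε (G.q v x)

/-- A smooth function measuring the number of short vectors. -/
noncomputable def height (ε : ℝ) (x : E) : ℝ := ∑ᶠ v, G.bump ε v x

theorem bump_nonneg (ε : ℝ) (v : L) (x : E) : 0 ≤ G.bump ε v x := by
  unfold bump; split_ifs
  · exact le_rfl
  · exact cut_nonneg _ _

theorem bump_of_ne {ε : ℝ} {v : L} (hv : v ≠ 0) (x : E) : G.bump ε v x = cut ε (G.q v x) :=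
  if_neg hv

theorem bump_smooth (ε : ℝ) (v : L) : ContDiffOn ℝ ∞ (G.bump ε v) G.X := by
  by_cases hv : v = 0
  · have : G.bump ε v = fun _ => 0 := by funext x; exact if_pos hv
    rw [this]; exact contDiffOn_const
  · have : G.bump ε v = fun x => cut ε (G.q v x) := by funext x; exact if_neg hv
    rw [this]; exact (cut_smooth ε).comp_contDiffOn (G.q_smooth v)

theorem height_nonneg (ε : ℝ) (x : E) : 0 ≤ G.height ε x :=
  finsum_nonneg fun v => G.bump_nonneg ε v x

section

variable [FiniteDimensional ℝ E]

theorem exists_compact_nhds {x : E} (hx : x ∈ G.X) : ∃ K ∈ 𝓝 x, IsCompact K ∧ K ⊆ G.X := by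
  have : ProperSpace E := FiniteDimensional.proper ℝ E
  obtain ⟨K, h1, h2, h3⟩ := local_compact_nhds (G.isOpen.mem_nhds hx)
  exact ⟨K, h1, h3, h2⟩

theorem bump_locFin {ε : ℝ} (hε : 0 < ε) : LocFin G.X (G.bump ε) := fun x hx => by
  obtain ⟨K, hK, hKc, hKX⟩ := G.exists_compact_nhds hx
  refine ⟨(G.finite_short K hKc hKX (ε / 2)).toFinset, ?_⟩
  filter_upwards [hK] with y hy v hv
  rw [Finite.mem_toFinset] at hv
  unfold bump; split_ifs
  · rfl
  · refine cut_eq_zero hε (le_of_not_ge fun h => hv ⟨y, hy, h⟩)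

theorem height_smooth {ε : ℝ} (hε : 0 < ε) : ContDiffOn ℝ ∞ (G.height ε) G.X :=
  (G.bump_locFin hε).contDiffOn G.isOpen subset_rfl (G.bump_smooth ε)

theorem height_act {ε : ℝ} (g : Γ) {x : E} (hx : x ∈ G.X) :
    G.height ε (G.act g x) = G.height ε x := by
  unfold height
  rw [← finsum_comp_equiv (MulAction.toPerm g : Equiv.Perm L)]
  refine finsum_congr fun v => ?_
  change G.bump ε (g • v) (G.act g x) = G.bump ε v x
  by_cases hv : v = 0
  · rw [hv, smul_zero, bump, bump, if_pos rfl, if_pos rfl]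
  · rw [G.bump_of_ne hv, G.bump_of_ne fun h => hv ((smul_eq_zero_iff_eq g).1 h), G.q_act g v x hx]

theorem one_le_height {ε : ℝ} (hε : 0 < ε) {x : E} (hx : x ∈ G.X) {v : L} (hv : v ≠ 0)
    (h : G.q v x ≤ ε / 4) : 1 ≤ G.height ε x := by
  have h1 : G.bump ε v x = 1 := by rw [G.bump_of_ne hv, cut_eq_one hε h]
  rw [← h1]
  exact single_le_finsum v ((G.bump_locFin hε).finite hx) fun v => G.bump_nonneg ε v x

open Classical in
/-- A partition of unity subordinate to the sublevel sets, indexed by vectors; the zero vector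
indexes the whole space. -/
theorem exists_smoothPart {ε : ℝ} (hε : 0 < ε) : ∃ ψ : L → E → ℝ, SmoothPart G.X (G.V ε) ψ ∧
    ∀ x ∈ G.X, ∀ v, v ≠ 0 → G.q v x < ε / 4 → ψ 0 x = 0 := by
  let κ : E → ℝ := fun x => Real.smoothTransition (1 - G.height ε x)
  have hκs : ContDiffOn ℝ ∞ κ G.X :=
    Real.smoothTransition.contDiff.comp_contDiffOn (contDiffOn_const.sub (G.height_smooth hε))
  let D : E → ℝ := fun x => G.height ε x + κ x
  have hD : ∀ x, 0 < D x := fun x => by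
    rcases (G.height_nonneg ε x).eq_or_lt with h | h
    · have : κ x = 1 := Real.smoothTransition.one_of_one_le (by rw [← h, sub_zero])
      change 0 < G.height ε x + κ x
      rw [← h, this]; norm_num
    · exact add_pos_of_pos_of_nonneg h (Real.smoothTransition.nonneg _)
  have hDs : ContDiffOn ℝ ∞ D G.X := (G.height_smooth hε).add hκs
  let f : L → E → ℝ := fun v x => G.bump ε v x + if v = 0 then κ x else 0
  have hlf : LocFin G.X f := fun x hx => by
    obtain ⟨t, ht⟩ := G.bump_locFin hε x hx
    refine ⟨insert 0 t, ht.mono fun y hy v hv => ?_⟩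
    rw [Finset.mem_insert, not_or] at hv
    change G.bump ε v y + (if v = 0 then κ y else 0) = 0
    rw [hy v hv.2, if_neg hv.1, add_zero]
  have hsum : ∀ x ∈ G.X, ∑ᶠ v, f v x = D x := fun x hx => by
    have h2 : (Function.support fun v : L => if v = 0 then κ x else 0).Finite :=
      (finite_singleton (0 : L)).subset fun v hv => by
        by_contra h
        exact hv (if_neg h)
    have h1 := finsum_add_distrib ((G.bump_locFin hε).finite hx) h2
    refine h1.trans ?_
    rw [finsum_eq_single _ (0 : L) fun v hv => if_neg hv, if_pos rfl]
    rfl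
  refine ⟨fun v x => f v x * (D x)⁻¹, ⟨fun v => ?_, fun x hx => ?_, fun x hx => ?_,
    fun v x hx hv => ?_⟩, fun x hx v hv h => ?_⟩
  · refine ContDiffOn.mul ((G.bump_smooth ε v).add ?_) (hDs.inv fun x _ => (hD x).ne')
    by_cases hv : v = 0
    · simpa [hv] using hκs
    · simpa [hv] using contDiffOn_const
  · obtain ⟨t, ht⟩ := hlf x hx
    exact ⟨t, ht.mono fun y hy v hv => by rw [hy v hv, zero_mul]⟩
  · rw [← finsum_mul, hsum x hx, mul_inv_cancel₀ (hD x).ne']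
  · have hv0 : v ≠ 0 := by
      rintro rfl
      exact hv (by simpa [V, G.q_zero hx] using hε)
    have h1 : ∀ᶠ y in 𝓝 x, ε / 2 < G.q v y :=
      ((G.q_smooth v).continuousOn.continuousAt (G.isOpen.mem_nhds hx)).eventually_const_lt
        (lt_of_lt_of_le (half_lt_self hε) (not_lt.1 hv))
    filter_upwards [h1] with y hy
    change (G.bump ε v y + (if v = 0 then κ y else 0)) * (D y)⁻¹ = 0
    rw [G.bump_of_ne hv0, cut_eq_zero hε hy.le, if_neg hv0, add_zero, zero_mul]
  · have h1 : κ x = 0 := Real.smoothTransition.zero_of_nonpos (by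
      have := G.one_le_height hε hx hv h.le
      linarith)
    change (G.bump ε 0 x + (if (0 : L) = 0 then κ x else 0)) * (D x)⁻¹ = 0
    rw [bump, if_pos rfl, if_pos rfl, h1, add_zero, zero_mul]

end

end ReductionData

end

section

open Set Filter Topology
open scoped ContDiff

namespace ReductionData

variable {Γ L E : Type} [Group Γ] [AddCommGroup L] [DistribMulAction Γ L]
  [NormedAddCommGroup E] [NormedSpace ℝ E] (G : ReductionData Γ L E) [FiniteDimensional ℝ E]

theorem le_q_of_height [IsAddTorsionFree L] (M : ℕ) : ∃ ε > 0, ∀ x ∈ G.X, G.height 1 x < M + 1 →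
    ∀ v, v ≠ 0 → ε ≤ G.q v x := by
  refine ⟨1 / (4 * (M + 1) ^ 2), by positivity, fun x hx hM v hv => ?_⟩
  by_contra! h
  refine hM.not_ge ?_
  have hinj : Function.Injective fun k : ℕ => k • v := fun a b hab => by
    by_contra hne
    have h1 : (a : ℤ) • v = (b : ℤ) • v := by simpa using hab
    exact hne (by exact_mod_cast smul_left_injective ℤ hv h1)
  let t : Finset L := (Finset.Icc 1 (M + 1)).map ⟨_, hinj⟩
  have h1 : ∀ w ∈ t, G.bump 1 w x = 1 := by
    intro w hw
    obtain ⟨k, hk, rfl⟩ := Finset.mem_map.1 hw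
    rw [Finset.mem_Icc] at hk
    have hk0 : k • v ≠ 0 := smul_ne_zero (by omega) hv
    refine (G.bump_of_ne hk0 x).trans (cut_eq_one one_pos ?_)
    rw [G.q_nsmul k v x hx]
    have h2 : (0 : ℝ) < 4 * (M + 1) ^ 2 := by positivity
    rw [lt_div_iff₀ h2] at h
    have h3 : (k : ℝ) ^ 2 ≤ (M + 1) ^ 2 := by
      have : (k : ℝ) ≤ M + 1 := by exact_mod_cast hk.2
      gcongr
    rcases le_total 0 (G.q v x) with h4 | h4
    · nlinarith
    · nlinarith [sq_nonneg (k : ℝ)]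
  have hfin := (G.bump_locFin one_pos).finite hx
  have h5 : ∑ w ∈ t, G.bump 1 w x = M + 1 := by
    rw [Finset.sum_congr rfl h1]
    simp [t]
  unfold height
  rw [finsum_eq_sum_of_support_subset (s := hfin.toFinset) _ (by simp [Function.support]), ← h5]
  refine Finset.sum_le_sum_of_subset_of_nonneg (fun w hw => ?_) fun w _ _ => G.bump_nonneg _ _ _
  simp [h1 w hw]

theorem height_bound {ε : ℝ} (hε : 0 < ε) : ∃ M : ℕ, ∀ x ∈ G.X, (∀ v, v ≠ 0 → ε ≤ G.q v x) →
    G.height 1 x ≤ M := by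
  obtain ⟨K, hK, hKX, h⟩ := G.mahler ε hε
  obtain ⟨B, hB⟩ := (hK.image_of_continuousOn
    ((G.height_smooth one_pos).continuousOn.mono hKX)).bddAbove
  obtain ⟨M, hM⟩ := exists_nat_ge B
  refine ⟨M, fun x hx hv => ?_⟩
  obtain ⟨g, hg⟩ := h x hx hv
  rw [← G.height_act g hx]
  exact (hB ⟨_, hg, rfl⟩).trans hM

/-- A bump function adapted to height `k`. -/
theorem exists_bump {K : Set E} (hK : IsCompact K) (hKX : K ⊆ G.X) : ∃ (β : E → ℝ) (C : Set E),
    IsCompact C ∧ C ⊆ G.X ∧ ContDiff ℝ ∞ β ∧ (∀ x, 0 ≤ β x) ∧ (∀ x ∈ K, 0 < β x) ∧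
      ∀ x ∉ C, β x = 0 := by
  have : ProperSpace E := FiniteDimensional.proper ℝ E
  obtain ⟨C, hC, hKC, hCX⟩ := exists_compact_between hK G.isOpen hKX
  obtain ⟨f, hf, hfs, hfr⟩ := (isOpen_interior (s := C)).exists_contDiff_support_eq (n := ⊤)
  have h0 : ∀ x, 0 ≤ f x := fun x => (hfr ⟨x, rfl⟩).1
  refine ⟨f, C, hC, hCX, hfs, h0, fun x hx => (h0 x).lt_of_ne ?_, fun x hx => ?_⟩
  · have : x ∈ f.support := hf ▸ hKC hx
    exact (Ne.symm this)
  · by_contra h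
    have : x ∈ f.support := h
    rw [hf] at this
    exact hx (interior_subset this)

/-- A partition of unity consisting of the translates of one function with controlled support. -/
theorem exists_translates [IsAddTorsionFree L] : ∃ φ : E → ℝ,
    SmoothPart G.X (fun _ : Γ => univ) (fun g x => φ (G.act g⁻¹ x)) ∧
    ∀ ε > 0, ∃ K, IsCompact K ∧ K ⊆ G.X ∧
      ∀ x ∈ G.X, (∀ v, v ≠ 0 → ε ≤ G.q v x) → x ∉ K → φ x = 0 := by
  have hk : ∀ k : ℕ, ∃ (β : E → ℝ) (C : Set E), IsCompact C ∧ C ⊆ G.X ∧ ContDiff ℝ ∞ β ∧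
      (∀ x, 0 ≤ β x) ∧ (∀ x ∈ G.X, G.height 1 x < k + 1 → ∃ g, 0 < β (G.act g x)) ∧
      ∀ x ∉ C, β x = 0 := fun k => by
    obtain ⟨ε, hε, h1⟩ := G.le_q_of_height k
    obtain ⟨K, hK, hKX, h2⟩ := G.mahler ε hε
    obtain ⟨β, C, hC, hCX, hβ, hβ0, hβK, hβC⟩ := G.exists_bump hK hKX
    refine ⟨β, C, hC, hCX, hβ, hβ0, fun x hx h => ?_, hβC⟩
    obtain ⟨g, hg⟩ := h2 x hx (h1 x hx h)
    exact ⟨g, hβK _ hg⟩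
  choose β C hC hCX hβ hβ0 hβK hβC using hk
  let u := G.height 1
  have hu : ContDiffOn ℝ ∞ u G.X := G.height_smooth one_pos
  let η : ℕ → ℝ → ℝ := fun k t =>
    Real.smoothTransition (t - k + 1) * Real.smoothTransition (k + 1 - t)
  have hη0 : ∀ k t, 0 ≤ η k t := fun k t =>
    mul_nonneg (Real.smoothTransition.nonneg _) (Real.smoothTransition.nonneg _)
  have hηs : ∀ k, ContDiff ℝ ∞ (η k) := fun k =>
    (Real.smoothTransition.contDiff.comp ((contDiff_id.sub contDiff_const).add contDiff_const)).mul
      (Real.smoothTransition.contDiff.comp (contDiff_const.sub contDiff_id))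
  have hη1 : ∀ (k : ℕ) (t : ℝ), t + 1 ≤ k → η k t = 0 := fun k t h => by
    have : Real.smoothTransition (t - k + 1) = 0 :=
      Real.smoothTransition.zero_of_nonpos (by linarith)
    simp only [η, this, zero_mul]
  have hη2 : ∀ t, 0 ≤ t → 0 < η ⌊t⌋₊ t := fun t ht =>
    mul_pos (Real.smoothTransition.pos_of_pos (by linarith [Nat.floor_le ht]))
      (Real.smoothTransition.pos_of_pos (by linarith [Nat.lt_floor_add_one t]))
  let h : ℕ → E → ℝ := fun k x => η k (u x) * β k x
  have hh0 : ∀ k x, 0 ≤ h k x := fun k x => mul_nonneg (hη0 _ _) (hβ0 _ _)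
  have hhM : ∀ M k : ℕ, ∀ x, u x ≤ M → M + 1 ≤ k → h k x = 0 := fun M k x hM hk => by
    have h1 : (M : ℝ) + 1 ≤ k := by exact_mod_cast hk
    simp only [h, hη1 k (u x) (by linarith), zero_mul]
  have hub : ∀ x ∈ G.X, ∃ M : ℕ, ∀ᶠ y in 𝓝 x, u y ≤ M := fun x hx => by
    obtain ⟨M, hM⟩ := exists_nat_gt (u x)
    exact ⟨M, ((hu.continuousOn.continuousAt (G.isOpen.mem_nhds hx)).eventually_lt_const hM).mono
      fun y hy => hy.le⟩
  have hlf : LocFin G.X h := fun x hx => by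
    obtain ⟨M, hM⟩ := hub x hx
    exact ⟨Finset.range (M + 1), hM.mono fun y hy k hk => hhM M k y hy (by simpa using hk)⟩
  let f : E → ℝ := fun x => ∑ᶠ k, h k x
  have hf0 : ∀ x, 0 ≤ f x := fun x => finsum_nonneg fun k => hh0 k x
  have hfs : ContDiffOn ℝ ∞ f G.X := hlf.contDiffOn G.isOpen subset_rfl fun k =>
    ((hηs k).comp_contDiffOn hu).mul (hβ k).contDiffOn
  have hfC : ∀ (M : ℕ) x, u x ≤ M → x ∉ ⋃ k ∈ Finset.range (M + 1), C k → f x = 0 := by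
    intro M x hM hx
    refine (finsum_congr fun k => ?_).trans finsum_zero
    by_cases hk : M + 1 ≤ k
    · exact hhM M k x hM hk
    · have : x ∉ C k := fun h => hx (mem_biUnion (by simpa using hk) h)
      simp only [h, hβC k x this, mul_zero]
  have hCM : ∀ M : ℕ, IsCompact (⋃ k ∈ Finset.range (M + 1), C k) := fun M =>
    (Finset.range (M + 1)).isCompact_biUnion fun k _ => hC k
  have hCMX : ∀ M : ℕ, (⋃ k ∈ Finset.range (M + 1), C k) ⊆ G.X := fun M =>
    iUnion₂_subset fun k _ => hCX k
  have hlfΓ : LocFin G.X fun (g : Γ) x => f (G.act g⁻¹ x) := fun x hx => by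
    obtain ⟨M, hM⟩ := hub x hx
    obtain ⟨B, hB, hBc, hBX⟩ := G.exists_compact_nhds hx
    have hfin := G.proper _ (hBc.union (hCM M)) (union_subset hBX (hCMX M))
    refine ⟨(hfin.image (·⁻¹)).toFinset, ?_⟩
    filter_upwards [hB, hM] with y hy hyM g hg
    refine hfC M _ (by rw [show u (G.act g⁻¹ y) = u y from G.height_act _ (hBX hy)]; exact hyM)
      fun hgy => hg ?_
    rw [Finite.mem_toFinset]
    exact ⟨g⁻¹, ⟨y, Or.inl hy, Or.inr hgy⟩, inv_inv g⟩
  let Φ : E → ℝ := fun x => ∑ᶠ g : Γ, f (G.act g⁻¹ x)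
  have hΦs : ContDiffOn ℝ ∞ Φ G.X := hlfΓ.contDiffOn G.isOpen subset_rfl fun g =>
    hfs.comp (G.act_smooth _) (G.act_mem _)
  have hΦ0 : ∀ x ∈ G.X, 0 < Φ x := fun x hx => by
    have hu0 : 0 ≤ u x := G.height_nonneg 1 x
    obtain ⟨g, hg⟩ := hβK ⌊u x⌋₊ x hx (Nat.lt_floor_add_one _)
    have hgX := G.act_mem g hx
    have h1 : 0 < h ⌊u x⌋₊ (G.act g x) := by
      refine mul_pos ?_ hg
      rw [show u (G.act g x) = u x from G.height_act _ hx]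
      exact hη2 _ hu0
    have h2 : 0 < f (G.act g x) :=
      h1.trans_le (single_le_finsum _ (hlf.finite hgX) fun k => hh0 k _)
    have h3 : f (G.act g x) ≤ Φ x := by
      have := single_le_finsum g⁻¹ (hlfΓ.finite hx) fun k => hf0 _
      simpa using this
    exact h2.trans_le h3
  have hΦact : ∀ g, ∀ x ∈ G.X, Φ (G.act g x) = Φ x := fun g x hx => by
    change ∑ᶠ k : Γ, f (G.act k⁻¹ (G.act g x)) = ∑ᶠ k : Γ, f (G.act k⁻¹ x)
    rw [← finsum_comp_equiv (Equiv.mulLeft g)]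
    refine finsum_congr fun k => ?_
    rw [← G.act_mul _ _ _ hx]
    simp
  refine ⟨fun x => f x * (Φ x)⁻¹, ⟨fun g => ?_, fun x hx => ?_, fun x hx => ?_,
    fun g x _ hg => absurd (mem_univ x) hg⟩, fun ε hε => ?_⟩
  · exact (hfs.mul (hΦs.inv fun x hx => (hΦ0 x hx).ne')).comp (G.act_smooth _) (G.act_mem _)
  · obtain ⟨t, ht⟩ := hlfΓ x hx
    exact ⟨t, ht.mono fun y hy g hg => by
      have h1 : f (G.act g⁻¹ y) = 0 := hy g hg
      change f (G.act g⁻¹ y) * _ = 0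
      rw [h1, zero_mul]⟩
  · change ∑ᶠ g : Γ, f (G.act g⁻¹ x) * (Φ (G.act g⁻¹ x))⁻¹ = 1
    rw [finsum_congr fun g : Γ => by rw [hΦact g⁻¹ x hx], ← finsum_mul]
    exact mul_inv_cancel₀ (hΦ0 x hx).ne'
  · obtain ⟨M, hM⟩ := G.height_bound hε
    refine ⟨_, hCM M, hCMX M, fun x hx hv hxC => ?_⟩
    change f x * _ = 0
    rw [hfC M x (hM x hx hv) hxC, zero_mul]

end ReductionData

end

section

open Set Filter Topology
open scoped ContDiff

theorem apt_map {S T A : Type*} [AddCommGroup A] (f : S → T) (ps : List (S × S))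
    (c : List T → A) : apt (ps.map (Prod.map f f)) c = apt ps fun l => c (l.map f) := by
  induction ps generalizing c with
  | nil => rfl
  | cons p ps ih => rw [List.map_cons, apt, apt, ih, ih]; rfl

theorem apt_smul {S : Type*} (ps : List (S × S)) (r : ℝ) (c : List S → ℝ) :
    apt ps (fun l => r * c l) = r * apt ps c := by
  induction ps generalizing c with
  | nil => rfl
  | cons p ps ih => rw [apt, apt, ih, ih, mul_sub]

namespace ReductionData

variable {Γ L E : Type} [Group Γ] [AddCommGroup L] [DistribMulAction Γ L]
  [NormedAddCommGroup E] [NormedSpace ℝ E] (G : ReductionData Γ L E) {q : ℕ}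

/-- Translation of forms by a group element, scaled by `r`. -/
noncomputable def tr (r : ℝ) (g : Γ) :
    (E → E [⋀^Fin q]→L[ℝ] ℝ) →ₗ[ℝ] (E → E [⋀^Fin q]→L[ℝ] ℝ) where
  toFun w := r • pull G.X (G.act g⁻¹) w
  map_add' v w := by rw [pull_add, smul_add]
  map_smul' a w := by rw [pull_smul, smul_comm]; rfl

variable {G}

theorem tr_apply (r : ℝ) (g : Γ) (w : E → E [⋀^Fin q]→L[ℝ] ℝ) (x : E) :
    G.tr r g w x = r • pull G.X (G.act g⁻¹) w x := rfl

theorem tr_smooth {r : ℝ} {g : Γ} {w : E → E [⋀^Fin q]→L[ℝ] ℝ} {U V : Set E} (hU : U ⊆ G.X)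
    (hUV : MapsTo (G.act g⁻¹) U V) (hw : ContDiffOn ℝ ∞ w V) : ContDiffOn ℝ ∞ (G.tr r g w) U :=
  (contDiffOn_pull G.isOpen (G.act_smooth g⁻¹) hU hUV hw).const_smul r

theorem extDeriv_tr {r : ℝ} {g : Γ} {w : E → E [⋀^Fin q]→L[ℝ] ℝ} {x : E} (hx : x ∈ G.X)
    (hw : DifferentiableAt ℝ w (G.act g⁻¹ x)) :
    extDeriv (G.tr r g w) x = G.tr r g (extDeriv w) x := by
  refine (extDeriv_const_smul' r _ x).trans ?_
  rw [extDeriv_pull G.isOpen (G.act_smooth _) hx hw]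
  rfl

theorem tr_eq_zero {r : ℝ} {g : Γ} {w : E → E [⋀^Fin q]→L[ℝ] ℝ} {x : E}
    (hw : w (G.act g⁻¹ x) = 0) : G.tr r g w x = 0 := by
  rw [tr_apply, pull_eq_zero hw, smul_zero]

theorem tr_congr {r : ℝ} {g : Γ} {v w : E → E [⋀^Fin q]→L[ℝ] ℝ} {x : E}
    (hw : v (G.act g⁻¹ x) = w (G.act g⁻¹ x)) : G.tr r g v x = G.tr r g w x := by
  rw [← sub_eq_zero]
  have h := map_sub (G.tr (q := q) r g) v w
  have h2 : G.tr r g (v - w) x = 0 := tr_eq_zero (by simp [hw])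
  rw [h] at h2
  exact h2

theorem tr_zero_apply (r : ℝ) (g : Γ) (w : E → E [⋀^Fin 0]→L[ℝ] ℝ) {x : E} (hx : x ∈ G.X) :
    G.tr r g w x 0 = r * w (G.act g⁻¹ x) 0 := by
  rw [tr_apply, pull_apply hx]
  simp only [ContinuousAlternatingMap.smul_apply, smul_eq_mul,
    ContinuousAlternatingMap.compContinuousLinearMap_apply]
  congr 2
  exact Subsingleton.elim _ _

theorem tr_tr {r s : ℝ} {g h : Γ} (w : E → E [⋀^Fin q]→L[ℝ] ℝ) :
    G.tr r g (G.tr s h w) = G.tr (r * s) (g * h) w := by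
  change r • pull G.X (G.act g⁻¹) (s • pull G.X (G.act h⁻¹) w) =
    (r * s) • pull G.X (G.act (g * h)⁻¹) w
  rw [pull_smul, smul_smul, pull_pull G.isOpen G.isOpen (G.act_smooth _) (G.act_smooth _)
    (G.act_mem _) (h := G.act (g * h)⁻¹) fun x hx => by rw [mul_inv_rev, G.act_mul _ _ x hx]]

theorem tr_one {w : E → E [⋀^Fin q]→L[ℝ] ℝ} {x : E} (hx : x ∈ G.X) : G.tr 1 1 w x = w x := by
  classical
  let v : E → E [⋀^Fin q]→L[ℝ] ℝ := fun x => if x ∈ G.X then w x else 0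
  have h1 : v x = w x := if_pos hx
  have h2 : v (G.act 1⁻¹ x) = w (G.act 1⁻¹ x) := if_pos (G.act_mem _ hx)
  rw [← tr_congr h2, ← h1, tr_apply, one_smul, pull_id G.isOpen (fun y hy => by
    rw [inv_one, G.act_one y hy]) fun y hy => if_neg hy]

/-- Translation of cochains of forms. -/
noncomputable def trC (r : ℝ) (g : Γ) {S : Type} [SMul Γ S]
    (x : List S → E → E [⋀^Fin q]→L[ℝ] ℝ) : List S → E → E [⋀^Fin q]→L[ℝ] ℝ :=
  fun l => G.tr r g (x (l.map (g⁻¹ • ·)))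

theorem cob_trC (r : ℝ) (g : Γ) {S : Type} [SMul Γ S] (x : List S → E → E [⋀^Fin q]→L[ℝ] ℝ) :
    cob (G.trC r g x) = G.trC r g (cob x) := by
  funext l
  unfold trC
  have h := map_cob (G.tr (q := q) r g).toAddMonoidHom (fun t => x (t.map (g⁻¹ • ·))) l
  refine h.symm.trans ?_
  change G.tr r g _ = _
  rw [← cob_map]

variable (G)

/-- The part of the space where some vector is short. -/
def N (ε : ℝ) : Set E := {x | x ∈ G.X ∧ ∃ v : L, v ≠ 0 ∧ G.q v x < ε}

variable {G}

theorem N_mono {ε δ : ℝ} (h : ε ≤ δ) : G.N ε ⊆ G.N δ := fun _ hx =>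
  ⟨hx.1, hx.2.imp fun _ hv => ⟨hv.1, hv.2.trans_le h⟩⟩

theorem act_mem_N {ε : ℝ} (g : Γ) {x : E} (hx : x ∈ G.N ε) : G.act g x ∈ G.N ε := by
  obtain ⟨hX, v, hv, h⟩ := hx
  exact ⟨G.act_mem g hX, g • v, fun h => hv ((smul_eq_zero_iff_eq g).1 h), by rwa [G.q_act g v x hX]⟩

theorem isOpen_N (ε : ℝ) : IsOpen (G.N ε) := by
  have : G.N ε = ⋃ (v : L) (_ : v ≠ 0), G.X ∩ G.V ε v := by
    ext x; simp only [N, V, mem_iUnion, mem_inter_iff, exists_prop]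
    constructor
    · rintro ⟨h1, v, h2, h3⟩; exact ⟨v, h2, h1, h3⟩
    · rintro ⟨v, h2, h1, h3⟩; exact ⟨h1, v, h2, h3⟩
  rw [this]
  exact isOpen_iUnion fun v => isOpen_iUnion fun _ => G.isOpen_V ε v

theorem inter_subset_N {ε : ℝ} {v : L} {l : List L} (hv : v ≠ 0) :
    inter G.X (G.V ε) (v :: l) ⊆ G.N ε := fun _ hx =>
  ⟨hx.1, v, hv, hx.2 v List.mem_cons_self⟩

theorem act_mem_inter {ε : ℝ} (g : Γ) {x : E} {l : List L} (hx : x ∈ inter G.X (G.V ε) l) :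
    G.act g x ∈ inter G.X (G.V ε) (l.map (g • ·)) := by
  refine ⟨G.act_mem g hx.1, fun s hs => ?_⟩
  obtain ⟨v, hv, rfl⟩ := List.mem_map.1 hs
  change G.q _ _ < ε
  rw [G.q_act g v x hx.1]
  exact hx.2 v hv

variable (G)

/-- The combinatorial input: acyclicity of the complex of isotropic lists in low degrees. -/
structure TitsData (n : ℕ) (χ : Γ → ℝ) (Frame : List (L × L) → Prop) : Prop where
  acyclic : ∀ j ≤ n, ∀ c : List L → ℝ,
    (∀ l : List L, (∀ s ∈ l, s ≠ 0) → l.Pairwise G.orth → l.length = j + 1 → cob c l = 0) →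
    (j = n → ∀ ps, Frame ps → apt ps c = 0) →
    ∃ b : List L → ℝ, ∀ l : List L, (∀ s ∈ l, s ≠ 0) → l.Pairwise G.orth → l.length = j →
      cob b l = c l
  swap : ∀ ps, Frame ps → ∃ p qs, ps = p :: qs ∧ qs.length + 1 = n ∧ p.1 ≠ 0 ∧ p.2 ≠ 0 ∧
    (∀ l, Transversal qs l → (∀ v ∈ l, v ≠ 0) ∧ (p.1 :: -p.1 :: l).Pairwise G.orth ∧
      (p.2 :: l).Pairwise G.orth) ∧
    ∃ g, 0 < χ g ∧ g • p.1 = p.2 ∧ g • p.2 = -p.1 ∧ ∀ r ∈ qs, g • r.1 = r.1 ∧ g • r.2 = r.2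

/-- Cochains of forms on intersections of sublevel sets which vanish where some vector is short. -/
def PV (ε δ : ℝ) (p q : ℕ) (x : List L → E → E [⋀^Fin q]→L[ℝ] ℝ) : Prop :=
  (∀ l : List L, l.length = p → ContDiffOn ℝ ∞ (x l) (inter G.X (G.V ε) l)) ∧
  ∀ l : List L, l.length = p → (∀ v ∈ l, v ≠ 0) → ∀ e ∈ inter G.X (G.V ε) l, e ∈ G.N δ → x l e = 0

variable {G}

theorem PV.cob {ε δ : ℝ} {p : ℕ} {x : List L → E → E [⋀^Fin q]→L[ℝ] ℝ} (hx : G.PV ε δ p q x) :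
    G.PV ε δ (p + 1) q (cob x) := by
  refine ⟨fun l hl => contDiffOn_cob fun t ht htl =>
    (hx.1 t (by omega)).mono (inter_anti _ _ ht), fun l hl hv e he heN => ?_⟩
  rw [cob_apply', cob_congr (c' := fun _ => 0) fun t ht htl =>
    hx.2 t (by omega) (fun v h => hv v (ht.subset h)) e (inter_anti _ _ ht he) heN]
  exact cob_zero l

theorem PV.sub {ε δ : ℝ} {p : ℕ} {x y : List L → E → E [⋀^Fin q]→L[ℝ] ℝ} (hx : G.PV ε δ p q x)
    (hy : G.PV ε δ p q y) : G.PV ε δ p q fun l e => x l e - y l e :=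
  ⟨fun l hl => (hx.1 l hl).sub (hy.1 l hl), fun l hl hv e he heN => by
    dsimp only
    rw [hx.2 l hl hv e he heN, hy.2 l hl hv e he heN, sub_zero]⟩

theorem PV.mono {ε δ δ' : ℝ} (h : δ' ≤ δ) {p : ℕ} {x : List L → E → E [⋀^Fin q]→L[ℝ] ℝ}
    (hx : G.PV ε δ p q x) : G.PV ε δ' p q x :=
  ⟨hx.1, fun l hl hv e he heN => hx.2 l hl hv e he (N_mono h heN)⟩

theorem isOpen_inter (ε : ℝ) (l : List L) : IsOpen (inter G.X (G.V ε) l) :=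
  isOpen_inter' G.isOpen (G.isOpen_V ε) l

theorem PV.trC {ε δ : ℝ} {p : ℕ} {x : List L → E → E [⋀^Fin q]→L[ℝ] ℝ} (hx : G.PV ε δ p q x)
    (r : ℝ) (g : Γ) : G.PV ε δ p q (G.trC r g x) := by
  refine ⟨fun l hl => tr_smooth (inter_subset _ _ _) (fun e he => act_mem_inter _ he)
    (hx.1 _ (by simpa using hl)), fun l hl hv e he heN => tr_eq_zero ?_⟩
  refine hx.2 _ (by simpa using hl) (fun v h => ?_) _ (act_mem_inter _ he) (act_mem_N _ heN)
  obtain ⟨u, hu, rfl⟩ := List.mem_map.1 h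
  exact fun h => hv u hu ((smul_eq_zero_iff_eq _).1 h)

variable (G) in
open Classical in
theorem descent_PV (ε : ℝ) [FiniteDimensional ℝ E] :
    Descent (inter G.X (G.V ε)) (G.PV ε ε) where
  isOpen := isOpen_inter ε
  anti h := inter_anti _ _ h
  smooth h := h.1
  cob h := h.cob
  sub h h' := h.sub h'
  zero := ⟨fun l _ => contDiffOn_const, fun _ _ _ _ _ _ => rfl⟩
  col := fun {p q x} hx hd => by
    have h : ∀ l : List L, l.length = p + 1 → ∃ y : E → E [⋀^Fin q]→L[ℝ] ℝ,
        ContDiffOn ℝ ∞ y (inter G.X (G.V ε) l) ∧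
        ∀ e ∈ inter G.X (G.V ε) l, extDeriv y e = x l e := fun l hl =>
      exists_primitive_of_convex (isOpen_inter ε l) (G.convex_inter ε l) (x l) (hx.1 l hl)
        fun e he => hd l hl e he
    choose y hy hyx using h
    refine ⟨fun l => if h : l.length = p + 1 ∧ ¬ ∀ v ∈ l, v ≠ 0 then y l h.1 else 0,
      ⟨fun l hl => ?_, fun l hl hv e he heN => ?_⟩, fun l hl e he => ?_⟩
    · by_cases h : ¬ ∀ v ∈ l, v ≠ 0
      · simp only [hl, true_and]
        rw [dif_pos h]; exact hy l hl
      · simp only [hl, true_and]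
        rw [dif_neg h]; exact contDiffOn_const
    · dsimp only
      rw [dif_neg fun h => h.2 hv]; rfl
    · unfold dF
      by_cases h : ¬ ∀ v ∈ l, v ≠ 0
      · simp only [hl, true_and]
        rw [dif_pos h]; exact hyx l hl e he
      · simp only [hl, true_and]
        rw [dif_neg h]
        have h' := not_not.1 h
        obtain ⟨v, l, rfl⟩ := List.exists_cons_of_length_eq_add_one hl
        rw [hx.2 _ hl h' e he (inter_subset_N (h' v List.mem_cons_self) he)]
        exact extDeriv_zero_form e

variable (G) in
theorem ascent_PV {ε : ℝ} (hε : 0 < ε) [FiniteDimensional ℝ E] :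
    Ascent (inter G.X (G.V ε)) (G.PV ε (ε / 4)) where
  smooth h := h.1
  d := fun {p q x} hx => ⟨fun l hl => contDiffOn_extDeriv (isOpen_inter ε l) (hx.1 l hl),
    fun l hl hv e he heN => by
      have h1 : IsOpen (inter G.X (G.V ε) l ∩ G.N (ε / 4)) :=
        (isOpen_inter ε l).inter (isOpen_N _)
      have := extDeriv_congr_on h1 (w := fun _ => 0)
        (fun y hy => hx.2 l hl hv y hy.1 hy.2) ⟨he, heN⟩
      exact this.trans (extDeriv_zero_form e)⟩
  sub h h' := h.sub h'
  row := fun {p q x} hx hc => by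
    obtain ⟨ψ, hψ, hψ0⟩ := G.exists_smoothPart hε
    refine ⟨rowAvg ψ x, ⟨fun l hl => hψ.rowAvg_smooth G.isOpen (G.isOpen_V ε) hx.1 l hl,
      fun l hl hv e he heN => ?_⟩, hψ.rowAvg_cob hc⟩
    refine (finsum_congr fun s => ?_).trans finsum_zero
    have heX := inter_subset _ _ _ he
    by_cases hs : s = 0
    · obtain ⟨-, v, hv, h⟩ := heN
      rw [hs, hψ0 e heX v hv h, zero_smul]
    · by_cases hse : e ∈ G.V ε s
      · rw [hx.2 (s :: l) (by simp [hl]) (by simpa [hs] using hv) e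
          (by rw [inter_cons]; exact ⟨he, hse⟩) heN, smul_zero]
      · rw [(hψ.supp s e heX hse).self_of_nhds, zero_smul]
  cover := fun e he => ⟨0, he.1, fun s hs => by
    rw [List.mem_singleton.1 hs]
    change G.q 0 e < ε
    rw [G.q_zero he.1]; exact hε⟩

theorem Linked.trC {ε : ℝ} {m : ℕ} {a : List L → E → E [⋀^Fin (m + 1)]→L[ℝ] ℝ} (r : ℝ) (g : Γ) {p : ℕ}
    {x : List L → E → E [⋀^Fin (q + 1)]→L[ℝ] ℝ}
    (h : Linked (inter G.X (G.V ε)) (G.PV ε ε) a p q x) :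
    Linked (inter G.X (G.V ε)) (G.PV ε ε) (G.trC r g a) p q (G.trC r g x) := by
  induction h with
  | base => exact .base
  | step p q x y hx hy hyx ih =>
    refine .step p q _ _ ih (hy.trC r g) fun l hl e he => ?_
    have h1 := act_mem_inter g⁻¹ he
    rw [cob_trC]
    refine (extDeriv_tr he.1 (diffAt_of_contDiffOn (isOpen_inter ε _)
      (hy.1 _ (by simpa using hl)) h1)).trans (tr_congr ?_)
    exact hyx _ (by simpa using hl) _ h1

theorem LinkedBot.trC {ε : ℝ} {m : ℕ} {a : List L → E → E [⋀^Fin (m + 1)]→L[ℝ] ℝ} (r : ℝ) (g : Γ)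
    {y : List L → E → E [⋀^Fin 0]→L[ℝ] ℝ}
    (h : LinkedBot (inter G.X (G.V ε)) (G.PV ε ε) a y) :
    LinkedBot (inter G.X (G.V ε)) (G.PV ε ε) (G.trC r g a) (G.trC r g y) := by
  obtain ⟨hy, x, hx, hyx⟩ := h
  refine ⟨hy.trC r g, _, Linked.trC r g hx, fun l hl e he => ?_⟩
  have h1 := act_mem_inter g⁻¹ he
  rw [cob_trC]
  refine (extDeriv_tr he.1 (diffAt_of_contDiffOn (isOpen_inter ε _)
    (hy.1 _ (by simpa using hl)) h1)).trans (tr_congr ?_)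
  exact hyx _ (by simpa using hl) _ h1

end ReductionData

end

section

open Set Filter Topology
open scoped ContDiff

section

variable {E : Type} [NormedAddCommGroup E] [NormedSpace ℝ E]

/-- Evaluation of forms of degree zero at a point. -/
def evZero (e : E) : (E → E [⋀^Fin 0]→L[ℝ] ℝ) →+ ℝ where
  toFun w := w e 0
  map_zero' := rfl
  map_add' _ _ := rfl

theorem zeroForm_ext {v w : E [⋀^Fin 0]→L[ℝ] ℝ} (h : v 0 = w 0) : v = w := by
  ext u
  rw [Subsingleton.elim u 0, h]

/-- Constant forms of degree zero. -/
noncomputable def constForm (r : ℝ) : E → E [⋀^Fin 0]→L[ℝ] ℝ := fun _ =>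
  ContinuousAlternatingMap.constOfIsEmpty ℝ E (Fin 0) r

theorem evZero_constForm (e : E) (r : ℝ) : evZero e (constForm r) = r := rfl

theorem extDeriv_constForm (r : ℝ) (e : E) : extDeriv (constForm (E := E) r) e = 0 := by
  have h : fderiv ℝ (constForm (E := E) r) e = 0 := fderiv_const_apply _
  rw [extDeriv, h]
  ext v
  simp [ContinuousAlternatingMap.alternatizeUncurryFin_apply]

end

namespace ReductionData

variable {Γ L E : Type} [Group Γ] [AddCommGroup L] [DistribMulAction Γ L]
  [NormedAddCommGroup E] [NormedSpace ℝ E] {G : ReductionData Γ L E} {q : ℕ}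

/-- Lists of nonzero pairwise orthogonal vectors. -/
def Iso (G : ReductionData Γ L E) (l : List L) : Prop := (∀ s ∈ l, s ≠ 0) ∧ l.Pairwise G.orth

theorem Iso.sublist {l t : List L} (h : G.Iso l) (ht : t.Sublist l) : G.Iso t :=
  ⟨fun s hs => h.1 s (ht.subset hs), h.2.sublist ht⟩

theorem TitsData.apt_eq_zero {n : ℕ} {χ : Γ → ℝ} {Frame : List (L × L) → Prop}
    (hT : G.TitsData n χ Frame) {c : List L → ℝ}
    (hc : ∀ l, G.Iso l → l.length = n + 1 → cob c l = 0)
    (hg : ∀ g, 0 < χ g → ∃ β : List L → ℝ, ∀ l, G.Iso l → l.length = n →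
      c l - (χ g)⁻¹ * c (l.map (g⁻¹ • ·)) = cob β l) (ps : List (L × L)) (hps : Frame ps) :
    apt ps c = 0 := by
  obtain ⟨p, qs, rfl, hn, hp1, hp2, hqs, g, hgχ, hgp, hgp', hgq⟩ := hT.swap ps hps
  obtain ⟨β, hβ⟩ := hg g hgχ
  have hp1' : -p.1 ≠ 0 := neg_ne_zero.2 hp1
  have hI1 : ∀ l, Transversal qs l → G.Iso (p.1 :: -p.1 :: l) := fun l hl =>
    ⟨by simpa [hp1] using (hqs l hl).1, (hqs l hl).2.1⟩
  have hI2 : ∀ l, Transversal qs l → G.Iso (p.2 :: l) := fun l hl =>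
    ⟨by simpa [hp2] using (hqs l hl).1, (hqs l hl).2.2⟩
  let F : L → ℝ := fun s => apt qs fun l => c (s :: l)
  have hA : apt (p :: qs) c = F p.1 - F p.2 := rfl
  have h1 : F p.1 - F (-p.1) = 0 := by
    change apt qs _ - apt qs _ = 0
    rw [← apt_sub, ← apt_cob qs fun u => c (p.1 :: -p.1 :: u)]
    refine apt_congr fun l hl => ?_
    have h := hc _ (hI1 l hl) (by simp [hl.length, hn])
    rw [cob_cons, cob_cons] at h
    linarith
  have h2 : F p.2 - F (-p.1) = (χ g)⁻¹ * apt (p :: qs) c := by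
    let ps' : List (L × L) := (p.2, -p.1) :: qs
    have e1 : F p.2 - F (-p.1) = apt ps' c := rfl
    have e2 : ps'.map (Prod.map (g⁻¹ • ·) (g⁻¹ • ·)) = p :: qs := by
      rw [List.map_cons]
      congr 1
      · ext
        · exact inv_smul_eq_iff.2 hgp.symm
        · exact inv_smul_eq_iff.2 hgp'.symm
      · refine (List.map_congr_left (g := id) fun r hr => ?_).trans (List.map_id qs)
        ext
        · exact inv_smul_eq_iff.2 (hgq r hr).1.symm
        · exact inv_smul_eq_iff.2 (hgq r hr).2.symm
    rw [e1, ← e2, apt_map, ← apt_smul, ← sub_eq_zero, ← apt_sub, ← apt_cob ps' β]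
    refine apt_congr fun l hl => hβ l ?_ ?_
    · have hl' : Transversal ((p.2, -p.1) :: qs) l := hl
      cases hl' with
      | fst _ h => exact hI2 _ h
      | snd _ h => exact (hI1 _ h).sublist (List.sublist_cons_self _ _)
    · rw [hl.length]; exact hn
  have h3 : 0 < (χ g)⁻¹ := inv_pos.2 hgχ
  have h4 : (1 + (χ g)⁻¹) * apt (p :: qs) c = 0 := by
    rw [add_mul, one_mul, ← h2, hA]; linarith
  exact (mul_eq_zero.1 h4).resolve_left (by positivity)

theorem N_nonempty [Nontrivial L] {ε : ℝ} (hε : 0 < ε) : (G.N ε).Nonempty := by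
  obtain ⟨v, hv⟩ := exists_ne (0 : L)
  obtain ⟨x, hx, h⟩ := G.exists_short [v] (by simpa using hv) (List.pairwise_singleton _ _) ε hε
  exact ⟨x, hx, v, hv, h v List.mem_cons_self⟩

theorem zeroForm_eq_zero [Nontrivial L] {ε : ℝ} (hε : 0 < ε) {w : E → E [⋀^Fin 0]→L[ℝ] ℝ}
    (hw : ContDiffOn ℝ ∞ w G.X) (hd : ∀ x ∈ G.X, extDeriv w x = 0) (h0 : ∀ x ∈ G.N ε, w x = 0)
    {x : E} (hx : x ∈ G.X) : w x = 0 := by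
  obtain ⟨y, hy⟩ := N_nonempty (G := G) hε
  rw [const_of_extDeriv_zero G.isOpen G.convex hw hd hx hy.1, h0 y hy]

theorem iso_of_mem {ε : ℝ} (hε1 : ε ≤ 1) {l : List L} (hl : ∀ s ∈ l, s ≠ 0) {e : E}
    (he : e ∈ inter G.X (G.V ε) l) : G.Iso l := by
  refine ⟨hl, List.pairwise_iff_forall_sublist.2 fun {a b} hab => ?_⟩
  have ha : a ∈ l := hab.subset List.mem_cons_self
  have hb : b ∈ l := hab.subset (List.mem_cons_of_mem _ List.mem_cons_self)
  exact G.orth_of_short a b (hl a ha) (hl b hb) e he.1 ((he.2 a ha).trans_le hε1)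
    ((he.2 b hb).trans_le hε1)

theorem zero_mem_V {ε : ℝ} (hε : 0 < ε) {l : List L} {e : E} (he : e ∈ inter G.X (G.V ε) l) :
    e ∈ inter G.X (G.V ε) (0 :: l) := by
  rw [inter_cons]
  refine ⟨he, ?_⟩
  change G.q 0 e < ε
  rw [G.q_zero he.1]
  exact hε

open Classical in
/-- The locally constant values of a closed cochain of functions. -/
noncomputable def val (G : ReductionData Γ L E) (ε : ℝ)
    (z : List L → E → E [⋀^Fin 0]→L[ℝ] ℝ) (l : List L) : ℝ :=
  if h : (inter G.X (G.V ε) l).Nonempty then evZero h.some (z l) else 0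

theorem val_eq {ε : ℝ} {z : List L → E → E [⋀^Fin 0]→L[ℝ] ℝ} {l : List L}
    (hz : ContDiffOn ℝ ∞ (z l) (inter G.X (G.V ε) l))
    (hd : ∀ e ∈ inter G.X (G.V ε) l, extDeriv (z l) e = 0) {e : E}
    (he : e ∈ inter G.X (G.V ε) l) : G.val ε z l = evZero e (z l) := by
  have h : (inter G.X (G.V ε) l).Nonempty := ⟨e, he⟩
  rw [val, dif_pos h]
  change z l _ 0 = z l e 0
  rw [const_of_extDeriv_zero (isOpen_inter ε l) (G.convex_inter ε l) hz hd h.some_mem he]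

theorem exists_primitive_vanishing [FiniteDimensional ℝ E] {n : ℕ} {χ : Γ → ℝ} {Frame : List (L × L) → Prop}
    (hT : G.TitsData n χ Frame) {ε : ℝ} (hε : 0 < ε) (hε1 : ε ≤ 1) {m : ℕ} (hm : m + 1 ≤ n)
    {w : E → E [⋀^Fin (m + 1)]→L[ℝ] ℝ} (hw : ContDiffOn ℝ ∞ w G.X)
    (hd : ∀ x ∈ G.X, extDeriv w x = 0) (h0 : ∀ x ∈ G.N ε, w x = 0)
    (hinv : m + 1 = n → ∀ g, 0 < χ g → ∀ x ∈ G.X, G.tr (χ g)⁻¹ g w x = w x) :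
    ∃ η : E → E [⋀^Fin m]→L[ℝ] ℝ, ContDiffOn ℝ ∞ η G.X ∧ (∀ x ∈ G.N (ε / 4), η x = 0) ∧
      ∀ x ∈ G.X, extDeriv η x = w x := by
  have hP := G.descent_PV ε
  have hP' := G.ascent_PV hε
  let W := inter G.X (G.V ε)
  let a : List L → E → E [⋀^Fin (m + 1)]→L[ℝ] ℝ := fun _ => w
  have ha : G.PV ε ε 0 (m + 1) a := ⟨fun l _ => hw.mono (inter_subset _ _ _),
    fun l _ _ e _ he => h0 e he⟩
  obtain ⟨y, hy⟩ := LinkedBot.exists hP ha fun l _ e he => hd e (inter_subset _ _ _ he)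
  have hyd := hy.closed hP
  have hyP := hP.cob hy.1
  let c := G.val ε (cob y)
  have hc : ∀ l : List L, l.length = m + 2 → ∀ e ∈ W l, c l = evZero e (cob y l) :=
    fun l hl e he => val_eq (hyP.1 l hl) (hyd l hl) he
  have hcc : ∀ l : List L, l.length = m + 3 → ∀ e ∈ W l, cob c l = 0 := fun l hl e he => by
    rw [cob_congr (c' := fun t => evZero e (cob y t)) fun t ht htl =>
      hc t (by omega) e (inter_anti _ _ ht he), ← map_cob, cob_cob, map_zero]
  have hc0 : ∀ l : List L, l.length = m + 2 → (∀ s ∈ l, s ≠ 0) → ∀ e ∈ W l, c l = 0 :=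
    fun l hl hs e he => by
      rw [hc l hl e he]
      obtain ⟨v, l, rfl⟩ := List.exists_cons_of_length_eq_add_one hl
      have h := hyP.2 _ hl hs e he (inter_subset_N (hs v List.mem_cons_self) he)
      change (cob y (v :: l) e) 0 = 0
      rw [h]; rfl
  have hne : ∀ l, G.Iso l → ∃ e, e ∈ W l := fun l hl => by
    obtain ⟨e, he, h⟩ := G.exists_short l hl.1 hl.2 ε hε
    exact ⟨e, he, h⟩
  let cs : List L → ℝ := fun l => c (0 :: l)
  have hcs : ∀ l, G.Iso l → l.length = m + 2 → cob cs l = 0 := fun l hl hlm => by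
    obtain ⟨e, he⟩ := hne l hl
    have := hcc (0 :: l) (by simp [hlm]) e (zero_mem_V hε he)
    rwa [cob_cons, hc0 l hlm hl.1 e he, zero_sub, neg_eq_zero] at this
  have hapt : m + 1 = n → ∀ ps, Frame ps → apt ps cs = 0 := by
    intro hmn
    subst hmn
    refine hT.apt_eq_zero hcs fun g hg => ?_
    have hya := LinkedBot.trC (χ g)⁻¹ g hy
    obtain ⟨b, hb, hbd, hby⟩ := (hy.sub hP hya).descend hP fun l _ e he => by
      change w e - G.tr (χ g)⁻¹ g w e = 0
      rw [hinv rfl g hg e (inter_subset _ _ _ he), sub_self]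
    let β : List L → ℝ := G.val ε b
    refine ⟨fun t => -β (0 :: t), fun l hl hlm => ?_⟩
    obtain ⟨e, he⟩ := hne l hl
    have he0 := zero_mem_V hε he
    have e1 := congrFun (congrArg DFunLike.coe (hby (0 :: l) (by simp [hlm]) e he0)) 0
    rw [cob_sub_fun] at e1
    have e2 : evZero e (cob b (0 :: l)) = -cob (fun t => β (0 :: t)) l := by
      rw [cob_cons, map_sub, map_cob]
      have h1 : evZero e (b l) = 0 := by
        obtain ⟨v, l, rfl⟩ := List.exists_cons_of_length_eq_add_one hlm
        have h := hb.2 _ hlm hl.1 e he (inter_subset_N (hl.1 v List.mem_cons_self) he)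
        change b _ e 0 = 0
        rw [h]; rfl
      rw [h1, zero_sub]
      congr 1
      refine cob_congr fun t ht htl => ?_
      have hlen : (0 :: t : List L).length = m + 1 := by simp; omega
      exact (val_eq (hb.1 _ hlen) (hbd _ hlen)
        (inter_anti _ _ (ht.cons_cons 0) he0)).symm
    have e3 := map_cob (negAddMonoidHom : ℝ →+ ℝ) (fun u => β (0 :: u)) l
    change -(_ : ℝ) = cob (fun u => -β (0 :: u)) l at e3
    rw [← e3, ← e2]
    have e4 : cs l = evZero e (cob y (0 :: l)) := hc _ (by simp [hlm]) e he0
    have e5 : evZero e (cob (G.trC (χ g)⁻¹ g y) (0 :: l)) =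
        (χ g)⁻¹ * cs (l.map (g⁻¹ • ·)) := by
      rw [cob_trC]
      change G.tr _ _ _ e 0 = _
      rw [tr_zero_apply _ _ _ he.1]
      congr 1
      have h1 := act_mem_inter g⁻¹ he0
      rw [List.map_cons, smul_zero] at h1 ⊢
      exact (hc _ (by simp [hlm]) _ h1).symm
    rw [e4, ← e5]
    exact e1.symm
  obtain ⟨b₀, hb₀⟩ := hT.acyclic (m + 1) hm cs (fun l h1 h2 hl => hcs l ⟨h1, h2⟩ hl) hapt
  let b : List L → ℝ := fun l => cs l - cob b₀ l
  have hbc : ∀ l : List L, l.length = m + 2 → ∀ e ∈ W l, cob b l = c l := fun l hl e he => by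
    rw [cob_sub, cob_cob, sub_zero]
    exact cob_cone (hcc (0 :: l) (by simp [hl]) e (zero_mem_V hε he))
  obtain ⟨η, hη, hηw⟩ := hy.ascend hP hP' (fun h => h.mono (by linarith))
    (b := fun l => constForm (b l)) ⟨fun l _ => contDiffOn_const, fun l hl hs e he _ => by
      have hI := iso_of_mem hε1 hs he
      have : b l = 0 := by
        change cs l - _ = 0
        rw [hb₀ l hI.1 hI.2 hl, sub_self]
      change constForm (b l) e = 0
      rw [this]; exact zeroForm_ext rfl⟩ (fun l _ e _ => extDeriv_constForm _ e)
    (fun l hl e he => by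
      refine zeroForm_ext ?_
      change evZero e _ = evZero e _
      rw [map_cob, ← hc l hl e he, ← hbc l hl e he]
      rfl)
  have hX : inter G.X (G.V ε) [] = G.X := inter_nil _ _
  refine ⟨η [], (hη.1 [] rfl).mono hX.ge, fun x hx => hη.2 [] rfl (by simp) x
    (hX.ge hx.1) hx, fun x hx => hηw [] rfl x (hX.ge hx)⟩

end ReductionData

end

section

open Set Filter Topology
open scoped ContDiff

namespace ReductionData

variable {Γ L E : Type} [Group Γ] [AddCommGroup L] [DistribMulAction Γ L]
  [NormedAddCommGroup E] [NormedSpace ℝ E] {G : ReductionData Γ L E} {q : ℕ}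

theorem tr_finsum {ι : Type*} (r : ℝ) (g : Γ) (f : ι → E → E [⋀^Fin q]→L[ℝ] ℝ) {e : E}
    (hf : {i | f i (G.act g⁻¹ e) ≠ 0}.Finite) :
    G.tr r g (fun x => ∑ᶠ i, f i x) e = ∑ᶠ i, G.tr r g (f i) e := by
  have h1 : ∑ᶠ i, G.tr r g (f i) e = ∑ i ∈ hf.toFinset, G.tr r g (f i) e :=
    finsum_eq_sum_of_support_subset _ fun i hi => by
      by_contra h
      refine hi (tr_eq_zero ?_)
      simpa using h
  have h2 : ∑ᶠ i, f i (G.act g⁻¹ e) = (∑ i ∈ hf.toFinset, f i) (G.act g⁻¹ e) := by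
    rw [Finset.sum_apply]
    exact finsum_eq_sum_of_support_subset _ fun i hi => by simpa using hi
  rw [tr_congr (w := ∑ i ∈ hf.toFinset, f i) h2, map_sum, Finset.sum_apply, h1]

theorem tr_smul_fun (r : ℝ) (g : Γ) (f : E → ℝ) (w : E → E [⋀^Fin q]→L[ℝ] ℝ) (e : E) :
    G.tr r g (fun x => f x • w x) e = f (G.act g⁻¹ e) • G.tr r g w e := by
  have h := congrFun ((G.tr r g).map_smul (f (G.act g⁻¹ e)) w) e
  rw [Pi.smul_apply] at h
  rw [← h]
  exact tr_congr rfl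

variable (G) in
/-- Equivariant cochains of forms, vanishing where some vector is very short. -/
def Equi (χ : Γ →* ℝ) (p q : ℕ) (x : List Γ → E → E [⋀^Fin q]→L[ℝ] ℝ) : Prop :=
  (∀ l : List Γ, l.length = p → ContDiffOn ℝ ∞ (x l) G.X) ∧
  (∃ ε > 0, ∀ l : List Γ, l.length = p → ∀ e ∈ G.N ε, x l e = 0) ∧
  ∀ g, ∀ l : List Γ, l.length = p → ∀ e ∈ G.X, G.trC (χ g)⁻¹ g x l e = x l e

variable (G) in
/-- The condition on equivariant cochains used in the descent. -/
def EquiInv (χ : Γ →* ℝ) (n p q : ℕ) (x : List Γ → E → E [⋀^Fin q]→L[ℝ] ℝ) : Prop :=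
  G.Equi χ p q x ∧
  (q = n → ∀ g, ∀ l : List Γ, l.length = p → ∀ e ∈ G.X, G.tr (χ g)⁻¹ g (x l) e = x l e) ∧
  (n < q → ∀ l : List Γ, l.length = p → ∀ e ∈ G.X, x l e = 0)

variable {χ : Γ →* ℝ}

theorem mem_inter_univ {l : List Γ} {e : E} :
    e ∈ inter G.X (fun _ : Γ => univ) l ↔ e ∈ G.X := by simp [inter]

theorem inter_univ_eq (l : List Γ) : inter G.X (fun _ : Γ => univ) l = G.X := by
  ext; exact mem_inter_univ

theorem Equi.sub {p : ℕ} {x y : List Γ → E → E [⋀^Fin q]→L[ℝ] ℝ} (hx : G.Equi χ p q x)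
    (hy : G.Equi χ p q y) : G.Equi χ p q fun l e => x l e - y l e := by
  obtain ⟨h1, ⟨ε, hε, h2⟩, h3⟩ := hx
  obtain ⟨h1', ⟨ε', hε', h2'⟩, h3'⟩ := hy
  refine ⟨fun l hl => (h1 l hl).sub (h1' l hl), ⟨min ε ε', lt_min hε hε', fun l hl e he => ?_⟩,
    fun g l hl e he => ?_⟩
  · dsimp only
    rw [h2 l hl e (N_mono (min_le_left _ _) he), h2' l hl e (N_mono (min_le_right _ _) he), sub_zero]
  · dsimp only
    rw [← h3 g l hl e he, ← h3' g l hl e he]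
    exact congrFun (map_sub (G.tr (χ g)⁻¹ g) _ _) e

theorem Equi.cob {p : ℕ} {x : List Γ → E → E [⋀^Fin q]→L[ℝ] ℝ} (hx : G.Equi χ p q x) :
    G.Equi χ (p + 1) q (cob x) := by
  obtain ⟨h1, ⟨ε, hε, h2⟩, h3⟩ := hx
  refine ⟨fun l hl => contDiffOn_cob fun t ht htl => h1 t (by omega),
    ⟨ε, hε, fun l hl e he => ?_⟩, fun g l hl e he => ?_⟩
  · rw [cob_apply', cob_congr (c' := fun _ => 0) fun t ht htl => h2 t (by omega) e he]
    exact cob_zero l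
  · rw [← cob_trC, cob_apply', cob_apply']
    exact cob_congr fun t ht htl => h3 g t (by omega) e he

theorem Equi.dF {p : ℕ} {x : List Γ → E → E [⋀^Fin q]→L[ℝ] ℝ} (hx : G.Equi χ p q x) :
    G.Equi χ p (q + 1) (dF x) := by
  obtain ⟨h1, ⟨ε, hε, h2⟩, h3⟩ := hx
  refine ⟨fun l hl => contDiffOn_extDeriv G.isOpen (h1 l hl),
    ⟨ε, hε, fun l hl e he => ?_⟩, fun g l hl e he => ?_⟩
  · exact (extDeriv_congr_on (isOpen_N ε) (w := fun _ => 0) (h2 l hl) he).trans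
      (extDeriv_zero_form e)
  · refine Eq.trans ?_ (extDeriv_congr_on G.isOpen (h3 g l hl) he)
    exact (extDeriv_tr he (diffAt_of_contDiffOn G.isOpen (h1 _ (by simpa using hl))
      (G.act_mem _ he))).symm

theorem Equi.rowAvg {p : ℕ} {x : List Γ → E → E [⋀^Fin q]→L[ℝ] ℝ} {φ : E → ℝ}
    (hφ : SmoothPart G.X (fun _ : Γ => univ) (fun g x => φ (G.act g⁻¹ x)))
    (hx : G.Equi χ (p + 1) q x) :
    G.Equi χ p q (rowAvg (fun g x => φ (G.act g⁻¹ x)) x) := by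
  obtain ⟨h1, ⟨ε, hε, h2⟩, h3⟩ := hx
  refine ⟨fun l hl => ?_, ⟨ε, hε, fun l hl e he => ?_⟩, fun g l hl e he => ?_⟩
  · have := hφ.rowAvg_smooth G.isOpen (fun s => by rw [inter_univ]; exact G.isOpen) (x := x)
      (fun l hl => by rw [inter_univ_eq]; exact h1 l hl) l hl
    rwa [inter_univ_eq] at this
  · refine (finsum_congr fun s => ?_).trans finsum_zero
    rw [h2 (s :: l) (by simp [hl]) e he, smul_zero]
  · have hm := G.act_mem g⁻¹ he
    change G.tr _ g (fun y => ∑ᶠ s, _) e = ∑ᶠ s, _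
    rw [tr_finsum _ _ _ ((hφ.locFin.finite hm).subset fun s hs h => hs (by simp only [h, zero_smul])),
      ← finsum_comp_equiv (Equiv.mulLeft g⁻¹)]
    refine finsum_congr fun s => ?_
    rw [tr_smul_fun]
    have e1 : G.act (Equiv.mulLeft g⁻¹ s)⁻¹ (G.act g⁻¹ e) = G.act s⁻¹ e := by
      rw [← G.act_mul _ _ _ he]; simp
    dsimp only
    rw [e1, ← h3 g (s :: l) (by simp [hl]) e he]
    rfl

theorem EquiInv.cob {n p : ℕ} {x : List Γ → E → E [⋀^Fin q]→L[ℝ] ℝ} (hx : G.EquiInv χ n p q x) :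
    G.EquiInv χ n (p + 1) q (cob x) := by
  refine ⟨hx.1.cob, fun hq g l hl e he => ?_, fun hq l hl e he => ?_⟩
  · have h := map_cob (G.tr (q := q) (χ g)⁻¹ g).toAddMonoidHom x l
    refine (congrFun h e).trans ?_
    rw [cob_apply', cob_apply']
    exact cob_congr fun t ht htl => hx.2.1 hq g t (by omega) e he
  · rw [cob_apply', cob_congr (c' := fun _ => 0) fun t ht htl => hx.2.2 hq t (by omega) e he]
    exact cob_zero l

theorem EquiInv.sub {n p : ℕ} {x y : List Γ → E → E [⋀^Fin q]→L[ℝ] ℝ} (hx : G.EquiInv χ n p q x)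
    (hy : G.EquiInv χ n p q y) : G.EquiInv χ n p q fun l e => x l e - y l e := by
  refine ⟨hx.1.sub hy.1, fun hq g l hl e he => ?_, fun hq l hl e he => ?_⟩
  · dsimp only
    rw [← hx.2.1 hq g l hl e he, ← hy.2.1 hq g l hl e he]
    exact congrFun (map_sub (G.tr (χ g)⁻¹ g) _ _) e
  · dsimp only
    rw [hx.2.2 hq l hl e he, hy.2.2 hq l hl e he, sub_zero]

theorem EquiInv.zero {n p q : ℕ} : G.EquiInv χ n p q 0 :=
  ⟨⟨fun _ _ => contDiffOn_const, ⟨1, one_pos, fun _ _ _ _ => rfl⟩,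
    fun _ _ _ _ _ => tr_eq_zero rfl⟩, fun _ _ _ _ _ _ => tr_eq_zero rfl, fun _ _ _ _ _ => rfl⟩

theorem EquiInv.col [FiniteDimensional ℝ E] {n p : ℕ} {Frame : List (L × L) → Prop}
    (hT : G.TitsData n χ Frame) {x : List Γ → E → E [⋀^Fin (q + 1)]→L[ℝ] ℝ}
    (hx : G.EquiInv χ n (p + 1) (q + 1) x)
    (hd : ∀ l : List Γ, l.length = p + 1 → ∀ e ∈ G.X, extDeriv (x l) e = 0) :
    ∃ y, G.EquiInv χ n (p + 1) q y ∧
      ∀ l : List Γ, l.length = p + 1 → ∀ e ∈ G.X, extDeriv (y l) e = x l e := by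
  obtain ⟨⟨h1, ⟨ε, hε, h2⟩, h3⟩, h4, h5⟩ := hx
  rcases lt_or_ge n (q + 1) with hq | hq
  · refine ⟨0, EquiInv.zero, fun l hl e he => ?_⟩
    rw [h5 hq l hl e he]
    exact extDeriv_zero_form e
  set δ := min ε 1 with hδ
  have hδ0 : 0 < δ := lt_min hε one_pos
  have hex : ∀ t : List Γ, ∃ η : E → E [⋀^Fin q]→L[ℝ] ℝ, t.length = p →
      ContDiffOn ℝ ∞ η G.X ∧ (∀ e ∈ G.N (δ / 4), η e = 0) ∧
        ∀ e ∈ G.X, extDeriv η e = x (1 :: t) e := fun t => by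
    by_cases ht : t.length = p
    · have hl : (1 :: t).length = p + 1 := by simp [ht]
      obtain ⟨η, h⟩ := exists_primitive_vanishing hT hδ0 (min_le_right _ _) hq (h1 _ hl)
        (hd _ hl) (fun e he => h2 _ hl e (N_mono (min_le_left _ _) he))
        fun hqn g _ e he => h4 hqn g _ hl e he
      exact ⟨η, fun _ => h⟩
    · exact ⟨0, fun h => absurd h ht⟩
  choose η hη using hex
  let y : List Γ → E → E [⋀^Fin q]→L[ℝ] ℝ := fun l => match l with
    | [] => 0
    | g :: t => G.tr (χ g)⁻¹ g (η (t.map (g⁻¹ • ·)))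
  refine ⟨y, ⟨⟨fun l hl => ?_, ⟨δ / 4, by positivity, fun l hl e he => ?_⟩,
    fun h l hl e he => ?_⟩, fun h => by omega, fun h => by omega⟩, fun l hl e he => ?_⟩
  all_goals
    obtain ⟨g, t, rfl⟩ := List.exists_cons_of_length_eq_add_one hl
    have ht : (t.map (g⁻¹ • ·)).length = p := by simpa using hl
    obtain ⟨hη1, hη2, hη3⟩ := hη _ ht
  · exact tr_smooth subset_rfl (G.act_mem _) hη1
  · exact tr_eq_zero (hη2 _ (act_mem_N _ he))
  · change G.tr _ h (G.tr (χ (h⁻¹ * g))⁻¹ (h⁻¹ * g) (η _)) e = G.tr _ _ _ e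
    rw [tr_tr]
    have e1 : (χ h)⁻¹ * (χ (h⁻¹ * g))⁻¹ = (χ g)⁻¹ := by
      rw [← mul_inv, ← map_mul, mul_inv_cancel_left]
    rw [e1, mul_inv_cancel_left, List.map_map]
    have e2 : ((fun s => ((fun s => h⁻¹ • s) g)⁻¹ • s) ∘ fun s => h⁻¹ • s) = fun s : Γ => g⁻¹ • s := by
      funext s
      simp [mul_assoc]
    rw [e2]
  · change extDeriv (G.tr _ _ _) e = _
    rw [extDeriv_tr he (diffAt_of_contDiffOn G.isOpen hη1 (G.act_mem _ he)),
      ← h3 g _ hl e he]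
    refine tr_congr ?_
    rw [hη3 _ (G.act_mem _ he), List.map_cons, smul_eq_mul, inv_mul_cancel]

theorem descent_equi [FiniteDimensional ℝ E] {n : ℕ} {Frame : List (L × L) → Prop}
    (hT : G.TitsData n χ Frame) :
    Descent (inter G.X (fun _ : Γ => univ)) (G.EquiInv χ n) where
  isOpen l := by rw [inter_univ_eq]; exact G.isOpen
  anti h := inter_anti _ _ h
  smooth h l hl := by rw [inter_univ_eq]; exact h.1.1 l hl
  cob h := h.cob
  sub h h' := h.sub h'
  zero := EquiInv.zero
  col hx hd := by
    obtain ⟨y, hy, hyx⟩ := EquiInv.col hT hx fun l hl e he => hd l hl e (mem_inter_univ.2 he)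
    exact ⟨y, hy, fun l hl e he => hyx l hl e (mem_inter_univ.1 he)⟩

theorem ascent_equi {φ : E → ℝ}
    (hφ : SmoothPart G.X (fun _ : Γ => univ) (fun g x => φ (G.act g⁻¹ x))) :
    Ascent (inter G.X (fun _ : Γ => univ)) (G.Equi χ) where
  smooth h l hl := by rw [inter_univ_eq]; exact h.1 l hl
  d h := h.dF
  sub h h' := h.sub h'
  row hx hc := ⟨_, hx.rowAvg hφ, hφ.rowAvg_cob hc⟩
  cover e he := ⟨1, mem_inter_univ.2 (mem_inter_univ.1 he)⟩

theorem exists_equivariant_primitive [FiniteDimensional ℝ E] [Nontrivial L] {m : ℕ}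
    {Frame : List (L × L) → Prop} (hT : G.TitsData (m + 1) χ Frame) {φ : E → ℝ}
    (hφ : SmoothPart G.X (fun _ : Γ => univ) (fun g x => φ (G.act g⁻¹ x)))
    {w : E → E [⋀^Fin (m + 1)]→L[ℝ] ℝ} (hw : ContDiffOn ℝ ∞ w G.X)
    (hd : ∀ x ∈ G.X, extDeriv w x = 0) {ε : ℝ} (hε : 0 < ε) (h0 : ∀ x ∈ G.N ε, w x = 0)
    (hinv : ∀ g, ∀ x ∈ G.X, G.tr (χ g)⁻¹ g w x = w x) :
    ∃ η : E → E [⋀^Fin m]→L[ℝ] ℝ, ContDiffOn ℝ ∞ η G.X ∧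
      (∃ δ > 0, ∀ x ∈ G.N δ, η x = 0) ∧ (∀ g, ∀ x ∈ G.X, G.tr (χ g)⁻¹ g η x = η x) ∧
      ∀ x ∈ G.X, extDeriv η x = w x := by
  have hP := descent_equi hT
  let a : List Γ → E → E [⋀^Fin (m + 1)]→L[ℝ] ℝ := fun _ => w
  have ha : G.EquiInv χ (m + 1) 0 (m + 1) a := ⟨⟨fun _ _ => hw, ⟨ε, hε, fun _ _ => h0⟩,
    fun g _ _ => hinv g⟩, fun _ g _ _ => hinv g, fun h => absurd h (lt_irrefl _)⟩
  obtain ⟨y, hy⟩ := LinkedBot.exists hP ha fun l _ e he => hd e (mem_inter_univ.1 he)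
  have hyc := hy.closed hP
  obtain ⟨h1, ⟨δ, hδ, h2⟩, -⟩ := hy.1.1.cob
  obtain ⟨η, hη, hηw⟩ := hy.ascend hP (ascent_equi hφ) (fun h => h.1) (b := 0) (EquiInv.zero (n := 0)).1
    (fun l _ e _ => extDeriv_zero_form e) fun l hl e he => by
      rw [zeroForm_eq_zero hδ (h1 l hl) (fun x hx => hyc l hl x (mem_inter_univ.2 hx)) (h2 l hl)
        (mem_inter_univ.1 he)]
      have : cob (0 : List Γ → E → E [⋀^Fin 0]→L[ℝ] ℝ) l = 0 := cob_zero l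
      rw [this]; rfl
  obtain ⟨g1, ⟨δ, hδ, g2⟩, g3⟩ := hη
  exact ⟨η [], g1 [] rfl, ⟨δ, hδ, g2 [] rfl⟩, fun g => g3 g [] rfl,
    fun x hx => hηw [] rfl x (mem_inter_univ.2 hx)⟩

end ReductionData

end

section

open Set Filter Topology
open scoped ContDiff

section Degree

variable {E : Type} [NormedAddCommGroup E] [NormedSpace ℝ E] {X : Set E} {D : ℕ}

/-- Integration: a functional on forms of top degree whose kernel is the space of exact forms. -/
theorem CompactCohomology.exists_integral (h : CompactCohomology X D) :
    ∃ (τ : Omc X D →ₗ[ℝ] ℝ) (w₀ : Omc X D), τ w₀ = 1 ∧ ∀ w, τ w = 0 ↔ CExact X w.1 := by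
  obtain ⟨w₀, h0, h1, h2⟩ := h.top
  choose a ha using fun w : Omc X D => h2 w.1 w.2
  have huniq : ∀ (w : Omc X D) (b : ℝ), CExact X (w.1 - b • w₀) → a w = b := fun w b hb => by
    by_contra hne
    have h3 := ((ha w).sub hb).smul (b - a w)⁻¹
    refine h1 (h3.congr fun x => ?_)
    have : b - a w ≠ 0 := sub_ne_zero.2 (Ne.symm hne)
    have e : (w.1 - a w • w₀ - (w.1 - b • w₀)) = (b - a w) • w₀ := by
      ext x v; simp; ring
    rw [e, smul_smul, inv_mul_cancel₀ this, one_smul]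
  have h00 : CExact X (0 : E → E [⋀^Fin D]→L[ℝ] ℝ) := by
    have := (ha ⟨w₀, h0⟩).smul 0
    rwa [zero_smul] at this
  let τ : Omc X D →ₗ[ℝ] ℝ :=
    { toFun := a
      map_add' := fun v w => huniq _ _ (by
        have := (ha v).sub ((ha w).smul (-1))
        refine this.congr fun x => congrFun ?_ x
        change _ = v.1 + w.1 - _
        ext x v; simp; ring)
      map_smul' := fun r w => huniq _ _ (by
        refine ((ha w).smul r).congr fun x => congrFun ?_ x
        change _ = r • w.1 - _
        rw [RingHom.id_apply, smul_eq_mul, smul_sub, smul_smul]) }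
  refine ⟨τ, ⟨w₀, h0⟩, huniq _ _ ?_, fun w => ⟨fun hw => ?_, fun hw => huniq _ _ ?_⟩⟩
  · rwa [one_smul, sub_self]
  · have h3 := ha w
    have h4 : a w = 0 := hw
    rwa [h4, zero_smul, sub_zero] at h3
  · rwa [zero_smul, sub_zero]

theorem IsDiffeo.integral_omcPull {τ : Omc X D →ₗ[ℝ] ℝ} {w₀ : Omc X D} (h0 : τ w₀ = 1)
    (hτ : ∀ w, τ w = 0 ↔ CExact X w.1) {f g : E → E} (hf : IsDiffeo X X f g) (w : Omc X D) :
    τ (hf.omcPull D w) = τ (hf.omcPull D w₀) * τ w := by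
  have h1 : τ (w + (-τ w) • w₀) = 0 := by
    rw [map_add, map_smul, h0, smul_eq_mul, mul_one, add_neg_cancel]
  have h2 : τ (hf.omcPull D (w + (-τ w) • w₀)) = 0 := (hτ _).2 (hf.cExact_pull ((hτ _).1 h1))
  rw [map_add, map_smul, map_add, map_smul, smul_eq_mul] at h2
  linarith

end Degree

namespace ReductionData

variable {Γ L E : Type} [Group Γ] [AddCommGroup L] [DistribMulAction Γ L]
  [NormedAddCommGroup E] [NormedSpace ℝ E] (G : ReductionData Γ L E) {q : ℕ}

theorem isDiffeo (g : Γ) : IsDiffeo G.X G.X (G.act g⁻¹) (G.act g) :=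
  ⟨G.isOpen, G.isOpen, G.act_smooth _, G.act_smooth _, G.act_mem _, G.act_mem _,
    fun _ hx => G.act_act_inv hx, fun _ hx => G.act_inv_act hx⟩

theorem tr_mem (r : ℝ) (g : Γ) {w : E → E [⋀^Fin q]→L[ℝ] ℝ} (hw : w ∈ Omc G.X q) :
    G.tr r g w ∈ Omc G.X q := Submodule.smul_mem _ r ((G.isDiffeo g).pull_mem hw)

/-- Translation of compactly supported forms. -/
noncomputable def trO (q : ℕ) (r : ℝ) (g : Γ) : Omc G.X q →ₗ[ℝ] Omc G.X q :=
  (G.tr r g).restrict fun _ hw => G.tr_mem r g hw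

/-- An orientation character. -/
structure IsOrientation (D : ℕ) (τ : Omc G.X D →ₗ[ℝ] ℝ) (w₀ : Omc G.X D) (χ : Γ →* ℝ) : Prop where
  one : τ w₀ = 1
  ker : ∀ w, τ w = 0 ↔ CExact G.X w.1
  act : ∀ g w, τ (G.trO D (χ g)⁻¹ g w) = τ w

variable {G}

theorem coe_trO (r : ℝ) (g : Γ) (w : Omc G.X q) : (G.trO q r g w).1 = G.tr r g w.1 := rfl

theorem chi_ne_zero (χ : Γ →* ℝ) (g : Γ) : χ g ≠ 0 := fun h => by
  have := map_mul χ g g⁻¹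
  rw [h, mul_inv_cancel, map_one, zero_mul] at this
  exact one_ne_zero this

theorem exists_orientation {D : ℕ} (h : CompactCohomology G.X D) :
    ∃ τ w₀ χ, G.IsOrientation D τ w₀ χ := by
  obtain ⟨τ, w₀, h0, hτ⟩ := h.exists_integral
  have h1 : ∀ g w, τ (G.trO D 1 g w) = τ (G.trO D 1 g w₀) * τ w := fun g w => by
    have e : ∀ w, G.trO D 1 g w = (G.isDiffeo g).omcPull D w := fun w =>
      Subtype.ext (one_smul ℝ (pull G.X (G.act g⁻¹) w.1))
    rw [e, e, (G.isDiffeo g).integral_omcPull h0 hτ]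
  let χ : Γ →* ℝ :=
    { toFun := fun g => τ (G.trO D 1 g w₀)
      map_one' := by
        have : G.trO D 1 1 w₀ = w₀ := by
          ext1
          funext x
          by_cases hx : x ∈ G.X
          · exact tr_one hx
          · rw [Omc.eq_zero w₀.2 hx]
            exact Omc.eq_zero (G.tr_mem 1 1 w₀.2) hx
        rw [this, h0]
      map_mul' := fun g h => by
        rw [← h1 g (G.trO D 1 h w₀)]
        congr 1
        ext1
        change _ = G.tr 1 g (G.tr 1 h w₀.1)
        rw [tr_tr, one_mul]; rfl }
  refine ⟨τ, w₀, χ, h0, hτ, fun g w => ?_⟩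
  have e : G.trO D (χ g)⁻¹ g w = (χ g)⁻¹ • G.trO D 1 g w := by
    ext1
    change (χ g)⁻¹ • pull G.X (G.act g⁻¹) w.1 = (χ g)⁻¹ • (1 : ℝ) • pull G.X (G.act g⁻¹) w.1
    rw [one_smul]
  rw [e, map_smul, h1 g w, smul_eq_mul, ← mul_assoc]
  change (χ g)⁻¹ * χ g * τ w = τ w
  rw [inv_mul_cancel₀ (chi_ne_zero χ g), one_mul]

theorem IsOrientation.pos_of_sqrt {D : ℕ} {τ : Omc G.X D →ₗ[ℝ] ℝ} {w₀ : Omc G.X D} {χ : Γ →* ℝ}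
    (h : G.IsOrientation D τ w₀ χ) {f f' : E → E} (hf : IsDiffeo G.X G.X f f') (g : Γ)
    (hg : ∀ x ∈ G.X, G.act g⁻¹ x = f (f x)) : 0 < χ g := by
  have h1 := h.act g w₀
  have e : G.trO D (χ g)⁻¹ g w₀ = (χ g)⁻¹ • hf.omcPull D (hf.omcPull D w₀) := by
    ext1
    change (χ g)⁻¹ • _ = (χ g)⁻¹ • pull G.X f (pull G.X f w₀.1)
    rw [pull_pull G.isOpen G.isOpen hf.smooth hf.smooth hf.maps (h := G.act g⁻¹) hg]
    rfl
  rw [e, map_smul, hf.integral_omcPull h.one h.ker, h.one, smul_eq_mul] at h1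
  have h2 : χ g = τ (hf.omcPull D w₀) * τ (hf.omcPull D w₀) := by
    have := chi_ne_zero χ g
    field_simp at h1
    linarith
  have h3 := mul_self_nonneg (τ (hf.omcPull D w₀))
  rw [← h2] at h3
  exact h3.lt_of_ne (chi_ne_zero χ g).symm

theorem part_mem {f : E → ℝ} (hf : ContDiffOn ℝ ∞ f G.X) {w : E → E [⋀^Fin q]→L[ℝ] ℝ}
    (hw : w ∈ Omc G.X q) : (fun x => f x • w x) ∈ Omc G.X q := by
  obtain ⟨h, K, hK, hKX, h0⟩ := hw
  have hzero : ∀ x ∉ K, f x • w x = 0 := fun x hx => by rw [h0 x hx, smul_zero]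
  have h1 : ContDiffOn ℝ ∞ (fun x => f x • w x) G.X := hf.smul h.contDiffOn
  exact ⟨contDiff_of_compact G.isOpen hK hKX h1 hzero, K, hK, hKX, hzero⟩

/-- Multiplication of compactly supported forms by a function. -/
noncomputable def mulO (q : ℕ) (f : E → ℝ) (hf : ContDiffOn ℝ ∞ f G.X) :
    Omc G.X q →ₗ[ℝ] Omc G.X q where
  toFun w := ⟨fun x => f x • w.1 x, part_mem hf w.2⟩
  map_add' v w := by ext1; funext x; exact smul_add _ _ _
  map_smul' r w := by ext1; funext x; exact smul_comm (f x) r (w.1 x)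

/-- Evaluation of forms at a point. -/
def evO (x : E) : Omc G.X q →+ E [⋀^Fin q]→L[ℝ] ℝ where
  toFun w := w.1 x
  map_zero' := rfl
  map_add' _ _ := rfl

theorem omc_ext {v w : Omc G.X q} (h : ∀ x ∈ G.X, v.1 x = w.1 x) : v = w := by
  ext1
  funext x
  by_cases hx : x ∈ G.X
  · exact h x hx
  · rw [Omc.eq_zero v.2 hx, Omc.eq_zero w.2 hx]

theorem mulO_finite {φ : E → ℝ}
    (hφ : SmoothPart G.X (fun _ : Γ => univ) (fun g x => φ (G.act g⁻¹ x))) (w : Omc G.X q) :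
    {g | mulO q _ (hφ.smooth g) w ≠ 0}.Finite := by
  obtain ⟨-, K, hK, hKX, h0⟩ := w.2
  refine (hφ.locFin.finite_compact hK hKX).subset fun g hg => ?_
  by_contra h
  refine hg ?_
  ext1
  funext x
  change φ (G.act g⁻¹ x) • w.1 x = 0
  by_cases hx : x ∈ K
  · have : φ (G.act g⁻¹ x) = 0 := by
      by_contra h'
      exact h ⟨x, hx, h'⟩
    rw [this, zero_smul]
  · rw [h0 x hx, smul_zero]

variable (G) in
/-- The complex of compactly supported forms with the twisted action. -/
noncomputable def complex (χ : Γ →* ℝ) {φ : E → ℝ}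
    (hφ : SmoothPart G.X (fun _ : Γ => univ) (fun g x => φ (G.act g⁻¹ x))) :
    GammaComplex Γ fun r => Omc G.X r where
  d := omcD G.X
  d_d := omcD_omcD G.X
  act r g := G.trO r (χ g)⁻¹ g
  act_one r w := omc_ext fun x hx => by
    rw [coe_trO, map_one, inv_one]; exact tr_one hx
  act_mul r g h w := by
    ext1
    rw [coe_trO, coe_trO, coe_trO, tr_tr, map_mul, mul_inv]
  act_d r g w := omc_ext fun x hx =>
    (extDeriv_tr hx (Omc.differentiableAt w.2 _)).symm
  part r g := mulO r _ (hφ.smooth g)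
  part_finite r w := mulO_finite hφ w
  part_sum r w := omc_ext fun x hx => by
    have := (evO (G := G) (q := r) x).map_finsum (mulO_finite hφ w)
    refine this.trans ?_
    change ∑ᶠ g : Γ, φ (G.act g⁻¹ x) • w.1 x = w.1 x
    have h2 := ((smulAddHom ℝ (E [⋀^Fin r]→L[ℝ] ℝ)).flip (w.1 x)).map_finsum
      (hφ.locFin.finite hx)
    refine Eq.trans h2.symm ?_
    change (∑ᶠ g : Γ, φ (G.act g⁻¹ x)) • w.1 x = w.1 x
    rw [hφ.sum x hx, one_smul]
  act_part r g h w := omc_ext fun x hx => by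
    refine (tr_smul_fun _ _ _ _ _).trans ?_
    change _ = φ (G.act (g * h)⁻¹ x) • _
    rw [mul_inv_rev, G.act_mul _ _ _ hx]
    rfl

end ReductionData

end

section

open Set Filter Topology
open scoped ContDiff

theorem LinearMap.exists_comp_eq {V M : Type*} [AddCommGroup V] [Module ℝ V] [AddCommGroup M]
    [Module ℝ M] (P : V →ₗ[ℝ] M) (T : V →ₗ[ℝ] ℝ) (h : ∀ v, P v = 0 → T v = 0) :
    ∃ S : M →ₗ[ℝ] ℝ, S ∘ₗ P = T := by
  have hker : T ∈ (LinearMap.ker P).dualAnnihilator := by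
    rw [Submodule.mem_dualAnnihilator]
    exact fun v hv => h v hv
  rw [← LinearMap.range_dualMap_eq_dualAnnihilator_ker] at hker
  exact hker

theorem GammaComplex.exists_extension {Γ : Type} [Group Γ] {C : ℕ → Type}
    [∀ r, AddCommGroup (C r)] [∀ r, Module ℝ (C r)] (G : GammaComplex Γ C) {n : ℕ} {M : Type}
    [AddCommGroup M] [Module ℝ M] (N : C (n + 1) → M) (hadd : ∀ v w, N (v + w) = N v + N w)
    (hsmul : ∀ (r : ℝ) w, N (r • w) = r • N w) (hN : ∀ g w, N (G.act _ g w) = N w)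
    (T : C n →ₗ[ℝ] ℝ) (h : ∀ w, N (G.d n w) = 0 → T w = 0) :
    ∃ S : C (n + 1) →ₗ[ℝ] ℝ, (∀ g w, S (G.act _ g w) = S w) ∧ ∀ w, S (G.d n w) = T w := by
  let N' : C (n + 1) →ₗ[ℝ] M := { toFun := N, map_add' := hadd, map_smul' := hsmul }
  obtain ⟨S, hS⟩ := LinearMap.exists_comp_eq (N' ∘ₗ G.d n) T h
  exact ⟨S ∘ₗ N', fun g w => congrArg S (hN g w), fun w => LinearMap.congr_fun hS w⟩

namespace ReductionData

variable {Γ L E : Type} [Group Γ] [AddCommGroup L] [DistribMulAction Γ L]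
  [NormedAddCommGroup E] [NormedSpace ℝ E] {G : ReductionData Γ L E} {q : ℕ} {χ : Γ →* ℝ}

variable (G) in
/-- Averaging a compactly supported form over the group. -/
noncomputable def avg (χ : Γ →* ℝ) (w : E → E [⋀^Fin q]→L[ℝ] ℝ) (x : E) : E [⋀^Fin q]→L[ℝ] ℝ :=
  ∑ᶠ g, G.tr (χ g)⁻¹ g w x

theorem avg_congr {v w : E → E [⋀^Fin q]→L[ℝ] ℝ} (h : ∀ x ∈ G.X, v x = w x) {x : E}
    (hx : x ∈ G.X) : G.avg χ v x = G.avg χ w x :=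
  finsum_congr fun _ => tr_congr (h _ (G.act_mem _ hx))

theorem avg_tr (h : Γ) (w : E → E [⋀^Fin q]→L[ℝ] ℝ) (x : E) :
    G.avg χ (G.tr (χ h)⁻¹ h w) x = G.avg χ w x := by
  unfold avg
  rw [← finsum_comp_equiv (Equiv.mulRight h) (f := fun g => G.tr (χ g)⁻¹ g w x)]
  refine finsum_congr fun g => ?_
  rw [tr_tr, ← mul_inv, ← map_mul]
  rfl

section

variable [FiniteDimensional ℝ E]

theorem avg_locFin {w : E → E [⋀^Fin q]→L[ℝ] ℝ} (hw : w ∈ Omc G.X q) :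
    LocFin G.X fun g => G.tr (χ g)⁻¹ g w := fun x hx => by
  obtain ⟨-, K, hK, hKX, h0⟩ := hw
  obtain ⟨K', hK', hKc, hKX'⟩ := G.exists_compact_nhds hx
  have h1 := (G.proper (K ∪ K') (hK.union hKc) (union_subset hKX hKX')).preimage
    (f := fun g : Γ => g⁻¹) inv_injective.injOn
  refine ⟨h1.toFinset, ?_⟩
  filter_upwards [hK'] with y hy g hg
  refine tr_eq_zero (h0 _ fun h => hg ?_)
  rw [Finite.mem_toFinset]
  exact ⟨y, Or.inr hy, Or.inl h⟩

theorem avg_smooth {w : E → E [⋀^Fin q]→L[ℝ] ℝ} (hw : w ∈ Omc G.X q) :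
    ContDiffOn ℝ ∞ (G.avg χ w) G.X :=
  (avg_locFin hw).contDiffOn G.isOpen subset_rfl fun _ =>
    tr_smooth subset_rfl (G.act_mem _) (Omc.contDiff hw).contDiffOn

theorem avg_add {v w : E → E [⋀^Fin q]→L[ℝ] ℝ} (hv : v ∈ Omc G.X q) (hw : w ∈ Omc G.X q) {x : E}
    (hx : x ∈ G.X) : G.avg χ (v + w) x = G.avg χ v x + G.avg χ w x := by
  unfold avg
  rw [← finsum_add_distrib ((avg_locFin hv).finite hx) ((avg_locFin hw).finite hx)]
  exact finsum_congr fun g => congrFun (map_add (G.tr (χ g)⁻¹ g) v w) x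

theorem avg_sub {v w : E → E [⋀^Fin q]→L[ℝ] ℝ} (hv : v ∈ Omc G.X q) (hw : w ∈ Omc G.X q) {x : E}
    (hx : x ∈ G.X) : G.avg χ (v - w) x = G.avg χ v x - G.avg χ w x := by
  unfold avg
  rw [← finsum_sub_distrib ((avg_locFin hv).finite hx) ((avg_locFin hw).finite hx)]
  exact finsum_congr fun g => congrFun (map_sub (G.tr (χ g)⁻¹ g) v w) x

theorem avg_smul (r : ℝ) {w : E → E [⋀^Fin q]→L[ℝ] ℝ} (hw : w ∈ Omc G.X q) {x : E}
    (hx : x ∈ G.X) : G.avg χ (r • w) x = r • G.avg χ w x := by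
  have h := (smulAddHom ℝ (E [⋀^Fin q]→L[ℝ] ℝ) r).map_finsum ((avg_locFin (χ := χ) hw).finite hx)
  refine Eq.trans ?_ h.symm
  exact finsum_congr fun g => congrFun (map_smul (G.tr (χ g)⁻¹ g) r w) x

theorem extDeriv_avg {w : E → E [⋀^Fin q]→L[ℝ] ℝ} (hw : w ∈ Omc G.X q) {x : E} (hx : x ∈ G.X) :
    extDeriv (G.avg χ w) x = G.avg χ (extDeriv w) x := by
  obtain ⟨t, ht⟩ := avg_locFin (χ := χ) hw x hx
  have hd : ∀ g, DifferentiableAt ℝ (G.tr (χ g)⁻¹ g w) x := fun g =>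
    diffAt_of_contDiffOn G.isOpen
      (tr_smooth subset_rfl (G.act_mem _) (Omc.contDiff hw).contDiffOn) hx
  have he : ∀ g, extDeriv (G.tr (χ g)⁻¹ g w) x = G.tr (χ g)⁻¹ g (extDeriv w) x := fun g =>
    extDeriv_tr hx (Omc.differentiableAt hw _)
  have h1 : G.avg χ w =ᶠ[𝓝 x] fun y => ∑ g ∈ t, G.tr (χ g)⁻¹ g w y := ht.mono fun y hy =>
    finsum_eq_sum_of_support_subset _ fun s hs => by
      by_contra hst
      exact hs (hy s hst)
  have h2 : G.avg χ (extDeriv w) x = ∑ g ∈ t, G.tr (χ g)⁻¹ g (extDeriv w) x :=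
    finsum_eq_sum_of_support_subset _ fun g hg => by
      by_contra hgt
      refine hg ?_
      have h3 : G.tr (χ g)⁻¹ g w =ᶠ[𝓝 x] fun _ => 0 := ht.mono fun y hy => hy g hgt
      refine (he g).symm.trans ?_
      rw [Filter.EventuallyEq.extDeriv_eq h3]
      exact extDeriv_zero_form x
  rw [h1.extDeriv_eq, h2]
  clear h1 h2 ht
  induction t using Finset.cons_induction with
  | empty => simp [extDeriv_zero_form x]
  | cons g t hg ih =>
    rw [Finset.sum_cons, ← ih, ← he]
    have := extDeriv_fun_add (hd g) (DifferentiableAt.fun_sum fun g (_ : g ∈ t) => hd g)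
    rw [← this]
    congr 1
    funext y
    exact Finset.sum_cons _

theorem tr_avg (h : Γ) {w : E → E [⋀^Fin q]→L[ℝ] ℝ} (hw : w ∈ Omc G.X q) {x : E} (hx : x ∈ G.X) :
    G.tr (χ h)⁻¹ h (G.avg χ w) x = G.avg χ w x := by
  refine (tr_finsum _ _ _ ((avg_locFin hw).finite (G.act_mem _ hx))).trans ?_
  unfold avg
  rw [← finsum_comp_equiv (Equiv.mulLeft h) (f := fun g => G.tr (χ g)⁻¹ g w x)]
  refine finsum_congr fun g => ?_
  rw [tr_tr, ← mul_inv, ← map_mul]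
  rfl

theorem avg_vanishing [IsAddTorsionFree L] {w : E → E [⋀^Fin q]→L[ℝ] ℝ} (hw : w ∈ Omc G.X q) :
    ∃ ε > 0, ∀ x ∈ G.N ε, G.avg χ w x = 0 := by
  obtain ⟨-, K, hK, hKX, h0⟩ := hw
  obtain ⟨M, hM⟩ := hK.exists_bound_of_continuousOn
    ((G.height_smooth one_pos).continuousOn.mono hKX)
  obtain ⟨ε, hε, h⟩ := G.le_q_of_height ⌈M⌉₊
  refine ⟨ε, hε, fun x hx => ?_⟩
  have : ∀ g, G.tr (χ g)⁻¹ g w x = 0 := fun g => tr_eq_zero (h0 _ fun hg => by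
    obtain ⟨h1, v, hv, h2⟩ := act_mem_N g⁻¹ hx
    refine (h _ h1 ?_ v hv).not_gt h2
    have h3 := (le_abs_self _).trans (hM _ hg)
    have := Nat.le_ceil M
    linarith)
  unfold avg
  simp only [this, finsum_zero]

/-- A form with equivariant average exact has the same average as an exact form. -/
theorem exists_avg_eq_zero [IsAddTorsionFree L] [Nontrivial L] {m : ℕ}
    {Frame : List (L × L) → Prop} (hT : G.TitsData (m + 1) χ Frame) {w : Omc G.X (m + 1)}
    (hw : ∀ x ∈ G.X, G.avg χ (extDeriv w.1) x = 0) :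
    ∃ β : Omc G.X m, ∀ x ∈ G.X, G.avg χ (w - omcD G.X m β).1 x = 0 := by
  classical
  obtain ⟨φ, hφ, hK⟩ := G.exists_translates
  obtain ⟨ε, hε, h0⟩ := avg_vanishing (χ := χ) w.2
  obtain ⟨η, h1, ⟨δ, hδ, h2⟩, h3, h4⟩ := exists_equivariant_primitive hT hφ (avg_smooth w.2)
    (fun x hx => by rw [extDeriv_avg w.2 hx, hw x hx]) hε h0 fun g x hx => tr_avg g w.2 hx
  obtain ⟨K, hKc, hKX, hK⟩ := hK δ hδ
  let β : E → E [⋀^Fin m]→L[ℝ] ℝ := fun x => if x ∈ G.X then φ x • η x else 0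
  have hφs : ContDiffOn ℝ ∞ φ G.X := (hφ.smooth 1).congr fun x hx => by
    rw [inv_one, G.act_one x hx]
  have hβ0 : ∀ x ∈ G.X, β x = φ x • η x := fun x hx => if_pos hx
  have hβK : ∀ x ∉ K, β x = 0 := fun x hx => by
    by_cases hX : x ∈ G.X
    · rw [hβ0 x hX]
      by_cases hN : x ∈ G.N δ
      · rw [h2 x hN, smul_zero]
      · rw [hK x hX (fun v hv => by
          by_contra! h
          exact hN ⟨hX, v, hv, h⟩) hx, zero_smul]
    · exact if_neg hX
  have hβs : ContDiffOn ℝ ∞ β G.X := (hφs.smul h1).congr hβ0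
  have hβ : β ∈ Omc G.X m := ⟨contDiff_of_compact G.isOpen hKc hKX hβs hβK, K, hKc, hKX, hβK⟩
  have hav : ∀ x ∈ G.X, G.avg χ β x = η x := fun x hx => by
    rw [avg_congr hβ0 hx]
    have h5 : G.avg χ (fun x => φ x • η x) x = ∑ᶠ g, φ (G.act g⁻¹ x) • η x :=
      finsum_congr fun g => by rw [tr_smul_fun, h3 g x hx]
    have h6 := ((smulAddHom ℝ (E [⋀^Fin m]→L[ℝ] ℝ)).flip (η x)).map_finsum
      (hφ.locFin.finite hx)
    rw [h5]
    refine Eq.trans h6.symm ?_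
    change (∑ᶠ g : Γ, φ (G.act g⁻¹ x)) • η x = η x
    rw [hφ.sum x hx, one_smul]
  refine ⟨⟨β, hβ⟩, fun x hx => ?_⟩
  refine (avg_sub w.2 (omcD G.X m ⟨β, hβ⟩).2 hx).trans ?_
  have h7 : G.avg χ (omcD G.X m ⟨β, hβ⟩).1 x = G.avg χ w.1 x := by
    refine (extDeriv_avg hβ hx).symm.trans ?_
    rw [← h4 x hx]
    exact extDeriv_congr_on G.isOpen hav hx
  rw [h7, sub_self]

variable (G χ) in
theorem functional_eq_zero {φ : E → ℝ}
    (hφ : SmoothPart G.X (fun _ : Γ => univ) (fun g x => φ (G.act g⁻¹ x)))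
    {T : Omc G.X q →ₗ[ℝ] ℝ} (hT : ∀ g w, T (G.trO q (χ g)⁻¹ g w) = T w) {w : Omc G.X q}
    (hw : ∀ x ∈ G.X, G.avg χ w.1 x = 0) : T w = 0 := by
  let C := G.complex χ hφ
  have h1 : ∀ g, C.part q g w = C.act q g (C.part q 1 (C.act q g⁻¹ w)) := fun g => by
    rw [C.act_part, ← C.act_mul, mul_inv_cancel, C.act_one, mul_one]
  have h2 : ∀ g, T (C.part q g w) = T (C.part q 1 (C.act q g⁻¹ w)) := fun g => by
    rw [h1 g]; exact hT g _
  have hfin : {g | C.part q 1 (C.act q g⁻¹ w) ≠ 0}.Finite :=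
    (C.part_finite q w).subset fun g hg h => hg (by
      have h3 := congrArg (C.act q g⁻¹) h
      rwa [h1 g, ← C.act_mul, inv_mul_cancel, C.act_one, map_zero] at h3)
  have h3 : ∑ᶠ g, C.part q 1 (C.act q g⁻¹ w) = 0 := omc_ext fun x hx => by
    have h4 := (evO (G := G) (q := q) x).map_finsum hfin
    refine h4.trans ?_
    have h5 : G.avg χ w.1 x = ∑ᶠ g, G.tr (χ g⁻¹)⁻¹ g⁻¹ w.1 x :=
      (finsum_comp_equiv (Equiv.inv Γ) (f := fun g => G.tr (χ g)⁻¹ g w.1 x)).symm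
    have hfin2 : {g : Γ | G.tr (χ g⁻¹)⁻¹ g⁻¹ w.1 x ≠ 0}.Finite :=
      ((avg_locFin (χ := χ) w.2).finite hx).preimage (f := fun g : Γ => g⁻¹) inv_injective.injOn
    have h6 := (smulAddHom ℝ (E [⋀^Fin q]→L[ℝ] ℝ) (φ (G.act 1⁻¹ x))).map_finsum hfin2
    rw [← h5, hw x hx, map_zero] at h6
    exact h6.symm
  have h4 := T.toAddMonoidHom.map_finsum (C.part_finite q w)
  have h5 := T.toAddMonoidHom.map_finsum hfin
  rw [h3, map_zero] at h5
  rw [C.part_sum] at h4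
  refine h4.trans (Eq.trans ?_ h5.symm)
  exact finsum_congr h2

/-- Vanishing of cohomology for a group acting with reduction theory. -/
theorem cocycle_eq_cob [IsAddTorsionFree L] [Nontrivial L] {k m : ℕ} {τ w₀}
    (hχ : G.IsOrientation (k + 1 + (m + 1)) τ w₀ χ)
    (hX : CompactCohomology G.X (k + 1 + (m + 1)))
    {Frame : List (L × L) → Prop} (hT : G.TitsData (k + 1) χ Frame) {c : List Γ → ℝ}
    (hc : ∀ l, l.length = m + 1 + 2 → cob c l = 0)
    (hinv : ∀ g l, l.length = m + 1 + 1 → c (l.map (g * ·)) = c l) :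
    ∃ b : List Γ → ℝ, (∀ g l, l.length = m + 1 → b (l.map (g * ·)) = b l) ∧
      ∀ l, l.length = m + 1 + 1 → cob b l = c l := by
  obtain ⟨φ, hφ, -⟩ := G.exists_translates
  let C := G.complex χ hφ
  refine C.exists_cob_of_functionals (n := k + 1) (m := m) hχ.act w₀ hχ.one (fun w => ?_)
    (fun r hr w hw => ?_) (fun T hTi hTd => ?_) hc hinv
  · rw [hχ.ker]
    exact ⟨fun ⟨η, h1, h2⟩ => ⟨⟨η, h1⟩, Subtype.ext (funext h2)⟩,
      fun ⟨v, hv⟩ => ⟨v.1, v.2, fun x => congrFun (congrArg Subtype.val hv) x⟩⟩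
  · obtain ⟨η, h1, h2⟩ := hX.exact (r + 1) (by omega) w.1 w.2
      fun x => congrFun (congrArg Subtype.val hw) x
    exact ⟨⟨η, h1⟩, Subtype.ext (funext h2)⟩
  · refine C.exists_extension (M := G.X → E [⋀^Fin (k + 1 + 1)]→L[ℝ] ℝ)
      (fun w x => G.avg χ w.1 x) (fun v w => funext fun x => avg_add v.2 w.2 x.2)
      (fun r w => funext fun x => avg_smul r w.2 x.2)
      (fun g w => funext fun x => avg_tr g w.1 x) T fun w hw => ?_
    obtain ⟨β, hβ⟩ := exists_avg_eq_zero hT (w := w) fun x hx => congrFun hw ⟨x, hx⟩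
    have h1 := functional_eq_zero G χ hφ hTi hβ
    have h2 := hTd _ ⟨k, rfl, β, rfl⟩
    have h3 := T.map_sub w (omcD G.X k β)
    exact (sub_eq_zero.1 (h3.symm.trans h1)).trans h2

end

end ReductionData

end

/-- A transference theorem: a lattice in a quadratic space is generated by short vectors as soon as
its dual has no short vectors. -/
theorem le_closure_of_dual {V : Type*} [AddCommGroup V] [Module ℝ V] [FiniteDimensional ℝ V]
    (M : AddSubgroup V) {δ : ℝ} (hδ : 0 < δ) : ∀ (N : ℕ) (B : V →ₗ[ℝ] V →ₗ[ℝ] ℝ)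
    (_ : ∀ v w, B v w = B w v) (_ : ∀ v, 0 ≤ B v v)
    (_ : Module.finrank ℝ (LinearMap.range B) ≤ N)
    (_ : ∀ c, ((fun v => B v) '' {v | v ∈ M ∧ B v v ≤ c}).Finite)
    (_ : ∀ β, (∀ v ∈ M, ∃ k : ℤ, B v β = k) → B β β ≠ 0 → δ ≤ B β β),
    M ≤ AddSubgroup.closure {v | v ∈ M ∧ B v v ≤ (4 / 3) ^ N / δ} := by
  intro N
  induction N with
  | zero =>
    intro B _ _ hr _ _ v hv
    refine AddSubgroup.subset_closure ⟨hv, ?_⟩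
    have h1 : LinearMap.range B = ⊥ := Submodule.finrank_eq_zero.1 (by omega)
    have h2 : B = 0 := LinearMap.range_eq_bot.1 h1
    rw [h2]
    simp only [LinearMap.zero_apply]
    positivity
  | succ N ih =>
    intro B hs hp hr hf hD
    by_cases h0 : ∀ v ∈ M, B v v = 0
    · exact fun v hv => AddSubgroup.subset_closure ⟨hv, by rw [h0 v hv]; positivity⟩
    push Not at h0
    obtain ⟨v₀, hv₀, hv₀'⟩ := h0
    obtain ⟨b, hb, hb0, hmin⟩ : ∃ b ∈ M, 0 < B b b ∧ ∀ v ∈ M, 0 < B v v → B b b ≤ B v v := by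
      have hfin : ((fun v => B v v) '' {v | v ∈ M ∧ 0 < B v v ∧ B v v ≤ B v₀ v₀}).Finite := by
        have h1 : ∀ v w, B v = B w → B v v = B w w := fun v w h => by
          rw [h, hs w v, h]
        have h2 := hf (B v₀ v₀)
        refine (h2.image fun f => Classical.epsilon fun r => ∃ v, B v = f ∧ B v v = r).subset ?_
        rintro _ ⟨v, ⟨hv, -, hvc⟩, rfl⟩
        refine ⟨B v, ⟨v, ⟨hv, hvc⟩, rfl⟩, ?_⟩
        obtain ⟨w, hw, hw'⟩ := Classical.epsilon_spec (p := fun r => ∃ w, B w = B v ∧ B w w = r)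
          ⟨_, v, rfl, rfl⟩
        exact hw'.symm.trans (h1 w v hw)
      obtain ⟨-, ⟨b, ⟨hb, hb0, hb1⟩, rfl⟩, hm⟩ := hfin.exists_minimal
        ⟨_, v₀, ⟨hv₀, (hp v₀).lt_of_ne hv₀'.symm, le_rfl⟩, rfl⟩
      refine ⟨b, hb, hb0, fun v hv hv0 => ?_⟩
      by_contra! h
      exact h.not_ge (hm ⟨v, ⟨hv, hv0, h.le.trans hb1⟩, rfl⟩ h.le)
    set m := B b b with hm
    let B' : V →ₗ[ℝ] V →ₗ[ℝ] ℝ := B - (B b).smulRight (m⁻¹ • B b)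
    have hB' : ∀ v w, B' v w = B v w - B v b * B w b / m := fun v w => by
      change B v w - B b v * (m⁻¹ * B b w) = _
      rw [hs b v, hs b w]; ring
    have hs' : ∀ v w, B' v w = B' w v := fun v w => by rw [hB', hB', hs v w]; ring
    have hexp : ∀ v (t : ℝ), B (v - t • b) (v - t • b) = B' v v + (B v b / m - t) ^ 2 * m :=
      fun v t => by
        rw [hB']
        simp only [map_sub, LinearMap.sub_apply, map_smul, LinearMap.smul_apply, smul_eq_mul,
          hs b v, ← hm]
        field_simp
        ring
    have hp' : ∀ v, 0 ≤ B' v v := fun v => by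
      have := hexp v (B v b / m)
      rw [sub_self] at this
      have h2 := hp (v - (B v b / m) • b)
      rw [this] at h2
      linarith
    have hcs : ∀ v w, B' v v = 0 → B' v w = 0 := fun v w hv => by
      have := LinearMap.BilinForm.apply_sq_le_of_symm B' hp' ⟨fun v w => hs' v w⟩ v w
      rw [hv, zero_mul] at this
      exact pow_eq_zero_iff two_ne_zero |>.1 (le_antisymm this (sq_nonneg _))
    have hsize : ∀ v ∈ M, ∃ k : ℤ, v - k • b ∈ M ∧
        B (v - k • b) (v - k • b) ≤ B' v v + m / 4 ∧ B' v v ≤ B (v - k • b) (v - k • b) := by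
      intro v hv
      refine ⟨round (B v b / m), M.sub_mem hv (M.zsmul_mem hb _), ?_⟩
      have h1 := hexp v (round (B v b / m) : ℤ)
      rw [Int.cast_smul_eq_zsmul] at h1
      have h2 := abs_sub_round (B v b / m)
      have h3 := sq_le_sq' (neg_le_of_abs_le h2) (le_of_abs_le h2)
      rw [h1]
      constructor <;> nlinarith [sq_nonneg (B v b / m - round (B v b / m))]
    have hbB : ∀ v (k : ℤ), B' (v - k • b) = B' v := fun v k => by
      have : B' b = 0 := by
        ext w
        rw [hB', ← hm, LinearMap.zero_apply, hs w b]
        field_simp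
        ring
      rw [map_sub, map_zsmul, this, smul_zero, sub_zero]
    have hr' : Module.finrank ℝ (LinearMap.range B') ≤ N := by
      have hlt : LinearMap.range B' < LinearMap.range B := by
        refine lt_of_le_of_ne ?_ fun h => ?_
        · rintro _ ⟨v, rfl⟩
          refine ⟨v - (B v b / m) • b, ?_⟩
          ext w
          rw [hB', map_sub, map_smul, LinearMap.sub_apply, LinearMap.smul_apply, hs b w,
            smul_eq_mul]
          ring
        · have : B b ∈ LinearMap.range B' := h ▸ ⟨b, rfl⟩
          obtain ⟨v, hv⟩ := this
          have h1 : B' v b = m := by rw [hv]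
          rw [hB', ← hm] at h1
          field_simp at h1
          linarith
      have := Submodule.finrank_lt_finrank_of_lt hlt
      omega
    have hf' : ∀ c, ((fun v => B' v) '' {v | v ∈ M ∧ B' v v ≤ c}).Finite := fun c => by
      refine ((hf (c + m / 4)).image fun f => f - (f b * m⁻¹) • B b).subset ?_
      rintro _ ⟨v, ⟨hv, hvc⟩, rfl⟩
      obtain ⟨k, h1, h2, -⟩ := hsize v hv
      refine ⟨B (v - k • b), ⟨_, ⟨h1, by linarith⟩, rfl⟩, ?_⟩
      dsimp only
      rw [← hbB v k]
      ext w
      rw [hB', LinearMap.sub_apply, LinearMap.smul_apply, hs b w, smul_eq_mul]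
      ring
    have hD' : ∀ β, (∀ v ∈ M, ∃ k : ℤ, B' v β = k) → B' β β ≠ 0 → δ ≤ B' β β := fun β h1 h2 => by
      have h3 : ∀ v, B v (β - (B β b / m) • b) = B' v β := fun v => by
        rw [hB', map_sub, map_smul, smul_eq_mul]; ring
      have h4 : B (β - (B β b / m) • b) (β - (B β b / m) • b) = B' β β := by
        rw [hexp, sub_self]; ring
      have := hD (β - (B β b / m) • b) (fun v hv => by rw [h3]; exact h1 v hv) (by rwa [h4])
      rwa [h4] at this
    have key := ih B' hs' hp' hr' hf' hD'
    set R := (4 / 3 : ℝ) ^ N / δ with hR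
    have hR0 : 0 < R := by positivity
    have hmR : m ≤ 4 / 3 * R := by
      by_cases h1 : ∀ v ∈ M, B' v v ≤ R → B' v v = 0
      · have h2 : ∀ v ∈ M, B' v = 0 := fun v hv => by
          have : AddSubgroup.closure {v | v ∈ M ∧ B' v v ≤ R} ≤ B'.toAddMonoidHom.ker := by
            rw [AddSubgroup.closure_le]
            exact fun v hv => LinearMap.ext fun w => hcs v w (h1 v hv.1 hv.2)
          exact this (key hv)
        have h3 := hD (m⁻¹ • b) (fun v hv => by
          obtain ⟨k, h4, h5, -⟩ := hsize v hv
          have h6 : B (v - k • b) (v - k • b) = 0 := by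
            by_contra h
            have := hmin _ h4 ((hp _).lt_of_ne (Ne.symm h))
            rw [h2 v hv, LinearMap.zero_apply] at h5
            linarith
          have h7 := hexp v k
          rw [Int.cast_smul_eq_zsmul, h6, h2 v hv, LinearMap.zero_apply, zero_add] at h7
          refine ⟨k, ?_⟩
          have h8 : B v b / m - k = 0 := by
            rcases mul_eq_zero.1 h7.symm with h | h
            · exact pow_eq_zero_iff two_ne_zero |>.1 h
            · exact absurd h hb0.ne'
          rw [map_smul, smul_eq_mul, mul_comm, ← div_eq_mul_inv]
          linarith) (by
            rw [map_smul, map_smul, LinearMap.smul_apply, ← hm]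
            simp only [smul_eq_mul]
            positivity)
        rw [map_smul, map_smul, LinearMap.smul_apply, ← hm] at h3
        simp only [smul_eq_mul] at h3
        rw [inv_mul_cancel₀ hb0.ne', mul_one, le_inv_comm₀ hδ hb0] at h3
        have h4 : (1 : ℝ) ≤ (4 / 3) ^ N := one_le_pow₀ (by norm_num)
        have h5 : δ⁻¹ ≤ R := by
          rw [hR, div_eq_mul_inv]
          nlinarith [inv_pos.2 hδ]
        linarith
      · push Not at h1
        obtain ⟨v, hv, hvR, hv0⟩ := h1
        obtain ⟨k, h4, h5, h6⟩ := hsize v hv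
        have := hmin _ h4 (((hp' v).lt_of_ne hv0.symm).trans_le h6)
        linarith
    have hpow : (4 / 3 : ℝ) ^ (N + 1) / δ = 4 / 3 * R := by rw [hR]; ring
    rw [hpow]
    refine key.trans ((AddSubgroup.closure_le _).2 fun v hv => ?_)
    obtain ⟨k, h4, h5, -⟩ := hsize v hv.1
    have h6 := hv.2
    have h7 : v = (v - k • b) + k • b := by abel
    rw [h7]
    exact AddSubgroup.add_mem _ (AddSubgroup.subset_closure ⟨h4, by linarith⟩)
      (AddSubgroup.zsmul_mem _ (AddSubgroup.subset_closure (k := {v | v ∈ M ∧ B v v ≤ 4 / 3 * R})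
        ⟨hb, hmR⟩) k)

section HermitianForms

open Matrix
open scoped ComplexOrder

variable {l : Type*} [Fintype l]

/-- The real part of the sesquilinear form with matrix `A` on row vectors. -/
def hermRe (A : Matrix l l ℂ) (u v : l → ℂ) : ℝ := (u ⬝ᵥ A *ᵥ star v).re

lemma hermRe_add_left (A : Matrix l l ℂ) (u u' v : l → ℂ) :
    hermRe A (u + u') v = hermRe A u v + hermRe A u' v := by
  simp [hermRe, add_dotProduct]

lemma hermRe_smul_left (A : Matrix l l ℂ) (c : ℝ) (u v : l → ℂ) :
    hermRe A (c • u) v = c * hermRe A u v := by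
  simp [hermRe, smul_dotProduct]

lemma hermRe_comm {A : Matrix l l ℂ} (hA : A.IsHermitian) (u v : l → ℂ) :
    hermRe A u v = hermRe A v u := by
  have h : star (u ⬝ᵥ A *ᵥ star v) = v ⬝ᵥ A *ᵥ star u := by
    rw [← star_dotProduct_star, star_mulVec, star_star, hA.eq, dotProduct_mulVec]
  rw [hermRe, hermRe, ← h]
  simp

lemma hermRe_add_right {A : Matrix l l ℂ} (hA : A.IsHermitian) (u v v' : l → ℂ) :
    hermRe A u (v + v') = hermRe A u v + hermRe A u v' := by
  rw [hermRe_comm hA, hermRe_add_left, hermRe_comm hA v, hermRe_comm hA v']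

lemma hermRe_smul_right {A : Matrix l l ℂ} (hA : A.IsHermitian) (c : ℝ) (u v : l → ℂ) :
    hermRe A u (c • v) = c * hermRe A u v := by
  rw [hermRe_comm hA, hermRe_smul_left, hermRe_comm hA]

lemma hermRe_smul_self (A : Matrix l l ℂ) (c : ℂ) (u : l → ℂ) :
    hermRe A (c • u) (c • u) = ‖c‖ ^ 2 * hermRe A u u := by
  have : (c • u) ⬝ᵥ A *ᵥ star (c • u) = ((‖c‖ ^ 2 : ℝ) : ℂ) * (u ⬝ᵥ A *ᵥ star u) := by
    rw [star_smul, mulVec_smul, smul_dotProduct, dotProduct_smul, smul_smul, smul_eq_mul]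
    congr 1
    rw [Complex.star_def, Complex.mul_conj, Complex.normSq_eq_norm_sq]
  rw [hermRe, this, Complex.re_ofReal_mul, hermRe]

lemma hermRe_nonneg {A : Matrix l l ℂ} (hA : A.PosSemidef) (u : l → ℂ) : 0 ≤ hermRe A u u := by
  have := hA.dotProduct_mulVec_nonneg (star u)
  rw [star_star] at this
  exact (Complex.le_def.1 this).1

lemma hermRe_pos {A : Matrix l l ℂ} (hA : A.PosDef) {u : l → ℂ} (hu : u ≠ 0) :
    0 < hermRe A u u := by
  have := hA.dotProduct_mulVec_pos (x := star u) (by simpa using hu)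
  rw [star_star] at this
  exact (Complex.lt_def.1 this).1

lemma hermRe_conj (g A : Matrix l l ℂ) (u v : l → ℂ) :
    hermRe (g * A * gᴴ) u v = hermRe A (u ᵥ* g) (v ᵥ* g) := by
  rw [hermRe, hermRe, star_vecMul, ← mulVec_mulVec, ← mulVec_mulVec, dotProduct_mulVec]

lemma hermRe_transpose (A : Matrix l l ℂ) (u v : l → ℂ) :
    hermRe Aᵀ u v = hermRe A (star v) (star u) := by
  rw [hermRe, hermRe, star_star, mulVec_transpose, dotProduct_comm, ← dotProduct_mulVec]

variable [DecidableEq l]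

lemma two_re_dotProduct_le {A : Matrix l l ℂ} (hA : A.PosDef) (u z : l → ℂ) :
    2 * (u ⬝ᵥ z).re ≤ hermRe A u u + hermRe A⁻¹ (star z) (star z) := by
  have hu : IsUnit A.det := (isUnit_iff_isUnit_det _).1 hA.isUnit
  set ζ : l → ℂ := star (A⁻¹ *ᵥ z) with hζ
  have h1 : A *ᵥ star ζ = z := by
    rw [hζ, star_star, mulVec_mulVec, mul_nonsing_inv _ hu, one_mulVec]
  have h2 : hermRe A u ζ = (u ⬝ᵥ z).re := by rw [hermRe, h1]
  have h3 : hermRe A ζ ζ = hermRe A⁻¹ (star z) (star z) := by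
    rw [hermRe, h1, hζ, star_mulVec, ← dotProduct_mulVec, hermRe, star_star, hA.inv.1.eq]
  have h4 := hermRe_nonneg hA.posSemidef (u + (-1 : ℝ) • ζ)
  rw [hermRe_add_left, hermRe_add_right hA.1, hermRe_add_right hA.1, hermRe_smul_right hA.1,
    hermRe_smul_left, hermRe_smul_left, hermRe_smul_right hA.1, hermRe_comm hA.1 ζ u, h2, h3] at h4
  linarith

lemma two_re_dotProduct_eq {A : Matrix l l ℂ} (hA : A.PosDef) (z : l → ℂ) :
    2 * (star (A⁻¹ *ᵥ z) ⬝ᵥ z).re = hermRe A (star (A⁻¹ *ᵥ z)) (star (A⁻¹ *ᵥ z)) +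
      hermRe A⁻¹ (star z) (star z) := by
  have hu : IsUnit A.det := (isUnit_iff_isUnit_det _).1 hA.isUnit
  have h1 : A *ᵥ (A⁻¹ *ᵥ z) = z := by rw [mulVec_mulVec, mul_nonsing_inv _ hu, one_mulVec]
  rw [hermRe, star_star, h1, star_mulVec, ← dotProduct_mulVec, hermRe, star_star, hA.inv.1.eq]
  ring

end HermitianForms

section SiegelChart

open Matrix
open scoped ComplexOrder

variable {m : Type*} [Fintype m] [DecidableEq m]

/-- The positive definite symplectic Hermitian matrix with coordinates `(S, Y)`. -/
noncomputable def siegelForm (x : Matrix m m ℂ × Matrix m m ℂ) : Matrix (m ⊕ m) (m ⊕ m) ℂ :=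
  fromBlocks (x.2ᵀ + x.1 * x.2⁻¹ * x.1ᴴ) (x.1 * x.2⁻¹) (x.2⁻¹ * x.1ᴴ) x.2⁻¹

/-- The coordinates `(S, Y)` of a positive definite symplectic Hermitian matrix. -/
noncomputable def siegelCoord (H : Matrix (m ⊕ m) (m ⊕ m) ℂ) : Matrix m m ℂ × Matrix m m ℂ :=
  (H.toBlocks₁₂ * H.toBlocks₂₂⁻¹, H.toBlocks₂₂⁻¹)

/-- A shear. -/
def siegelShear (S : Matrix m m ℂ) : Matrix (m ⊕ m) (m ⊕ m) ℂ := fromBlocks 1 S 0 1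

lemma siegelForm_eq (x : Matrix m m ℂ × Matrix m m ℂ) :
    siegelForm x = siegelShear x.1 * fromBlocks x.2ᵀ 0 0 x.2⁻¹ * (siegelShear x.1)ᴴ := by
  simp [siegelForm, siegelShear, fromBlocks_multiply, fromBlocks_conjTranspose, mul_assoc]

lemma siegelShear_mem {S : Matrix m m ℂ} (hS : S.IsSymm) :
    siegelShear S ∈ symplecticGroup m ℂ := by
  simp [siegelShear, SymplecticGroup.fromBlocks_mem_iff, hS.eq]

lemma Matrix.PosDef.isUnit_det' {Y : Matrix m m ℂ} (hY : Y.PosDef) : IsUnit Y.det :=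
  (isUnit_iff_isUnit_det _).1 hY.isUnit

lemma isUnit_siegelShear (S : Matrix m m ℂ) : IsUnit (siegelShear S) := by
  rw [isUnit_iff_isUnit_det, siegelShear, det_fromBlocks_zero₂₁]
  simp

lemma posDef_fromBlocks_diag {A B : Matrix m m ℂ} (hA : A.PosDef) (hB : B.PosDef) :
    (fromBlocks A 0 0 B).PosDef := by
  refine .of_dotProduct_mulVec_pos ?_ fun x hx => ?_
  · rw [IsHermitian, fromBlocks_conjTranspose, hA.1.eq, hB.1.eq]; simp
  · rw [fromBlocks_mulVec]
    have : star x ⬝ᵥ Sum.elim (A *ᵥ (x ∘ Sum.inl) + 0 *ᵥ (x ∘ Sum.inr))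
        (0 *ᵥ (x ∘ Sum.inl) + B *ᵥ (x ∘ Sum.inr)) =
        star (x ∘ Sum.inl) ⬝ᵥ A *ᵥ (x ∘ Sum.inl) + star (x ∘ Sum.inr) ⬝ᵥ B *ᵥ (x ∘ Sum.inr) := by
      simp [dotProduct, Fintype.sum_sum_type]
    rw [this]
    by_cases h : x ∘ Sum.inl = 0
    · have h' : x ∘ Sum.inr ≠ 0 := fun h' => hx <| by
        ext (i | i)
        · exact congrFun h i
        · exact congrFun h' i
      exact add_pos_of_nonneg_of_pos (hA.posSemidef.dotProduct_mulVec_nonneg _)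
        (hB.dotProduct_mulVec_pos h')
    · exact add_pos_of_pos_of_nonneg (hA.dotProduct_mulVec_pos h)
        (hB.posSemidef.dotProduct_mulVec_nonneg _)

lemma posDef_conj {l : Type*} [Fintype l] [DecidableEq l] {g H : Matrix l l ℂ} (hg : IsUnit g)
    (hH : H.PosDef) : (g * H * gᴴ).PosDef :=
  (IsUnit.posDef_star_right_conjugate_iff hg).2 hH

lemma conjTranspose_mem_symplecticGroup {g : Matrix (m ⊕ m) (m ⊕ m) ℂ}
    (hg : g ∈ symplecticGroup m ℂ) : gᴴ ∈ symplecticGroup m ℂ := by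
  have := SymplecticGroup.map_mem (hA := SymplecticGroup.transpose_mem hg) (f := starRingEnd ℂ)
  exact this

lemma posDef_siegelForm {x : Matrix m m ℂ × Matrix m m ℂ} (hx : x.2.PosDef) :
    (siegelForm x).PosDef := by
  rw [siegelForm_eq]
  exact posDef_conj (isUnit_siegelShear _) (posDef_fromBlocks_diag hx.transpose hx.inv)

lemma siegelForm_mem {x : Matrix m m ℂ × Matrix m m ℂ} (hS : x.1.IsSymm) (hx : x.2.PosDef) :
    siegelForm x ∈ symplecticGroup m ℂ := by
  rw [siegelForm_eq]
  refine mul_mem (mul_mem (siegelShear_mem hS) ?_)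
    (conjTranspose_mem_symplecticGroup (siegelShear_mem hS))
  simp [SymplecticGroup.fromBlocks_mem_iff, mul_nonsing_inv _ hx.isUnit_det']

lemma siegelCoord_siegelForm {x : Matrix m m ℂ × Matrix m m ℂ} (hx : x.2.PosDef) :
    siegelCoord (siegelForm x) = x := by
  have := hx.isUnit_det'
  simp [siegelCoord, siegelForm, mul_assoc, nonsing_inv_nonsing_inv _ this,
    nonsing_inv_mul _ this]

lemma posDef_toBlocks₂₂ {H : Matrix (m ⊕ m) (m ⊕ m) ℂ} (hH : H.PosDef) :
    H.toBlocks₂₂.PosDef :=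
  hH.submatrix (e := Sum.inr) Sum.inr_injective

lemma siegelCoord_aux {H : Matrix (m ⊕ m) (m ⊕ m) ℂ} (hH : H.PosDef)
    (hs : H ∈ symplecticGroup m ℂ) :
    (siegelCoord H).1.IsSymm ∧ (siegelCoord H).2.PosDef ∧ siegelForm (siegelCoord H) = H := by
  have hR := posDef_toBlocks₂₂ hH
  set P := H.toBlocks₁₁ with hP
  set Q := H.toBlocks₁₂ with hQ
  set R := H.toBlocks₂₂ with hR'
  have hu : IsUnit R.det := hR.isUnit_det'
  have huT : IsUnit Rᵀ.det := by rwa [det_transpose]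
  have hRR : R⁻¹ᴴ = R⁻¹ := hR.inv.1.eq
  have h21 : H.toBlocks₂₁ = Qᴴ := by
    ext i j
    have := congrFun (congrFun hH.1.eq (Sum.inr i)) (Sum.inl j)
    simpa [toBlocks₂₁, hQ, toBlocks₁₂] using this.symm
  have hHb : H = fromBlocks P Q Qᴴ R := by
    rw [← h21, fromBlocks_toBlocks]
  have hPH : Pᴴ = P := by
    ext i j
    have := congrFun (congrFun hH.1.eq (Sum.inl i)) (Sum.inl j)
    simpa [hP, toBlocks₁₁] using this
  rw [hHb, SymplecticGroup.fromBlocks_mem_iff] at hs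
  obtain ⟨-, h2, h3⟩ := hs
  have hS : (Q * R⁻¹)ᵀ = Q * R⁻¹ := by
    rw [transpose_mul, transpose_nonsing_inv]
    calc Rᵀ⁻¹ * Qᵀ = Rᵀ⁻¹ * (Qᵀ * R) * R⁻¹ := by
          rw [mul_assoc, mul_assoc, mul_nonsing_inv _ hu, mul_one]
      _ = Q * R⁻¹ := by
          rw [h2, ← mul_assoc, nonsing_inv_mul _ huT, one_mul]
  refine ⟨hS, hR.inv, ?_⟩
  rw [siegelForm]
  conv_rhs => rw [hHb]
  simp only [siegelCoord]
  have h4 : R⁻¹⁻¹ = R := nonsing_inv_nonsing_inv _ hu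
  rw [h4]
  have hSH : (Q * R⁻¹)ᴴ = R⁻¹ * Qᴴ := by rw [conjTranspose_mul, hRR]
  have hP' : P = R⁻¹ᵀ + Q * R⁻¹ * Qᴴ := by
    have h5 : Pᵀ * R = 1 + Qᴴᵀ * Q := by rw [← h3]; abel
    have h6 : Pᵀ = R⁻¹ + Qᴴᵀ * (Q * R⁻¹) := by
      calc Pᵀ = Pᵀ * R * R⁻¹ := by rw [mul_assoc, mul_nonsing_inv _ hu, mul_one]
        _ = _ := by rw [h5, add_mul, one_mul, mul_assoc]
    have h7 := congrArg transpose h6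
    rw [transpose_transpose, transpose_add, transpose_mul, hS, transpose_transpose] at h7
    exact h7
  congr 1
  · rw [hSH, mul_assoc Q R⁻¹ R, nonsing_inv_mul _ hu, mul_one, ← mul_assoc]
    exact hP'.symm
  · rw [mul_assoc, nonsing_inv_mul _ hu, mul_one]
  · rw [hSH, ← mul_assoc, mul_nonsing_inv _ hu, one_mul]

/-- The symplectic form on row vectors. -/
def sympl {R : Type*} [CommRing R] (v w : m ⊕ m → R) : R := w ⬝ᵥ J m R *ᵥ v

lemma inv_eq_of_mem_symplecticGroup {R : Type*} [CommRing R] {H : Matrix (m ⊕ m) (m ⊕ m) R}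
    (hs : H ∈ symplecticGroup m R) : H⁻¹ = -J m R * Hᵀ * J m R :=
  SymplecticGroup.inv_eq_symplectic_inv H hs

lemma hermRe_inv_eq {H : Matrix (m ⊕ m) (m ⊕ m) ℂ} (hs : H ∈ symplecticGroup m ℂ)
    (z : m ⊕ m → ℂ) :
    hermRe H⁻¹ (star z) (star z) = hermRe H (J m ℂ *ᵥ z) (J m ℂ *ᵥ z) := by
  have hJ : (J m ℂ)ᴴ = -J m ℂ := by
    rw [conjTranspose, J_transpose]
    ext i j
    rcases i with i | i <;> rcases j with j | j <;> simp [J, Matrix.one_apply, apply_ite]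
  have h1 : H⁻¹ = J m ℂ * Hᵀ * (J m ℂ)ᴴ := by
    rw [inv_eq_of_mem_symplecticGroup hs, hJ]; simp
  have h2 : star z ᵥ* J m ℂ = - star (J m ℂ *ᵥ z) := by
    rw [star_mulVec, hJ, vecMul_neg, neg_neg]
  rw [h1, hermRe_conj, hermRe_transpose, h2, star_neg, star_star,
    ← neg_one_smul ℂ, hermRe_smul_self]
  simp

lemma two_norm_sympl_le {H : Matrix (m ⊕ m) (m ⊕ m) ℂ} (hH : H.PosDef)
    (hs : H ∈ symplecticGroup m ℂ) (v w : m ⊕ m → ℂ) :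
    2 * ‖sympl v w‖ ≤ hermRe H v v + hermRe H w w := by
  obtain ⟨c, hc, hc'⟩ : ∃ c : ℂ, ‖c‖ = 1 ∧ c * sympl v w = ‖sympl v w‖ := by
    by_cases h : sympl v w = 0
    · exact ⟨1, by simp, by simp [h]⟩
    · refine ⟨‖sympl v w‖ / sympl v w, ?_, div_mul_cancel₀ _ h⟩
      rw [norm_div, Complex.norm_real, norm_norm, div_self (norm_ne_zero_iff.2 h)]
  have h1 := two_re_dotProduct_le hH (c • w) (J m ℂ *ᵥ v)
  rw [smul_dotProduct, smul_eq_mul, ← sympl, hc', Complex.ofReal_re, hermRe_smul_self, hc,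
    one_pow, one_mul, hermRe_inv_eq hs, mulVec_mulVec, J_squared, neg_mulVec, one_mulVec,
    ← neg_one_smul ℂ v, hermRe_smul_self] at h1
  simp only [norm_neg, norm_one, one_pow, one_mul] at h1
  linarith

end SiegelChart

section SiegelConvex

open Matrix
open scoped ComplexOrder

variable {m : Type*} [Fintype m] [DecidableEq m]

lemma vecMul_siegelShear (S : Matrix m m ℂ) (v : m ⊕ m → ℂ) :
    v ᵥ* siegelShear S = Sum.elim (v ∘ Sum.inl) ((v ∘ Sum.inl) ᵥ* S + v ∘ Sum.inr) := by
  rw [siegelShear, vecMul_fromBlocks]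
  simp

lemma hermRe_fromBlocks (A B : Matrix m m ℂ) (a b : m → ℂ) :
    hermRe (fromBlocks A 0 0 B) (Sum.elim a b) (Sum.elim a b) = hermRe A a a + hermRe B b b := by
  have : star (Sum.elim a b) = Sum.elim (star a) (star b) := by
    ext (i | i) <;> simp
  rw [hermRe, this, fromBlocks_mulVec]
  simp [hermRe, Sum.elim_comp_inl, Sum.elim_comp_inr]

lemma hermRe_siegelForm (x : Matrix m m ℂ × Matrix m m ℂ) (v : m ⊕ m → ℂ) :
    hermRe (siegelForm x) v v = hermRe x.2ᵀ (v ∘ Sum.inl) (v ∘ Sum.inl) +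
      hermRe x.2⁻¹ ((v ∘ Sum.inl) ᵥ* x.1 + v ∘ Sum.inr) ((v ∘ Sum.inl) ᵥ* x.1 + v ∘ Sum.inr) := by
  rw [siegelForm_eq, hermRe_conj, vecMul_siegelShear, hermRe_fromBlocks]

lemma hermRe_add_smul (A B : Matrix m m ℂ) (s t : ℝ) (u v : m → ℂ) :
    hermRe (s • A + t • B) u v = s * hermRe A u v + t * hermRe B u v := by
  simp [hermRe, add_mulVec, smul_mulVec, dotProduct_add, dotProduct_smul]

lemma posDef_add_smul {A B : Matrix m m ℂ} (hA : A.PosDef) (hB : B.PosDef) {s t : ℝ}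
    (hs : 0 ≤ s) (ht : 0 ≤ t) (hst : s + t = 1) : (s • A + t • B).PosDef := by
  rcases hs.eq_or_lt with rfl | hs
  · have : t = 1 := by linarith
    subst this
    simpa using hB
  · exact (hA.smul hs).add_posSemidef (hB.posSemidef.smul ht)

lemma hermRe_siegelForm_convex {x y : Matrix m m ℂ × Matrix m m ℂ} (hx : x.2.PosDef)
    (hy : y.2.PosDef) {s t : ℝ} (hs : 0 ≤ s) (ht : 0 ≤ t) (hst : s + t = 1) (v : m ⊕ m → ℂ) :
    hermRe (siegelForm (s • x + t • y)) v v ≤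
      s * hermRe (siegelForm x) v v + t * hermRe (siegelForm y) v v := by
  have hc := posDef_add_smul hx hy hs ht hst
  rw [hermRe_siegelForm, hermRe_siegelForm x, hermRe_siegelForm y]
  simp only [Prod.fst_add, Prod.snd_add, Prod.smul_fst, Prod.smul_snd, transpose_add,
    transpose_smul, hermRe_add_smul]
  set a := v ∘ Sum.inl
  set b := v ∘ Sum.inr
  set Z := s • x.2 + t • y.2 with hZ
  have hu : a ᵥ* (s • x.1 + t • y.1) + b = s • (a ᵥ* x.1 + b) + t • (a ᵥ* y.1 + b) := by
    rw [vecMul_add, vecMul_smul, vecMul_smul, smul_add, smul_add]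
    nth_rewrite 1 [← one_smul ℝ b]
    rw [← hst, add_smul]
    abel
  rw [hu]
  set u₁ := a ᵥ* x.1 + b
  set u₂ := a ᵥ* y.1 + b
  set z := Z⁻¹ *ᵥ star (s • u₁ + t • u₂) with hz
  have h1 := two_re_dotProduct_le hx.inv u₁ z
  have h2 := two_re_dotProduct_le hy.inv u₂ z
  have h3 := two_re_dotProduct_eq hc.inv z
  rw [nonsing_inv_nonsing_inv _ hx.isUnit_det'] at h1
  rw [nonsing_inv_nonsing_inv _ hy.isUnit_det'] at h2
  rw [nonsing_inv_nonsing_inv _ hc.isUnit_det'] at h3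
  have h4 : star (Z *ᵥ z) = s • u₁ + t • u₂ := by
    rw [hz, mulVec_mulVec, mul_nonsing_inv _ hc.isUnit_det', one_mulVec, star_star]
  rw [h4, hermRe_add_smul, add_dotProduct, smul_dotProduct, smul_dotProduct, Complex.add_re,
    Complex.smul_re, Complex.smul_re, smul_eq_mul, smul_eq_mul] at h3
  have h5 := mul_le_mul_of_nonneg_left h1 hs
  have h6 := mul_le_mul_of_nonneg_left h2 ht
  linarith

end SiegelConvex

section InverseDifference

open Matrix
open scoped ComplexOrder

variable {m : Type*} [Fintype m] [DecidableEq m]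

lemma trace_conj_nonneg {A : Matrix m m ℂ} (hA : A.PosSemidef) (D : Matrix m m ℂ) :
    0 ≤ (Dᴴ * A * D).trace :=
  (hA.conjTranspose_mul_mul_same D).trace_nonneg

lemma eq_zero_of_mul_eq_neg {A B D : Matrix m m ℂ} (hA : A.PosDef) (hB : B.PosDef)
    (h : A * D = -(D * B)) : D = 0 := by
  have h1 := trace_conj_nonneg hA.posSemidef D
  have h2 := trace_conj_nonneg hB.posSemidef Dᴴ
  have h3 : (Dᴴ * A * D).trace = -(Dᴴᴴ * B * Dᴴ).trace := by
    rw [mul_assoc, h, mul_neg, trace_neg, conjTranspose_conjTranspose, trace_mul_comm]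
  have h4 : (Dᴴ * A * D).trace = 0 := le_antisymm (by rw [h3]; simpa using h2) h1
  by_contra hD
  obtain ⟨j, hj⟩ : ∃ j, (fun i => D i j) ≠ 0 := by
    by_contra! h
    exact hD (by ext i j; exact congrFun (h j) i)
  have h5 : ∀ j, (Dᴴ * A * D) j j = star (fun i => D i j) ⬝ᵥ A *ᵥ (fun i => D i j) := fun j => by
    rw [mul_assoc, mul_apply, dotProduct]
    rfl
  have h6 : 0 < (Dᴴ * A * D).trace := by
    refine Finset.sum_pos' (fun j _ => ?_) ⟨j, Finset.mem_univ j, ?_⟩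
    · rw [diag_apply, h5]; exact hA.posSemidef.dotProduct_mulVec_nonneg _
    · rw [diag_apply, h5]; exact hA.dotProduct_mulVec_pos hj
  exact h6.ne' h4

lemma sub_inv_injective {A B : Matrix m m ℂ} (hA : A.PosDef) (hB : B.PosDef)
    (h : A - A⁻¹ = B - B⁻¹) : A = B := by
  have h1 : A - B = A⁻¹ - B⁻¹ := by
    rw [← sub_eq_zero, ← sub_eq_zero.2 h]
    abel
  rw [← sub_eq_zero]
  refine eq_zero_of_mul_eq_neg hA hB.inv ?_
  have h2 : A * (A - B) * B = -(A - B) := by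
    rw [h1, mul_sub, mul_nonsing_inv _ hA.isUnit_det', sub_mul, one_mul, mul_assoc,
      nonsing_inv_mul _ hB.isUnit_det', mul_one, ← h1]
    abel
  rw [← neg_mul, ← h2, mul_assoc, mul_nonsing_inv _ hB.isUnit_det', mul_one]

lemma eq_zero_of_add_conj_inv {A D : Matrix m m ℂ} (hA : A.PosDef)
    (h : D + A⁻¹ * D * A⁻¹ = 0) : D = 0 := by
  refine eq_zero_of_mul_eq_neg hA hA.inv ?_
  calc A * D = A * -(A⁻¹ * D * A⁻¹) := by rw [← eq_neg_of_add_eq_zero_left h]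
    _ = -((A * A⁻¹) * D * A⁻¹) := by noncomm_ring
    _ = -(D * A⁻¹) := by rw [mul_nonsing_inv _ hA.isUnit_det', one_mul]

lemma exists_sub_inv_eq {Z : Matrix m m ℂ} (hZ : Z.IsHermitian) :
    ∃ A : Matrix m m ℂ, A.PosDef ∧ A - A⁻¹ = Z := by
  set U : Matrix m m ℂ := (hZ.eigenvectorUnitary).1 with hU
  set d := hZ.eigenvalues
  have hUU : U * Uᴴ = 1 := Unitary.mul_star_self_of_mem hZ.eigenvectorUnitary.2
  have hUU' : Uᴴ * U = 1 := Unitary.star_mul_self_of_mem hZ.eigenvectorUnitary.2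
  have hZ' : Z = U * diagonal (fun i => (d i : ℂ)) * Uᴴ := hZ.spectral_theorem
  let f : m → ℝ := fun i => (d i + √(d i ^ 2 + 4)) / 2
  have hf : ∀ i, 0 < f i := fun i => by
    have h1 : |d i| < √(d i ^ 2 + 4) := by
      rw [← Real.sqrt_sq_eq_abs]
      exact Real.sqrt_lt_sqrt (sq_nonneg _) (by linarith)
    have := neg_abs_le (d i)
    simp only [f]
    linarith
  have hfd : ∀ i, f i - (f i)⁻¹ = d i := fun i => by
    have h0 := (hf i).ne'
    have h1 := Real.sq_sqrt (show 0 ≤ d i ^ 2 + 4 by positivity)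
    have h2 : f i * f i - 1 = d i * f i := by
      simp only [f]
      nlinarith
    field_simp
    linarith
  set F : Matrix m m ℂ := diagonal fun i => (f i : ℂ) with hF
  set F' : Matrix m m ℂ := diagonal fun i => ((f i)⁻¹ : ℂ) with hF'
  have hFF : F * F' = 1 := by
    rw [hF, hF', diagonal_mul_diagonal, ← diagonal_one]
    congr 1
    ext i
    have := (hf i).ne'
    rw [mul_inv_cancel₀ (by exact_mod_cast this)]
  have hFP : F.PosDef := PosDef.diagonal fun i => by exact_mod_cast hf i
  have hinv : (U * F * Uᴴ)⁻¹ = U * F' * Uᴴ := by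
    refine inv_eq_right_inv ?_
    calc U * F * Uᴴ * (U * F' * Uᴴ) = U * F * (Uᴴ * U) * F' * Uᴴ := by noncomm_ring
      _ = 1 := by rw [hUU', mul_one, mul_assoc U, hFF, mul_one, hUU]
  refine ⟨U * F * Uᴴ, posDef_conj ⟨⟨U, Uᴴ, hUU, hUU'⟩, rfl⟩ hFP, ?_⟩
  rw [hinv, ← sub_mul, ← mul_sub, hZ', hF, hF', diagonal_sub]
  congr 3
  ext i
  exact_mod_cast hfd i

end InverseDifference

section InverseFunction

open Set Filter Topology
open scoped ContDiff

theorem exists_isDiffeo_univ {E : Type} [NormedAddCommGroup E] [NormedSpace ℝ E]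
    [FiniteDimensional ℝ E] {X : Set E} (hX : IsOpen X) {f : E → E} (hf : ContDiffOn ℝ ∞ f X)
    (hinj : InjOn f X) (hsurj : ∀ y, ∃ x ∈ X, f x = y)
    (hder : ∀ x ∈ X, ∀ d, fderiv ℝ f x d = 0 → d = 0) : ∃ g, IsDiffeo X univ f g := by
  have : CompleteSpace E := FiniteDimensional.complete ℝ E
  choose g hgX hg using hsurj
  refine ⟨g, hX, isOpen_univ, hf, fun y _ => ContDiffAt.contDiffWithinAt ?_, fun _ _ => mem_univ _,
    fun y _ => hgX y, fun x hx => hinj (hgX _) hx (hg _), fun y _ => hg y⟩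
  have hx := hgX y
  have hfx : ContDiffAt ℝ ∞ f (g y) := hf.contDiffAt (hX.mem_nhds hx)
  have hne : (∞ : WithTop ℕ∞) ≠ 0 := by simp
  let e : E ≃L[ℝ] E := (LinearEquiv.ofInjectiveEndo (fderiv ℝ f (g y) : E →ₗ[ℝ] E)
    ((injective_iff_map_eq_zero _).2 (hder _ hx))).toContinuousLinearEquiv
  have he : HasFDerivAt f (e : E →L[ℝ] E) (g y) := by
    have h1 := (hfx.differentiableAt hne).hasFDerivAt
    convert! h1 using 1
  have hs := hfx.hasStrictFDerivAt' he hne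
  have h1 : ContDiffAt ℝ ∞ (hfx.localInverse he hne) y := by
    have := hfx.to_localInverse he hne
    rwa [hg] at this
  have h2 : hfx.localInverse he hne y = g y := by
    have := hfx.localInverse_apply_image he hne
    rwa [hg] at this
  have h3 : ∀ᶠ z in 𝓝 y, f (hfx.localInverse he hne z) = z := by
    have := hs.eventually_right_inverse
    rwa [hg] at this
  have h4 : ∀ᶠ z in 𝓝 y, hfx.localInverse he hne z ∈ X :=
    h1.continuousAt.eventually_mem (by rw [h2]; exact hX.mem_nhds hx)
  refine h1.congr_of_eventuallyEq ?_
  filter_upwards [h3, h4] with z hz hz'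
  exact hinj (hgX z) hz' ((hg z).trans hz.symm)

end InverseFunction

section SiegelModel

open Set Filter Topology Matrix
open scoped ComplexOrder ContDiff

attribute [local instance] Matrix.linftyOpNormedRing Matrix.linftyOpNormedAlgebra

lemma Matrix.contDiff_of_linear {E F : Type*} [NormedAddCommGroup E] [NormedSpace ℝ E]
    [FiniteDimensional ℝ E] [NormedAddCommGroup F] [NormedSpace ℝ F] (f : E →ₗ[ℝ] F) :
    ContDiff ℝ ∞ f :=
  (LinearMap.toContinuousLinearMap f).contDiff

variable {m : Type*} [Fintype m] [DecidableEq m]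

lemma contDiffAt_matrix_inv {Y : Matrix m m ℂ} (hY : IsUnit Y.det) :
    ContDiffAt ℝ ∞ (fun Y : Matrix m m ℂ => Y⁻¹) Y := by
  have : CompleteSpace (Matrix m m ℂ) := FiniteDimensional.complete ℝ _
  obtain ⟨u, rfl⟩ := (isUnit_iff_isUnit_det _).2 hY
  have := contDiffAt_ringInverse (n := ∞) ℝ u
  convert! this using 1
  ext1 Y
  exact nonsing_inv_eq_ringInverse _

lemma contDiff_hermRe (u : m → ℂ) : ContDiff ℝ ∞ fun A : Matrix m m ℂ => hermRe A u u := by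
  let f : Matrix m m ℂ →ₗ[ℝ] ℝ :=
    { toFun := fun A => hermRe A u u
      map_add' := fun A B => by simpa using hermRe_add_smul A B 1 1 u u
      map_smul' := fun c A => by simpa using hermRe_add_smul A 0 c 0 u u }
  exact Matrix.contDiff_of_linear f

lemma continuous_matrix_entry (i j : m) : Continuous fun A : Matrix m m ℂ => A i j :=
  (Matrix.contDiff_of_linear (Matrix.entryLinearMap ℝ ℂ i j)).continuous

lemma continuous_hermRe :
    Continuous fun p : Matrix m m ℂ × (m → ℂ) => hermRe p.1 p.2 p.2 := by
  have : (fun p : Matrix m m ℂ × (m → ℂ) => hermRe p.1 p.2 p.2) =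
      fun p => (∑ i, p.2 i * ∑ j, p.1 i j * star (p.2 j)).re := rfl
  rw [this]
  refine Complex.continuous_re.comp (continuous_finsetSum _ fun i _ => Continuous.mul (by fun_prop)
    (continuous_finsetSum _ fun j _ => Continuous.mul
      ((continuous_matrix_entry i j).comp continuous_fst) (by fun_prop)))

lemma posDef_of_hermRe_pos {Y : Matrix m m ℂ} (hY : Y.IsHermitian)
    (h : ∀ u ∈ Metric.sphere (0 : m → ℂ) 1, 0 < hermRe Y u u) : Y.PosDef := by
  refine .of_dotProduct_mulVec_pos hY fun x hx => ?_
  have hx' : ‖x‖ ≠ 0 := norm_ne_zero_iff.2 hx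
  have h1 : 0 < hermRe Y (star x) (star x) := by
    have h2 : star x = (‖x‖ : ℂ) • ((‖x‖ : ℂ)⁻¹ • star x) := by
      rw [smul_smul, mul_inv_cancel₀ (by exact_mod_cast hx'), one_smul]
    rw [h2, hermRe_smul_self]
    refine mul_pos (by simp; positivity) (h _ ?_)
    rw [mem_sphere_zero_iff_norm, norm_smul, norm_star]
    simp [hx']
  rw [Complex.lt_def]
  refine ⟨by simpa [hermRe] using h1, ?_⟩
  have h3 : star (star x ⬝ᵥ Y *ᵥ x) = star x ⬝ᵥ Y *ᵥ x := by
    rw [← star_dotProduct_star, star_mulVec, star_star, hY.eq, dotProduct_mulVec]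
  exact (Complex.conj_eq_iff_im.1 h3).symm

lemma eventually_posDef {Y : Matrix m m ℂ} (hY : Y.PosDef) :
    ∀ᶠ Z in 𝓝 Y, Z.IsHermitian → Z.PosDef := by
  have h1 : ∀ u ∈ Metric.sphere (0 : m → ℂ) 1, ∀ᶠ p : Matrix m m ℂ × (m → ℂ) in 𝓝 Y ×ˢ 𝓝 u,
      0 < hermRe p.1 p.2 p.2 := fun u hu => by
    have hu0 : u ≠ 0 := by
      rintro rfl
      simp at hu
    rw [← nhds_prod_eq]
    exact continuous_hermRe.continuousAt.eventually_mem (Ioi_mem_nhds (hermRe_pos hY hu0))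
  have h2 := (isCompact_sphere (0 : m → ℂ) 1).eventually_forall_of_forall_eventually
    (x₀ := Y) (P := fun Z u => 0 < hermRe Z u u) fun u hu => by
      rw [nhds_prod_eq]; exact h1 u hu
  filter_upwards [h2] with Z hZ hZ'
  exact posDef_of_hermRe_pos hZ' hZ

end SiegelModel

section SiegelModelSpace

open Set Filter Topology Matrix
open scoped ComplexOrder ContDiff

attribute [local instance] Matrix.linftyOpNormedRing Matrix.linftyOpNormedAlgebra

/-- The matrix has real entries. -/
def Matrix.IsRealMatrix {m : Type*} (A : Matrix m m ℂ) : Prop := Aᴴ = Aᵀ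

section
variable {m : Type*} {A B : Matrix m m ℂ}

lemma Matrix.IsRealMatrix.add (hA : A.IsRealMatrix) (hB : B.IsRealMatrix) :
    (A + B).IsRealMatrix := by
  rw [IsRealMatrix, conjTranspose_add, transpose_add, hA, hB]

lemma Matrix.IsRealMatrix.smul (c : ℝ) (hA : A.IsRealMatrix) : (c • A).IsRealMatrix := by
  rw [IsRealMatrix, conjTranspose_smul, transpose_smul, hA]
  simp

lemma Matrix.IsRealMatrix.transpose (hA : A.IsRealMatrix) : Aᵀ.IsRealMatrix := by
  ext i j
  exact congrFun (congrFun hA j) i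

lemma Matrix.IsRealMatrix.conjTranspose (hA : A.IsRealMatrix) : Aᴴ.IsRealMatrix := by
  rw [hA]; exact hA.transpose

lemma Matrix.IsRealMatrix.star_apply (hA : A.IsRealMatrix) (i j : m) : star (A i j) = A i j :=
  congrFun (congrFun hA j) i

variable [Fintype m] [DecidableEq m]

lemma Matrix.IsRealMatrix.mul (hA : A.IsRealMatrix) (hB : B.IsRealMatrix) :
    (A * B).IsRealMatrix := by
  rw [IsRealMatrix, conjTranspose_mul, transpose_mul, hA, hB]

lemma Matrix.IsRealMatrix.inv (hA : A.IsRealMatrix) : A⁻¹.IsRealMatrix := by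
  rw [IsRealMatrix, conjTranspose_nonsing_inv, transpose_nonsing_inv, hA]

lemma Matrix.IsRealMatrix.one : (1 : Matrix m m ℂ).IsRealMatrix := by
  simp [IsRealMatrix]

lemma Matrix.IsRealMatrix.fromBlocks {C D : Matrix m m ℂ} (hA : A.IsRealMatrix)
    (hB : B.IsRealMatrix) (hC : C.IsRealMatrix) (hD : D.IsRealMatrix) :
    (Matrix.fromBlocks A B C D).IsRealMatrix := by
  rw [IsRealMatrix, fromBlocks_conjTranspose, fromBlocks_transpose, hA, hB, hC, hD]

lemma Matrix.IsRealMatrix.siegelForm {x : Matrix m m ℂ × Matrix m m ℂ} (h1 : x.1.IsRealMatrix)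
    (h2 : x.2.IsRealMatrix) : (siegelForm x).IsRealMatrix :=
  .fromBlocks (.add h2.transpose ((h1.mul h2.inv).mul h1.conjTranspose)) (h1.mul h2.inv)
    (h2.inv.mul h1.conjTranspose) h2.inv

lemma Matrix.IsRealMatrix.siegelCoord {H : Matrix (m ⊕ m) (m ⊕ m) ℂ} (h : H.IsRealMatrix) :
    (siegelCoord H).1.IsRealMatrix ∧ (siegelCoord H).2.IsRealMatrix := by
  have h12 : H.toBlocks₁₂.IsRealMatrix := by
    ext i j; exact congrFun (congrFun h (Sum.inr i)) (Sum.inl j)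
  have h22 : H.toBlocks₂₂.IsRealMatrix := by
    ext i j; exact congrFun (congrFun h (Sum.inr i)) (Sum.inr j)
  exact ⟨h12.mul h22.inv, h22.inv⟩

end

variable {W : Type} [Fintype W] (r : W → Prop) (n : ℕ)

/-- The vector space of families of pairs `(S, Y)` with `S` symmetric and `Y` Hermitian, real at
the places where `r` holds. -/
def siegelModel : Submodule ℝ (W → Matrix (Fin n) (Fin n) ℂ × Matrix (Fin n) (Fin n) ℂ) where
  carrier := {x | ∀ w, (x w).1.IsSymm ∧ (x w).2.IsHermitian ∧
    (r w → (x w).1.IsRealMatrix ∧ (x w).2.IsRealMatrix)}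
  add_mem' {x y} hx hy w := ⟨(hx w).1.add (hy w).1, (hx w).2.1.add (hy w).2.1, fun h =>
    ⟨((hx w).2.2 h).1.add ((hy w).2.2 h).1, ((hx w).2.2 h).2.add ((hy w).2.2 h).2⟩⟩
  zero_mem' w := ⟨by simp [IsSymm], by simp [IsHermitian], fun h => by simp [IsRealMatrix]⟩
  smul_mem' c x hx w := ⟨(hx w).1.smul c, by
    rw [IsHermitian, Pi.smul_apply, Prod.smul_snd, conjTranspose_smul, (hx w).2.1.eq]; simp,
    fun h => ⟨((hx w).2.2 h).1.smul c, ((hx w).2.2 h).2.smul c⟩⟩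

variable {r n}

/-- The Siegel space inside its model. -/
def siegelSet : Set (siegelModel r n) := {x | ∀ w, (x.1 w).2.PosDef}

/-- The symplectic Hermitian matrix at a place. -/
noncomputable def siegelAt (x : siegelModel r n) (w : W) : Matrix (Fin n ⊕ Fin n) (Fin n ⊕ Fin n) ℂ :=
  siegelForm (x.1 w)

lemma posDef_siegelAt {x : siegelModel r n} (hx : x ∈ siegelSet) (w : W) :
    (siegelAt x w).PosDef := posDef_siegelForm (hx w)

lemma siegelAt_mem {x : siegelModel r n} (hx : x ∈ siegelSet) (w : W) :
    siegelAt x w ∈ symplecticGroup (Fin n) ℂ := siegelForm_mem (x.2 w).1 (hx w)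

lemma siegelAt_real (x : siegelModel r n) {w : W} (hw : r w) :
    (siegelAt x w).IsRealMatrix := .siegelForm ((x.2 w).2.2 hw).1 ((x.2 w).2.2 hw).2

lemma exists_siegelProj (r : W → Prop) (n : ℕ) :
    ∃ f : (W → Matrix (Fin n) (Fin n) ℂ × Matrix (Fin n) (Fin n) ℂ) →ₗ[ℝ] siegelModel r n,
      ∀ x : siegelModel r n, f x.1 = x := by
  obtain ⟨f, hf⟩ := LinearMap.exists_leftInverse_of_injective (siegelModel r n).subtype
    (Submodule.ker_subtype _)
  exact ⟨f, fun x => LinearMap.congr_fun hf x⟩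

/-- A linear projection to the model. -/
noncomputable def siegelProj :
    (W → Matrix (Fin n) (Fin n) ℂ × Matrix (Fin n) (Fin n) ℂ) →ₗ[ℝ] siegelModel r n :=
  (exists_siegelProj r n).choose

lemma siegelProj_coe (x : siegelModel r n) : siegelProj x.1 = x :=
  (exists_siegelProj r n).choose_spec x

/-- The point of the Siegel space with given matrices. -/
noncomputable def siegelPoint (H : W → Matrix (Fin n ⊕ Fin n) (Fin n ⊕ Fin n) ℂ) :
    siegelModel r n :=
  siegelProj fun w => siegelCoord (H w)

lemma siegelPoint_coe {H : W → Matrix (Fin n ⊕ Fin n) (Fin n ⊕ Fin n) ℂ} (hH : ∀ w, (H w).PosDef)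
    (hs : ∀ w, H w ∈ symplecticGroup (Fin n) ℂ) (hr : ∀ w, r w → (H w).IsRealMatrix) :
    (siegelPoint H : siegelModel r n).1 = fun w => siegelCoord (H w) :=
  congrArg Subtype.val (siegelProj_coe ⟨fun w => siegelCoord (H w), fun w =>
    ⟨(siegelCoord_aux (hH w) (hs w)).1, (siegelCoord_aux (hH w) (hs w)).2.1.1, fun h =>
      (hr w h).siegelCoord⟩⟩)

lemma siegelPoint_mem {H : W → Matrix (Fin n ⊕ Fin n) (Fin n ⊕ Fin n) ℂ} (hH : ∀ w, (H w).PosDef)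
    (hs : ∀ w, H w ∈ symplecticGroup (Fin n) ℂ) (hr : ∀ w, r w → (H w).IsRealMatrix) :
    (siegelPoint H : siegelModel r n) ∈ siegelSet := fun w => by
  rw [siegelPoint_coe hH hs hr]
  exact (siegelCoord_aux (hH w) (hs w)).2.1

lemma siegelAt_siegelPoint {H : W → Matrix (Fin n ⊕ Fin n) (Fin n ⊕ Fin n) ℂ}
    (hH : ∀ w, (H w).PosDef) (hs : ∀ w, H w ∈ symplecticGroup (Fin n) ℂ)
    (hr : ∀ w, r w → (H w).IsRealMatrix) (w : W) :
    siegelAt (siegelPoint H : siegelModel r n) w = H w := by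
  rw [siegelAt, siegelPoint_coe hH hs hr]
  exact (siegelCoord_aux (hH w) (hs w)).2.2

lemma siegelPoint_siegelAt {x : siegelModel r n} (hx : x ∈ siegelSet) :
    siegelPoint (siegelAt x) = x := by
  have : (fun w => siegelCoord (siegelAt x w)) = x.1 :=
    funext fun w => siegelCoord_siegelForm (hx w)
  rw [siegelPoint, this, siegelProj_coe]

/-- Families of symplectic matrices, real where required. -/
def IsRealPoint (r : W → Prop) (g : W → Matrix (Fin n ⊕ Fin n) (Fin n ⊕ Fin n) ℂ) : Prop :=
  ∀ w, g w ∈ symplecticGroup (Fin n) ℂ ∧ (r w → (g w).IsRealMatrix)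

/-- The action on the Siegel space. -/
noncomputable def siegelAct (g : W → Matrix (Fin n ⊕ Fin n) (Fin n ⊕ Fin n) ℂ)
    (x : siegelModel r n) : siegelModel r n :=
  siegelPoint fun w => g w * siegelAt x w * (g w)ᴴ

section Action

variable {g h : W → Matrix (Fin n ⊕ Fin n) (Fin n ⊕ Fin n) ℂ} {x : siegelModel r n}

lemma isUnit_of_mem_symplecticGroup {g : Matrix (Fin n ⊕ Fin n) (Fin n ⊕ Fin n) ℂ}
    (hg : g ∈ symplecticGroup (Fin n) ℂ) : IsUnit g :=
  (isUnit_iff_isUnit_det _).2 (SymplecticGroup.symplectic_det hg)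

lemma siegelAct_aux (hg : IsRealPoint r g) (hx : x ∈ siegelSet) :
    (∀ w, (g w * siegelAt x w * (g w)ᴴ).PosDef) ∧
    (∀ w, g w * siegelAt x w * (g w)ᴴ ∈ symplecticGroup (Fin n) ℂ) ∧
    ∀ w, r w → (g w * siegelAt x w * (g w)ᴴ).IsRealMatrix :=
  ⟨fun w => posDef_conj (isUnit_of_mem_symplecticGroup (hg w).1) (posDef_siegelAt hx w),
    fun w => mul_mem (mul_mem (hg w).1 (siegelAt_mem hx w))
      (conjTranspose_mem_symplecticGroup (hg w).1),
    fun w hw => (((hg w).2 hw).mul (siegelAt_real x hw)).mul ((hg w).2 hw).conjTranspose⟩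

lemma siegelAct_mem (hg : IsRealPoint r g) (hx : x ∈ siegelSet) : siegelAct g x ∈ siegelSet :=
  siegelPoint_mem (siegelAct_aux hg hx).1 (siegelAct_aux hg hx).2.1 (siegelAct_aux hg hx).2.2

lemma siegelAt_siegelAct (hg : IsRealPoint r g) (hx : x ∈ siegelSet) (w : W) :
    siegelAt (siegelAct g x) w = g w * siegelAt x w * (g w)ᴴ :=
  siegelAt_siegelPoint (siegelAct_aux hg hx).1 (siegelAct_aux hg hx).2.1 (siegelAct_aux hg hx).2.2 w

lemma siegelAct_one (hx : x ∈ siegelSet) : siegelAct (fun _ => 1) x = x := by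
  simpa [siegelAct] using siegelPoint_siegelAt hx

lemma siegelAct_mul (hh : IsRealPoint r h) (hx : x ∈ siegelSet) :
    siegelAct (fun w => g w * h w) x = siegelAct g (siegelAct h x) := by
  rw [siegelAct, siegelAct]
  congr 1
  ext1 w
  rw [siegelAt_siegelAct hh hx, conjTranspose_mul]
  simp only [mul_assoc]

end Action

lemma isOpen_siegelSet : IsOpen (siegelSet : Set (siegelModel r n)) := by
  rw [isOpen_iff_mem_nhds]
  intro x hx
  have : ∀ w, ∀ᶠ y : siegelModel r n in 𝓝 x, (y.1 w).2.PosDef := fun w => by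
    have h1 : Continuous fun y : siegelModel r n => (y.1 w).2 :=
      continuous_snd.comp ((continuous_apply w).comp continuous_subtype_val)
    filter_upwards [h1.continuousAt.eventually (eventually_posDef (hx w))] with y hy
    exact hy (y.2 w).2.1
  exact eventually_all.2 this

lemma convex_siegelSet : Convex ℝ (siegelSet : Set (siegelModel r n)) :=
  fun _ hx _ hy _ _ hs ht hst w => posDef_add_smul (hx w) (hy w) hs ht hst


lemma contDiff_siegel_fst (w : W) : ContDiff ℝ ∞ fun x : siegelModel r n => (x.1 w).1 :=
  contDiff_fst.comp ((contDiff_apply ℝ _ w).comp (siegelModel r n).subtypeL.contDiff)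

lemma contDiff_siegel_snd (w : W) : ContDiff ℝ ∞ fun x : siegelModel r n => (x.1 w).2 :=
  contDiff_snd.comp ((contDiff_apply ℝ _ w).comp (siegelModel r n).subtypeL.contDiff)

end SiegelModelSpace

section SiegelSmooth

open Set Filter Topology Matrix
open scoped ComplexOrder ContDiff

attribute [local instance] Matrix.linftyOpNormedRing Matrix.linftyOpNormedAlgebra

variable {W : Type} [Fintype W] {r : W → Prop} {n : ℕ}

lemma contDiffOn_siegel_inv (w : W) :
    ContDiffOn ℝ ∞ (fun x : siegelModel r n => (x.1 w).2⁻¹) siegelSet := fun x hx =>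
  ((contDiffAt_matrix_inv (hx w).isUnit_det').comp x
    (contDiff_siegel_snd w).contDiffAt).contDiffWithinAt

/-- Assembling a block matrix, as a linear map. -/
def fromBlocksLinear (n : ℕ) : (Matrix (Fin n) (Fin n) ℂ × Matrix (Fin n) (Fin n) ℂ) ×
    (Matrix (Fin n) (Fin n) ℂ × Matrix (Fin n) (Fin n) ℂ) →ₗ[ℝ]
      Matrix (Fin n ⊕ Fin n) (Fin n ⊕ Fin n) ℂ where
  toFun p := fromBlocks p.1.1 p.1.2 p.2.1 p.2.2
  map_add' p q := by simp [fromBlocks_add]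
  map_smul' c p := by simp [fromBlocks_smul]

lemma contDiff_conjTranspose {l : Type*} [Fintype l] [DecidableEq l] :
    ContDiff ℝ ∞ fun A : Matrix l l ℂ => Aᴴ := by
  let f : Matrix l l ℂ →ₗ[ℝ] Matrix l l ℂ :=
    { toFun := fun A => Aᴴ
      map_add' := conjTranspose_add
      map_smul' := fun c A => by simp [conjTranspose_smul] }
  exact Matrix.contDiff_of_linear f

lemma contDiff_transpose {l : Type*} [Fintype l] [DecidableEq l] :
    ContDiff ℝ ∞ fun A : Matrix l l ℂ => Aᵀ :=
  Matrix.contDiff_of_linear (transposeLinearEquiv l l ℝ ℂ).toLinearMap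

lemma contDiffOn_siegelAt (w : W) :
    ContDiffOn ℝ ∞ (fun x : siegelModel r n => siegelAt x w) siegelSet := by
  have h1 := (contDiff_siegel_fst (r := r) (n := n) w).contDiffOn (s := siegelSet)
  have h2 := (contDiff_siegel_snd (r := r) (n := n) w).contDiffOn (s := siegelSet)
  have h3 := contDiffOn_siegel_inv (r := r) (n := n) w
  have h4 := contDiff_conjTranspose.comp_contDiffOn h1
  have h5 := contDiff_transpose.comp_contDiffOn h2
  exact (Matrix.contDiff_of_linear (fromBlocksLinear n)).comp_contDiffOn
    (((h5.add ((h1.mul h3).mul h4)).prodMk (h1.mul h3)).prodMk ((h3.mul h4).prodMk h3))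

lemma contDiffAt_siegelCoord {H : Matrix (Fin n ⊕ Fin n) (Fin n ⊕ Fin n) ℂ}
    (hH : IsUnit H.toBlocks₂₂.det) : ContDiffAt ℝ ∞ siegelCoord H := by
  let f12 : Matrix (Fin n ⊕ Fin n) (Fin n ⊕ Fin n) ℂ →ₗ[ℝ] Matrix (Fin n) (Fin n) ℂ :=
    { toFun := toBlocks₁₂, map_add' := fun _ _ => rfl, map_smul' := fun _ _ => rfl }
  let f22 : Matrix (Fin n ⊕ Fin n) (Fin n ⊕ Fin n) ℂ →ₗ[ℝ] Matrix (Fin n) (Fin n) ℂ :=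
    { toFun := toBlocks₂₂, map_add' := fun _ _ => rfl, map_smul' := fun _ _ => rfl }
  have h1 := (Matrix.contDiff_of_linear f12).contDiffAt (x := H)
  have h2 := (Matrix.contDiff_of_linear f22).contDiffAt (x := H)
  have h3 : ContDiffAt ℝ ∞ (fun H : Matrix (Fin n ⊕ Fin n) (Fin n ⊕ Fin n) ℂ =>
      H.toBlocks₂₂⁻¹) H := ContDiffAt.comp (g := fun Y : Matrix (Fin n) (Fin n) ℂ => Y⁻¹) H
    (contDiffAt_matrix_inv hH) h2
  exact (h1.mul h3).prodMk h3

lemma contDiff_siegelProj : ContDiff ℝ ∞ (siegelProj (r := r) (n := n)) :=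
  Matrix.contDiff_of_linear _

lemma contDiffOn_siegelAct {g : W → Matrix (Fin n ⊕ Fin n) (Fin n ⊕ Fin n) ℂ}
    (hg : IsRealPoint r g) : ContDiffOn ℝ ∞ (siegelAct (r := r) g) siegelSet := by
  refine (contDiff_siegelProj (r := r) (n := n)).comp_contDiffOn (contDiffOn_pi.2 fun w x hx => ?_)
  have h1 : ContDiffWithinAt ℝ ∞ (fun x : siegelModel r n => g w * siegelAt x w * (g w)ᴴ)
      siegelSet x := (contDiffWithinAt_const.mul (contDiffOn_siegelAt w x hx)).mul
        contDiffWithinAt_const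
  exact (contDiffAt_siegelCoord (posDef_toBlocks₂₂
    ((siegelAct_aux hg hx).1 w)).isUnit_det').comp_contDiffWithinAt x h1

/-- The quadratic form attached to a point of the Siegel space. -/
noncomputable def siegelQ (v : W → (Fin n ⊕ Fin n → ℂ)) (x : siegelModel r n) : ℝ :=
  ∑ w, hermRe (siegelAt x w) (v w) (v w)

lemma contDiffOn_siegelQ (v : W → (Fin n ⊕ Fin n → ℂ)) :
    ContDiffOn ℝ ∞ (siegelQ (r := r) v) siegelSet :=
  ContDiffOn.sum fun w _ => (contDiff_hermRe (v w)).comp_contDiffOn (contDiffOn_siegelAt w)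

lemma convex_siegelQ (v : W → (Fin n ⊕ Fin n → ℂ)) (c : ℝ) :
    Convex ℝ {x : siegelModel r n | x ∈ siegelSet ∧ siegelQ v x < c} := by
  intro x hx y hy s t hs ht hst
  refine ⟨convex_siegelSet hx.1 hy.1 hs ht hst, ?_⟩
  have h1 : siegelQ v (s • x + t • y) ≤ s * siegelQ v x + t * siegelQ v y := by
    rw [siegelQ, siegelQ, siegelQ, Finset.mul_sum, Finset.mul_sum, ← Finset.sum_add_distrib]
    exact Finset.sum_le_sum fun w _ => hermRe_siegelForm_convex (hx.1 w) (hy.1 w) hs ht hst (v w)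
  have hx2 := hx.2
  have hy2 := hy.2
  rcases hs.eq_or_lt with rfl | hs
  · have : t = 1 := by linarith
    subst this
    linarith
  · have h2 := mul_lt_mul_of_pos_left hx2 hs
    have h3 := mul_le_mul_of_nonneg_left hy2.le ht
    have h4 : s * c + t * c = c := by rw [← add_mul, hst, one_mul]
    linarith

lemma siegelQ_nonneg (v : W → (Fin n ⊕ Fin n → ℂ)) {x : siegelModel r n} (hx : x ∈ siegelSet) :
    0 ≤ siegelQ v x :=
  Finset.sum_nonneg fun w _ => hermRe_nonneg (posDef_siegelAt hx w).posSemidef _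

lemma siegelQ_act {g : W → Matrix (Fin n ⊕ Fin n) (Fin n ⊕ Fin n) ℂ} (hg : IsRealPoint r g)
    (v : W → (Fin n ⊕ Fin n → ℂ)) {x : siegelModel r n} (hx : x ∈ siegelSet) :
    siegelQ v (siegelAct g x) = siegelQ (fun w => v w ᵥ* g w) x :=
  Finset.sum_congr rfl fun w _ => by rw [siegelAt_siegelAct hg hx, hermRe_conj]

/-- A standard point of the Siegel space. -/
noncomputable def siegelBase (W : Type) [Fintype W] (r : W → Prop) (n : ℕ) (t : ℝ) :
    siegelModel r n :=
  ⟨fun _ => (0, t • 1), fun w => ⟨by simp [IsSymm], by simp [IsHermitian, conjTranspose_smul],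
    fun _ => ⟨by simp [IsRealMatrix], .smul t .one⟩⟩⟩

lemma siegelBase_mem {t : ℝ} (ht : 0 < t) : siegelBase W r n t ∈ siegelSet :=
  fun _ => PosDef.one.smul ht

lemma siegelQ_base (t : ℝ) (a : W → Fin n → ℂ) :
    siegelQ (fun w => Sum.elim (a w) 0) (siegelBase W r n t) = t * ∑ w, hermRe 1 (a w) (a w) := by
  rw [siegelQ, Finset.mul_sum]
  refine Finset.sum_congr rfl fun w _ => ?_
  rw [siegelAt, hermRe_siegelForm]
  simp only [siegelBase, Sum.elim_comp_inl, Sum.elim_comp_inr, vecMul_zero, add_zero,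
    transpose_smul, transpose_one]
  have h1 := hermRe_add_smul (1 : Matrix (Fin n) (Fin n) ℂ) 0 t 0 (a w) (a w)
  rw [zero_smul, add_zero, zero_mul, add_zero] at h1
  rw [h1]
  simp [hermRe]

/-- The global coordinates on the Siegel space. -/
noncomputable def siegelGlobal (x : siegelModel r n) : siegelModel r n :=
  siegelProj fun w => ((x.1 w).1, (x.1 w).2 - (x.1 w).2⁻¹)

lemma siegelGlobal_coe (x : siegelModel r n) :
    (siegelGlobal x).1 = fun w => ((x.1 w).1, (x.1 w).2 - (x.1 w).2⁻¹) :=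
  congrArg Subtype.val (siegelProj_coe ⟨fun w => ((x.1 w).1, (x.1 w).2 - (x.1 w).2⁻¹), fun w =>
    ⟨(x.2 w).1, (x.2 w).2.1.sub (x.2 w).2.1.inv, fun h => ⟨((x.2 w).2.2 h).1, by
      have h2 := ((x.2 w).2.2 h).2
      change ((x.1 w).2 - (x.1 w).2⁻¹).IsRealMatrix
      rw [sub_eq_add_neg, ← neg_one_smul ℝ]
      exact h2.add (h2.inv.smul _)⟩⟩⟩)

lemma contDiffOn_siegelGlobal : ContDiffOn ℝ ∞ (siegelGlobal (r := r) (n := n)) siegelSet :=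
  (contDiff_siegelProj (r := r) (n := n)).comp_contDiffOn (contDiffOn_pi.2 fun w =>
    (contDiff_siegel_fst (r := r) (n := n) w).contDiffOn.prodMk
      ((contDiff_siegel_snd (r := r) (n := n) w).contDiffOn.sub
        (contDiffOn_siegel_inv (r := r) (n := n) w)))

lemma injOn_siegelGlobal : InjOn (siegelGlobal (r := r) (n := n)) siegelSet := by
  intro x hx y hy h
  have h1 := congrArg Subtype.val h
  rw [siegelGlobal_coe, siegelGlobal_coe] at h1
  refine Subtype.ext (funext fun w => ?_)
  have h2 := Prod.ext_iff.1 (congrFun h1 w)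
  exact Prod.ext h2.1 (sub_inv_injective (hx w) (hy w) h2.2)

lemma surj_siegelGlobal (y : siegelModel r n) : ∃ x ∈ siegelSet, siegelGlobal x = y := by
  choose A hA hA' using fun w => exists_sub_inv_eq (y.2 w).2.1
  let x : siegelModel r n := ⟨fun w => ((y.1 w).1, A w), fun w => ⟨(y.2 w).1, (hA w).1,
    fun h => ⟨((y.2 w).2.2 h).1, by
      have hY := ((y.2 w).2.2 h).2
      refine sub_inv_injective (hA w).conjTranspose (hA w).transpose ?_
      rw [← conjTranspose_nonsing_inv, ← conjTranspose_sub, hA', ← transpose_nonsing_inv,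
        ← transpose_sub, hA', hY]⟩⟩⟩
  refine ⟨x, hA, Subtype.ext ?_⟩
  rw [siegelGlobal_coe]
  exact funext fun w => Prod.ext rfl (hA' w)

end SiegelSmooth

section SiegelDiffeo

open Set Filter Topology Matrix
open scoped ComplexOrder ContDiff

attribute [local instance] Matrix.linftyOpNormedRing Matrix.linftyOpNormedAlgebra

variable {W : Type} [Fintype W] {r : W → Prop} {n : ℕ}

lemma eq_zero_of_hasFDerivAt_sub_inv {E : Type*} [NormedAddCommGroup E] [NormedSpace ℝ E]
    {L : E →L[ℝ] Matrix (Fin n) (Fin n) ℂ} {x : E} (hx : (L x).PosDef)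
    {f : E →L[ℝ] Matrix (Fin n) (Fin n) ℂ} (hf : HasFDerivAt (fun y => L y - (L y)⁻¹) f x)
    {d : E} (hd : f d = 0) : L d = 0 := by
  have : CompleteSpace (Matrix (Fin n) (Fin n) ℂ) := FiniteDimensional.complete ℝ _
  obtain ⟨u, hu⟩ := (isUnit_iff_isUnit_det _).2 hx.isUnit_det'
  have h1 := hasFDerivAt_ringInverse (𝕜 := ℝ) u
  have h2 : (Ring.inverse : Matrix (Fin n) (Fin n) ℂ → _) = fun Y => Y⁻¹ :=
    funext fun Y => (nonsing_inv_eq_ringInverse Y).symm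
  rw [h2, hu] at h1
  have h3 := hf.unique (L.hasFDerivAt.sub (h1.comp x L.hasFDerivAt))
  rw [h3] at hd
  have h4 : (↑u⁻¹ : Matrix (Fin n) (Fin n) ℂ) = (L x)⁻¹ := by
    rw [← hu, coe_units_inv]
  refine eq_zero_of_add_conj_inv hx (D := L d) ?_
  rw [← hd]
  rw [h4]
  exact (sub_neg_eq_add _ _).symm

lemma exists_isDiffeo_siegelGlobal :
    ∃ g, IsDiffeo (siegelSet : Set (siegelModel r n)) univ siegelGlobal g := by
  refine exists_isDiffeo_univ isOpen_siegelSet contDiffOn_siegelGlobal injOn_siegelGlobal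
    surj_siegelGlobal fun x hx d hd => ?_
  have hF : HasFDerivAt (siegelGlobal (r := r) (n := n)) (fderiv ℝ siegelGlobal x) x :=
    ((contDiffOn_siegelGlobal.contDiffAt (isOpen_siegelSet.mem_nhds hx)).differentiableAt
      (by simp)).hasFDerivAt
  have hw (w : W) : (d.1 w).1 = 0 ∧ (d.1 w).2 = 0 := by
    let P : siegelModel r n →L[ℝ] Matrix (Fin n) (Fin n) ℂ × Matrix (Fin n) (Fin n) ℂ :=
      (ContinuousLinearMap.proj (R := ℝ)
        (φ := fun _ : W => Matrix (Fin n) (Fin n) ℂ × Matrix (Fin n) (Fin n) ℂ) w).comp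
          (siegelModel r n).subtypeL
    let L₁ := (ContinuousLinearMap.fst ℝ _ _).comp P
    let L₂ := (ContinuousLinearMap.snd ℝ _ _).comp P
    have h1 : HasFDerivAt (fun y => L₁ y) (L₁.comp (fderiv ℝ siegelGlobal x)) x := by
      have := L₁.hasFDerivAt.comp x hF
      refine this.congr_of_eventuallyEq (.of_forall fun y => ?_)
      exact (congrArg Prod.fst (congrFun (siegelGlobal_coe y) w)).symm
    have h2 : HasFDerivAt (fun y => L₂ y - (L₂ y)⁻¹) (L₂.comp (fderiv ℝ siegelGlobal x)) x := by
      have := L₂.hasFDerivAt.comp x hF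
      refine this.congr_of_eventuallyEq (.of_forall fun y => ?_)
      exact (congrArg Prod.snd (congrFun (siegelGlobal_coe y) w)).symm
    refine ⟨?_, eq_zero_of_hasFDerivAt_sub_inv (L := L₂) (hx w) h2 (d := d) ?_⟩
    · have h3 := congrArg (· d) (h1.unique L₁.hasFDerivAt)
      refine h3.symm.trans ?_
      exact (congrArg L₁ hd).trans (map_zero _)
    · exact (congrArg L₂ hd).trans (map_zero _)
  exact Subtype.ext (funext fun w => Prod.ext (hw w).1 (hw w).2)

lemma compactCohomology_siegelSet :
    CompactCohomology (siegelSet : Set (siegelModel r n)) (Module.finrank ℝ (siegelModel r n)) :=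
  exists_isDiffeo_siegelGlobal.elim fun _ h => .of_diffeo compactCohomology_univ h

end SiegelDiffeo

section SiegelDim

open Set Matrix

variable {W : Type} [Fintype W] {r : W → Prop} {n : ℕ}

/-- The local factor of `siegelModel`. -/
def siegelFiber (p : Prop) (n : ℕ) :
    Submodule ℝ (Matrix (Fin n) (Fin n) ℂ × Matrix (Fin n) (Fin n) ℂ) where
  carrier := {x | x.1.IsSymm ∧ x.2.IsHermitian ∧ (p → x.1.IsRealMatrix ∧ x.2.IsRealMatrix)}
  add_mem' {x y} hx hy := ⟨hx.1.add hy.1, hx.2.1.add hy.2.1, fun h =>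
    ⟨(hx.2.2 h).1.add (hy.2.2 h).1, (hx.2.2 h).2.add (hy.2.2 h).2⟩⟩
  zero_mem' := ⟨by simp [IsSymm], by simp [IsHermitian], fun h => by simp [IsRealMatrix]⟩
  smul_mem' c x hx := ⟨hx.1.smul c, by
    rw [IsHermitian, Prod.smul_snd, conjTranspose_smul, hx.2.1.eq]; simp,
    fun h => ⟨(hx.2.2 h).1.smul c, (hx.2.2 h).2.smul c⟩⟩

/-- `siegelModel` is the product of its local factors. -/
def siegelModelEquiv (r : W → Prop) (n : ℕ) :
    siegelModel r n ≃ₗ[ℝ] (∀ w, siegelFiber (r w) n) where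
  toFun x w := ⟨x.1 w, x.2 w⟩
  invFun y := ⟨fun w => (y w).1, fun w => (y w).2⟩
  map_add' _ _ := rfl
  map_smul' _ _ := rfl

lemma finrank_siegelFiber_of_true {p : Prop} (hp : p) :
    Module.finrank ℝ (siegelFiber p n) = n * (n + 1) := by
  let f : (Sym2 (Fin n) → ℝ) × (Sym2 (Fin n) → ℝ) →ₗ[ℝ]
      Matrix (Fin n) (Fin n) ℂ × Matrix (Fin n) (Fin n) ℂ :=
    { toFun := fun a => (of fun i j => (a.1 s(i, j) : ℂ), of fun i j => (a.2 s(i, j) : ℂ))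
      map_add' := fun a b => by ext <;> simp
      map_smul' := fun c a => by ext <;> simp }
  have hf : Function.Injective f := fun a b h => by
    have h1 := Prod.ext_iff.1 h
    refine Prod.ext (funext fun p => ?_) (funext fun p => ?_)
    · induction p with | _ i j => exact Complex.ofReal_injective (congrFun (congrFun h1.1 i) j)
    · induction p with | _ i j => exact Complex.ofReal_injective (congrFun (congrFun h1.2 i) j)
  have hr : LinearMap.range f = siegelFiber p n := by
    ext x
    constructor
    · rintro ⟨a, rfl⟩
      refine ⟨?_, ?_, fun _ => ⟨?_, ?_⟩⟩ <;> ext i j <;> simp [f, Sym2.eq_swap]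
    · rintro ⟨h1, h2, h3⟩
      have h4 (A : Matrix (Fin n) (Fin n) ℂ) (hA : A.IsRealMatrix) (i j) :
          ((A i j).re : ℂ) = A i j := Complex.conj_eq_iff_re.1 (hA.star_apply i j)
      have h5 : x.2.IsSymm := (h3 hp).2.symm.trans h2
      refine ⟨(Sym2.lift ⟨fun i j => (x.1 i j).re, fun i j => congrArg Complex.re (h1.apply j i)⟩,
        Sym2.lift ⟨fun i j => (x.2 i j).re, fun i j => congrArg Complex.re (h5.apply j i)⟩), Prod.ext ?_ ?_⟩
      · ext i j : 2
        exact h4 _ (h3 hp).1 i j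
      · ext i j : 2
        exact h4 _ (h3 hp).2 i j
  rw [← hr, LinearMap.finrank_range_of_inj hf, Module.finrank_prod, Module.finrank_fintype_fun_eq_card,
    Sym2.card, Fintype.card_fin, Nat.choose_two_right, ← two_mul, Nat.mul_div_cancel', mul_comm]
  · rfl
  · exact (Nat.even_mul_pred_self _).two_dvd

lemma finrank_siegelFiber_of_false {p : Prop} (hp : ¬ p) :
    Module.finrank ℝ (siegelFiber p n) = n * (2 * n + 1) := by
  let f : (Sym2 (Fin n) → ℂ) × Matrix (Fin n) (Fin n) ℝ →ₗ[ℝ]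
      Matrix (Fin n) (Fin n) ℂ × Matrix (Fin n) (Fin n) ℂ :=
    { toFun := fun a => (of fun i j => a.1 s(i, j),
        of fun i j => ⟨a.2 i j + a.2 j i, a.2 i j - a.2 j i⟩)
      map_add' := fun a b => by
        ext <;> simp [Complex.ext_iff]
        constructor <;> ring
      map_smul' := fun c a => by
        ext <;> simp [Complex.ext_iff]
        constructor <;> ring }
  have hf : Function.Injective f := fun a b h => by
    have h1 := Prod.ext_iff.1 h
    refine Prod.ext (funext fun p => ?_) ?_
    · induction p with | _ i j => exact congrFun (congrFun h1.1 i) j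
    · ext i j
      have h2 := congrFun (congrFun h1.2 i) j
      have h3 := congrArg Complex.re h2
      have h4 := congrArg Complex.im h2
      change a.2 i j + a.2 j i = b.2 i j + b.2 j i at h3
      change a.2 i j - a.2 j i = b.2 i j - b.2 j i at h4
      linarith
  have hr : LinearMap.range f = siegelFiber p n := by
    ext x
    constructor
    · rintro ⟨a, rfl⟩
      refine ⟨?_, ?_, fun h => absurd h hp⟩
      · ext i j; simp [f, Sym2.eq_swap]
      · ext i j
        simp [f, Complex.ext_iff, add_comm]
    · rintro ⟨h1, h2, -⟩
      refine ⟨(Sym2.lift ⟨fun i j => x.1 i j, fun i j => (h1.apply j i)⟩,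
        of fun i j => ((x.2 i j).re + (x.2 i j).im) / 2), Prod.ext ?_ ?_⟩
      · ext i j : 2
        rfl
      · ext i j : 2
        have h3 := h2.apply j i
        have h4 := congrArg Complex.re h3
        have h5 := congrArg Complex.im h3
        simp only [Complex.star_def, Complex.conj_re, Complex.conj_im] at h4 h5
        apply Complex.ext
        · change ((x.2 i j).re + (x.2 i j).im) / 2 + ((x.2 j i).re + (x.2 j i).im) / 2 = _
          linarith
        · change ((x.2 i j).re + (x.2 i j).im) / 2 - ((x.2 j i).re + (x.2 j i).im) / 2 = _
          linarith
  have h2 : 2 * (n * (n + 1) / 2) = n * (n + 1) :=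
    Nat.mul_div_cancel' (Nat.even_mul_succ_self n).two_dvd
  rw [← hr, LinearMap.finrank_range_of_inj hf, Module.finrank_prod, Module.finrank_matrix,
    Module.finrank_pi_fintype]
  simp only [Complex.finrank_real_complex, Finset.sum_const, Finset.card_univ, Sym2.card,
    Fintype.card_fin, Nat.choose_two_right, smul_eq_mul, Module.finrank_self, Nat.add_sub_cancel]
  have h3 := h2
  rw [mul_comm (n + 1) n]
  nlinarith

lemma finrank_siegelModel [DecidablePred r] : Module.finrank ℝ (siegelModel r n) =
    Fintype.card {w // r w} * (n * (n + 1)) + Fintype.card {w // ¬ r w} * (n * (2 * n + 1)) := by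
  rw [(siegelModelEquiv r n).finrank_eq, Module.finrank_pi_fintype]
  have (w : W) : Module.finrank ℝ (siegelFiber (r w) n) =
      if r w then n * (n + 1) else n * (2 * n + 1) := by
    split_ifs with h
    · exact finrank_siegelFiber_of_true h
    · exact finrank_siegelFiber_of_false h
  simp only [this, Finset.sum_ite, Finset.sum_const, smul_eq_mul, Fintype.card_subtype]

end SiegelDim

section Places

open Set Filter Topology Matrix NumberField NumberField.InfinitePlace
open scoped ComplexOrder ContDiff

attribute [local instance] Matrix.linftyOpNormedRing Matrix.linftyOpNormedAlgebra

variable {K : Type} [Field K] {n : ℕ}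

/-- The images of a vector at the infinite places. -/
noncomputable def placeVec {l : Type*} (v : l → K) (w : InfinitePlace K) : l → ℂ :=
  fun i => w.embedding (v i)

/-- The images of a matrix at the infinite places. -/
noncomputable def placeMat {l : Type*} (g : Matrix l l K) (w : InfinitePlace K) : Matrix l l ℂ :=
  g.map w.embedding

lemma placeVec_vecMul {l : Type*} [Fintype l] (v : l → K) (g : Matrix l l K)
    (w : InfinitePlace K) : placeVec (v ᵥ* g) w = placeVec v w ᵥ* placeMat g w :=
  funext fun i => RingHom.map_vecMul w.embedding g v i

lemma placeMat_mul {l : Type*} [Fintype l] (g h : Matrix l l K) (w : InfinitePlace K) :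
    placeMat (g * h) w = placeMat g w * placeMat h w :=
  Matrix.map_mul

lemma placeMat_one {l : Type*} [DecidableEq l] (w : InfinitePlace K) :
    placeMat (1 : Matrix l l K) w = 1 := Matrix.map_one _ (map_zero _) (map_one _)

lemma isRealPoint_placeMat {g : Matrix (Fin n ⊕ Fin n) (Fin n ⊕ Fin n) K}
    (hg : g ∈ symplecticGroup (Fin n) K) : IsRealPoint IsReal (placeMat g) := fun w =>
  ⟨SymplecticGroup.map_mem (hA := hg) (f := w.embedding), fun hw => by
    ext i j
    exact RingHom.congr_fun (ComplexEmbedding.isReal_iff.1 (isReal_iff.1 hw)) (g j i)⟩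

lemma sympl_single {R : Type*} [CommRing R] (v : Fin n ⊕ Fin n → R) (i : Fin n ⊕ Fin n) :
    sympl v (Pi.single i 1) = Sum.elim (fun j => -v (Sum.inr j)) (fun j => v (Sum.inl j)) i := by
  rw [sympl, single_dotProduct, one_mul, J, fromBlocks_mulVec]
  rcases i with i | i <;> simp [neg_mulVec]

lemma sympl_map {R S : Type*} [CommRing R] [CommRing S] (f : R →+* S) {m : Type*} [Fintype m]
    [DecidableEq m] (v w : m ⊕ m → R) : f (sympl v w) = sympl (f ∘ v) (f ∘ w) := by
  rw [sympl, sympl, RingHom.map_dotProduct]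
  congr 1
  ext i
  rw [Function.comp_apply, RingHom.map_mulVec, Matrix.map_J]

variable [NumberField K]

/-- Points of the Siegel space of a number field. -/
abbrev SiegelPoint (K : Type) [Field K] [NumberField K] (n : ℕ) : Type :=
  siegelModel (W := InfinitePlace K) IsReal n

lemma hermRe_le_siegelQ {W : Type} [Fintype W] {r : W → Prop} (v : W → (Fin n ⊕ Fin n → ℂ))
    {x : siegelModel r n} (hx : x ∈ siegelSet) (w : W) :
    hermRe (siegelAt x w) (v w) (v w) ≤ siegelQ v x :=
  Finset.single_le_sum (f := fun w => hermRe (siegelAt x w) (v w) (v w))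
    (fun w _ => hermRe_nonneg (posDef_siegelAt hx w).posSemidef _) (Finset.mem_univ w)

lemma two_norm_sympl_le_siegelQ {W : Type} [Fintype W] {r : W → Prop}
    (u v : W → (Fin n ⊕ Fin n → ℂ)) {x : siegelModel r n} (hx : x ∈ siegelSet) (w : W) :
    2 * ‖sympl (u w) (v w)‖ ≤ siegelQ u x + siegelQ v x :=
  (two_norm_sympl_le (posDef_siegelAt hx w) (siegelAt_mem hx w) _ _).trans
    (add_le_add (hermRe_le_siegelQ u hx w) (hermRe_le_siegelQ v hx w))

lemma exists_siegelQ_bound {W : Type} [Fintype W] {r : W → Prop} {C : Set (siegelModel r n)}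
    (hC : IsCompact C) (hC' : C ⊆ siegelSet) {ι : Type} [Finite ι]
    (v : ι → W → (Fin n ⊕ Fin n → ℂ)) : ∃ B, ∀ i, ∀ x ∈ C, siegelQ (v i) x ≤ B := by
  have h (i) : ∃ B, ∀ x ∈ C, siegelQ (v i) x ≤ B := by
    obtain ⟨B, hB⟩ := hC.bddAbove_image ((contDiffOn_siegelQ (v i)).continuousOn.mono hC')
    exact ⟨B, fun x hx => hB (mem_image_of_mem _ hx)⟩
  choose B hB using h
  obtain ⟨M, hM⟩ := (Set.finite_range B).bddAbove
  exact ⟨M, fun i x hx => (hB i x hx).trans (hM (mem_range_self i))⟩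

lemma placeVec_single {l : Type*} [DecidableEq l] (i : l) (w : InfinitePlace K) :
    placeVec (Pi.single i (1 : K)) w = Pi.single i 1 := by
  ext j
  by_cases h : j = i
  · subst h; simp [placeVec]
  · simp [placeVec, Pi.single_eq_of_ne h]

/-- The integers with bounded archimedean absolute values. -/
lemma finite_integers_le (B : ℝ) : {a : 𝓞 K | ∀ w : InfinitePlace K, w a ≤ B}.Finite := by
  refine Set.Finite.of_injOn (f := fun a : 𝓞 K => (a : K)) (fun a ha => ?_)
    (RingOfIntegers.coe_injective.injOn) (Embeddings.finite_of_norm_le K ℂ B)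
  exact ⟨a.isIntegral_coe, fun φ => le_iff_le (a : K) B |>.1 ha φ⟩

/-- The vector over the field attached to an integral vector. -/
def intVec {l : Type*} (v : l → 𝓞 K) : l → K := fun i => v i

lemma finite_short_siegelQ {C : Set (SiegelPoint K n)} (hC : IsCompact C) (hC' : C ⊆ siegelSet)
    (c : ℝ) : {v : Fin n ⊕ Fin n → 𝓞 K | ∃ x ∈ C, siegelQ (placeVec (intVec v)) x ≤ c}.Finite := by
  obtain ⟨B, hB⟩ := exists_siegelQ_bound hC hC'
    (fun i : Fin n ⊕ Fin n => placeVec (Pi.single i (1 : K)))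
  refine (Set.Finite.pi' fun _ => finite_integers_le ((c + B) / 2)).subset ?_
  rintro v ⟨x, hx, hv⟩ i w
  have key (j) : ‖sympl (placeVec (intVec v) w) (Pi.single j 1)‖ ≤ (c + B) / 2 := by
    have := two_norm_sympl_le_siegelQ (placeVec (intVec v)) (placeVec (Pi.single j 1)) (hC' hx) w
    rw [placeVec_single] at this
    linarith [hB j x hx]
  rw [← norm_embedding_eq]
  rcases i with i | i
  · have := key (Sum.inr i)
    rwa [sympl_single, Sum.elim_inr] at this
  · have := key (Sum.inl i)
    rwa [sympl_single, Sum.elim_inl, norm_neg] at this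

lemma sympl_eq_zero_of_short {x : SiegelPoint K n} (hx : x ∈ siegelSet)
    {u v : Fin n ⊕ Fin n → 𝓞 K} (hu : siegelQ (placeVec (intVec u)) x < 1)
    (hv : siegelQ (placeVec (intVec v)) x < 1) : sympl u v = 0 := by
  by_contra h
  obtain ⟨w₀⟩ : Nonempty (InfinitePlace K) := inferInstance
  have key (w : InfinitePlace K) : w ((sympl u v : 𝓞 K) : K) < 1 := by
    rw [← norm_embedding_eq]
    have h1 := two_norm_sympl_le_siegelQ (placeVec (intVec u)) (placeVec (intVec v)) hx w
    have h2 : w.embedding ((sympl u v : 𝓞 K) : K) =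
        sympl (placeVec (intVec u) w) (placeVec (intVec v) w) :=
      sympl_map (w.embedding.comp (algebraMap (𝓞 K) K)) u v
    rw [h2]
    linarith
  have := one_le_of_lt_one (w := w₀) h fun {z} _ => key z
  exact absurd (key w₀) (not_lt.2 this)

end Places

section SymplecticFrames

open Matrix

variable {R L : Type*} [CommRing R] [IsDomain R] [IsPrincipalIdealRing R] [AddCommGroup L]
  [Module R L] [Module.Free R L] [Module.Finite R L] {ω : LinearMap.BilinForm R L}

lemma finrank_perp (hω : ω.IsAlt) {M : Submodule R L} {z v : L} (hz : z ∈ M) (hv : v ∈ M)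
    (hzv : ω z v = 1) : Module.finrank R M = Module.finrank R (perp ω M z v) + 2 := by
  have hvz : ω v z = -1 := by rw [← hω.neg_eq, hzv]
  have hzz := hω.self_eq_zero z
  have hvv := hω.self_eq_zero v
  let e : M ≃ₗ[R] perp ω M z v × (R × R) :=
    { toFun := fun x => (⟨x.1 + ω v x • z - ω z x • v, mem_perp.2 ⟨⟨M.sub_mem (M.add_mem x.2
          (M.smul_mem _ hz)) (M.smul_mem _ hv), by simp [hzv, hzz]⟩, by simp [hvz, hvv]⟩⟩,
        (ω z x, ω v x))
      invFun := fun y => ⟨y.1.1 - y.2.2 • z + y.2.1 • v, M.add_mem (M.sub_mem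
        (mem_perp.1 y.1.2).1.1 (M.smul_mem _ hz)) (M.smul_mem _ hv)⟩
      left_inv := fun x => by
        ext
        simp only
        abel
      right_inv := fun y => by
        have h1 := (mem_perp.1 y.1.2).1.2
        have h2 := (mem_perp.1 y.1.2).2
        refine Prod.ext (Subtype.ext ?_) (Prod.ext ?_ ?_)
        · simp only [map_add, map_sub, map_smul, smul_eq_mul, h1, h2, hzz, hzv, hvz, hvv]
          simp only [mul_zero, mul_one, mul_neg, sub_zero, zero_add, add_zero, zero_sub, neg_neg]
          abel
        · simp [h1, hzz, hzv]
        · simp [h2, hvz, hvv]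
      map_add' := fun x y => by
        refine Prod.ext (Subtype.ext ?_) (by simp)
        simp only [Submodule.coe_add, map_add, add_smul, Prod.fst_add]
        abel
      map_smul' := fun c x => by
        refine Prod.ext (Subtype.ext ?_) (by simp)
        simp [smul_sub, smul_add, smul_smul] }
  rw [e.finrank_eq, Module.finrank_prod, Module.finrank_prod, Module.finrank_self]

lemma splits_of_finrank (hω : ω.IsAlt) [Module.IsTorsionFree R L] (k : ℕ) :
    ∀ M : Submodule R L, HasPrim ω M → 2 * k ≤ Module.finrank R M → Splits ω k M := by
  induction k with
  | zero => exact fun _ _ _ => trivial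
  | succ k ih =>
    intro M hM hk
    constructor
    · have h1 : M ≠ ⊥ := by
        rintro rfl
        rw [finrank_bot] at hk
        lia
      obtain ⟨v, hv, hv0⟩ := Submodule.exists_mem_ne_zero_of_ne_bot h1
      obtain ⟨_, e, _, he⟩ := hM v hv hv0
      exact ⟨e, he⟩
    · intro z hz v hv hzv
      have := finrank_perp hω hz hv hzv
      exact ih _ (hasPrim_perp hω hM hz hv hzv) (by lia)

lemma exists_frame (hω : ω.IsAlt) [Module.IsTorsionFree R L] (k : ℕ) :
    ∀ M : Submodule R L, HasPrim ω M → Module.finrank R M = 2 * k → ∀ l : List L,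
      (∀ v ∈ l, v ∈ M) → (∀ u ∈ l, ∀ v ∈ l, ω u v = 0) →
      ∃ ps : List (L × L), IsFrame ω ps ∧ (∀ p ∈ ps, p.1 ∈ M ∧ p.2 ∈ M) ∧ ps.length = k ∧
        ∀ v ∈ l, v ∈ Submodule.span R {u | u ∈ ps.map Prod.fst} := by
  induction k with
  | zero =>
    intro M hM hk l hl hl'
    refine ⟨[], ⟨by simp, by simp⟩, by simp, rfl, fun v hv => ?_⟩
    have : M = ⊥ := by
      rw [← Submodule.finrank_eq_zero (R := R), hk]
    have h1 := hl v hv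
    rw [this] at h1
    rw [(Submodule.mem_bot R).1 h1]
    exact zero_mem _
  | succ k ih =>
    intro M hM hk l hl hl'
    obtain ⟨e, ⟨heM, z, hz, hez⟩, he⟩ : ∃ e, PrimIn ω M e ∧ ∀ v ∈ l, ω e v = 0 := by
      by_cases h0 : ∀ v ∈ l, v = 0
      · obtain ⟨e, he⟩ := (splits_of_finrank hω (k + 1) M hM hk.ge).1
        exact ⟨e, he, fun v hv => by rw [h0 v hv, map_zero]⟩
      · push Not at h0
        obtain ⟨v, hv, hv0⟩ := h0
        obtain ⟨m, e, rfl, he⟩ := hM v (hl v hv) hv0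
        refine ⟨e, he, fun u hu => ?_⟩
        have := hl' _ hv u hu
        rw [map_smul, LinearMap.smul_apply, smul_eq_mul] at this
        exact (mul_eq_zero.1 this).resolve_left fun h => hv0 (by rw [h, zero_smul])
    have hze : ω z e = -1 := by rw [← hω.neg_eq, hez]
    have hzz := hω.self_eq_zero z
    have hee := hω.self_eq_zero e
    have he' : ∀ v ∈ l, ω v e = 0 := fun v hv => by rw [← hω.neg_eq, he v hv, neg_zero]
    obtain ⟨ps, hps, hpM, hlen, hspan⟩ := ih (perp ω M e z) (hasPrim_perp hω hM heM hz hez)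
      (by have := finrank_perp hω heM hz hez; lia) (l.map fun v => v + ω z v • e) (by
        intro x hx
        obtain ⟨v, hv, rfl⟩ := List.mem_map.1 hx
        refine mem_perp.2 ⟨⟨M.add_mem (hl v hv) (M.smul_mem _ heM), ?_⟩, ?_⟩
        · simp [he v hv, hee]
        · simp [hze]) (by
        intro x hx y hy
        obtain ⟨u, hu, rfl⟩ := List.mem_map.1 hx
        obtain ⟨v, hv, rfl⟩ := List.mem_map.1 hy
        simp [hl' u hu v hv, he v hv, he' u hu, hee])
    refine ⟨(e, z) :: ps, ⟨?_, ?_⟩, ?_, by simp [hlen], fun v hv => ?_⟩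
    · intro p hp
      rcases List.mem_cons.1 hp with rfl | hp
      · exact hez
      · exact hps.1 p hp
    · refine List.pairwise_cons.2 ⟨fun p hp => ?_, hps.2⟩
      have h1 := mem_perp.1 (hpM p hp).1
      have h2 := mem_perp.1 (hpM p hp).2
      exact ⟨h1.1.2, h2.1.2, h1.2, h2.2⟩
    · intro p hp
      rcases List.mem_cons.1 hp with rfl | hp
      · exact ⟨heM, hz⟩
      · exact ⟨(mem_perp.1 (hpM p hp).1).1.1, (mem_perp.1 (hpM p hp).2).1.1⟩
    · have h1 := hspan _ (List.mem_map_of_mem hv)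
      have h2 : Submodule.span R {u | u ∈ ps.map Prod.fst} ≤
          Submodule.span R {u | u ∈ ((e, z) :: ps).map Prod.fst} :=
        Submodule.span_mono fun u hu => List.mem_cons_of_mem _ hu
      have h3 : e ∈ Submodule.span R {u | u ∈ ((e, z) :: ps).map Prod.fst} :=
        Submodule.subset_span List.mem_cons_self
      have h4 := Submodule.sub_mem _ (h2 h1) (Submodule.smul_mem _ (ω z v) h3)
      simpa using h4

end SymplecticFrames

section StandardForm

open Matrix

variable {R : Type*} [CommRing R] {m : Type*} [Fintype m] [DecidableEq m]

lemma sympl_eq_sum (v w : m ⊕ m → R) :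
    sympl v w = ∑ i, (v (Sum.inl i) * w (Sum.inr i) - v (Sum.inr i) * w (Sum.inl i)) := by
  rw [sympl, J, fromBlocks_mulVec, dotProduct, Fintype.sum_sum_type, ← Finset.sum_add_distrib]
  refine Finset.sum_congr rfl fun i _ => ?_
  simp [neg_mulVec]
  ring

/-- The standard symplectic form as a bilinear form. -/
def symplForm (R m : Type*) [CommRing R] [Fintype m] [DecidableEq m] :
    LinearMap.BilinForm R (m ⊕ m → R) :=
  LinearMap.mk₂ R sympl (fun _ _ _ => by simp [sympl, mulVec_add, dotProduct_add])
    (fun _ _ _ => by simp [sympl, mulVec_smul]) (fun _ _ _ => by simp [sympl, add_dotProduct])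
    (fun _ _ _ => by simp [sympl])

lemma symplForm_apply (v w : m ⊕ m → R) : symplForm R m v w = sympl v w := rfl

lemma symplForm_isAlt : (symplForm R m).IsAlt := fun v => by
  rw [symplForm_apply, sympl_eq_sum]
  exact Finset.sum_eq_zero fun i _ => by ring

lemma sympl_swap (v w : m ⊕ m → R) : sympl w v = -sympl v w :=
  (symplForm_isAlt.neg_eq v w).symm

lemma symplForm_hasPrim [IsDomain R] [IsPrincipalIdealRing R] : HasPrim (symplForm R m) ⊤ := by
  intro v _ hv
  set I := Ideal.span (Set.range v) with hI
  set d := Submodule.IsPrincipal.generator I with hd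
  have h1 (i) : d ∣ v i := (Submodule.IsPrincipal.mem_iff_generator_dvd I).1
    (Ideal.subset_span ⟨i, rfl⟩)
  choose u hu using h1
  have hd0 : d ≠ 0 := fun h => hv (funext fun i => by rw [hu, h, zero_mul]; rfl)
  obtain ⟨c, hc⟩ := (Submodule.mem_span_range_iff_exists_fun R).1
    (show d ∈ Submodule.span R (Set.range v) from Submodule.IsPrincipal.generator_mem I)
  have h2 : ∑ i, c i * u i = 1 := by
    refine mul_left_cancel₀ hd0 ?_
    rw [Finset.mul_sum, mul_one]
    refine Eq.trans (Finset.sum_congr rfl fun i _ => ?_) hc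
    rw [smul_eq_mul, hu i]
    ring
  refine ⟨d, u, funext hu, trivial, -(c ᵥ* J m R), trivial, ?_⟩
  rw [symplForm_apply, sympl, dotProduct_mulVec, neg_vecMul, vecMul_vecMul, J_squared,
    vecMul_neg, vecMul_one, neg_neg]
  exact h2

/-- The matrix with prescribed rows taken from a list of pairs. -/
def frameMatrix {n : ℕ} (p : Fin n → (Fin n ⊕ Fin n → R) × (Fin n ⊕ Fin n → R)) :
    Matrix (Fin n ⊕ Fin n) (Fin n ⊕ Fin n) R :=
  of (Sum.elim (fun i => (p i).1) (fun i => (p i).2))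

lemma mul_J_mul_transpose_apply (P : Matrix (m ⊕ m) (m ⊕ m) R) (a b : m ⊕ m) :
    (P * J m R * Pᵀ) a b = sympl (P b) (P a) := by
  rw [sympl, dotProduct_mulVec]
  rfl

lemma frameMatrix_mem {n : ℕ} {p : Fin n → (Fin n ⊕ Fin n → R) × (Fin n ⊕ Fin n → R)}
    (hp : ∀ i, sympl (p i).1 (p i).2 = 1)
    (h : ∀ i j, i < j → sympl (p i).1 (p j).1 = 0 ∧ sympl (p i).1 (p j).2 = 0 ∧
      sympl (p i).2 (p j).1 = 0 ∧ sympl (p i).2 (p j).2 = 0) :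
    frameMatrix p ∈ symplecticGroup (Fin n) R := by
  rw [SymplecticGroup.mem_iff]
  ext a b
  rw [mul_J_mul_transpose_apply]
  have self (u : Fin n ⊕ Fin n → R) : sympl u u = 0 := symplForm_isAlt u
  rcases a with i | i <;> rcases b with j | j <;>
    simp only [J, fromBlocks_apply₁₁, fromBlocks_apply₁₂, fromBlocks_apply₂₁,
      fromBlocks_apply₂₂, Matrix.zero_apply, Matrix.neg_apply, Matrix.one_apply]
  · change sympl (p j).1 (p i).1 = 0
    rcases lt_trichotomy i j with hij | rfl | hij
    · rw [sympl_swap, (h i j hij).1, neg_zero]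
    · exact self _
    · exact (h j i hij).1
  · change sympl (p j).2 (p i).1 = _
    rcases lt_trichotomy i j with hij | rfl | hij
    · rw [sympl_swap, (h i j hij).2.1, if_neg hij.ne]
    · rw [sympl_swap, hp, if_pos rfl]
    · rw [(h j i hij).2.2.1, if_neg hij.ne', neg_zero]
  · change sympl (p j).1 (p i).2 = _
    rcases lt_trichotomy i j with hij | rfl | hij
    · rw [sympl_swap, (h i j hij).2.2.1, if_neg hij.ne, neg_zero]
    · rw [hp, if_pos rfl]
    · rw [(h j i hij).2.1, if_neg hij.ne']
  · change sympl (p j).2 (p i).2 = 0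
    rcases lt_trichotomy i j with hij | rfl | hij
    · rw [sympl_swap, (h i j hij).2.2.2, neg_zero]
    · exact self _
    · exact (h j i hij).2.2.2

lemma exists_symplectic_of_isotropic {K : Type*} [Field K] {n : ℕ}
    (l : List (Fin n ⊕ Fin n → K)) (hl : ∀ u ∈ l, ∀ v ∈ l, sympl u v = 0) :
    ∃ P ∈ symplecticGroup (Fin n) K, ∀ v ∈ l, ∃ c : Fin n → K, v = Sum.elim c 0 ᵥ* P := by
  obtain ⟨ps, hps, -, hlen, hspan⟩ := exists_frame symplForm_isAlt n ⊤
    (symplForm_hasPrim (R := K) (m := Fin n)) (by simp [two_mul]) l (by simp) hl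
  have hi (i : Fin n) : i < ps.length := hlen.symm ▸ i.2
  refine ⟨frameMatrix fun i => ps[i]'(hi i), frameMatrix_mem
    (fun i => hps.1 (ps[i]'(hi i)) (List.getElem_mem _))
    fun i j h => List.pairwise_iff_getElem.1 hps.2 i j (hi i) (hi j) h, fun v hv => ?_⟩
  have h1 : {u | u ∈ ps.map Prod.fst} = Set.range fun i : Fin n => (ps[i]'(hi i)).1 := by
    ext u
    constructor
    · intro hu
      obtain ⟨p, hp, rfl⟩ := List.mem_map.1 hu
      obtain ⟨i, hi', rfl⟩ := List.mem_iff_getElem.1 hp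
      exact ⟨⟨i, hlen ▸ hi'⟩, rfl⟩
    · rintro ⟨i, rfl⟩
      exact List.mem_map_of_mem (List.getElem_mem _)
  have h2 := hspan v hv
  rw [h1, Submodule.mem_span_range_iff_exists_fun] at h2
  obtain ⟨c, rfl⟩ := h2
  refine ⟨c, ?_⟩
  rw [vecMul_eq_sum, Fintype.sum_sum_type]
  simp only [Sum.elim_inl, Sum.elim_inr, Pi.zero_apply, zero_smul, Finset.sum_const_zero, add_zero]
  rfl

end StandardForm

section IntegralAction

open Set Filter Topology Matrix NumberField NumberField.InfinitePlace
open scoped ComplexOrder ContDiff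

attribute [local instance] Matrix.linftyOpNormedRing Matrix.linftyOpNormedAlgebra

/-- The action of the symplectic group on row vectors. -/
instance (priority := high) symplecticSMul {R : Type*} [CommRing R] {n : ℕ} :
    SMul (symplecticGroup (Fin n) R) (Fin n ⊕ Fin n → R) where
  smul g v := v ᵥ* (g⁻¹).1

lemma symplectic_smul_def {R : Type*} [CommRing R] {n : ℕ} (g : symplecticGroup (Fin n) R)
    (v : Fin n ⊕ Fin n → R) : g • v = v ᵥ* (g⁻¹).1 := rfl

instance (priority := high) symplecticDistribMulAction {R : Type*} [CommRing R] {n : ℕ} :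
    DistribMulAction (symplecticGroup (Fin n) R) (Fin n ⊕ Fin n → R) where
  toSMul := symplecticSMul
  one_smul v := by
    rw [symplectic_smul_def, inv_one]; exact vecMul_one v
  mul_smul g h v := by
    rw [symplectic_smul_def, symplectic_smul_def, symplectic_smul_def, _root_.mul_inv_rev,
      vecMul_vecMul]
    rfl
  smul_zero g := zero_vecMul _
  smul_add g v w := add_vecMul _ _ _

variable {K : Type} [Field K] [NumberField K] {n : ℕ}

/-- The matrix over the field attached to an integral matrix. -/
def intMat {l : Type*} (g : Matrix l l (𝓞 K)) : Matrix l l K := g.map (algebraMap (𝓞 K) K)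

lemma intVec_vecMul {l : Type*} [Fintype l] (v : l → 𝓞 K) (g : Matrix l l (𝓞 K)) :
    intVec (v ᵥ* g) = intVec v ᵥ* intMat g :=
  funext fun i => RingHom.map_vecMul (algebraMap (𝓞 K) K) g v i

lemma intMat_mul {l : Type*} [Fintype l] (g h : Matrix l l (𝓞 K)) :
    intMat (g * h) = intMat g * intMat h := Matrix.map_mul

lemma intMat_one {l : Type*} [DecidableEq l] : intMat (1 : Matrix l l (𝓞 K)) = 1 :=
  Matrix.map_one _ (map_zero _) (map_one _)

lemma isRealPoint_intMat (g : symplecticGroup (Fin n) (𝓞 K)) :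
    IsRealPoint IsReal (placeMat (intMat g.1)) :=
  isRealPoint_placeMat (SymplecticGroup.map_mem (hA := g.2) (f := algebraMap (𝓞 K) K))

/-- The action of the integral symplectic group on the Siegel space. -/
noncomputable def spAct (g : symplecticGroup (Fin n) (𝓞 K)) (x : SiegelPoint K n) :
    SiegelPoint K n := siegelAct (placeMat (intMat g.1)) x

/-- The quadratic form at a point evaluated on integral vectors. -/
noncomputable def spQ (v : Fin n ⊕ Fin n → 𝓞 K) (x : SiegelPoint K n) : ℝ :=
  siegelQ (placeVec (intVec v)) x

lemma spAct_one {x : SiegelPoint K n} (hx : x ∈ siegelSet) : spAct 1 x = x := by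
  have h : placeMat (intMat (1 : symplecticGroup (Fin n) (𝓞 K)).1) =
      fun _ : InfinitePlace K => 1 := funext fun w => by
    change placeMat (intMat (1 : Matrix (Fin n ⊕ Fin n) (Fin n ⊕ Fin n) (𝓞 K))) w = 1
    rw [intMat_one, placeMat_one]
  rw [spAct, h, siegelAct_one hx]

lemma spAct_mul (g h : symplecticGroup (Fin n) (𝓞 K)) {x : SiegelPoint K n}
    (hx : x ∈ siegelSet) : spAct (g * h) x = spAct g (spAct h x) := by
  rw [spAct, spAct, spAct, ← siegelAct_mul (isRealPoint_intMat h) hx]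
  congr 1
  ext1 w
  rw [← placeMat_mul, ← intMat_mul]
  rfl

lemma spAct_mem (g : symplecticGroup (Fin n) (𝓞 K)) {x : SiegelPoint K n}
    (hx : x ∈ siegelSet) : spAct g x ∈ siegelSet := siegelAct_mem (isRealPoint_intMat g) hx

lemma spQ_act (g : symplecticGroup (Fin n) (𝓞 K)) (v : Fin n ⊕ Fin n → 𝓞 K)
    {x : SiegelPoint K n} (hx : x ∈ siegelSet) : spQ (g • v) (spAct g x) = spQ v x := by
  rw [spQ, spAct, siegelQ_act (isRealPoint_intMat g) _ hx, spQ]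
  congr 1
  ext1 w
  rw [← placeVec_vecMul, ← intVec_vecMul, symplectic_smul_def, vecMul_vecMul]
  have : (g⁻¹).1 * g.1 = 1 := congrArg Subtype.val (inv_mul_cancel g)
  rw [this, vecMul_one]

lemma spQ_nsmul (k : ℕ) (v : Fin n ⊕ Fin n → 𝓞 K) (x : SiegelPoint K n) :
    spQ (k • v) x = k ^ 2 * spQ v x := by
  rw [spQ, siegelQ, spQ, siegelQ, Finset.mul_sum]
  refine Finset.sum_congr rfl fun w _ => ?_
  have : placeVec (intVec (k • v)) w = (k : ℂ) • placeVec (intVec v) w := by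
    ext i
    simp [placeVec, intVec]
  rw [this, hermRe_smul_self]
  simp

lemma exists_short_spQ (l : List (Fin n ⊕ Fin n → 𝓞 K))
    (hl : l.Pairwise fun u v => sympl u v = 0) {ε : ℝ} (hε : 0 < ε) :
    ∃ x : SiegelPoint K n, x ∈ siegelSet ∧ ∀ v ∈ l, spQ v x < ε := by
  have hl' : ∀ u ∈ l, ∀ v ∈ l, sympl u v = 0 := fun u hu v hv =>
    haveI : Std.Symm fun u v : Fin n ⊕ Fin n → 𝓞 K => sympl u v = 0 :=
      ⟨fun a b h => by rw [sympl_swap, h, neg_zero]⟩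
    hl.forall_of_forall (fun a _ => symplForm_isAlt a) hu hv
  obtain ⟨P, hP, hc⟩ := exists_symplectic_of_isotropic (l.map intVec) (by
    intro u' hu' v' hv'
    obtain ⟨u, hu, rfl⟩ := List.mem_map.1 hu'
    obtain ⟨v, hv, rfl⟩ := List.mem_map.1 hv'
    have := sympl_map (algebraMap (𝓞 K) K) u v
    rw [hl' u hu v hv, map_zero] at this
    exact this.symm)
  choose! c hc using fun v hv => hc (intVec v) (List.mem_map_of_mem hv)
  have hP' : IsRealPoint IsReal (placeMat ((⟨P, hP⟩ : symplecticGroup (Fin n) K)⁻¹).1) :=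
    isRealPoint_placeMat ((⟨P, hP⟩ : symplecticGroup (Fin n) K)⁻¹).2
  have hPP : P * ((⟨P, hP⟩ : symplecticGroup (Fin n) K)⁻¹).1 = 1 :=
    congrArg Subtype.val (mul_inv_cancel (⟨P, hP⟩ : symplecticGroup (Fin n) K))
  let N : (Fin n ⊕ Fin n → 𝓞 K) → ℝ := fun v =>
    ∑ w, hermRe 1 (placeVec (c v) w) (placeVec (c v) w)
  obtain ⟨B, hB⟩ := ((List.finite_toSet l).image N).bddAbove
  have hB0 : 0 < max B 0 + 1 := by positivity
  have ht : 0 < ε / (max B 0 + 1) := by positivity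
  refine ⟨siegelAct (placeMat ((⟨P, hP⟩ : symplecticGroup (Fin n) K)⁻¹).1)
    (siegelBase _ _ n (ε / (max B 0 + 1))), siegelAct_mem hP' (siegelBase_mem ht), fun v hv => ?_⟩
  rw [spQ, siegelQ_act hP' _ (siegelBase_mem ht)]
  have h1 : (fun w => placeVec (intVec v) w ᵥ*
      placeMat ((⟨P, hP⟩ : symplecticGroup (Fin n) K)⁻¹).1 w) =
        fun w => Sum.elim (placeVec (c v) w) 0 := by
    ext1 w
    rw [← placeVec_vecMul, hc v hv, vecMul_vecMul, hPP, vecMul_one]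
    ext i
    rcases i with i | i <;> simp [placeVec]
  rw [h1, siegelQ_base]
  have h2 : N v ≤ B := hB (mem_image_of_mem _ hv)
  have h3 : N v < max B 0 + 1 := by linarith [le_max_left B 0]
  calc ε / (max B 0 + 1) * N v < ε / (max B 0 + 1) * (max B 0 + 1) :=
        mul_lt_mul_of_pos_left h3 ht
    _ = ε := div_mul_cancel₀ _ hB0.ne'

lemma proper_spAct {C : Set (SiegelPoint K n)} (hC : IsCompact C) (hC' : C ⊆ siegelSet) :
    {g : symplecticGroup (Fin n) (𝓞 K) | ∃ x ∈ C, spAct g x ∈ C}.Finite := by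
  obtain ⟨B, hB⟩ := exists_siegelQ_bound hC hC'
    (fun i : Fin n ⊕ Fin n => placeVec (intVec (Pi.single i (1 : 𝓞 K))))
  refine Set.Finite.of_injOn (f := fun g i => g • (Pi.single i 1 : Fin n ⊕ Fin n → 𝓞 K))
    (t := {f | ∀ i, f i ∈ {v | ∃ x ∈ C, spQ v x ≤ B}}) ?_ ?_
    (Set.Finite.pi' fun _ => finite_short_siegelQ hC hC' B)
  · rintro g ⟨x, hx, hgx⟩ i
    exact ⟨_, hgx, by rw [spQ_act g _ (hC' hx)]; exact hB i x hx⟩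
  · intro g _ h _ hgh
    have h1 : (g⁻¹).1 = (h⁻¹).1 := by
      ext i j
      have := congrFun (congrFun hgh i) j
      simpa [symplectic_smul_def] using this
    exact inv_injective (Subtype.ext h1)

end IntegralAction

section TraceDual

open Matrix NumberField NumberField.InfinitePlace
open scoped ComplexConjugate

variable {K : Type} [Field K] [NumberField K]

lemma sum_embedding_traceDual {ι : Type*} [Fintype ι] [DecidableEq ι] (b : Module.Basis ι ℚ K)
    [DecidableEq (K →ₐ[ℚ] ℂ)] (φ ψ : K →ₐ[ℚ] ℂ) :
    ∑ j, φ (b j) * ψ (b.traceDual j) = if φ = ψ then 1 else 0 := by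
  let A : Matrix ι (K →ₐ[ℚ] ℂ) ℂ := of fun i φ => φ (b i)
  let C : Matrix (K →ₐ[ℚ] ℂ) ι ℂ := of fun φ j => φ (b.traceDual j)
  have h : A * C = 1 := by
    ext i j
    have h1 := trace_eq_sum_embeddings (K := ℚ) (L := K) ℂ (x := b i * b.traceDual j)
    rw [Module.Basis.trace_mul_traceDual] at h1
    rw [mul_apply, one_apply]
    simp only [A, C, of_apply, ← map_mul]
    rw [← h1]
    split_ifs <;> simp
  have h2 : C * A = 1 := (mul_eq_one_comm_of_card_eq _ _ _ (by
    rw [AlgHom.card, Module.finrank_eq_card_basis b])).1 h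
  have h3 := congrFun (congrFun h2 ψ) φ
  rw [mul_apply, one_apply] at h3
  simp only [A, C, of_apply] at h3
  rw [Finset.sum_congr rfl fun j _ => mul_comm _ _, h3]
  simp [eq_comm]

lemma sum_ringHom_traceDual {ι : Type*} [Fintype ι] [DecidableEq ι] (b : Module.Basis ι ℚ K)
    [DecidableEq (K →+* ℂ)] (φ ψ : K →+* ℂ) :
    ∑ j, φ (b j) * ψ (b.traceDual j) = if φ = ψ then 1 else 0 := by
  classical
  have := sum_embedding_traceDual b φ.toRatAlgHom ψ.toRatAlgHom
  simp only [RingHom.toRatAlgHom_apply] at this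
  rw [this]
  congr 1
  rw [eq_iff_iff]
  exact (RingHom.equivRatAlgHom (R := K) (S := ℂ)).injective.eq_iff

/-- A functional on the field integral on a basis comes from the trace form. -/
lemma eq_mult_mul_of_sum_re {ι : Type*} [Fintype ι] [DecidableEq ι] (b : Module.Basis ι ℚ K)
    (k : ι → ℤ) (γ : InfinitePlace K → ℂ) (hγ : ∀ w, w.IsReal → conj (γ w) = γ w)
    (h : ∀ j, ∑ w : InfinitePlace K, (w.embedding (b j) * γ w).re = k j) (w : InfinitePlace K) :
    γ w = w.mult * w.embedding (∑ j, (k j : K) * b.traceDual j) := by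
  classical
  have h1 (j) : (k j : ℂ) = ∑ u : InfinitePlace K, (u.embedding (b j) * γ u +
      ComplexEmbedding.conjugate u.embedding (b j) * conj (γ u)) / 2 := by
    rw [← Complex.ofReal_intCast, ← h j, Complex.ofReal_sum]
    refine Finset.sum_congr rfl fun u _ => ?_
    rw [Complex.re_eq_add_conj, map_mul, ComplexEmbedding.conjugate_coe_eq]
  have h2 : w.embedding (∑ j, (k j : K) * b.traceDual j) = ∑ u : InfinitePlace K,
      ((if u.embedding = w.embedding then 1 else 0) * γ u +
      (if ComplexEmbedding.conjugate u.embedding = w.embedding then 1 else 0) * conj (γ u)) / 2 := by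
    rw [map_sum]
    simp only [map_mul, map_intCast, h1, Finset.sum_mul]
    rw [Finset.sum_comm]
    refine Finset.sum_congr rfl fun u _ => ?_
    rw [← sum_ringHom_traceDual b, ← sum_ringHom_traceDual b, Finset.sum_mul, Finset.sum_mul,
      ← Finset.sum_add_distrib, Finset.sum_div]
    refine Finset.sum_congr rfl fun j _ => ?_
    ring
  rw [h2, Finset.sum_eq_single w]
  · by_cases hw : w.IsReal
    · have h3 : ComplexEmbedding.conjugate w.embedding = w.embedding := isReal_iff.1 hw
      rw [h3, if_pos rfl, mult_isReal ⟨w, hw⟩, hγ w hw]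
      push_cast
      ring
    · have h3 : ComplexEmbedding.conjugate w.embedding ≠ w.embedding := fun h => hw (isReal_iff.2 h)
      rw [if_neg h3, if_pos rfl, mult_isComplex ⟨w, not_isReal_iff_isComplex.1 hw⟩]
      push_cast
      ring
  · intro u _ hu
    have h3 : u.embedding ≠ w.embedding := fun h => hu (by
      rw [← mk_embedding u, h, mk_embedding])
    have h4 : ComplexEmbedding.conjugate u.embedding ≠ w.embedding := fun h => hu (by
      rw [← mk_embedding u, ← mk_conjugate_eq, h, mk_embedding])
    rw [if_neg h3, if_neg h4]
    simp
  · simp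

end TraceDual

section ShortGenerators

open Matrix NumberField NumberField.InfinitePlace
open scoped ComplexConjugate ComplexOrder

lemma hermRe_eq_hermRe_J {m : Type*} [Fintype m] [DecidableEq m] {H : Matrix (m ⊕ m) (m ⊕ m) ℂ}
    (hH : H.PosDef) (hs : H ∈ symplecticGroup m ℂ) (u : m ⊕ m → ℂ) :
    hermRe H u u = hermRe H (J m ℂ *ᵥ (H *ᵥ star u)) (J m ℂ *ᵥ (H *ᵥ star u)) := by
  have hu : IsUnit H.det := (isUnit_iff_isUnit_det _).1 hH.isUnit
  have h1 : H⁻¹ *ᵥ (H *ᵥ star u) = star u := by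
    rw [mulVec_mulVec, nonsing_inv_mul _ hu, one_mulVec]
  rw [← hermRe_inv_eq hs, hermRe, hermRe, star_star, h1, star_dotProduct_star, Complex.star_def,
    Complex.conj_re, dotProduct_comm]

variable {K : Type} [Field K] [NumberField K] {n : ℕ}

/-- The real coordinates of vectors over the archimedean completion. -/
noncomputable def placeCoord (l : Type*) (w : InfinitePlace K) :
    (l → Module.Free.ChooseBasisIndex ℤ (𝓞 K) → ℝ) →ₗ[ℝ] (l → ℂ) where
  toFun t i := ∑ j, (t i j : ℂ) * w.embedding (integralBasis K j)
  map_add' s t := by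
    ext i
    simp [add_mul, Finset.sum_add_distrib]
  map_smul' c t := by
    ext i
    simp [Finset.mul_sum, mul_assoc]

lemma placeCoord_real {l : Type*} {w : InfinitePlace K} (hw : w.IsReal)
    (t : l → Module.Free.ChooseBasisIndex ℤ (𝓞 K) → ℝ) :
    star (placeCoord l w t) = placeCoord l w t := by
  ext i
  have h (a : K) : conj (w.embedding a) = w.embedding a := by
    rw [← ComplexEmbedding.conjugate_coe_eq]
    exact congrArg (fun f : K →+* ℂ => f a) (isReal_iff.1 hw)
  simp [placeCoord, h]

/-- The real coordinates of an integral vector. -/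
noncomputable def intCoord (K : Type) [Field K] [NumberField K] (l : Type*) :
    (l → 𝓞 K) →+ (l → Module.Free.ChooseBasisIndex ℤ (𝓞 K) → ℝ) where
  toFun v i j := ((RingOfIntegers.basis K).repr (v i) j : ℝ)
  map_zero' := by ext; simp
  map_add' v w := by ext; simp

lemma intCoord_injective (l : Type*) : Function.Injective (intCoord K l) := by
  intro v w h
  ext i
  congr 1
  refine (RingOfIntegers.basis K).repr.injective (Finsupp.ext fun j => ?_)
  have h1 : ((RingOfIntegers.basis K).repr (v i) j : ℝ) = (RingOfIntegers.basis K).repr (w i) j :=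
    congrFun (congrFun h i) j
  exact_mod_cast h1

lemma placeCoord_intCoord {l : Type*} (w : InfinitePlace K) (v : l → 𝓞 K) :
    placeCoord l w (intCoord K l v) = placeVec (intVec v) w := by
  ext i
  have h := (RingOfIntegers.basis K).sum_repr (v i)
  have hrepr := congrArg (fun a : 𝓞 K => w.embedding (a : K)) h
  simp only [map_sum, zsmul_eq_mul, map_mul, map_intCast] at hrepr
  simp only [placeCoord, intCoord, LinearMap.coe_mk, AddHom.coe_mk, AddMonoidHom.coe_mk,
    ZeroHom.coe_mk, placeVec, intVec, integralBasis_apply, Complex.ofReal_intCast]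
  exact hrepr

/-- The positive definite form on real coordinates attached to a point of the Siegel space. -/
noncomputable def coordForm {x : SiegelPoint K n} (hx : x ∈ siegelSet) :
    (Fin n ⊕ Fin n → Module.Free.ChooseBasisIndex ℤ (𝓞 K) → ℝ) →ₗ[ℝ]
      (Fin n ⊕ Fin n → Module.Free.ChooseBasisIndex ℤ (𝓞 K) → ℝ) →ₗ[ℝ] ℝ :=
  LinearMap.mk₂ ℝ (fun s t => ∑ w : InfinitePlace K,
      hermRe (siegelAt x w) (placeCoord _ w s) (placeCoord _ w t))
    (fun s s' t => by simp only [map_add, hermRe_add_left, Finset.sum_add_distrib])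
    (fun c s t => by simp only [map_smul, hermRe_smul_left, Finset.mul_sum, smul_eq_mul])
    (fun s t t' => by
      simp only [map_add, hermRe_add_right (posDef_siegelAt hx _).1, Finset.sum_add_distrib])
    (fun c s t => by
      simp only [map_smul, hermRe_smul_right (posDef_siegelAt hx _).1, Finset.mul_sum, smul_eq_mul])

lemma coordForm_apply {x : SiegelPoint K n} (hx : x ∈ siegelSet)
    (s t : Fin n ⊕ Fin n → Module.Free.ChooseBasisIndex ℤ (𝓞 K) → ℝ) :
    coordForm hx s t = ∑ w : InfinitePlace K,
      hermRe (siegelAt x w) (placeCoord _ w s) (placeCoord _ w t) := rfl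

lemma coordForm_intCoord {x : SiegelPoint K n} (hx : x ∈ siegelSet) (v : Fin n ⊕ Fin n → 𝓞 K) :
    coordForm hx (intCoord K _ v) (intCoord K _ v) = spQ v x := by
  rw [coordForm_apply, spQ, siegelQ]
  simp only [placeCoord_intCoord]

/-- A denominator for the dual basis of an integral basis. -/
lemma exists_traceDual_denominator (K : Type) [Field K] [NumberField K] :
    ∃ N : ℤ, N ≠ 0 ∧ ∀ j, ∃ c : 𝓞 K, (c : K) = N * (integralBasis K).traceDual j := by
  classical
  obtain ⟨N, hN, h⟩ := exists_integral_multiples ℤ ℚ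
    (Finset.univ.image fun j => (integralBasis K).traceDual j)
  refine ⟨N, hN, fun j => ?_⟩
  have := h _ (Finset.mem_image_of_mem _ (Finset.mem_univ j))
  rw [zsmul_eq_mul] at this
  exact ⟨⟨_, this⟩, rfl⟩

lemma le_coordForm_of_integral {N : ℤ} (hN : N ≠ 0)
    (hdual : ∀ j, ∃ c : 𝓞 K, (c : K) = N * (integralBasis K).traceDual j)
    {x : SiegelPoint K n} (hx : x ∈ siegelSet) {ε : ℝ}
    (hε : ∀ v : Fin n ⊕ Fin n → 𝓞 K, v ≠ 0 → ε ≤ spQ v x)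
    (β : Fin n ⊕ Fin n → Module.Free.ChooseBasisIndex ℤ (𝓞 K) → ℝ)
    (hβ : ∀ v, ∃ k : ℤ, coordForm hx (intCoord K _ v) β = k) (h0 : coordForm hx β β ≠ 0) :
    ε / N ^ 2 ≤ coordForm hx β β := by
  classical
  choose c hc using hdual
  choose k hk using fun i j => hβ (Pi.single i (RingOfIntegers.basis K j))
  let γ (w : InfinitePlace K) : Fin n ⊕ Fin n → ℂ :=
    siegelAt x w *ᵥ star (placeCoord _ w β)
  have hγ (i) (w : InfinitePlace K) (hw : w.IsReal) : conj (γ w i) = γ w i := by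
    have h1 : star (γ w) = γ w := by
      simp only [γ]
      rw [placeCoord_real hw, star_mulVec, placeCoord_real hw, siegelAt_real x hw, vecMul_transpose]
    exact congrFun h1 i
  have hsum (i j) : ∑ w : InfinitePlace K, (w.embedding (integralBasis K j) * γ w i).re = k i j := by
    rw [← hk i j, coordForm_apply]
    refine Finset.sum_congr rfl fun w _ => ?_
    rw [placeCoord_intCoord, hermRe]
    have : placeVec (intVec (Pi.single i (RingOfIntegers.basis K j))) w =
        Pi.single i (w.embedding (integralBasis K j)) := by
      ext i'
      by_cases h : i' = i
      · subst h; simp [placeVec, intVec]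
      · simp [placeVec, intVec, Pi.single_eq_of_ne h]
    rw [this, single_dotProduct]
  let v : Fin n ⊕ Fin n → 𝓞 K := fun i => ∑ j, (k i j : 𝓞 K) * c j
  have hv (w : InfinitePlace K) : ((N : ℤ) : ℂ) • γ w =
      (w.mult : ℂ) • (placeVec (intVec v) w) := by
    ext i
    have h1 := eq_mult_mul_of_sum_re (integralBasis K) (k i) (fun w => γ w i) (hγ i) (hsum i) w
    have h2 : ((v i : 𝓞 K) : K) = N * ∑ j, (k i j : K) * (integralBasis K).traceDual j := by
      simp only [v, map_sum, map_mul, map_intCast, hc, Finset.mul_sum]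
      refine Finset.sum_congr rfl fun j _ => ?_
      ring
    simp only [Pi.smul_apply, placeVec, intVec, h2, smul_eq_mul, map_mul, map_intCast]
    rw [h1]
    ring
  have hJ (w : InfinitePlace K) : ((N : ℤ) : ℂ) • (J (Fin n) ℂ *ᵥ γ w) =
      (w.mult : ℂ) • placeVec (intVec (J (Fin n) (𝓞 K) *ᵥ v)) w := by
    rw [← mulVec_smul, hv, mulVec_smul]
    congr 1
    ext i
    have := RingHom.map_mulVec (w.embedding.comp (algebraMap (𝓞 K) K)) (J (Fin n) (𝓞 K)) v i
    rw [Matrix.map_J] at this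
    exact this.symm
  have hterm (w : InfinitePlace K) : hermRe (siegelAt x w)
      (placeVec (intVec (J (Fin n) (𝓞 K) *ᵥ v)) w) (placeVec (intVec (J (Fin n) (𝓞 K) *ᵥ v)) w) ≤
      (N : ℝ) ^ 2 * hermRe (siegelAt x w) (placeCoord _ w β) (placeCoord _ w β) := by
    have h1 := hermRe_smul_self (siegelAt x w) ((N : ℤ) : ℂ) (J (Fin n) ℂ *ᵥ γ w)
    rw [hJ, hermRe_smul_self, ← hermRe_eq_hermRe_J (posDef_siegelAt hx w) (siegelAt_mem hx w)] at h1
    have h2 : ‖((N : ℤ) : ℂ)‖ ^ 2 = (N : ℝ) ^ 2 := by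
      rw [Complex.norm_intCast, sq_abs]
    rw [h2] at h1
    rw [← h1]
    refine le_mul_of_one_le_left (hermRe_nonneg (posDef_siegelAt hx w).posSemidef _) ?_
    have h3 : (1 : ℝ) ≤ w.mult := by exact_mod_cast mult_pos
    rw [Complex.norm_natCast]
    exact one_le_pow₀ h3
  have htot : spQ (J (Fin n) (𝓞 K) *ᵥ v) x ≤ (N : ℝ) ^ 2 * coordForm hx β β := by
    rw [coordForm_apply, Finset.mul_sum]
    exact Finset.sum_le_sum fun w _ => hterm w
  have hNpos : 0 < (N : ℝ) ^ 2 := by positivity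
  rw [div_le_iff₀ hNpos, mul_comm]
  refine (hε _ fun h => h0 ?_).trans htot
  rw [coordForm_apply]
  refine Finset.sum_eq_zero fun w _ => ?_
  have h1 := hJ w
  rw [h] at h1
  have h2 : placeVec (intVec (0 : Fin n ⊕ Fin n → 𝓞 K)) w = 0 := by
    ext i; simp [placeVec, intVec]
  rw [h2, smul_zero, smul_eq_zero] at h1
  rw [hermRe_eq_hermRe_J (posDef_siegelAt hx w) (siegelAt_mem hx w)]
  change hermRe _ (J (Fin n) ℂ *ᵥ γ w) (J (Fin n) ℂ *ᵥ γ w) = 0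
  rw [h1.resolve_left (by exact_mod_cast hN)]
  simp [hermRe]

/-- Lattices without short vectors are generated by vectors of bounded length. -/
lemma exists_closure_short (K : Type) [Field K] [NumberField K] (n : ℕ) {ε : ℝ} (hε : 0 < ε) :
    ∃ R : ℝ, ∀ x : SiegelPoint K n, x ∈ siegelSet →
      (∀ v : Fin n ⊕ Fin n → 𝓞 K, v ≠ 0 → ε ≤ spQ v x) →
      AddSubgroup.closure {v : Fin n ⊕ Fin n → 𝓞 K | spQ v x ≤ R} = ⊤ := by
  obtain ⟨N, hN, hdual⟩ := exists_traceDual_denominator K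
  have hδ : 0 < ε / (N : ℝ) ^ 2 := by positivity
  let V := Fin n ⊕ Fin n → Module.Free.ChooseBasisIndex ℤ (𝓞 K) → ℝ
  refine ⟨(4 / 3) ^ Module.finrank ℝ V / (ε / (N : ℝ) ^ 2), fun x hx hs => ?_⟩
  have h := le_closure_of_dual (intCoord K (Fin n ⊕ Fin n)).range hδ (Module.finrank ℝ V)
    (coordForm hx) (fun s t => ?_) (fun s => ?_) (LinearMap.finrank_range_le _) (fun c => ?_)
    (fun β hβ h0 => le_coordForm_of_integral hN hdual hx hs β (fun v => hβ _ ⟨v, rfl⟩) h0)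
  · rw [eq_top_iff]
    intro v _
    have h1 := h ⟨v, rfl⟩
    have h2 : {s | s ∈ (intCoord K (Fin n ⊕ Fin n)).range ∧ coordForm hx s s ≤
        (4 / 3) ^ Module.finrank ℝ V / (ε / (N : ℝ) ^ 2)} = intCoord K (Fin n ⊕ Fin n) ''
        {v | spQ v x ≤ (4 / 3) ^ Module.finrank ℝ V / (ε / (N : ℝ) ^ 2)} := by
      ext s
      constructor
      · rintro ⟨⟨v, rfl⟩, hv⟩
        rw [coordForm_intCoord] at hv
        exact ⟨v, hv, rfl⟩
      · rintro ⟨v, hv, rfl⟩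
        exact ⟨⟨v, rfl⟩, (coordForm_intCoord hx v).trans_le hv⟩
    rw [h2, ← AddMonoidHom.map_closure] at h1
    obtain ⟨v', hv', hvv⟩ := h1
    rwa [← intCoord_injective _ hvv]
  · rw [coordForm_apply, coordForm_apply]
    exact Finset.sum_congr rfl fun w _ => hermRe_comm (posDef_siegelAt hx w).1 _ _
  · rw [coordForm_apply]
    exact Finset.sum_nonneg fun w _ => hermRe_nonneg (posDef_siegelAt hx w).posSemidef _
  · have h1 := finite_short_siegelQ (isCompact_singleton (x := x))
      (Set.singleton_subset_iff.2 hx) c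
    refine ((h1.image (intCoord K _)).image fun s => coordForm hx s).subset ?_
    rintro _ ⟨s, ⟨⟨v, rfl⟩, hv⟩, rfl⟩
    rw [coordForm_intCoord] at hv
    exact ⟨_, ⟨v, ⟨x, rfl, hv⟩, rfl⟩, rfl⟩

end ShortGenerators

section FiniteClasses

open Matrix NumberField NumberField.InfinitePlace

/-- A set meets finitely many fibres of a map to a finite type. -/
lemma Set.exists_finite_representatives {α β : Type*} [Finite β] (f : α → β) (S : Set α) :
    ∃ T ⊆ S, T.Finite ∧ ∀ a ∈ S, ∃ t ∈ T, f t = f a := by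
  obtain ⟨T, hT, hbij⟩ := S.exists_subset_bijOn f
  refine ⟨T, hT, Set.Finite.of_finite_image (Set.toFinite _) hbij.injOn, fun a ha => ?_⟩
  have : f a ∈ f '' T := hbij.image_eq.symm ▸ ⟨a, ha, rfl⟩
  exact this

/-- Two congruent bases with the same Gram matrix differ by an integral symplectic matrix. -/
lemma exists_symplectic_of_congr {R : Type*} [CommRing R] [IsDomain R] {m : Type*} [Fintype m]
    [DecidableEq m] {P P' : Matrix (m ⊕ m) (m ⊕ m) R} (hP : P.det ≠ 0)
    (hG : P * J m R * Pᵀ = P' * J m R * P'ᵀ)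
    (hc : ∀ i j, (P * J m R * Pᵀ).det ∣ P' i j - P i j) :
    ∃ g ∈ symplecticGroup m R, P' = P * g := by
  choose X hX using hc
  let Y : Matrix (m ⊕ m) (m ⊕ m) R := of X
  have h1 : P' = P * (1 + ((J m R).det * P.det) • (P.adjugate * Y)) := by
    rw [mul_add, mul_one, mul_smul_comm, ← mul_assoc, mul_adjugate]
    ext i j
    have h2 := hX i j
    rw [det_mul, det_mul, det_transpose] at h2
    simp only [smul_mul_assoc, one_mul, Matrix.add_apply, Matrix.smul_apply, smul_eq_mul, Y, of_apply]
    linear_combination h2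
  refine ⟨_, ?_, h1⟩
  rw [SymplecticGroup.mem_iff]
  set g := 1 + ((J m R).det * P.det) • (P.adjugate * Y)
  have h2 : P * (g * J m R * gᵀ) * Pᵀ = P * J m R * Pᵀ := by
    rw [hG, h1, transpose_mul]
    simp only [mul_assoc]
  have hd : P.det • (1 : Matrix (m ⊕ m) (m ⊕ m) R) = P.adjugate * P := (adjugate_mul P).symm
  have h3 : (P.det * P.det) • (g * J m R * gᵀ) = (P.det * P.det) • J m R := by
    have key (A : Matrix (m ⊕ m) (m ⊕ m) R) :
        (P.det * P.det) • A = P.adjugate * (P * A * Pᵀ) * P.adjugateᵀ := by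
      rw [mul_assoc, mul_assoc (P * A), ← transpose_mul, adjugate_mul, ← mul_assoc, ← mul_assoc,
        adjugate_mul, transpose_smul, transpose_one, smul_mul_assoc, one_mul, mul_smul_comm,
        mul_one, smul_smul]
    rw [key, key, h2]
  ext i j
  have h4 := congrFun (congrFun h3 i) j
  simp only [Matrix.smul_apply, smul_eq_mul] at h4
  exact mul_left_cancel₀ (mul_ne_zero hP hP) h4

variable {K : Type} [Field K] [NumberField K] {n : ℕ}

lemma exists_finite_classes (F : Set (Matrix (Fin n ⊕ Fin n) (Fin n ⊕ Fin n) (𝓞 K)))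
    (hF : F.Finite) :
    ∃ T : Set (Matrix (Fin n ⊕ Fin n) (Fin n ⊕ Fin n) (𝓞 K)), T.Finite ∧
      (∀ P ∈ T, P.det ≠ 0) ∧ ∀ P : Matrix (Fin n ⊕ Fin n) (Fin n ⊕ Fin n) (𝓞 K), P.det ≠ 0 →
        P * J (Fin n) (𝓞 K) * Pᵀ ∈ F → ∃ P₀ ∈ T, ∃ g ∈ symplecticGroup (Fin n) (𝓞 K),
          P = P₀ * g := by
  have h (G : Matrix (Fin n ⊕ Fin n) (Fin n ⊕ Fin n) (𝓞 K)) :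
      ∃ T ⊆ {P : Matrix (Fin n ⊕ Fin n) (Fin n ⊕ Fin n) (𝓞 K) | P.det ≠ 0 ∧
        P * J (Fin n) (𝓞 K) * Pᵀ = G}, T.Finite ∧ ∀ P : Matrix _ _ (𝓞 K), P.det ≠ 0 →
          P * J (Fin n) (𝓞 K) * Pᵀ = G → ∃ P₀ ∈ T, ∃ g ∈ symplecticGroup (Fin n) (𝓞 K),
          P = P₀ * g := by
    by_cases hG : G.det = 0
    · refine ⟨∅, Set.empty_subset _, Set.finite_empty, fun P hP hPG => ?_⟩
      exfalso
      rw [← hPG, det_mul, det_mul, det_transpose] at hG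
      have hJ : (J (Fin n) (𝓞 K)).det ≠ 0 := (isUnit_det_J (Fin n) (𝓞 K)).ne_zero
      exact mul_ne_zero (mul_ne_zero hP hJ) hP hG
    · have hI : Ideal.span {G.det} ≠ ⊥ := by simpa using hG
      have : Finite (𝓞 K ⧸ Ideal.span {G.det}) := Ideal.finiteQuotientOfFreeOfNeBot _ hI
      obtain ⟨T, hTS, hT, hcl⟩ := Set.exists_finite_representatives
        (fun (P : Matrix (Fin n ⊕ Fin n) (Fin n ⊕ Fin n) (𝓞 K)) i j =>
          Ideal.Quotient.mk (Ideal.span {G.det}) (P i j))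
        {P | P.det ≠ 0 ∧ P * J (Fin n) (𝓞 K) * Pᵀ = G}
      refine ⟨T, hTS, hT, fun P hP hPG => ?_⟩
      obtain ⟨P₀, hP₀, hcong⟩ := hcl P ⟨hP, hPG⟩
      refine ⟨P₀, hP₀, exists_symplectic_of_congr (hTS hP₀).1
        ((hTS hP₀).2.trans hPG.symm) fun i j => ?_⟩
      rw [(hTS hP₀).2, ← Ideal.mem_span_singleton, ← Ideal.Quotient.eq]
      exact (congrFun (congrFun hcong i) j).symm
  choose T hTS hT hcl using h
  refine ⟨⋃ G ∈ F, T G, hF.biUnion fun G _ => hT G, fun P hP => ?_, fun P hP hPF => ?_⟩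
  · obtain ⟨G, -, hPG⟩ := Set.mem_iUnion₂.1 hP
    exact (hTS G hPG).1
  · obtain ⟨P₀, hP₀, h⟩ := hcl _ P hP rfl
    exact ⟨P₀, Set.mem_iUnion₂.2 ⟨_, hPF, hP₀⟩, h⟩

/-- Bases of vectors of bounded length have finitely many Gram matrices. -/
lemma finite_gram (K : Type) [Field K] [NumberField K] (n : ℕ) (R : ℝ) :
    {G : Matrix (Fin n ⊕ Fin n) (Fin n ⊕ Fin n) (𝓞 K) | ∃ x : SiegelPoint K n, x ∈ siegelSet ∧
      ∃ P : Matrix (Fin n ⊕ Fin n) (Fin n ⊕ Fin n) (𝓞 K), (∀ i, spQ (P i) x ≤ R) ∧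
        G = P * J (Fin n) (𝓞 K) * Pᵀ}.Finite := by
  refine (Set.Finite.pi' (t := fun _ : Fin n ⊕ Fin n => {f : Fin n ⊕ Fin n → 𝓞 K |
    ∀ j, f j ∈ {a : 𝓞 K | ∀ w : InfinitePlace K, w a ≤ R}}) fun _ => Set.Finite.pi' fun _ =>
    finite_integers_le R).subset ?_
  rintro _ ⟨x, hx, P, hP, rfl⟩ i j w
  rw [mul_J_mul_transpose_apply, ← norm_embedding_eq]
  have h1 := two_norm_sympl_le_siegelQ (placeVec (intVec (P j))) (placeVec (intVec (P i))) hx w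
  have h2 : w.embedding ((sympl (P j) (P i) : 𝓞 K) : K) =
      sympl (placeVec (intVec (P j)) w) (placeVec (intVec (P i)) w) :=
    sympl_map (w.embedding.comp (algebraMap (𝓞 K) K)) _ _
  rw [h2]
  have h3 := hP i
  have h4 := hP j
  rw [spQ] at h3 h4
  linarith

/-- Generating sets contain bases of the rational vector space. -/
lemma exists_basis_of_closure_eq_top {S : Set (Fin n ⊕ Fin n → 𝓞 K)}
    (hS : AddSubgroup.closure S = ⊤) :
    ∃ P : Matrix (Fin n ⊕ Fin n) (Fin n ⊕ Fin n) (𝓞 K), (∀ i, P i ∈ S) ∧ P.det ≠ 0 := by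
  have hspan : Submodule.span K ((intVec : (Fin n ⊕ Fin n → 𝓞 K) → _) '' S) = ⊤ := by
    have h1 (v : Fin n ⊕ Fin n → 𝓞 K) :
        intVec v ∈ Submodule.span K ((intVec : (Fin n ⊕ Fin n → 𝓞 K) → _) '' S) := by
      have hv : v ∈ AddSubgroup.closure S := hS ▸ AddSubgroup.mem_top v
      induction hv using AddSubgroup.closure_induction with
      | mem v hv => exact Submodule.subset_span ⟨v, hv, rfl⟩
      | zero =>
        convert Submodule.zero_mem _
        ext i; simp [intVec]
      | add v w _ _ hv hw =>
        convert Submodule.add_mem _ hv hw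
        ext i; simp [intVec]
      | neg v _ hv =>
        convert Submodule.neg_mem _ hv
        ext i; simp [intVec]
    rw [eq_top_iff, ← (Pi.basisFun K (Fin n ⊕ Fin n)).span_eq, Submodule.span_le]
    rintro _ ⟨i, rfl⟩
    refine (congrArg (· ∈ Submodule.span K _) (?_ : Pi.basisFun K (Fin n ⊕ Fin n) i =
      intVec (Pi.single i 1))).mpr (h1 (Pi.single i 1))
    ext j
    by_cases h : j = i
    · subst h; simp [intVec]
    · simp [intVec, Pi.single_eq_of_ne h]
  obtain ⟨b, hbS, hb, hli⟩ := exists_linearIndependent K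
    ((intVec : (Fin n ⊕ Fin n → 𝓞 K) → _) '' S)
  let B : Module.Basis b K (Fin n ⊕ Fin n → K) := Module.Basis.mk hli (by
    rw [Subtype.range_coe, hb, hspan])
  let e : b ≃ Fin n ⊕ Fin n := B.indexEquiv (Pi.basisFun K _)
  choose P hP hPe using fun i => hbS (e.symm i).2
  refine ⟨P, hP, fun h0 => ?_⟩
  have h1 : LinearIndependent K (fun i => intVec (P i)) := by
    have : (fun i => intVec (P i)) = (Subtype.val : b → _) ∘ e.symm := funext hPe
    rw [this]
    exact hli.comp _ e.symm.injective
  have h2 : IsUnit (intMat (P : Matrix (Fin n ⊕ Fin n) (Fin n ⊕ Fin n) (𝓞 K))) :=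
    linearIndependent_rows_iff_isUnit.1 h1
  rw [isUnit_iff_isUnit_det] at h2
  refine h2.ne_zero ?_
  have h3 := (algebraMap (𝓞 K) K).map_det P
  rw [h0, map_zero] at h3
  exact h3.symm

end FiniteClasses

section Mahler

open Set Matrix NumberField NumberField.InfinitePlace
open scoped ComplexOrder ContDiff

attribute [local instance] Matrix.linftyOpNormedRing Matrix.linftyOpNormedAlgebra

lemma norm_dotProduct_mulVec_le {m : Type*} [Fintype m] {H : Matrix m m ℂ} (hH : H.PosSemidef)
    {R : ℝ} {u v : m → ℂ} (hu : hermRe H u u ≤ R) (hv : hermRe H v v ≤ R) :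
    ‖u ⬝ᵥ H *ᵥ star v‖ ≤ 2 * R := by
  have key (v : m → ℂ) (hv : hermRe H v v ≤ R) : |(u ⬝ᵥ H *ᵥ star v).re| ≤ R := by
    have h1 := hermRe_nonneg hH (u + (-1 : ℝ) • v)
    have h2 := hermRe_nonneg hH (u + v)
    rw [hermRe_add_left, hermRe_add_right hH.1, hermRe_add_right hH.1, hermRe_smul_right hH.1,
      hermRe_smul_left, hermRe_smul_left, hermRe_smul_right hH.1, hermRe_comm hH.1 v u] at h1
    rw [hermRe_add_left, hermRe_add_right hH.1, hermRe_add_right hH.1,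
      hermRe_comm hH.1 v u] at h2
    change |hermRe H u v| ≤ R
    rw [abs_le]
    constructor <;> linarith
  have h1 := key v hv
  have h2 := key (Complex.I • v) (by rw [hermRe_smul_self]; simpa using hv)
  rw [star_smul, mulVec_smul, dotProduct_smul] at h2
  have h3 : (star Complex.I • (u ⬝ᵥ H *ᵥ star v)).re = (u ⬝ᵥ H *ᵥ star v).im := by simp
  rw [h3] at h2
  linarith [Complex.norm_le_abs_re_add_abs_im (u ⬝ᵥ H *ᵥ star v)]

lemma isClosed_posSemidef {m : Type*} [Fintype m] [DecidableEq m] :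
    IsClosed {H : Matrix m m ℂ | H.PosSemidef} := by
  have h1 : {H : Matrix m m ℂ | H.PosSemidef} =
      {H | Hᴴ = H} ∩ ⋂ u : m → ℂ, {H | 0 ≤ hermRe H u u} := by
    ext H
    refine ⟨fun h => ⟨h.1, mem_iInter.2 fun u => hermRe_nonneg h u⟩, fun h => ?_⟩
    have hH : H.IsHermitian := h.1
    refine .of_dotProduct_mulVec_nonneg hH fun x => ?_
    have h2 : 0 ≤ hermRe H (star x) (star x) := mem_iInter.1 h.2 (star x)
    have h3 : star (star x ⬝ᵥ H *ᵥ x) = star x ⬝ᵥ H *ᵥ x := by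
      rw [← star_dotProduct_star, star_mulVec, star_star, hH.eq, dotProduct_mulVec]
    rw [Complex.le_def]
    exact ⟨by simpa [hermRe] using h2, (Complex.conj_eq_iff_im.1 h3).symm⟩
  rw [h1]
  exact (isClosed_eq (contDiff_conjTranspose (l := m)).continuous continuous_id).inter
    (isClosed_iInter fun u => isClosed_le continuous_const (contDiff_hermRe u).continuous)

lemma isCompact_posSemidef_le {m : Type*} [Fintype m] [DecidableEq m] {U : Matrix m m ℂ}
    (hU : IsUnit U) (R : ℝ) :
    IsCompact {H : Matrix m m ℂ | H.PosSemidef ∧ ∀ i, hermRe H (U i) (U i) ≤ R} := by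
  have hU' : IsUnit U.det := (isUnit_iff_isUnit_det _).1 hU
  have hc : IsCompact {A : Matrix m m ℂ | ∀ i, A i ∈ {f : m → ℂ | ∀ j, f j ∈
      Metric.closedBall (0 : ℂ) (2 * R)}} :=
    isCompact_pi_infinite fun _ => isCompact_pi_infinite fun _ => isCompact_closedBall _ _
  have hcont : Continuous fun A : Matrix m m ℂ => U⁻¹ * A * (U⁻¹)ᴴ := by fun_prop
  refine (hc.image hcont).of_isClosed_subset ?_ ?_
  · simp only [Set.ofPred_and, Set.ofPred_forall]
    exact isClosed_posSemidef.inter (isClosed_iInter fun i =>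
      isClosed_le (contDiff_hermRe (U i)).continuous continuous_const)
  · rintro H ⟨hH, hR⟩
    refine ⟨U * H * Uᴴ, fun i j => ?_, ?_⟩
    · rw [mem_closedBall_zero_iff]
      have : (U * H * Uᴴ) i j = U i ⬝ᵥ H *ᵥ star (U j) := by
        rw [mul_apply', dotProduct_mulVec]
        rfl
      rw [this]
      exact norm_dotProduct_mulVec_le hH (hR i) (hR j)
    · change U⁻¹ * (U * H * Uᴴ) * (U⁻¹)ᴴ = H
      rw [conjTranspose_nonsing_inv]
      have h1 : IsUnit (Uᴴ).det := by rw [det_conjTranspose]; exact hU'.star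
      rw [mul_assoc, mul_assoc (U * H), mul_nonsing_inv _ h1, mul_one, ← mul_assoc,
        nonsing_inv_mul _ hU', one_mul]

lemma isCompact_siegelSet_le {W : Type} [Fintype W] {r : W → Prop} {n : ℕ}
    {U : W → Matrix (Fin n ⊕ Fin n) (Fin n ⊕ Fin n) ℂ} (hU : ∀ w, IsUnit (U w)) (R : ℝ) :
    ∃ C : Set (siegelModel r n), IsCompact C ∧ C ⊆ siegelSet ∧ ∀ x ∈ siegelSet,
      (∀ w i, hermRe (siegelAt x w) (U w i) (U w i) ≤ R) → x ∈ C := by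
  let S (w : W) : Set (Matrix (Fin n ⊕ Fin n) (Fin n ⊕ Fin n) ℂ) :=
    {H | H.PosSemidef ∧ ∀ i, hermRe H (U w i) (U w i) ≤ R} ∩
      {H | H ∈ symplecticGroup (Fin n) ℂ ∧ (r w → H.IsRealMatrix)}
  have hS (w) : IsCompact (S w) := by
    refine (isCompact_posSemidef_le (hU w) R).inter_right ?_
    have h1 : IsClosed {H : Matrix (Fin n ⊕ Fin n) (Fin n ⊕ Fin n) ℂ |
        H ∈ symplecticGroup (Fin n) ℂ} := by
      simp only [SymplecticGroup.mem_iff]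
      exact isClosed_eq ((continuous_id.mul continuous_const).mul contDiff_transpose.continuous)
        continuous_const
    by_cases hw : r w
    · have h2 : IsClosed {H : Matrix (Fin n ⊕ Fin n) (Fin n ⊕ Fin n) ℂ | H.IsRealMatrix} :=
        isClosed_eq contDiff_conjTranspose.continuous contDiff_transpose.continuous
      simpa [hw, Set.ofPred_and] using h1.inter h2
    · simpa [hw] using h1
  have hpos {w} {H} (hH : H ∈ S w) : H.PosDef :=
    hH.1.1.posDef_iff_isUnit.2 (isUnit_of_mem_symplecticGroup hH.2.1)
  have hc : IsCompact {H : W → Matrix (Fin n ⊕ Fin n) (Fin n ⊕ Fin n) ℂ | ∀ w, H w ∈ S w} :=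
    isCompact_pi_infinite hS
  refine ⟨siegelPoint '' {H | ∀ w, H w ∈ S w}, hc.image_of_continuousOn ?_, ?_, ?_⟩
  · refine (contDiff_siegelProj (r := r) (n := n)).continuous.comp_continuousOn
      (continuousOn_pi.2 fun w H hH => ?_)
    exact (ContinuousAt.comp (x := H) (g := siegelCoord)
      (f := fun H : W → Matrix (Fin n ⊕ Fin n) (Fin n ⊕ Fin n) ℂ => H w)
      (contDiffAt_siegelCoord (posDef_toBlocks₂₂ (hpos (hH w))).isUnit_det').continuousAt
      (continuous_apply w).continuousAt).continuousWithinAt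
  · rintro _ ⟨H, hH, rfl⟩
    exact siegelPoint_mem (fun w => hpos (hH w)) (fun w => (hH w).2.1) fun w => (hH w).2.2
  · intro x hx hR
    exact ⟨siegelAt x, fun w => ⟨⟨(posDef_siegelAt hx w).posSemidef, hR w⟩, siegelAt_mem hx w,
      fun hw => siegelAt_real x hw⟩, siegelPoint_siegelAt hx⟩

variable {K : Type} [Field K] [NumberField K] {n : ℕ}

lemma vecMul_inv_smul (g : symplecticGroup (Fin n) (𝓞 K)) (P : Matrix (Fin n ⊕ Fin n) (Fin n ⊕ Fin n) (𝓞 K))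
    (i : Fin n ⊕ Fin n) : g • (P * g.1) i = P i := by
  have h1 : g.1 * (g⁻¹).1 = 1 := congrArg Subtype.val (mul_inv_cancel g)
  change (P * g.1) i ᵥ* (g⁻¹).1 = P i
  have h2 : (P * g.1) i ᵥ* (g⁻¹).1 = (P * g.1 * (g⁻¹).1) i := rfl
  rw [h2, mul_assoc, h1, mul_one]

/-- Mahler's compactness criterion. -/
theorem mahler_spAct (K : Type) [Field K] [NumberField K] (n : ℕ) {ε : ℝ} (hε : 0 < ε) :
    ∃ C : Set (SiegelPoint K n), IsCompact C ∧ C ⊆ siegelSet ∧ ∀ x ∈ siegelSet,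
      (∀ v : Fin n ⊕ Fin n → 𝓞 K, v ≠ 0 → ε ≤ spQ v x) →
        ∃ g : symplecticGroup (Fin n) (𝓞 K), spAct g x ∈ C := by
  obtain ⟨R, hR⟩ := exists_closure_short K n hε
  obtain ⟨T, hT, hT0, hcl⟩ := exists_finite_classes _ (finite_gram K n R)
  have h (P : Matrix (Fin n ⊕ Fin n) (Fin n ⊕ Fin n) (𝓞 K)) (hP : P.det ≠ 0) :
      ∃ C : Set (SiegelPoint K n), IsCompact C ∧ C ⊆ siegelSet ∧ ∀ x ∈ siegelSet,
        (∀ i, spQ (P i) x ≤ R) → x ∈ C := by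
    obtain ⟨C, hC, hC', h⟩ := isCompact_siegelSet_le (r := (IsReal : InfinitePlace K → Prop))
      (U := placeMat (intMat P)) (fun w => by
        rw [isUnit_iff_isUnit_det]
        have h1 := (w.embedding.comp (algebraMap (𝓞 K) K)).map_det P
        have h2 : (placeMat (intMat P) w).det = w.embedding ((P.det : 𝓞 K) : K) := h1.symm
        rw [h2, isUnit_iff_ne_zero, map_ne_zero]
        exact_mod_cast hP) R
    exact ⟨C, hC, hC', fun x hx hxR => h x hx fun w i =>
      (hermRe_le_siegelQ (placeVec (intVec (P i))) hx w).trans (hxR i)⟩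
  choose! C hC hC' hCx using h
  refine ⟨⋃ P ∈ T, C P, hT.isCompact_biUnion fun P hP => hC P (hT0 P hP),
    iUnion₂_subset fun P hP => hC' P (hT0 P hP), fun x hx hxε => ?_⟩
  obtain ⟨P, hPR, hP⟩ := exists_basis_of_closure_eq_top (hR x hx hxε)
  obtain ⟨P₀, hP₀, g, hg, rfl⟩ := hcl P hP ⟨x, hx, P, hPR, rfl⟩
  refine ⟨⟨g, hg⟩, mem_iUnion₂.2 ⟨P₀, hP₀, hCx P₀ (hT0 P₀ hP₀) _ (spAct_mem _ hx) fun i => ?_⟩⟩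
  rw [← vecMul_inv_smul ⟨g, hg⟩ P₀ i, spQ_act _ _ hx]
  exact hPR i

end Mahler

section SymplecticReduction

open Set Matrix NumberField NumberField.InfinitePlace

attribute [local instance] Matrix.linftyOpNormedRing Matrix.linftyOpNormedAlgebra

variable (K : Type) [Field K] [NumberField K] (n : ℕ)

/-- Reduction theory for the integral symplectic group. -/
noncomputable def spData : ReductionData (symplecticGroup (Fin n) (𝓞 K)) (Fin n ⊕ Fin n → 𝓞 K)
    (SiegelPoint K n) where
  X := siegelSet
  isOpen := isOpen_siegelSet
  convex := convex_siegelSet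
  nonempty := ⟨_, siegelBase_mem one_pos⟩
  act := spAct
  act_smooth g := contDiffOn_siegelAct (isRealPoint_intMat g)
  act_mem g _ hx := spAct_mem g hx
  act_one _ hx := spAct_one hx
  act_mul g h _ hx := spAct_mul g h hx
  q := spQ
  q_smooth _ := contDiffOn_siegelQ _
  q_nsmul k v x _ := spQ_nsmul k v x
  q_convex _ c := convex_siegelQ _ c
  q_act g v _ hx := spQ_act g v hx
  orth v w := sympl v w = 0
  orth_of_short _ _ _ _ _ hx hv hw := sympl_eq_zero_of_short hx hv hw
  exists_short l _ hl _ hε := exists_short_spQ l hl hε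
  finite_short _ hC hC' c := finite_short_siegelQ hC hC' c
  proper _ hC hC' := proper_spAct hC hC'
  mahler _ hε := mahler_spAct K n hε

lemma compactCohomology_spData : CompactCohomology (spData K n).X
    (nrRealPlaces K * (n * (n + 1)) + nrComplexPlaces K * (n * (2 * n + 1))) := by
  classical
  have h := finrank_siegelModel (W := InfinitePlace K) (r := IsReal) (n := n)
  have h1 : Fintype.card {w : InfinitePlace K // ¬ IsReal w} = nrComplexPlaces K :=
    Fintype.card_congr (Equiv.subtypeEquivRight fun _ => not_isReal_iff_isComplex)
  have h2 : Fintype.card {w : InfinitePlace K // IsReal w} = nrRealPlaces K :=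
    Fintype.card_congr (Equiv.refl _)
  rw [h1, h2] at h
  rw [← h]
  exact compactCohomology_siegelSet

end SymplecticReduction

section SymplecticRotation

open Matrix

variable {R : Type*} [CommRing R] {m : Type*} [Fintype m] [DecidableEq m]

/-- The symplectic rotation in a hyperbolic plane. -/
def symplRot (e f : m ⊕ m → R) (a b : R) : Matrix (m ⊕ m) (m ⊕ m) R :=
  1 + vecMulVec (f ᵥ* J m R) ((a - 1) • e + b • f) +
    vecMulVec (J m R *ᵥ e) ((a - 1) • f - b • e)

variable {e f : m ⊕ m → R} {a b c d : R}

lemma vecMul_symplRot (v : m ⊕ m → R) : v ᵥ* symplRot e f a b =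
    v + sympl v f • ((a - 1) • e + b • f) + sympl e v • ((a - 1) • f - b • e) := by
  have h : v ⬝ᵥ f ᵥ* J m R = sympl v f := by
    rw [dotProduct_comm, ← dotProduct_mulVec]; rfl
  rw [symplRot, vecMul_add, vecMul_add, vecMul_one, vecMul_vecMulVec, vecMul_vecMulVec, h]
  rfl

lemma symplRot_map {S : Type*} [CommRing S] (φ : R →+* S) :
    (symplRot e f a b).map φ = symplRot (φ ∘ e) (φ ∘ f) (φ a) (φ b) := by
  have h1 (i) : φ ((J m R *ᵥ e) i) = (J m S *ᵥ (φ ∘ e)) i := by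
    rw [RingHom.map_mulVec, Matrix.map_J]
  have h2 (i) : φ ((f ᵥ* J m R) i) = ((φ ∘ f) ᵥ* J m S) i := by
    rw [RingHom.map_vecMul, Matrix.map_J]
  ext i j
  simp only [symplRot, map_apply, Matrix.add_apply, vecMulVec_apply, map_add, map_mul, h1, h2,
    Pi.add_apply, Pi.sub_apply, Pi.smul_apply, smul_eq_mul, map_sub, map_one, Function.comp_apply]
  congr 2
  rw [one_apply, one_apply]
  split_ifs <;> simp

lemma sympl_add_left (u v w : m ⊕ m → R) : sympl (u + v) w = sympl u w + sympl v w :=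
  LinearMap.BilinForm.add_left (B := symplForm R m) u v w

lemma sympl_add_right (u v w : m ⊕ m → R) : sympl u (v + w) = sympl u v + sympl u w :=
  LinearMap.BilinForm.add_right (B := symplForm R m) u v w

lemma sympl_smul_left (a : R) (v w : m ⊕ m → R) : sympl (a • v) w = a * sympl v w :=
  LinearMap.BilinForm.smul_left (B := symplForm R m) a v w

lemma sympl_smul_right (a : R) (v w : m ⊕ m → R) : sympl v (a • w) = a * sympl v w :=
  LinearMap.BilinForm.smul_right (B := symplForm R m) a v w

lemma sympl_sub_left (u v w : m ⊕ m → R) : sympl (u - v) w = sympl u w - sympl v w :=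
  by
  rw [← symplForm_apply, map_sub]; rfl

lemma sympl_sub_right (u v w : m ⊕ m → R) : sympl u (v - w) = sympl u v - sympl u w :=
  map_sub (symplForm R m u) v w

lemma sympl_self (v : m ⊕ m → R) : sympl v v = 0 := symplForm_isAlt v

lemma symplRot_mul (h : sympl e f = 1) : symplRot e f a b * symplRot e f c d =
    symplRot e f (a * c - b * d) (a * d + b * c) := by
  refine ext_iff_vecMul.2 fun v => ?_
  rw [← vecMul_vecMul]
  simp only [vecMul_symplRot, sympl_add_left, sympl_add_right, sympl_smul_left, sympl_smul_right,
    sympl_sub_left, sympl_sub_right, sympl_self, h]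
  module

lemma symplRot_one : symplRot e f 1 0 = 1 := by simp [symplRot]

lemma symplRot_mem (h : sympl e f = 1) (hab : a ^ 2 + b ^ 2 = 1) :
    symplRot e f a b ∈ symplecticGroup m R := by
  rw [SymplecticGroup.mem_iff]
  ext i j
  rw [mul_J_mul_transpose_apply]
  have h1 : J m R i j = sympl (Pi.single j 1) (Pi.single i 1) := by simp [sympl]
  have h2 (i) : symplRot e f a b i = Pi.single i 1 ᵥ* symplRot e f a b := by
    rw [single_one_vecMul]; rfl
  rw [h1, h2, h2]
  generalize (Pi.single i 1 : m ⊕ m → R) = v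
  generalize (Pi.single j 1 : m ⊕ m → R) = w
  simp only [vecMul_symplRot, sympl_add_left, sympl_add_right, sympl_smul_left, sympl_smul_right,
    sympl_sub_left, sympl_sub_right, sympl_self, h]
  rw [sympl_swap e w, sympl_swap e f, sympl_swap v f, h]
  linear_combination (sympl e v * sympl w f - sympl v f * sympl e w) * hab

end SymplecticRotation

section SymplecticTits

open Set Matrix NumberField NumberField.InfinitePlace

attribute [local instance] Matrix.linftyOpNormedRing Matrix.linftyOpNormedAlgebra

variable {K : Type} [Field K] [NumberField K] {n : ℕ}

lemma isRealPoint_symplRot {e f : Fin n ⊕ Fin n → 𝓞 K} (h : sympl e f = 1) {a b : ℝ}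
    (hab : a ^ 2 + b ^ 2 = 1) : IsRealPoint IsReal fun w : InfinitePlace K =>
      symplRot (placeVec (intVec e) w) (placeVec (intVec f) w) (a : ℂ) b := fun w => by
  refine ⟨symplRot_mem ?_ (by exact_mod_cast hab), fun hw => ?_⟩
  · have := sympl_map (w.embedding.comp (algebraMap (𝓞 K) K)) e f
    rw [h, map_one] at this
    exact this.symm
  · have h1 (v : Fin n ⊕ Fin n → 𝓞 K) : starRingEnd ℂ ∘ placeVec (intVec v) w =
        placeVec (intVec v) w := funext fun i =>
      RingHom.congr_fun (ComplexEmbedding.isReal_iff.1 (isReal_iff.1 hw)) (v i : K)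
    have h2 := symplRot_map (starRingEnd ℂ) (e := placeVec (intVec e) w)
      (f := placeVec (intVec f) w) (a := (a : ℂ)) (b := b)
    rw [h1, h1, Complex.conj_ofReal, Complex.conj_ofReal] at h2
    ext i j
    exact congrFun (congrFun h2 j) i

lemma exists_symplectic_swap {D : ℕ} {τ : Omc (spData K n).X D →ₗ[ℝ] ℝ} {w₀ : Omc (spData K n).X D}
    {χ : symplecticGroup (Fin n) (𝓞 K) →* ℝ} (hχ : (spData K n).IsOrientation D τ w₀ χ)
    {e f : Fin n ⊕ Fin n → 𝓞 K} (h : sympl e f = 1) :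
    ∃ g : symplecticGroup (Fin n) (𝓞 K), 0 < χ g ∧ g • e = f ∧ g • f = -e ∧
      ∀ v, sympl e v = 0 → sympl v f = 0 → g • v = v := by
  have hg : symplRot e f 0 1 ∈ symplecticGroup (Fin n) (𝓞 K) := symplRot_mem h (by simp)
  refine ⟨(⟨_, hg⟩ : symplecticGroup (Fin n) (𝓞 K))⁻¹, ?_, ?_, ?_, fun v h1 h2 => ?_⟩
  · set s : ℝ := (√2)⁻¹ with hs
    have hs2 : s ^ 2 = 1 / 2 := by rw [hs, inv_pow, Real.sq_sqrt zero_le_two, one_div]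
    have hC : (s : ℂ) * s + s * s = 1 := by
      norm_cast; linarith
    have h1 := isRealPoint_symplRot h (a := s) (b := s) (by linarith)
    have h2 := isRealPoint_symplRot h (a := s) (b := -s) (by linarith)
    have hω (w : InfinitePlace K) :
        sympl (placeVec (intVec e) w) (placeVec (intVec f) w) = 1 := by
      have := sympl_map (w.embedding.comp (algebraMap (𝓞 K) K)) e f
      rw [h, map_one] at this
      exact this.symm
    refine hχ.pos_of_sqrt (f := siegelAct _) (f' := siegelAct _) ⟨isOpen_siegelSet,
      isOpen_siegelSet, contDiffOn_siegelAct h1, contDiffOn_siegelAct h2,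
      fun x hx => siegelAct_mem h1 hx, fun x hx => siegelAct_mem h2 hx, fun x hx => ?_,
      fun x hx => ?_⟩ _ fun x hx => ?_
    · rw [← siegelAct_mul h1 hx]
      refine Eq.trans (congrArg (siegelAct · x) (funext fun w => ?_)) (siegelAct_one hx)
      rw [symplRot_mul (hω w), ← symplRot_one]
      congr 1 <;> push_cast
      · linear_combination hC
      · ring
    · rw [← siegelAct_mul h2 hx]
      refine Eq.trans (congrArg (siegelAct · x) (funext fun w => ?_)) (siegelAct_one hx)
      rw [symplRot_mul (hω w), ← symplRot_one]
      congr 1 <;> push_cast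
      · linear_combination hC
      · ring
    · rw [← siegelAct_mul h1 hx, inv_inv]
      refine congrArg (siegelAct · x) (funext fun w => ?_)
      have h3 := symplRot_map (w.embedding.comp (algebraMap (𝓞 K) K)) (e := e) (f := f)
        (a := 0) (b := 1)
      rw [map_zero, map_one] at h3
      rw [symplRot_mul (hω w)]
      refine Eq.trans h3 ?_
      congr 1
      · ring
      · linear_combination -hC
  · rw [symplectic_smul_def, inv_inv, vecMul_symplRot, h, sympl_self]
    module
  · rw [symplectic_smul_def, inv_inv, vecMul_symplRot, h, sympl_self]
    module
  · rw [symplectic_smul_def, inv_inv, vecMul_symplRot, h1, h2]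
    module

lemma IsEuclideanDomain.exists_rank {R : Type} [CommRing R] (hR : IsEuclideanDomain R) :
    IsPrincipalIdealRing R ∧ ∃ ρ : R → Ordinal.{0}, (∀ a, ρ a = 0 ↔ a = 0) ∧
      ∀ a b, b ≠ 0 → ∃ q, ρ (a + q * b) < ρ b := by
  classical
  obtain ⟨e, rfl⟩ := hR
  have : IsWellFounded R EuclideanDomain.r := ⟨EuclideanDomain.r_wellFounded⟩
  refine ⟨inferInstance, fun a => if a = 0 then 0 else IsWellFounded.rank EuclideanDomain.r a + 1,
    fun a => ?_, fun a b hb => ⟨-(a / b), ?_⟩⟩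
  · by_cases h : a = 0 <;> simp [h]
  · have h : a + -(a / b) * b = a % b := by
      linear_combination -(EuclideanDomain.div_add_mod a b)
    dsimp only
    rw [h, if_neg hb]
    split_ifs
    · simp
    · rw [← Order.succ_eq_add_one, ← Order.succ_eq_add_one, Order.succ_lt_succ_iff]
      exact IsWellFounded.rank_lt_of_rel (EuclideanDomain.remainder_lt a hb)

lemma titsData_spData (hE : IsEuclideanDomain (𝓞 K)) {D : ℕ}
    {τ : Omc (spData K n).X D →ₗ[ℝ] ℝ} {w₀ : Omc (spData K n).X D}
    {χ : symplecticGroup (Fin n) (𝓞 K) →* ℝ} (hχ : (spData K n).IsOrientation D τ w₀ χ)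
    (hn : n ≠ 0) : (spData K n).TitsData n χ
      fun ps => IsFrame (symplForm (𝓞 K) (Fin n)) ps ∧ ps.length = n := by
  obtain ⟨hpir, ρ, hρ0, hρ⟩ := hE.exists_rank
  have hF : ∀ ps : List ((Fin n ⊕ Fin n → 𝓞 K) × (Fin n ⊕ Fin n → 𝓞 K)),
      IsFrame (symplForm (𝓞 K) (Fin n)) ps → ∀ l, Transversal ps l →
      (∀ v ∈ l, v ≠ 0) ∧ l.Pairwise fun v w => sympl v w = 0 := fun ps hps l hl => by
    refine ⟨fun v hv hv0 => ?_, hl.pairwise _ hps.2⟩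
    obtain ⟨p, hp, h⟩ := hl.mem hv
    have := hps.1 p hp
    rcases h with rfl | rfl <;> simp [hv0] at this
  constructor
  · intro j hj c hc hfr
    have hprim := symplForm_hasPrim (R := 𝓞 K) (m := Fin n)
    obtain ⟨pg, hpg1, hpg2⟩ := exists_primGen _ hprim
    have hpg0 (w) (hw : PrimIn (symplForm (𝓞 K) (Fin n)) ⊤ w) : w ≠ 0 := by
      rintro rfl
      obtain ⟨-, z, -, hz⟩ := hw
      simp at hz
    have horth (s) (hs : s ≠ 0) (t) (ht : t ≠ 0) :
        symplForm (𝓞 K) (Fin n) (pg s) (pg t) = 0 ↔ sympl s t = 0 := by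
      obtain ⟨a, ha⟩ := (hpg2 s trivial hs).2
      obtain ⟨b, hb⟩ := (hpg2 t trivial ht).2
      have ha0 : a ≠ 0 := by rintro rfl; exact hs (by rw [ha, zero_smul])
      have hb0 : b ≠ 0 := by rintro rfl; exact ht (by rw [hb, zero_smul])
      conv_rhs => rw [ha, hb, sympl_smul_left, sympl_smul_right]
      simp [ha0, hb0, symplForm_apply]
    have hpw (l : List (Fin n ⊕ Fin n → 𝓞 K)) (hl : ∀ s ∈ l, s ≠ 0) :
        (l.Pairwise fun s t => symplForm (𝓞 K) (Fin n) (pg s) (pg t) = 0) ↔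
          l.Pairwise fun s t => sympl s t = 0 :=
      List.Pairwise.iff_of_mem fun {s t} hs ht => horth s (hl s hs) t (hl t ht)
    obtain ⟨b, hb⟩ := isotropic_acyclic symplForm_isAlt ρ hρ0 hρ n ⊤
      (splits_of_finrank symplForm_isAlt n ⊤ hprim
        (by rw [finrank_top, Module.finrank_fintype_fun_eq_card]; simp; omega)) hprim
      (fun s => s ≠ 0) pg id (fun s hs => (hpg2 s trivial hs).1)
      (fun w hw => ⟨hpg0 w hw, hpg1 w hw⟩) j hj c
      (fun l hl hl' h => hc l hl ((hpw l hl).1 hl') h)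
      (fun hj ps hps _ hlen => by simpa using hfr hj ps ⟨hps, hlen⟩)
    exact ⟨b, fun l hl hl' h => hb l hl ((hpw l hl).2 hl') h⟩
  · rintro (_ | ⟨p, qs⟩) ⟨hps, hlen⟩
    · exact absurd hlen.symm hn
    have hp : sympl p.1 p.2 = 1 := hps.1 p (by simp)
    have hpq := List.pairwise_cons.1 hps.2
    obtain ⟨g, hg, h1, h2, h3⟩ := exists_symplectic_swap hχ hp
    refine ⟨p, qs, rfl, by simpa using hlen, ?_, ?_, fun l hl => ?_, g, hg, h1, h2,
      fun r hr => ?_⟩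
    · rintro h; rw [h] at hp; simp [sympl] at hp
    · rintro h; rw [h] at hp; simp [sympl] at hp
    · have hc := hF _ hps _ (Transversal.fst p hl)
      have hc' := hF _ hps _ (Transversal.snd p hl)
      refine ⟨fun v hv => hc.1 v (List.mem_cons_of_mem _ hv), ?_, hc'.2⟩
      have ⟨hc1, hc2⟩ := List.pairwise_cons.1 hc.2
      have hneg (v) : sympl (-p.1) v = -sympl p.1 v := by
        rw [← symplForm_apply, map_neg]; rfl
      have hself : sympl p.1 (-p.1) = 0 := by
        rw [sympl_swap, hneg, sympl_self, neg_zero, neg_zero]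
      refine List.pairwise_cons.2 ⟨List.forall_mem_cons.2 ⟨hself, hc1⟩, List.pairwise_cons.2
        ⟨fun v hv => ?_, hc2⟩⟩
      change sympl _ _ = 0
      rw [hneg, hc1 v hv, neg_zero]
    · obtain ⟨ha, hb, hc, hd⟩ := hpq.1 r hr
      simp only [symplForm_apply] at ha hb hc hd
      exact ⟨h3 _ ha (by rw [sympl_swap, hc, neg_zero]), h3 _ hb (by rw [sympl_swap, hd, neg_zero])⟩

end SymplecticTits

section GroupCohomologyLists

open CategoryTheory

lemma cob_ofFn {S : Type*} : ∀ {k : ℕ} (c : List S → ℝ) (h : Fin (k + 1) → S),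
    cob c (List.ofFn h) = ∑ i : Fin (k + 1), (-1) ^ (i : ℕ) * c (List.ofFn (h ∘ i.succAbove))
  | 0, c, h => by simp [cob]
  | k + 1, c, h => by
    rw [Fin.sum_univ_succ, List.ofFn_succ, cob_cons, cob_ofFn, sub_eq_add_neg,
      ← Finset.sum_neg_distrib]
    congr 1
    · simp [Function.comp_def]
    · refine Finset.sum_congr rfl fun i _ => ?_
      rw [List.ofFn_succ (f := h ∘ i.succ.succAbove)]
      simp [Function.comp_def, pow_succ]

variable {Γ : Type} [Group Γ]

lemma cob_ofFn_partialProd {m : ℕ} {b : List Γ → ℝ}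
    (hb : ∀ g l, l.length = m + 1 → b (l.map (g * ·)) = b l) (g : Fin (m + 1) → Γ) :
    cob b (List.ofFn (Fin.partialProd g)) = b (List.ofFn (Fin.partialProd fun i => g i.succ)) +
      ∑ j : Fin (m + 1), (-1) ^ ((j : ℕ) + 1) *
        b (List.ofFn (Fin.partialProd (Fin.contractNth j (· * ·) g))) := by
  rw [cob_ofFn, Fin.sum_univ_succ]
  congr 1
  · rw [← hb (g 0) (List.ofFn (Fin.partialProd fun i => g i.succ)) (by simp), List.map_ofFn]
    simp only [Fin.val_zero, pow_zero, one_mul]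
    congr 2
    funext j
    rw [Function.comp_apply, Function.comp_apply, Fin.zero_succAbove]
    exact Fin.partialProd_succ' g j
  · refine Finset.sum_congr rfl fun j _ => ?_
    rw [Fin.partialProd_contractNth, Fin.val_succ]

/-- Rational cohomology vanishes when invariant real cocycles on lists are invariant
coboundaries. -/
theorem subsingleton_groupCohomology_of_lists {m : ℕ}
    (H : ∀ c : List Γ → ℝ, (∀ l, l.length = m + 1 + 2 → cob c l = 0) →
      (∀ g l, l.length = m + 1 + 1 → c (l.map (g * ·)) = c l) →
      ∃ b : List Γ → ℝ, (∀ g l, l.length = m + 1 → b (l.map (g * ·)) = b l) ∧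
        ∀ l, l.length = m + 1 + 1 → cob b l = c l) :
    Subsingleton (groupCohomology (Rep.trivial ℚ Γ ℚ) (m + 1)) := by
  obtain ⟨r, hr⟩ := LinearMap.exists_leftInverse_of_injective (Algebra.linearMap ℚ ℝ)
    (LinearMap.ker_eq_bot.2 (algebraMap ℚ ℝ).injective)
  have hr' (q : ℚ) : r (q : ℝ) = q := LinearMap.congr_fun hr q
  rw [← ModuleCat.isZero_iff_subsingleton]
  refine ((groupCohomology.inhomogeneousCochains _).exactAt_iff_isZero_homology _).1 ?_
  rw [HomologicalComplex.exactAt_iff' _ m (m + 1) (m + 2) (by simp) (by simp),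
    ShortComplex.moduleCat_exact_iff]
  intro f hf
  change (Fin (m + 1) → Γ) → ℚ at f
  have hf' : inhomogeneousCochains.d (Rep.trivial ℚ Γ ℚ) (m + 1) f = 0 := by
    rw [← groupCohomology.inhomogeneousCochains.d_def]; exact hf
  let c : List Γ → ℝ := fun l =>
    f fun i => (l.getD (i : ℕ) 1)⁻¹ * l.getD ((i : ℕ) + 1) 1
  have hc (h : Fin (m + 1 + 1) → Γ) :
      c (List.ofFn h) = f fun i => (h i.castSucc)⁻¹ * h i.succ := by
    simp only [c]
    congr 2
    funext i
    rw [List.getD_eq_getElem _ _ (by simp),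
      List.getD_eq_getElem _ _ (by simpa using i.is_le)]
    simp only [List.getElem_ofFn]
    rfl
  have hc' (g : Fin (m + 1) → Γ) : c (List.ofFn (Fin.partialProd g)) = f g := by
    rw [hc]
    simp only [Fin.partialProd_right_inv]
  have hinv : ∀ g l, l.length = m + 1 + 1 → c (l.map (g * ·)) = c l := by
    intro g l hl
    obtain ⟨h, rfl⟩ : ∃ h : Fin (m + 1 + 1) → Γ, l = List.ofFn h :=
      ⟨fun i => l.get (i.cast hl.symm), by rw [← List.ofFn_congr hl l.get, List.ofFn_get]⟩
    rw [List.map_ofFn, hc, hc]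
    simp [mul_assoc]
  obtain ⟨b, hb, hbc⟩ := H c (by
    intro l hl
    obtain ⟨h, rfl⟩ : ∃ h : Fin (m + 1 + 1 + 1) → Γ, l = List.ofFn h :=
      ⟨fun i => l.get (i.cast hl.symm), by rw [← List.ofFn_congr hl l.get, List.ofFn_get]⟩
    rw [← Fin.partialProd_left_inv h]
    set g := fun i : Fin (m + 1 + 1) => (h i.castSucc)⁻¹ * h i.succ
    have e : List.ofFn (h 0 • Fin.partialProd g) =
        (List.ofFn (Fin.partialProd g)).map (h 0 * ·) := by
      rw [List.map_ofFn]; rfl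
    rw [e, cob_map, cob_congr (c' := c) fun t _ ht => hinv _ t (by simpa using ht),
      cob_ofFn_partialProd hinv]
    have := congrFun hf' g
    rw [inhomogeneousCochains.d_hom_apply] at this
    simp only [hc']
    exact_mod_cast this) hinv
  refine ⟨fun g => r (b (List.ofFn (Fin.partialProd g))), ?_⟩
  change (groupCohomology.inhomogeneousCochains (Rep.trivial ℚ Γ ℚ)).d m (m + 1) _ = f
  rw [groupCohomology.inhomogeneousCochains.d_def]
  funext g
  rw [inhomogeneousCochains.d_hom_apply, ← hr' (f g), ← hc', ← hbc _ (by simp),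
    cob_ofFn_partialProd hb, map_add, map_sum]
  congr 1
  refine Finset.sum_congr rfl fun j _ => ?_
  rw [smul_eq_mul, ← smul_eq_mul, ← map_smul]
  congr 1
  rw [Rat.smul_def]
  simp

end GroupCohomologyLists

section TopCohomology

attribute [local instance] Matrix.linftyOpNormedRing Matrix.linftyOpNormedAlgebra

lemma subsingleton_groupCohomology_symplectic {K : Type} [Field K] [NumberField K]
    (hEucl : IsEuclideanDomain (RingOfIntegers K)) {k m : ℕ}
    (hm : nrRealPlaces K * ((k + 1) * (k + 1 + 1)) +
      nrComplexPlaces K * ((k + 1) * (2 * (k + 1) + 1)) = k + 1 + (m + 1)) :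
    Subsingleton (groupCohomology
      (Rep.trivial ℚ (Matrix.symplecticGroup (Fin (k + 1)) (RingOfIntegers K)) ℚ) (m + 1)) := by
  have hX := compactCohomology_spData K (k + 1)
  rw [hm] at hX
  obtain ⟨τ, w₀, χ, hχ⟩ := (spData K (k + 1)).exists_orientation hX
  exact subsingleton_groupCohomology_of_lists fun c hc hinv =>
    ReductionData.cocycle_eq_cob hχ hX (titsData_spData hEucl hχ k.succ_ne_zero) hc hinv

end TopCohomology

/-- **Brück–Santos Rego–Sroka, after Gunnells.** If the ring of integers of a number field
`K` is Euclidean, then for every `n ≥ 1` the rational cohomology of `Sp_{2n}(𝓞_K)` vanishes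
in its virtual cohomological dimension `r₁·n(n+1) + r₂·n(2n+1) − n`. -/
theorem sp2n_ringOfIntegers_euclidean_top_cohomology_vanishes
    (K : Type) [Field K] [NumberField K]
    (hEucl : IsEuclideanDomain (RingOfIntegers K)) (n : ℕ) (hn : 1 ≤ n) :
    Subsingleton
      (groupCohomology
        (Rep.trivial ℚ (↥(Matrix.symplecticGroup (Fin n) (RingOfIntegers K))) ℚ)
        (nrRealPlaces K * (n * (n + 1)) + nrComplexPlaces K * (n * (2 * n + 1)) - n)) := by
  obtain ⟨k, rfl⟩ : ∃ k, n = k + 1 := ⟨n - 1, by omega⟩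
  have hpos : 0 < nrRealPlaces K + nrComplexPlaces K := by
    rw [← card_eq_nrRealPlaces_add_nrComplexPlaces]
    exact Fintype.card_pos
  have hle : k + 1 + 1 ≤ nrRealPlaces K * ((k + 1) * (k + 1 + 1)) +
      nrComplexPlaces K * ((k + 1) * (2 * (k + 1) + 1)) := by
    rcases Nat.eq_zero_or_pos (nrRealPlaces K) with h | h
    · exact le_add_left ((by nlinarith : k + 1 + 1 ≤ (k + 1) * (2 * (k + 1) + 1)).trans
        (Nat.le_mul_of_pos_left _ (by omega)))
    · exact le_add_right ((Nat.le_mul_of_pos_left _ k.succ_pos).trans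
        (Nat.le_mul_of_pos_left _ h))
  obtain ⟨m, hm⟩ := Nat.exists_eq_add_of_le hle
  rw [show k + 1 + 1 + m = k + 1 + (m + 1) by ring] at hm
  rw [hm, Nat.add_sub_cancel_left]
  exact subsingleton_groupCohomology_symplectic hEucl hm
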